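/- For every c₁ > 0 there exist positive constants κ and C such that the following holds. Let Z ≥ 1, α > 0 with Zα² ≤ κ, δ with Z^{−1/6} ≤ δ ≤ 1, and D with 1 ≤ D ≤ Z^{1/24}·δ^{13/16}; set d = δ·Z^{−1/3} and r = D·Z^{−1/3}. Then for every pair of admissible cutoffs θ₀, θ₁ (with gradient constant c₁), every N ≥ 1, every divergence-free A ∈ C_c^∞(ℝ³,ℝ³), and every normalized N-electron wave function Ψ: 𝓔⁰_N[Ψ,A] ≥ −c_TF·Z^{7/3} − C·Z^{7/3}·(Z^{−1/30} + D^{−1}). -/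

import Mathlib

open MeasureTheory

noncomputable section

/-- Euclidean norm on ℝ³ (encoded as `Fin 3 → ℝ`). -/
def enorm3 (x : Fin 3 → ℝ) : ℝ := Real.sqrt (∑ k, x k ^ 2)

/-- The Pauli matrices σ₁, σ₂, σ₃. -/
def pauli : Fin 3 → Matrix (Fin 2) (Fin 2) ℂ :=
  ![!![0, 1; 1, 0], !![0, -Complex.I; Complex.I, 0], !![1, 0; 0, -1]]

/-- The partial derivative ∂ᵢ Aⱼ of a vector field on ℝ³. -/
def pdVec (A : (Fin 3 → ℝ) → Fin 3 → ℝ) (i j : Fin 3) (x : Fin 3 → ℝ) : ℝ :=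
  fderiv ℝ A x (Pi.single i 1) j

/-- The curl ∇×A of a vector field on ℝ³. -/
def curl3 (A : (Fin 3 → ℝ) → Fin 3 → ℝ) (x : Fin 3 → ℝ) : Fin 3 → ℝ :=
  ![pdVec A 1 2 x - pdVec A 2 1 x, pdVec A 2 0 x - pdVec A 0 2 x,
    pdVec A 0 1 x - pdVec A 1 0 x]

/-- |∇×A|²(x). -/
def curlSq (A : (Fin 3 → ℝ) → Fin 3 → ℝ) (x : Fin 3 → ℝ) : ℝ :=
  ∑ k, (curl3 A x k) ^ 2

/-- |∇⊗A|²(x) = Σᵢⱼ |∂ᵢAⱼ|². -/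
def gradSq (A : (Fin 3 → ℝ) → Fin 3 → ℝ) (x : Fin 3 → ℝ) : ℝ :=
  ∑ i, ∑ j, (pdVec A i j x) ^ 2

/-- A divergence-free smooth compactly supported vector potential. -/
def IsVecPot (A : (Fin 3 → ℝ) → Fin 3 → ℝ) : Prop :=
  ContDiff ℝ (⊤ : ℕ∞) A ∧ HasCompactSupport A ∧ ∀ x, ∑ k, pdVec A k k x = 0

/-- The unit basis vector of the configuration space (ℝ³)^N in direction
(particle j, coordinate k). -/
def eVec (N : ℕ) (j : Fin N) (k : Fin 3) : Fin N → Fin 3 → ℝ :=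
  Pi.single j (Pi.single k 1)

/-- A normalized `N`-electron wave function: smooth, compactly supported,
antisymmetric under simultaneous permutation of position-spin pairs, L²-normalized. -/
structure IsWaveFun (N : ℕ) (Ψ : (Fin N → Fin 3 → ℝ) → (Fin N → Fin 2) → ℂ) : Prop where
  smooth : ∀ s, ContDiff ℝ (⊤ : ℕ∞) fun x => Ψ x s
  compactSupport : ∀ s, HasCompactSupport fun x => Ψ x s
  antisymm : ∀ (π : Equiv.Perm (Fin N)) (x : Fin N → Fin 3 → ℝ) (s : Fin N → Fin 2),
    Ψ (fun i => x (π i)) (fun i => s (π i)) = ((Equiv.Perm.sign π : ℤ) : ℂ) * Ψ x s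
  normalized : ∑ s : Fin N → Fin 2, ∫ x : Fin N → Fin 3 → ℝ, ‖Ψ x s‖ ^ 2 = 1

/-- The expectation ∫ W |Ψ|² of a multiplication operator, including spin summation. -/
def potInt (N : ℕ) (W : (Fin N → Fin 3 → ℝ) → ℝ)
    (Ψ : (Fin N → Fin 3 → ℝ) → (Fin N → Fin 2) → ℂ) : ℝ :=
  ∑ s : Fin N → Fin 2, ∫ x : Fin N → Fin 3 → ℝ, W x * ‖Ψ x s‖ ^ 2

/-- The Pauli kinetic form t_A^{(j)}[Ψ] = ‖σ^{(j)}·(−i∇_{x_j} + A(x_j))Ψ‖². -/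
def pauliKin (N : ℕ) (A : (Fin 3 → ℝ) → Fin 3 → ℝ) (j : Fin N)
    (Ψ : (Fin N → Fin 3 → ℝ) → (Fin N → Fin 2) → ℂ) : ℝ :=
  ∑ s : Fin N → Fin 2, ∫ x : Fin N → Fin 3 → ℝ,
    ‖∑ k : Fin 3, ∑ t : Fin 2, pauli k (s j) t *
      (-Complex.I * fderiv ℝ (fun y => Ψ y (Function.update s j t)) x (eVec N j k)
        + (A (x j) k : ℂ) * Ψ x (Function.update s j t))‖ ^ 2

/-- The closed ball B_ρ = {x ∈ ℝ³ : |x| ≤ ρ}. -/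
def ball3 (ρ : ℝ) : Set (Fin 3 → ℝ) := {x | enorm3 x ≤ ρ}

/-- The gradient of a scalar function on ℝ³. -/
def grad3 (f : (Fin 3 → ℝ) → ℝ) (x : Fin 3 → ℝ) : Fin 3 → ℝ :=
  fun k => fderiv ℝ f x (Pi.single k 1)

/-- Admissible cutoff pair (θ₀, θ₁) on scale d with gradient constant c₁:
smooth [0,1]-valued, θ₀² + θ₁² ≡ 1, θ₁ supported in B_{2d} and ≡ 1 on B_d,
with |∇θ₀|, |∇θ₁| ≤ c₁/d. -/
structure AdmissibleCutoffs (d c₁ : ℝ) (θ₀ θ₁ : (Fin 3 → ℝ) → ℝ) : Prop where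
  smooth₀ : ContDiff ℝ (⊤ : ℕ∞) θ₀
  smooth₁ : ContDiff ℝ (⊤ : ℕ∞) θ₁
  mem₀ : ∀ x, θ₀ x ∈ Set.Icc (0 : ℝ) 1
  mem₁ : ∀ x, θ₁ x ∈ Set.Icc (0 : ℝ) 1
  partition : ∀ x, θ₀ x ^ 2 + θ₁ x ^ 2 = 1
  support₁ : ∀ x, 2 * d < enorm3 x → θ₁ x = 0
  one₁ : ∀ x, enorm3 x ≤ d → θ₁ x = 1
  grad₀ : ∀ x, enorm3 (grad3 θ₀ x) ≤ c₁ / d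
  grad₁ : ∀ x, enorm3 (grad3 θ₁ x) ≤ c₁ / d

/-- The localized potential W_loc(x) = Z/|x| + |∇θ₀(x)|² + |∇θ₁(x)|². -/
def Wloc (Z : ℝ) (θ₀ θ₁ : (Fin 3 → ℝ) → ℝ) (x : Fin 3 → ℝ) : ℝ :=
  Z / enorm3 x + (∑ k, grad3 θ₀ x k ^ 2) + (∑ k, grad3 θ₁ x k ^ 2)

/-- The wave function Ψ multiplied by the cutoff θ evaluated at the j-th
position variable. -/
def cutMul (N : ℕ) (θ : (Fin 3 → ℝ) → ℝ) (j : Fin N)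
    (Ψ : (Fin N → Fin 3 → ℝ) → (Fin N → Fin 2) → ℂ) :
    (Fin N → Fin 3 → ℝ) → (Fin N → Fin 2) → ℂ :=
  fun x s => (θ (x j) : ℂ) * Ψ x s

/-- The truncated functional 𝓔⁰_N[Ψ,A]. -/
def truncEnergy (N : ℕ) (Z α r : ℝ) (θ₀ θ₁ : (Fin 3 → ℝ) → ℝ)
    (A : (Fin 3 → ℝ) → Fin 3 → ℝ)
    (Ψ : (Fin N → Fin 3 → ℝ) → (Fin N → Fin 2) → ℂ) : ℝ :=
  (∑ j : Fin N, (pauliKin N A j (cutMul N θ₀ j Ψ)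
      - potInt N (fun x => Wloc Z θ₀ θ₁ (x j) * θ₀ (x j) ^ 2) Ψ))
    + (∑ i : Fin N, ∑ j : Fin N,
        if i < j then potInt N (fun x => (enorm3 (x i - x j))⁻¹) Ψ else 0)
    + (16 * Real.pi * α ^ 2)⁻¹ * ∫ x in ball3 (3 * r), gradSq A x

/-- The Coulomb self-energy D(ρ,ρ) = ½ ∬ ρ(x)ρ(y)|x−y|⁻¹ dx dy (as an
extended real, for nonnegative ρ). -/
def coulombSelf (ρ : (Fin 3 → ℝ) → ℝ) : ENNReal :=
  (1 / 2 : ENNReal) * ∫⁻ x : Fin 3 → ℝ, ∫⁻ y : Fin 3 → ℝ,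
    ENNReal.ofReal (ρ x * ρ y * (enorm3 (x - y))⁻¹)

/-- ∫ [ (ρ∗|·|⁻¹)(X) − |X|⁻¹ ]₋^{5/2} dX, with [t]₋ = max(−t,0) (as an extended real). -/
def tfNegIntegral (ρ : (Fin 3 → ℝ) → ℝ) : ENNReal :=
  ∫⁻ X : Fin 3 → ℝ, ENNReal.ofReal
    ((max ((enorm3 X)⁻¹ - ∫ y : Fin 3 → ℝ, ρ y * (enorm3 (X - y))⁻¹) 0) ^ ((5 : ℝ) / 2))

/-- The Thomas–Fermi constant c_TF. -/
def cTF : ℝ :=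
  (sInf {e : ENNReal | ∃ ρ : (Fin 3 → ℝ) → ℝ, Measurable ρ ∧ (∀ x, 0 ≤ ρ x) ∧
    coulombSelf ρ < ⊤ ∧
    e = coulombSelf ρ + ENNReal.ofReal (2 / (15 * Real.pi ^ 2)) * tfNegIntegral ρ}).toReal

/-- Squared Euclidean norm on `Fin 3 → ℝ`. -/
def nsq (x : Fin 3 → ℝ) : ℝ := ∑ k, x k ^ 2

lemma nsq_nonneg (x : Fin 3 → ℝ) : 0 ≤ nsq x := Finset.sum_nonneg fun _ _ => sq_nonneg _

lemma enorm3_eq_norm (x : Fin 3 → ℝ) : enorm3 x = ‖(WithLp.toLp 2 x : EuclideanSpace ℝ (Fin 3))‖ := by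
  simp [enorm3, EuclideanSpace.norm_eq]

lemma enorm3_nonneg (x : Fin 3 → ℝ) : 0 ≤ enorm3 x := Real.sqrt_nonneg _

lemma enorm3_sq (x : Fin 3 → ℝ) : enorm3 x ^ 2 = nsq x := Real.sq_sqrt (nsq_nonneg x)

lemma enorm3_zero : enorm3 0 = 0 := by simp [enorm3]

lemma enorm3_eq_zero {x : Fin 3 → ℝ} : enorm3 x = 0 ↔ x = 0 := by
  rw [enorm3_eq_norm, norm_eq_zero]
  exact ⟨fun h => by simpa using h, fun h => by simpa using h⟩

lemma enorm3_pos {x : Fin 3 → ℝ} (h : x ≠ 0) : 0 < enorm3 x :=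
  lt_of_le_of_ne (enorm3_nonneg x) fun h' => h (enorm3_eq_zero.1 h'.symm)

lemma nsq_pos {x : Fin 3 → ℝ} (h : x ≠ 0) : 0 < nsq x := by
  rw [← enorm3_sq]; exact pow_pos (enorm3_pos h) 2

lemma enorm3_add_le (x y : Fin 3 → ℝ) : enorm3 (x + y) ≤ enorm3 x + enorm3 y := by
  simp only [enorm3_eq_norm, WithLp.toLp_add]; exact norm_add_le _ _

lemma enorm3_neg (x : Fin 3 → ℝ) : enorm3 (-x) = enorm3 x := by simp [enorm3]

lemma enorm3_sub_le (x y : Fin 3 → ℝ) : enorm3 (x - y) ≤ enorm3 x + enorm3 y := by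
  rw [sub_eq_add_neg, ← enorm3_neg y]; exact enorm3_add_le _ _

lemma enorm3_smul (a : ℝ) (x : Fin 3 → ℝ) : enorm3 (a • x) = |a| * enorm3 x := by
  simp only [enorm3_eq_norm, WithLp.toLp_smul, norm_smul, Real.norm_eq_abs]

lemma nsq_smul (a : ℝ) (x : Fin 3 → ℝ) : nsq (a • x) = a ^ 2 * nsq x := by
  simp [nsq, mul_pow, Finset.mul_sum]

lemma nsq_neg (x : Fin 3 → ℝ) : nsq (-x) = nsq x := by simp [nsq]

lemma nsq_sub_comm (x y : Fin 3 → ℝ) : nsq (x - y) = nsq (y - x) := by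
  rw [← nsq_neg, neg_sub]

lemma continuous_nsq : Continuous nsq := by unfold nsq; fun_prop

lemma continuous_enorm3 : Continuous enorm3 := by unfold enorm3; fun_prop

lemma norm_le_enorm3 (x : Fin 3 → ℝ) : ‖x‖ ≤ enorm3 x := by
  refine (pi_norm_le_iff_of_nonneg (enorm3_nonneg x)).2 fun k => ?_
  rw [Real.norm_eq_abs]
  refine Real.abs_le_sqrt ?_
  exact Finset.single_le_sum (f := fun k => x k ^ 2) (fun _ _ => sq_nonneg _) (Finset.mem_univ k)

lemma nsq_le_norm (x : Fin 3 → ℝ) : nsq x ≤ 3 * ‖x‖ ^ 2 := by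
  have h : ∀ k, x k ^ 2 ≤ ‖x‖ ^ 2 := fun k => by
    rw [← sq_abs (x k)]
    exact pow_le_pow_left₀ (abs_nonneg _) (norm_le_pi_norm x k) 2
  simp only [nsq, Fin.sum_univ_three]
  linarith [h 0, h 1, h 2]

lemma enorm3_le_norm (x : Fin 3 → ℝ) : enorm3 x ≤ 2 * ‖x‖ := by
  refine Real.sqrt_le_iff.2 ⟨by positivity, ?_⟩
  have := nsq_le_norm x
  simp only [nsq] at this
  nlinarith [sq_nonneg ‖x‖]

lemma integral_gaussian3 {b : ℝ} (hb : 0 < b) :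
    ∫ x : Fin 3 → ℝ, Real.exp (-b * nsq x) = (Real.pi / b) ^ ((3 : ℝ) / 2) := by
  have h : ∀ x : Fin 3 → ℝ, Real.exp (-b * nsq x) = ∏ k, (fun t : ℝ => Real.exp (-b * t ^ 2)) (x k) := by
    intro x
    rw [← Real.exp_sum, nsq, Finset.mul_sum]
  simp_rw [h]
  rw [integral_fintype_prod_volume_eq_pow (f := fun t : ℝ => Real.exp (-b * t ^ 2)), integral_gaussian]
  rw [Real.sqrt_eq_rpow, ← Real.rpow_natCast, ← Real.rpow_mul (by positivity)]
  norm_num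

lemma integrable_gaussian3 {b : ℝ} (hb : 0 < b) :
    Integrable fun x : Fin 3 → ℝ => Real.exp (-b * nsq x) := by
  by_contra h
  have := integral_gaussian3 hb
  rw [integral_undef h] at this
  have h2 : 0 < (Real.pi / b) ^ ((3 : ℝ) / 2) := by positivity
  linarith

lemma lintegral_gaussian3 {b : ℝ} (hb : 0 < b) :
    ∫⁻ x : Fin 3 → ℝ, ENNReal.ofReal (Real.exp (-b * nsq x))
      = ENNReal.ofReal ((Real.pi / b) ^ ((3 : ℝ) / 2)) := by
  rw [← integral_gaussian3 hb, ofReal_integral_eq_lintegral_ofReal (integrable_gaussian3 hb)]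
  exact Filter.Eventually.of_forall fun _ => (Real.exp_pos _).le

lemma lintegral_gaussian3_sub {b : ℝ} (hb : 0 < b) (c : Fin 3 → ℝ) :
    ∫⁻ x : Fin 3 → ℝ, ENNReal.ofReal (Real.exp (-b * nsq (x - c)))
      = ENNReal.ofReal ((Real.pi / b) ^ ((3 : ℝ) / 2)) := by
  rw [lintegral_sub_right_eq_self (fun x => ENNReal.ofReal (Real.exp (-b * nsq x))) c,
    lintegral_gaussian3 hb]

/-- Product of two Gaussians integrated over the centre. -/
lemma lintegral_gaussian3_mul {a b : ℝ} (ha : 0 < a) (hb : 0 < b) (x y : Fin 3 → ℝ) :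
    ∫⁻ z : Fin 3 → ℝ, ENNReal.ofReal (Real.exp (-a * nsq (x - z)) * Real.exp (-b * nsq (z - y)))
      = ENNReal.ofReal ((Real.pi / (a + b)) ^ ((3 : ℝ) / 2)
          * Real.exp (-(a * b / (a + b)) * nsq (x - y))) := by
  have hab : 0 < a + b := by positivity
  have h : ∀ z : Fin 3 → ℝ, Real.exp (-a * nsq (x - z)) * Real.exp (-b * nsq (z - y))
      = Real.exp (-(a * b / (a + b)) * nsq (x - y)) *
        Real.exp (-(a + b) * nsq (z - (a + b)⁻¹ • (a • x + b • y))) := by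
    intro z
    rw [← Real.exp_add, ← Real.exp_add]
    congr 1
    simp only [nsq, Fin.sum_univ_three, Pi.sub_apply, Pi.smul_apply, Pi.add_apply, smul_eq_mul]
    field_simp
    ring
  simp_rw [h, ENNReal.ofReal_mul (Real.exp_pos _).le]
  rw [lintegral_const_mul _ (by unfold nsq; fun_prop), lintegral_gaussian3_sub hab, mul_comm,
    ENNReal.ofReal_mul (by positivity)]

lemma ae_ne3 (a : Fin 3 → ℝ) : ∀ᵐ x : Fin 3 → ℝ, x ≠ a := by
  rw [ae_iff]; simp

section PositiveDefinite

variable {Ω X : Type*} [MeasurableSpace Ω] [MeasurableSpace X] (μ : Measure Ω) [SFinite μ]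
  (ν : Measure X) [SFinite ν]

/-- Positive definiteness of a kernel with a feature map, in extended nonnegative form. -/
lemma lintegral_kernel_pd {N : ℕ} (φ : Ω → X → ENNReal) (hφ : Measurable (Function.uncurry φ))
    (q : Fin N → ENNReal) (p : Fin N → X) (ρ : X → ENNReal) (hρ : Measurable ρ) :
    2 * ∑ j, q j * ∫⁻ y, (∫⁻ ω, φ ω (p j) * φ ω y ∂μ) * ρ y ∂ν ≤
      (∑ i, ∑ j, q i * q j * ∫⁻ ω, φ ω (p i) * φ ω (p j) ∂μ)
        + ∫⁻ x, ∫⁻ y, ρ x * ρ y * (∫⁻ ω, φ ω x * φ ω y ∂μ) ∂ν ∂ν := by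
  have hm : ∀ x, Measurable fun ω => φ ω x := fun x => hφ.comp (measurable_id.prodMk measurable_const)
  have hm' : ∀ ω, Measurable fun x => φ ω x := fun ω => hφ.comp (measurable_const.prodMk measurable_id)
  set S : Ω → ENNReal := fun ω => ∑ j, q j * φ ω (p j) with hS
  set R : Ω → ENNReal := fun ω => ∫⁻ y, φ ω y * ρ y ∂ν with hR
  have hSm : Measurable S := Finset.measurable_fun_sum _ fun j _ => (hm _).const_mul _
  have hRm : Measurable R := by
    refine Measurable.lintegral_prod_right' (f := fun p : Ω × X => φ p.1 p.2 * ρ p.2) ?_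
    exact hφ.fun_mul (hρ.comp measurable_snd)
  have hφ2 : Measurable (fun z : X × Ω => φ z.2 z.1) := hφ.comp measurable_swap
  have h1 : ∑ j, q j * ∫⁻ y, (∫⁻ ω, φ ω (p j) * φ ω y ∂μ) * ρ y ∂ν = ∫⁻ ω, S ω * R ω ∂μ := by
    have : ∀ ω, S ω * R ω = ∑ j, q j * (φ ω (p j) * R ω) := by
      intro ω; rw [hS, Finset.sum_mul]; exact Finset.sum_congr rfl fun j _ => by ring
    simp_rw [this]
    rw [lintegral_finsetSum _ fun j _ => (((hm _).fun_mul hRm).const_mul _)]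
    refine Finset.sum_congr rfl fun j _ => ?_
    rw [lintegral_const_mul _ ((hm _).fun_mul hRm)]
    congr 1
    simp_rw [hR]
    have e1 : ∀ y, (∫⁻ ω, φ ω (p j) * φ ω y ∂μ) * ρ y = ∫⁻ ω, φ ω (p j) * φ ω y * ρ y ∂μ := fun y =>
      (lintegral_mul_const _ ((hm _).fun_mul (hm _))).symm
    have e2 : ∀ ω, φ ω (p j) * ∫⁻ y, φ ω y * ρ y ∂ν = ∫⁻ y, φ ω (p j) * φ ω y * ρ y ∂ν := fun ω => by
      rw [← lintegral_const_mul _ ((hm' _).fun_mul hρ)]; simp_rw [mul_assoc]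
    simp_rw [e1, e2]
    rw [lintegral_lintegral_swap]
    refine Measurable.aemeasurable ?_
    exact (((hm _).comp measurable_snd).fun_mul hφ2).fun_mul (hρ.comp measurable_fst)
  have h2 : ∑ i, ∑ j, q i * q j * ∫⁻ ω, φ ω (p i) * φ ω (p j) ∂μ = ∫⁻ ω, S ω ^ 2 ∂μ := by
    have : ∀ ω, S ω ^ 2 = ∑ i, ∑ j, q i * q j * (φ ω (p i) * φ ω (p j)) := by
      intro ω; rw [hS, sq, Finset.sum_mul_sum]
      exact Finset.sum_congr rfl fun j _ => Finset.sum_congr rfl fun j _ => by ring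
    simp_rw [this]
    rw [lintegral_finsetSum _ fun j _ => Finset.measurable_fun_sum _ fun i _ =>
      (((hm _).fun_mul (hm _)).const_mul _)]
    refine Finset.sum_congr rfl fun i _ => ?_
    rw [lintegral_finsetSum _ fun j _ => (((hm _).fun_mul (hm _)).const_mul _)]
    refine Finset.sum_congr rfl fun j _ => ?_
    rw [lintegral_const_mul _ ((hm _).fun_mul (hm _))]
  have h3 : ∫⁻ x, ∫⁻ y, ρ x * ρ y * (∫⁻ ω, φ ω x * φ ω y ∂μ) ∂ν ∂ν = ∫⁻ ω, R ω ^ 2 ∂μ := by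
    have e1 : ∀ x, ∫⁻ y, ρ x * ρ y * (∫⁻ ω, φ ω x * φ ω y ∂μ) ∂ν = ∫⁻ ω, ρ x * φ ω x * R ω ∂μ := by
      intro x
      have e2 : ∀ y, ρ x * ρ y * (∫⁻ ω, φ ω x * φ ω y ∂μ) = ∫⁻ ω, ρ x * ρ y * (φ ω x * φ ω y) ∂μ :=
        fun y => (lintegral_const_mul _ ((hm _).fun_mul (hm _))).symm
      have e3 : ∀ ω, ρ x * φ ω x * R ω = ∫⁻ y, ρ x * ρ y * (φ ω x * φ ω y) ∂ν := by
        intro ω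
        rw [← lintegral_const_mul _ ((hm' _).fun_mul hρ)]
        exact lintegral_congr fun y => by ring
      simp_rw [e2, e3]
      rw [lintegral_lintegral_swap]
      refine Measurable.aemeasurable ?_
      exact ((hρ.comp measurable_fst).const_mul _).fun_mul (((hm _).comp measurable_snd).fun_mul hφ2)
    simp_rw [e1]
    rw [lintegral_lintegral_swap]
    · refine lintegral_congr fun ω => ?_
      rw [lintegral_mul_const _ (hρ.fun_mul (hm' ω)), sq]
      congr 1
      exact lintegral_congr fun y => by ring
    · refine Measurable.aemeasurable ?_
      exact ((hρ.comp measurable_fst).fun_mul hφ2).fun_mul (hRm.comp measurable_snd)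
  rw [h1, h2, h3, ← lintegral_const_mul _ (hSm.fun_mul hRm), ← lintegral_add_left (hSm.pow_const 2)]
  refine lintegral_mono fun ω => ?_
  simp only []
  rw [← mul_assoc]
  rcases le_total (S ω) (R ω) with h | h
  · obtain ⟨c, hc⟩ := exists_add_of_le h
    rw [hc]
    calc 2 * S ω * (S ω + c) ≤ 2 * S ω * (S ω + c) + c ^ 2 := le_self_add
      _ = _ := by ring
  · obtain ⟨c, hc⟩ := exists_add_of_le h
    rw [hc]
    calc 2 * (R ω + c) * R ω ≤ 2 * (R ω + c) * R ω + c ^ 2 := le_self_add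
      _ = _ := by ring

end PositiveDefinite

/-- The normalization constant `2/√π`. -/
def cK : ℝ := 2 / Real.sqrt Real.pi

lemma cK_pos : 0 < cK := by unfold cK; positivity

lemma cK_le : cK ≤ 2 := by
  unfold cK
  refine div_le_self (by norm_num) ?_
  rw [Real.one_le_sqrt]; linarith [Real.pi_gt_three]

/-- The regularized Coulomb kernel. -/
def KT (T : ℝ) (x : Fin 3 → ℝ) : ENNReal :=
  ∫⁻ t in Set.Ioo 0 T, ENNReal.ofReal (cK * Real.exp (-t ^ 2 * nsq x))

lemma lintegral_Ioi_eq_inv {x : Fin 3 → ℝ} (hx : x ≠ 0) :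
    ∫⁻ t in Set.Ioi 0, ENNReal.ofReal (cK * Real.exp (-t ^ 2 * nsq x))
      = ENNReal.ofReal (enorm3 x)⁻¹ := by
  have hn := nsq_pos hx
  have hi : Integrable fun t : ℝ => cK * Real.exp (-t ^ 2 * nsq x) := by
    refine Integrable.const_mul ?_ _
    convert integrable_exp_neg_mul_sq hn using 3
    ring
  rw [← ofReal_integral_eq_lintegral_ofReal hi.integrableOn
    (Filter.Eventually.of_forall fun _ => by have := cK_pos; positivity)]
  congr 1
  rw [integral_const_mul]
  have h := integral_gaussian_Ioi (nsq x)
  have h2 : ∀ t : ℝ, Real.exp (-t ^ 2 * nsq x) = Real.exp (-nsq x * t ^ 2) := fun t => by ring_nf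
  simp_rw [h2]
  rw [h, cK, Real.sqrt_div Real.pi_pos.le, enorm3]
  have : 0 < Real.sqrt Real.pi := by positivity
  change 2 / _ * (_ / Real.sqrt (nsq x) / 2) = (Real.sqrt (nsq x))⁻¹
  have : 0 < Real.sqrt (nsq x) := by positivity
  field_simp

lemma measurable_KT (T : ℝ) : Measurable (KT T) := by
  unfold KT
  refine Measurable.lintegral_prod_right' (f := fun p : (Fin 3 → ℝ) × ℝ =>
    ENNReal.ofReal (cK * Real.exp (-p.2 ^ 2 * nsq p.1))) ?_
  refine Measurable.ennreal_ofReal (Continuous.measurable ?_)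
  have := continuous_nsq
  fun_prop

lemma KT_neg (T : ℝ) (x : Fin 3 → ℝ) : KT T (-x) = KT T x := by simp [KT, nsq_neg]

lemma KT_sub_comm (T : ℝ) (x y : Fin 3 → ℝ) : KT T (x - y) = KT T (y - x) := by
  rw [← KT_neg, neg_sub]

lemma KT_le_inv (T : ℝ) {x : Fin 3 → ℝ} (hx : x ≠ 0) : KT T x ≤ ENNReal.ofReal (enorm3 x)⁻¹ := by
  rw [← lintegral_Ioi_eq_inv hx]
  exact lintegral_mono_set Set.Ioo_subset_Ioi_self

lemma KT_le (T : ℝ) (x : Fin 3 → ℝ) : KT T x ≤ ENNReal.ofReal (cK * T) := by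
  calc KT T x ≤ ∫⁻ t in Set.Ioo 0 T, ENNReal.ofReal cK := by
        refine lintegral_mono fun t => ENNReal.ofReal_le_ofReal ?_
        refine mul_le_of_le_one_right cK_pos.le (Real.exp_le_one_iff.2 ?_)
        have := nsq_nonneg x
        nlinarith [mul_nonneg (sq_nonneg t) this]
    _ = _ := by
        rw [setLIntegral_const, Real.volume_Ioo, sub_zero, ENNReal.ofReal_mul cK_pos.le]

lemma KT_ne_top (T : ℝ) (x : Fin 3 → ℝ) : KT T x ≠ ⊤ :=
  ne_top_of_le_ne_top ENNReal.ofReal_ne_top (KT_le T x)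

lemma inv_le_KT_add {T : ℝ} (hT : 0 < T) {x : Fin 3 → ℝ} (hx : x ≠ 0) :
    ENNReal.ofReal (enorm3 x)⁻¹ ≤ KT T x + ENNReal.ofReal (2 / (T * nsq x)) := by
  have hn := nsq_pos hx
  rw [← lintegral_Ioi_eq_inv hx]
  have hsub : Set.Ioi (0 : ℝ) ⊆ Set.Ioo 0 T ∪ Set.Ici T := by
    intro t ht
    rcases lt_or_ge t T with h | h
    · exact Or.inl ⟨ht, h⟩
    · exact Or.inr h
  refine (lintegral_mono_set hsub).trans ((lintegral_union_le _ _ _).trans ?_)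
  refine add_le_add le_rfl ?_
  rw [Measure.restrict_congr_set Ioi_ae_eq_Ici.symm]
  have hi : IntegrableOn (fun t : ℝ => cK / nsq x * t ^ (-2 : ℝ)) (Set.Ioi T) :=
    (integrableOn_Ioi_rpow_of_lt (by norm_num) hT).const_mul _
  calc ∫⁻ t in Set.Ioi T, ENNReal.ofReal (cK * Real.exp (-t ^ 2 * nsq x))
      ≤ ∫⁻ t in Set.Ioi T, ENNReal.ofReal (cK / nsq x * t ^ (-2 : ℝ)) := by
        refine setLIntegral_mono' measurableSet_Ioi fun t ht => ENNReal.ofReal_le_ofReal ?_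
        have ht0 : 0 < t := hT.trans ht
        rw [div_mul_eq_mul_div, mul_div_assoc]
        refine mul_le_mul_of_nonneg_left ?_ cK_pos.le
        rw [Real.rpow_neg ht0.le, ← one_div, div_div, Real.rpow_two, neg_mul, Real.exp_neg, ← one_div]
        refine one_div_le_one_div_of_le (by positivity) ?_
        linarith [Real.add_one_le_exp (t ^ 2 * nsq x)]
    _ = ENNReal.ofReal (∫ t in Set.Ioi T, cK / nsq x * t ^ (-2 : ℝ)) := by
        rw [ofReal_integral_eq_lintegral_ofReal hi]
        refine (ae_restrict_iff' measurableSet_Ioi).2 (Filter.Eventually.of_forall fun t ht => ?_)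
        have ht0 : 0 < t := hT.trans ht
        have := cK_pos
        simp only [Pi.zero_apply]
        positivity
    _ ≤ _ := by
        refine ENNReal.ofReal_le_ofReal ?_
        rw [integral_const_mul, integral_Ioi_rpow_of_lt (by norm_num) hT]
        have : -T ^ ((-2 : ℝ) + 1) / (-2 + 1) = T⁻¹ := by
          norm_num [Real.rpow_neg_one]
        rw [this, ← div_eq_mul_inv, div_div, mul_comm (nsq x)]
        gcongr
        exact cK_le

/-- The normalized Gaussian of inverse width `T`. -/
def gk (T : ℝ) (y : Fin 3 → ℝ) : ℝ := (T ^ 2 / Real.pi) ^ ((3 : ℝ) / 2) * Real.exp (-T ^ 2 * nsq y)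

lemma gk_sub_comm (T : ℝ) (x y : Fin 3 → ℝ) : gk T (x - y) = gk T (y - x) := by
  unfold gk; rw [nsq_sub_comm]

lemma continuous_gk (T : ℝ) : Continuous (gk T) := by
  have := continuous_nsq
  unfold gk; fun_prop

lemma lintegral_gk {T : ℝ} (hT : 0 < T) : ∫⁻ y, ENNReal.ofReal (gk T y) = 1 := by
  have hm : Measurable fun y : Fin 3 → ℝ => ENNReal.ofReal (Real.exp (-T ^ 2 * nsq y)) := by
    have := continuous_nsq
    exact (Continuous.measurable (by fun_prop)).ennreal_ofReal
  unfold gk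
  simp_rw [ENNReal.ofReal_mul (show 0 ≤ (T ^ 2 / Real.pi) ^ ((3 : ℝ) / 2) by positivity)]
  rw [lintegral_const_mul _ hm, lintegral_gaussian3 (by positivity), ← ENNReal.ofReal_mul (by positivity),
    ← Real.mul_rpow (by positivity) (by positivity)]
  have : T ^ 2 / Real.pi * (Real.pi / T ^ 2) = 1 := by field_simp
  rw [this]; simp

lemma lintegral_gk_sub {T : ℝ} (hT : 0 < T) (x : Fin 3 → ℝ) :
    ∫⁻ y, ENNReal.ofReal (gk T (x - y)) = 1 := by
  rw [lintegral_sub_left_eq_self (fun y => ENNReal.ofReal (gk T y)) x, lintegral_gk hT]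

/-- The feature map of the kernel `KT`. -/
def featK (ω : ℝ × (Fin 3 → ℝ)) (x : Fin 3 → ℝ) : ENNReal :=
  ENNReal.ofReal (Real.sqrt (cK * (4 * ω.1 ^ 2 / Real.pi) ^ ((3 : ℝ) / 2)) *
    Real.exp (-(2 * ω.1 ^ 2) * nsq (x - ω.2)))

lemma measurable_featK : Measurable (Function.uncurry featK) := by
  unfold featK Function.uncurry
  refine Measurable.ennreal_ofReal ?_
  have := continuous_nsq
  refine Measurable.mul ?_ (Continuous.measurable (by fun_prop))
  fun_prop

lemma KT_eq_featK (T : ℝ) (x y : Fin 3 → ℝ) :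
    KT T (x - y) = ∫⁻ ω, featK ω x * featK ω y ∂((volume.restrict (Set.Ioo 0 T)).prod volume) := by
  have hm := measurable_featK
  rw [lintegral_prod]
  · unfold KT
    refine setLIntegral_congr_fun measurableSet_Ioo fun t ht => ?_
    have ht0 : 0 < t := ht.1
    have hc := cK_pos
    have e : ∀ z, featK (t, z) x * featK (t, z) y =
        ENNReal.ofReal (cK * (4 * t ^ 2 / Real.pi) ^ ((3 : ℝ) / 2)) *
        ENNReal.ofReal (Real.exp (-(2 * t ^ 2) * nsq (x - z)) * Real.exp (-(2 * t ^ 2) * nsq (z - y))) := by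
      intro z
      rw [featK, featK, ← ENNReal.ofReal_mul (by positivity), ← ENNReal.ofReal_mul (by positivity)]
      congr 1
      simp only []
      rw [nsq_sub_comm z y, mul_mul_mul_comm, Real.mul_self_sqrt (by positivity)]
    simp_rw [e]
    rw [lintegral_const_mul, lintegral_gaussian3_mul (by positivity) (by positivity),
      ← ENNReal.ofReal_mul (by positivity)]
    · congr 1
      have e1 : -(2 * t ^ 2 * (2 * t ^ 2) / (2 * t ^ 2 + 2 * t ^ 2)) = - t ^ 2 := by
        field_simp; ring
      have e2 : (4 * t ^ 2 / Real.pi) ^ ((3 : ℝ) / 2) * (Real.pi / (2 * t ^ 2 + 2 * t ^ 2)) ^ ((3 : ℝ) / 2) = 1 := by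
        rw [← Real.mul_rpow (by positivity) (by positivity)]
        have : 4 * t ^ 2 / Real.pi * (Real.pi / (2 * t ^ 2 + 2 * t ^ 2)) = 1 := by field_simp; norm_num
        rw [this, Real.one_rpow]
      rw [e1]
      linear_combination (-cK * Real.exp (-t ^ 2 * nsq (x - y))) * e2
    · have := continuous_nsq
      exact (Continuous.measurable (by fun_prop)).ennreal_ofReal
  · exact ((hm.comp (measurable_id.prodMk measurable_const)).mul
      (hm.comp (measurable_id.prodMk measurable_const))).aemeasurable

/-- Positive definiteness of the regularized Coulomb kernel. -/
lemma KT_pd {N : ℕ} (T : ℝ) (q : Fin N → ENNReal) (p : Fin N → Fin 3 → ℝ)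
    (ρ : (Fin 3 → ℝ) → ENNReal) (hρ : Measurable ρ) :
    2 * ∑ j, q j * ∫⁻ y, KT T (p j - y) * ρ y ≤
      (∑ i, ∑ j, q i * q j * KT T (p i - p j)) + ∫⁻ x, ∫⁻ y, ρ x * ρ y * KT T (x - y) := by
  simp_rw [KT_eq_featK]
  exact lintegral_kernel_pd _ volume featK measurable_featK q p ρ hρ

lemma KT_subst {T : ℝ} (hT : 0 < T) (x : Fin 3 → ℝ) :
    KT T x = ∫⁻ t in Set.Ioi 0, ENNReal.ofReal ((T ^ 2 / (t ^ 2 + T ^ 2)) ^ ((3 : ℝ) / 2)) *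
      ENNReal.ofReal (cK * Real.exp (-(t ^ 2 * T ^ 2 / (t ^ 2 + T ^ 2)) * nsq x)) := by
  set τ : ℝ → ℝ := fun t => T * t / Real.sqrt (t ^ 2 + T ^ 2) with hτ
  have hpos : ∀ t, 0 < t ^ 2 + T ^ 2 := fun t => by positivity
  have hs : ∀ t, 0 < Real.sqrt (t ^ 2 + T ^ 2) := fun t => Real.sqrt_pos.2 (hpos t)
  have hτsq : ∀ t, τ t ^ 2 = t ^ 2 * T ^ 2 / (t ^ 2 + T ^ 2) := fun t => by
    rw [hτ]; simp only []; rw [div_pow, Real.sq_sqrt (hpos t).le]; ring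
  have hd : ∀ t ∈ Set.Ioi (0 : ℝ), HasDerivWithinAt τ ((T ^ 2 / (t ^ 2 + T ^ 2)) ^ ((3 : ℝ) / 2)) (Set.Ioi 0) t := by
    intro t ht
    refine HasDerivAt.hasDerivWithinAt ?_
    have h1 : HasDerivAt (fun t : ℝ => T * t) T t := by simpa using (hasDerivAt_id t).const_mul T
    have h2 : HasDerivAt (fun t : ℝ => Real.sqrt (t ^ 2 + T ^ 2)) (2 * t / (2 * Real.sqrt (t ^ 2 + T ^ 2))) t := by
      refine HasDerivAt.sqrt ?_ (hpos t).ne'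
      simpa using ((hasDerivAt_id t).pow 2).add_const (T ^ 2)
    refine (h1.fun_div h2 (hs t).ne').congr_deriv ?_
    symm
    rw [show (3 : ℝ) / 2 = 1 / 2 * (3 : ℕ) by norm_num, Real.rpow_mul (by have := hpos t; positivity), Real.rpow_natCast,
      ← Real.sqrt_eq_rpow, Real.sqrt_div (by positivity), Real.sqrt_sq hT.le]
    have h3 := Real.sq_sqrt (hpos t).le
    have := hs t
    field_simp
    rw [h3]; ring
  have hinj : Set.InjOn τ (Set.Ioi 0) := by
    intro a ha b hb hab
    have h1 : τ a ^ 2 = τ b ^ 2 := by rw [hab]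
    rw [hτsq, hτsq, div_eq_div_iff (hpos a).ne' (hpos b).ne'] at h1
    have h2 : (a ^ 2 - b ^ 2) * T ^ 4 = 0 := by linear_combination h1
    have h3 : a ^ 2 = b ^ 2 := by
      rcases mul_eq_zero.1 h2 with h | h
      · linarith
      · exact absurd h (by positivity)
    exact (sq_eq_sq₀ (le_of_lt ha) (le_of_lt hb)).1 h3
  have himg : τ '' Set.Ioi 0 = Set.Ioo 0 T := by
    ext s
    constructor
    · rintro ⟨t, ht, rfl⟩
      have ht0 : 0 < t := ht
      refine ⟨by have := hs t; simp only [hτ]; positivity, ?_⟩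
      simp only [hτ]
      rw [div_lt_iff₀ (hs t)]
      refine mul_lt_mul_of_pos_left ?_ hT
      exact Real.lt_sqrt_of_sq_lt (by nlinarith)
    · rintro ⟨h0, h1⟩
      have hp : 0 < T ^ 2 - s ^ 2 := by nlinarith
      refine ⟨s * T / Real.sqrt (T ^ 2 - s ^ 2), by simp only [Set.mem_Ioi]; positivity, ?_⟩
      simp only [hτ]
      have e : (s * T / Real.sqrt (T ^ 2 - s ^ 2)) ^ 2 + T ^ 2 = (T ^ 2 / Real.sqrt (T ^ 2 - s ^ 2)) ^ 2 := by
        rw [div_pow, div_pow, Real.sq_sqrt hp.le]; field_simp; ring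
      rw [e, Real.sqrt_sq (by positivity)]
      field_simp
  rw [KT, ← himg, lintegral_image_eq_lintegral_abs_deriv_mul measurableSet_Ioi hd hinj]
  refine setLIntegral_congr_fun measurableSet_Ioi fun t ht => ?_
  rw [abs_of_nonneg (by have := hpos t; positivity), hτsq]

/-- `KT` is the Coulomb kernel convolved with a Gaussian. -/
lemma KT_eq_conv {T : ℝ} (hT : 0 < T) (x : Fin 3 → ℝ) :
    KT T x = ∫⁻ y, ENNReal.ofReal (enorm3 (x - y))⁻¹ * ENNReal.ofReal (gk T y) := by
  have hc := cK_pos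
  have hn := continuous_nsq
  have e1 : ∫⁻ y, ENNReal.ofReal (enorm3 (x - y))⁻¹ * ENNReal.ofReal (gk T y) =
      ∫⁻ y, ∫⁻ t in Set.Ioi 0, ENNReal.ofReal (cK * (T ^ 2 / Real.pi) ^ ((3 : ℝ) / 2)) * ENNReal.ofReal
        (Real.exp (-t ^ 2 * nsq (x - y)) * Real.exp (-T ^ 2 * nsq (y - 0))) := by
    refine lintegral_congr_ae ?_
    filter_upwards [ae_ne3 x] with y hy
    rw [← lintegral_Ioi_eq_inv (sub_ne_zero.2 hy.symm), ← lintegral_mul_const]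
    · refine lintegral_congr fun t => ?_
      rw [← ENNReal.ofReal_mul (by positivity), ← ENNReal.ofReal_mul (by positivity), gk, sub_zero]
      congr 1; ring
    · exact (Continuous.measurable (by fun_prop)).ennreal_ofReal
  rw [e1, lintegral_lintegral_swap, KT_subst hT]
  · refine setLIntegral_congr_fun measurableSet_Ioi fun t ht => ?_
    have ht0 : 0 < t := ht
    have e2 : ∀ y, Real.exp (-t ^ 2 * nsq (x - y)) = Real.exp (-(t ^ 2) * nsq (x - y)) := fun y => rfl
    rw [lintegral_const_mul, lintegral_gaussian3_mul (by positivity) (by positivity), sub_zero,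
      ← ENNReal.ofReal_mul (by positivity), ← ENNReal.ofReal_mul (by positivity)]
    · congr 1
      have e3 : (T ^ 2 / (t ^ 2 + T ^ 2)) ^ ((3 : ℝ) / 2) =
          (T ^ 2 / Real.pi) ^ ((3 : ℝ) / 2) * (Real.pi / (t ^ 2 + T ^ 2)) ^ ((3 : ℝ) / 2) := by
        rw [← Real.mul_rpow (by positivity) (by positivity)]
        congr 1; field_simp
      rw [e3]; ring
    · exact (Continuous.measurable (by fun_prop)).ennreal_ofReal
  · refine Measurable.aemeasurable ?_
    refine Measurable.const_mul ?_ _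
    exact (Continuous.measurable (by fun_prop)).ennreal_ofReal

/-- The regularized Coulomb potential of a density. -/
def PTe (T : ℝ) (ρ : (Fin 3 → ℝ) → ℝ) (X : Fin 3 → ℝ) : ENNReal :=
  ∫⁻ y, KT T (X - y) * ENNReal.ofReal (ρ y)

/-- Real-valued version of `PTe`. -/
def PT (T : ℝ) (ρ : (Fin 3 → ℝ) → ℝ) (X : Fin 3 → ℝ) : ℝ := (PTe T ρ X).toReal

lemma PT_nonneg (T : ℝ) (ρ : (Fin 3 → ℝ) → ℝ) (X : Fin 3 → ℝ) : 0 ≤ PT T ρ X := ENNReal.toReal_nonneg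

lemma measurable_PTe (T : ℝ) {ρ : (Fin 3 → ℝ) → ℝ} (hρ : Measurable ρ) : Measurable (PTe T ρ) := by
  unfold PTe
  refine Measurable.lintegral_prod_right' (f := fun p : (Fin 3 → ℝ) × (Fin 3 → ℝ) =>
    KT T (p.1 - p.2) * ENNReal.ofReal (ρ p.2)) ?_
  exact ((measurable_KT T).comp (measurable_fst.sub measurable_snd)).mul
    (hρ.comp measurable_snd).ennreal_ofReal

lemma measurable_PT (T : ℝ) {ρ : (Fin 3 → ℝ) → ℝ} (hρ : Measurable ρ) : Measurable (PT T ρ) :=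
  (measurable_PTe T hρ).ennreal_toReal

lemma lintegral_KT_le_coulombSelf (T : ℝ) {ρ : (Fin 3 → ℝ) → ℝ} (h0 : ∀ x, 0 ≤ ρ x) :
    ∫⁻ x, ∫⁻ y, ENNReal.ofReal (ρ x) * ENNReal.ofReal (ρ y) * KT T (x - y) ≤ 2 * coulombSelf ρ := by
  rw [coulombSelf, ← mul_assoc, one_div, ENNReal.mul_inv_cancel (by norm_num) (by norm_num), one_mul]
  refine lintegral_mono fun x => lintegral_mono_ae ?_
  filter_upwards [ae_ne3 x] with y hy
  rw [ENNReal.ofReal_mul (mul_nonneg (h0 x) (h0 y)), ENNReal.ofReal_mul (h0 x)]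
  gcongr
  exact KT_le_inv T (sub_ne_zero.2 hy.symm)

/-- `PD` in real form for distinct points. -/
lemma PTe_pd {N : ℕ} (T : ℝ) {ρ : (Fin 3 → ℝ) → ℝ} (hρ : Measurable ρ) (h0 : ∀ x, 0 ≤ ρ x)
    (m : ℝ) (q : Fin N → ENNReal) (p : Fin N → Fin 3 → ℝ) :
    2 * ∑ j, q j * (ENNReal.ofReal m * PTe T ρ (p j)) ≤
      (∑ i, ∑ j, q i * q j * KT T (p i - p j)) + ENNReal.ofReal m ^ 2 * (2 * coulombSelf ρ) := by
  have h := KT_pd T q p (fun y => ENNReal.ofReal m * ENNReal.ofReal (ρ y))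
    (hρ.ennreal_ofReal.const_mul _)
  refine le_trans (le_of_eq ?_) (h.trans (add_le_add le_rfl ?_))
  · congr 1
    refine Finset.sum_congr rfl fun j _ => ?_
    congr 1
    rw [PTe, ← lintegral_const_mul' _ _ ENNReal.ofReal_ne_top]
    exact lintegral_congr fun y => by ring
  · refine le_trans (le_of_eq ?_) (mul_le_mul' le_rfl (lintegral_KT_le_coulombSelf T h0))
    have e : ∀ x y, ENNReal.ofReal m * ENNReal.ofReal (ρ x) * (ENNReal.ofReal m * ENNReal.ofReal (ρ y)) * KT T (x - y)
        = ENNReal.ofReal m ^ 2 * (ENNReal.ofReal (ρ x) * ENNReal.ofReal (ρ y) * KT T (x - y)) :=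
      fun x y => by ring
    simp_rw [e]
    rw [← lintegral_const_mul' _ _ (by simp)]
    exact lintegral_congr fun x => lintegral_const_mul' _ _ (by simp)

lemma PTe_le {T : ℝ} {ρ : (Fin 3 → ℝ) → ℝ} (hρ : Measurable ρ) (h0 : ∀ x, 0 ≤ ρ x) (X : Fin 3 → ℝ) :
    2 * PTe T ρ X ≤ ENNReal.ofReal (cK * T) + 2 * coulombSelf ρ := by
  have h := PTe_pd (N := 1) T hρ h0 1 (fun _ => 1) (fun _ => X)
  simp only [Finset.univ_unique, Finset.sum_const, Finset.card_singleton, one_smul, one_mul, mul_one,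
    ENNReal.ofReal_one, one_pow, sub_self] at h
  exact h.trans (add_le_add (KT_le T 0) le_rfl)

lemma PTe_ne_top {T : ℝ} {ρ : (Fin 3 → ℝ) → ℝ} (hρ : Measurable ρ) (h0 : ∀ x, 0 ≤ ρ x)
    (hD : coulombSelf ρ < ⊤) (X : Fin 3 → ℝ) : PTe T ρ X ≠ ⊤ := by
  intro h
  have := PTe_le (T := T) hρ h0 X
  rw [h, ENNReal.mul_top (by norm_num), top_le_iff] at this
  exact absurd this (by simp [hD.ne, ENNReal.mul_eq_top])

lemma PT_le {T : ℝ} (hT : 0 ≤ T) {ρ : (Fin 3 → ℝ) → ℝ} (hρ : Measurable ρ) (h0 : ∀ x, 0 ≤ ρ x)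
    (hD : coulombSelf ρ < ⊤) (X : Fin 3 → ℝ) : 2 * PT T ρ X ≤ cK * T + 2 * (coulombSelf ρ).toReal := by
  have h := ENNReal.toReal_mono (by simp [hD.ne, ENNReal.mul_eq_top]) (PTe_le (T := T) hρ h0 X)
  have := cK_pos
  rw [ENNReal.toReal_mul, ENNReal.toReal_add (by simp) (by simp [hD.ne, ENNReal.mul_eq_top]), ENNReal.toReal_mul,
    ENNReal.toReal_ofReal (by positivity)] at h
  simpa [PT] using h

lemma sum_offdiag_symm {N : ℕ} (a : Fin N → Fin N → ℝ) (ha : ∀ i j, a i j = a j i) :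
    ∑ i, ∑ j, a i j = ∑ i, a i i + 2 * ∑ i, ∑ j, if i < j then a i j else 0 := by
  have h1 : ∀ i j, a i j = (if i = j then a i j else 0) + (if i < j then a i j else 0)
      + (if j < i then a j i else 0) := by
    intro i j
    rcases lt_trichotomy i j with h | h | h
    · simp [h, h.ne, h.le]
    · simp [h]
    · simp [h, h.ne', ha i j, h.le]
  have h2 : ∑ i, ∑ j, a i j = ∑ i, ∑ j, (if i = j then a i j else 0)
      + ∑ i, ∑ j, (if i < j then a i j else 0) + ∑ i, ∑ j, (if j < i then a j i else 0) := by
    rw [← Finset.sum_add_distrib, ← Finset.sum_add_distrib]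
    refine Finset.sum_congr rfl fun i _ => ?_
    rw [← Finset.sum_add_distrib, ← Finset.sum_add_distrib]
    exact Finset.sum_congr rfl fun j _ => h1 i j
  rw [h2, Finset.sum_comm (f := fun i j => if j < i then a j i else 0)]
  simp only [Finset.sum_ite_eq, Finset.mem_univ, if_true]
  ring

lemma inner_coulomb {N : ℕ} {T : ℝ} (hT : 0 ≤ T) {ρ : (Fin 3 → ℝ) → ℝ} (hρ : Measurable ρ) (h0 : ∀ x, 0 ≤ ρ x)
    (hD : coulombSelf ρ < ⊤) {m : ℝ} (hm : 0 ≤ m) (q : Fin N → ℝ) (hq0 : ∀ j, 0 ≤ q j) (hq1 : ∀ j, q j ≤ 1)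
    (p : Fin N → Fin 3 → ℝ) (hp : ∀ i j, i ≠ j → p i ≠ p j) :
    ∑ j, q j * (m * PT T ρ (p j) - cK * T / 2) - m ^ 2 * (coulombSelf ρ).toReal ≤
      ∑ i, ∑ j, if i < j then q i * q j * (enorm3 (p i - p j))⁻¹ else 0 := by
  have hc := cK_pos
  have h := PTe_pd T hρ h0 m (fun j => ENNReal.ofReal (q j)) p
  have hfin : (∑ i, ∑ j, ENNReal.ofReal (q i) * ENNReal.ofReal (q j) * KT T (p i - p j))
      + ENNReal.ofReal m ^ 2 * (2 * coulombSelf ρ) ≠ ⊤ := by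
    refine ENNReal.add_ne_top.2 ⟨?_, ?_⟩
    · refine ENNReal.sum_ne_top.2 fun i _ => ENNReal.sum_ne_top.2 fun j _ => ?_
      exact ENNReal.mul_ne_top (by finiteness) (KT_ne_top _ _)
    · exact ENNReal.mul_ne_top (by finiteness) (ENNReal.mul_ne_top (by finiteness) hD.ne)
  have h' := ENNReal.toReal_mono hfin h
  rw [ENNReal.toReal_add (ENNReal.add_ne_top.1 hfin).1 (ENNReal.add_ne_top.1 hfin).2, ENNReal.toReal_mul,
    ENNReal.toReal_sum (fun j _ => ENNReal.mul_ne_top (by finiteness)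
      (ENNReal.mul_ne_top (by finiteness) (PTe_ne_top hρ h0 hD _))),
    ENNReal.toReal_sum (fun i _ => ENNReal.sum_ne_top.2 fun j _ =>
      ENNReal.mul_ne_top (by finiteness) (KT_ne_top _ _))] at h'
  have e1 : ∀ i, (∑ j, ENNReal.ofReal (q i) * ENNReal.ofReal (q j) * KT T (p i - p j)).toReal
      = ∑ j, q i * q j * (KT T (p i - p j)).toReal := by
    intro i
    rw [ENNReal.toReal_sum (fun j _ => ENNReal.mul_ne_top (by finiteness) (KT_ne_top _ _))]
    refine Finset.sum_congr rfl fun j _ => ?_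
    rw [ENNReal.toReal_mul, ENNReal.toReal_mul, ENNReal.toReal_ofReal (hq0 i), ENNReal.toReal_ofReal (hq0 j)]
  have e2 : ∀ j, (ENNReal.ofReal (q j) * (ENNReal.ofReal m * PTe T ρ (p j))).toReal = q j * (m * PT T ρ (p j)) := by
    intro j
    rw [ENNReal.toReal_mul, ENNReal.toReal_mul, ENNReal.toReal_ofReal (hq0 j), ENNReal.toReal_ofReal hm, PT]
  simp_rw [e1, e2] at h'
  rw [sum_offdiag_symm (fun i j => q i * q j * (KT T (p i - p j)).toReal)
    (fun i j => by rw [KT_sub_comm]; ring)] at h'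
  simp only [ENNReal.toReal_mul, ENNReal.toReal_pow, ENNReal.toReal_ofReal hm, ENNReal.toReal_ofNat, sub_self] at h'
  have e3 : ∑ i, q i * q i * (KT T 0).toReal ≤ ∑ i, q i * (cK * T) := by
    refine Finset.sum_le_sum fun i _ => ?_
    have hk : (KT T 0).toReal ≤ cK * T :=
      ENNReal.toReal_le_of_le_ofReal (by positivity) (KT_le T 0)
    have : q i * q i ≤ q i := mul_le_of_le_one_right (hq0 i) (hq1 i)
    exact mul_le_mul this hk ENNReal.toReal_nonneg (hq0 i)
  have e4 : (∑ i, ∑ j, if i < j then q i * q j * (KT T (p i - p j)).toReal else 0) ≤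
      ∑ i, ∑ j, if i < j then q i * q j * (enorm3 (p i - p j))⁻¹ else 0 := by
    refine Finset.sum_le_sum fun i _ => Finset.sum_le_sum fun j _ => ?_
    split_ifs with hij
    · refine mul_le_mul_of_nonneg_left ?_ (mul_nonneg (hq0 i) (hq0 j))
      refine ENNReal.toReal_le_of_le_ofReal (inv_nonneg.2 (enorm3_nonneg _)) ?_
      exact KT_le_inv T (sub_ne_zero.2 (hp i j hij.ne))
    · exact le_rfl
  have e5 : ∑ j, q j * (m * PT T ρ (p j) - cK * T / 2) = ∑ j, q j * (m * PT T ρ (p j)) - (∑ j, q j * (cK * T)) / 2 := by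
    rw [Finset.sum_div, ← Finset.sum_sub_distrib]
    exact Finset.sum_congr rfl fun j _ => by ring
  rw [e5]
  linarith

lemma outer_coulomb {N : ℕ} {r B Z : ℝ} (hr : 0 < r) (hB : 0 ≤ B) (hZ : 1 ≤ Z) (x : Fin N → Fin 3 → ℝ)
    (hx : ∀ i j, i ≠ j → x i ≠ x j) :
    ∑ j, (if r ≤ ‖x j‖ then B * Z / enorm3 (x j) else 0) - (B + 1) ^ 2 * Z ^ 2 / r ≤
      ∑ i, ∑ j, if i < j then (if r ≤ ‖x i‖ ∧ r ≤ ‖x j‖ then (enorm3 (x i - x j))⁻¹ else 0) else 0 := by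
  set y : Fin N → ℝ := fun j => if r ≤ ‖x j‖ then (enorm3 (x j))⁻¹ else 0 with hy
  have hy0 : ∀ j, 0 ≤ y j := fun j => by
    simp only [hy]; split_ifs
    · exact inv_nonneg.2 (enorm3_nonneg _)
    · exact le_rfl
  have hy1 : ∀ j, y j ≤ r⁻¹ := fun j => by
    simp only [hy]; split_ifs with h
    · exact inv_anti₀ hr (h.trans (norm_le_enorm3 _))
    · positivity
  have key : ∀ i j, i < j → r / 2 * (y i * y j) ≤ if r ≤ ‖x i‖ ∧ r ≤ ‖x j‖ then (enorm3 (x i - x j))⁻¹ else 0 := by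
    intro i j hij
    split_ifs with h
    · have hi : y i = (enorm3 (x i))⁻¹ := if_pos h.1
      have hj : y j = (enorm3 (x j))⁻¹ := if_pos h.2
      have pi : r ≤ enorm3 (x i) := h.1.trans (norm_le_enorm3 _)
      have pj : r ≤ enorm3 (x j) := h.2.trans (norm_le_enorm3 _)
      have hd : 0 < enorm3 (x i - x j) := enorm3_pos (sub_ne_zero.2 (hx i j hij.ne))
      have hs := enorm3_sub_le (x i) (x j)
      have h1 : (enorm3 (x i) + enorm3 (x j))⁻¹ ≤ (enorm3 (x i - x j))⁻¹ := inv_anti₀ hd hs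
      refine le_trans ?_ h1
      rw [hi, hj]
      set a := enorm3 (x i)
      set b := enorm3 (x j)
      have ha : 0 < a := hr.trans_le pi
      have hb : 0 < b := hr.trans_le pj
      rw [← mul_inv, div_mul_eq_mul_div, ← div_eq_mul_inv, div_div, inv_eq_one_div, div_le_div_iff₀ (by positivity) (by positivity)]
      nlinarith
    · have : y i * y j = 0 := by
        rw [not_and_or] at h
        rcases h with h | h
        · simp [hy, h]
        · simp [hy, h]
      rw [this, mul_zero]
  have h1 : r / 2 * (∑ i, ∑ j, if i < j then y i * y j else 0) ≤
      ∑ i, ∑ j, if i < j then (if r ≤ ‖x i‖ ∧ r ≤ ‖x j‖ then (enorm3 (x i - x j))⁻¹ else 0) else 0 := by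
    rw [Finset.mul_sum]
    refine Finset.sum_le_sum fun i _ => ?_
    rw [Finset.mul_sum]
    refine Finset.sum_le_sum fun j _ => ?_
    by_cases hij : i < j
    · rw [if_pos hij, if_pos hij]; exact key i j hij
    · simp [hij]
  have h2 := sum_offdiag_symm (fun i j => y i * y j) fun i j => mul_comm _ _
  have h3 : ∑ i, ∑ j, y i * y j = (∑ i, y i) ^ 2 := by rw [sq, Finset.sum_mul_sum]
  have h4 : ∑ i, y i * y i ≤ r⁻¹ * ∑ i, y i := by
    rw [Finset.mul_sum]
    exact Finset.sum_le_sum fun i _ => mul_le_mul_of_nonneg_right (hy1 i) (hy0 i)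
  have h5 : ∑ j, (if r ≤ ‖x j‖ then B * Z / enorm3 (x j) else 0) = B * Z * ∑ j, y j := by
    rw [Finset.mul_sum]
    refine Finset.sum_congr rfl fun j _ => ?_
    simp only [hy]
    split_ifs
    · rw [div_eq_mul_inv]
    · simp
  rw [h5]
  refine le_trans ?_ h1
  rw [h3] at h2
  set S := ∑ i, y i
  set P := ∑ i, ∑ j, if i < j then y i * y j else 0
  have hrr : r * r⁻¹ = 1 := mul_inv_cancel₀ hr.ne'
  have h6 : r / 4 * S ^ 2 - 1 / 4 * S ≤ r / 2 * P := by
    have : r / 4 * S ^ 2 = r / 4 * (∑ i, y i * y i) + r / 2 * P := by rw [h2]; ring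
    have : r / 4 * (∑ i, y i * y i) ≤ r / 4 * (r⁻¹ * S) := mul_le_mul_of_nonneg_left h4 (by positivity)
    have : r / 4 * (r⁻¹ * S) = 1 / 4 * S := by linear_combination (S / 4) * hrr
    linarith
  refine le_trans ?_ h6
  have hS : 0 ≤ S := Finset.sum_nonneg fun i _ => hy0 i
  rw [sub_le_iff_le_add]
  have h7 : (B * Z + 1 / 4) * S ≤ r / 4 * S ^ 2 + (B * Z + 1 / 4) ^ 2 / r := by
    have : 0 ≤ (r / 2 * S - (B * Z + 1 / 4)) ^ 2 / r := by positivity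
    have e : (r / 2 * S - (B * Z + 1 / 4)) ^ 2 / r = r / 4 * S ^ 2 - (B * Z + 1 / 4) * S + (B * Z + 1 / 4) ^ 2 / r := by
      field_simp; ring
    linarith
  have h8 : (B * Z + 1 / 4) ^ 2 / r ≤ (B + 1) ^ 2 * Z ^ 2 / r := by
    rw [← mul_pow]
    gcongr
    nlinarith
  linarith

/-- Electrostatic lower bound for a configuration of distinct points. -/
lemma coulomb_lower {N : ℕ} {T : ℝ} (hT : 0 ≤ T) {ρ : (Fin 3 → ℝ) → ℝ} (hρ : Measurable ρ) (h0 : ∀ x, 0 ≤ ρ x)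
    (hD : coulombSelf ρ < ⊤) {m l r B Z : ℝ} (hm : 0 ≤ m) (hl : 0 < l) (hr : 0 < r) (hB : 0 ≤ B) (hZ : 1 ≤ Z)
    (q : Fin N → ℝ) (hq0 : ∀ j, 0 ≤ q j) (hq1 : ∀ j, q j ≤ 1)
    (x : Fin N → Fin 3 → ℝ) (hx : ∀ i j, i ≠ j → x i ≠ x j) (hq : ∀ j, r ≤ ‖x j‖ → q j = 0) :
    ∑ j, (q j * (l * m * PT T ρ (l • x j) - l * (cK * T / 2)) + if r ≤ ‖x j‖ then B * Z / enorm3 (x j) else 0)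
      - l * m ^ 2 * (coulombSelf ρ).toReal - (B + 1) ^ 2 * Z ^ 2 / r ≤
      ∑ i, ∑ j, if i < j then (enorm3 (x i - x j))⁻¹ else 0 := by
  have h1 := inner_coulomb hT hρ h0 hD hm q hq0 hq1 (fun j => l • x j) (fun i j hij h => hx i j hij (by
    have : l • (x i - x j) = 0 := by rw [smul_sub]; exact sub_eq_zero.2 h
    rcases smul_eq_zero.1 this with h | h
    · exact absurd h hl.ne'
    · exact sub_eq_zero.1 h))
  have h2 := outer_coulomb hr hB hZ x hx
  have h3 := mul_le_mul_of_nonneg_left h1 hl.le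
  have e1 : l * ∑ i, ∑ j, (if i < j then q i * q j * (enorm3 (l • x i - l • x j))⁻¹ else 0)
      = ∑ i, ∑ j, if i < j then q i * q j * (enorm3 (x i - x j))⁻¹ else 0 := by
    simp_rw [Finset.mul_sum]
    refine Finset.sum_congr rfl fun i _ => Finset.sum_congr rfl fun j _ => ?_
    split_ifs
    · rw [← smul_sub, enorm3_smul, abs_of_pos hl, mul_inv]; field_simp
    · simp
  rw [e1] at h3
  have e2 : (∑ i, ∑ j, if i < j then q i * q j * (enorm3 (x i - x j))⁻¹ else 0) +
      (∑ i, ∑ j, if i < j then (if r ≤ ‖x i‖ ∧ r ≤ ‖x j‖ then (enorm3 (x i - x j))⁻¹ else 0) else 0) ≤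
      ∑ i, ∑ j, if i < j then (enorm3 (x i - x j))⁻¹ else 0 := by
    simp_rw [← Finset.sum_add_distrib]
    refine Finset.sum_le_sum fun i _ => Finset.sum_le_sum fun j _ => ?_
    have hp := inv_nonneg.2 (enorm3_nonneg (x i - x j))
    by_cases hij : i < j
    · simp only [if_pos hij]
      by_cases h : r ≤ ‖x i‖ ∧ r ≤ ‖x j‖
      · rw [if_pos h, hq i h.1]; simp
      · rw [if_neg h, add_zero]
        exact mul_le_of_le_one_left hp (mul_le_one₀ (hq1 i) (hq0 j) (hq1 j))
    · simp [hij]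
  have e3 : l * (∑ j, q j * (m * PT T ρ (l • x j) - cK * T / 2) - m ^ 2 * (coulombSelf ρ).toReal)
      = ∑ j, q j * (l * m * PT T ρ (l • x j) - l * (cK * T / 2)) - l * m ^ 2 * (coulombSelf ρ).toReal := by
    rw [mul_sub, Finset.mul_sum]
    congr 1
    · exact Finset.sum_congr rfl fun j _ => by ring
    · ring
  rw [e3] at h3
  rw [Finset.sum_add_distrib]
  linarith

lemma lintegral_norm_rpow_lt_top {a : ℝ} (ha : a < 3) (R : ℝ) :
    ∫⁻ x in Metric.closedBall (0 : Fin 3 → ℝ) R, ENNReal.ofReal (‖x‖ ^ (-a)) < ⊤ := by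
  have h1 : Integrable (fun x : Fin 3 → ℝ => (Set.Iic R).indicator (fun t : ℝ => t ^ (-a)) ‖x‖) := by
    refine (integrable_fun_norm_addHaar (volume : Measure (Fin 3 → ℝ))
      (f := (Set.Iic R).indicator (fun t : ℝ => t ^ (-a)))).2 ?_
    have h2 : IntegrableOn (fun t : ℝ => t ^ (2 - a)) (Set.Ioc 0 (max R 0)) := by
      have := (intervalIntegral.intervalIntegrable_rpow' (a := 0) (b := max R 0) (r := 2 - a) (by linarith))
      rwa [intervalIntegrable_iff_integrableOn_Ioc_of_le (le_max_right _ _)] at this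
    have h3 : IntegrableOn ((Set.Iic R).indicator fun t : ℝ => t ^ (2 - a)) (Set.Ioi 0) := by
      have hs : Set.Ioc 0 (max R 0) = Set.Ioc 0 (max R 0) := rfl
      rw [IntegrableOn, integrable_indicator_iff measurableSet_Iic, IntegrableOn,
        Measure.restrict_restrict measurableSet_Iic]
      refine h2.mono_set ?_
      rintro t ⟨h, h'⟩
      exact ⟨h', le_max_of_le_left h⟩
    refine h3.congr_fun (fun t ht => ?_) measurableSet_Ioi
    have ht0 : 0 < t := ht
    simp only [Set.indicator, Module.finrank_fintype_fun_eq_card, Fintype.card_fin, smul_eq_mul]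
    split_ifs
    · rw [show (3 - 1 : ℕ) = 2 by norm_num, ← Real.rpow_natCast, ← Real.rpow_add ht0]; norm_num; ring_nf
    · simp
  have h4 := h1.lintegral_lt_top
  refine lt_of_le_of_lt ?_ h4
  rw [← lintegral_indicator Metric.isClosed_closedBall.measurableSet]
  refine lintegral_mono fun x => ?_
  simp only [Set.indicator, mem_closedBall_zero_iff, Set.mem_Iic]
  split_ifs <;> simp

lemma inv_enorm3_le {x : Fin 3 → ℝ} (hx : x ≠ 0) : (enorm3 x)⁻¹ ≤ ‖x‖⁻¹ :=
  inv_anti₀ (norm_pos_iff.2 hx) (norm_le_enorm3 x)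

/-- The indicator of the unit cube as a trial density. -/
def rhoTest (x : Fin 3 → ℝ) : ℝ := (Metric.closedBall (0 : Fin 3 → ℝ) 1).indicator (fun _ => 1) x

lemma measurable_rhoTest : Measurable rhoTest :=
  measurable_const.indicator Metric.isClosed_closedBall.measurableSet

lemma rhoTest_nonneg (x : Fin 3 → ℝ) : 0 ≤ rhoTest x :=
  Set.indicator_nonneg (fun _ _ => zero_le_one) x

lemma coulombSelf_rhoTest : coulombSelf rhoTest < ⊤ := by
  have hI := lintegral_norm_rpow_lt_top (a := 1) (by norm_num) 2
  set I := ∫⁻ x in Metric.closedBall (0 : Fin 3 → ℝ) 2, ENNReal.ofReal (‖x‖ ^ (-1 : ℝ))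
  have h : ∀ x, ∫⁻ y, ENNReal.ofReal (rhoTest x * rhoTest y * (enorm3 (x - y))⁻¹) ≤
      (Metric.closedBall (0 : Fin 3 → ℝ) 1).indicator (fun _ => I) x := by
    intro x
    by_cases hx : x ∈ Metric.closedBall (0 : Fin 3 → ℝ) 1
    · rw [Set.indicator_of_mem hx]
      simp only [I]
      rw [← lintegral_indicator Metric.isClosed_closedBall.measurableSet,
        ← lintegral_sub_left_eq_self ((Metric.closedBall (0 : Fin 3 → ℝ) 2).indicator
          fun x => ENNReal.ofReal (‖x‖ ^ (-1 : ℝ))) x]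
      refine lintegral_mono_ae ?_
      filter_upwards [ae_ne3 x] with y hy
      by_cases hy1 : y ∈ Metric.closedBall (0 : Fin 3 → ℝ) 1
      · have hxy : x - y ∈ Metric.closedBall (0 : Fin 3 → ℝ) 2 := by
          rw [mem_closedBall_zero_iff] at *
          linarith [norm_sub_le x y]
        rw [Set.indicator_of_mem hxy]
        simp only [rhoTest, Set.indicator_of_mem hx, Set.indicator_of_mem hy1, one_mul]
        rw [Real.rpow_neg_one]
        exact ENNReal.ofReal_le_ofReal (inv_enorm3_le (sub_ne_zero.2 hy.symm))
      · simp [rhoTest, Set.indicator_of_notMem hy1]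
    · simp [rhoTest, Set.indicator_of_notMem hx]
  refine ENNReal.mul_lt_top (by norm_num) ((lintegral_mono h).trans_lt ?_)
  rw [lintegral_indicator Metric.isClosed_closedBall.measurableSet, setLIntegral_const]
  exact ENNReal.mul_lt_top hI (isCompact_closedBall _ _).measure_lt_top

lemma tfNegIntegral_rhoTest : tfNegIntegral rhoTest < ⊤ := by
  refine lt_of_le_of_lt ?_ (lintegral_norm_rpow_lt_top (a := 5 / 2) (by norm_num) 4)
  rw [← lintegral_indicator Metric.isClosed_closedBall.measurableSet, tfNegIntegral]
  refine lintegral_mono_ae ?_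
  filter_upwards [ae_ne3 0] with X hX0
  have hXp := enorm3_pos hX0
  by_cases hX : X ∈ Metric.closedBall (0 : Fin 3 → ℝ) 4
  · rw [Set.indicator_of_mem hX]
    refine ENNReal.ofReal_le_ofReal ?_
    rw [Real.rpow_neg (norm_nonneg _), ← Real.inv_rpow (norm_nonneg _)]
    refine Real.rpow_le_rpow (le_max_right _ _) ?_ (by norm_num)
    refine max_le ?_ (by positivity)
    refine le_trans (sub_le_self _ ?_) (inv_enorm3_le hX0)
    exact integral_nonneg fun y => mul_nonneg (rhoTest_nonneg y) (inv_nonneg.2 (enorm3_nonneg _))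
  · rw [Set.indicator_of_notMem hX, nonpos_iff_eq_zero, ENNReal.ofReal_eq_zero]
    have hXn : 4 < ‖X‖ := by simpa using hX
    have hX4 : 4 < enorm3 X := hXn.trans_le (norm_le_enorm3 X)
    have h1 : (enorm3 X)⁻¹ ≤ ∫ y : Fin 3 → ℝ, rhoTest y * (enorm3 (X - y))⁻¹ := by
      have hb : ∀ y ∈ Metric.closedBall (0 : Fin 3 → ℝ) 1, 0 < enorm3 (X - y) := by
        intro y hy
        rw [mem_closedBall_zero_iff] at hy
        refine lt_of_lt_of_le ?_ (norm_le_enorm3 _)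
        have := norm_sub_norm_le X y
        linarith
      have e : ∀ y, rhoTest y * (enorm3 (X - y))⁻¹ =
          (Metric.closedBall (0 : Fin 3 → ℝ) 1).indicator (fun y => (enorm3 (X - y))⁻¹) y := by
        intro y; simp only [rhoTest, Set.indicator]; split_ifs <;> simp
      simp_rw [e]
      rw [integral_indicator Metric.isClosed_closedBall.measurableSet]
      have hc : ContinuousOn (fun y => (enorm3 (X - y))⁻¹) (Metric.closedBall (0 : Fin 3 → ℝ) 1) := by
        refine ContinuousOn.inv₀ ?_ fun y hy => (hb y hy).ne'
        exact (continuous_enorm3.comp (continuous_const.sub continuous_id)).continuousOn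
      have hle : ∀ y ∈ Metric.closedBall (0 : Fin 3 → ℝ) 1, (enorm3 X)⁻¹ / 8 ≤ (enorm3 (X - y))⁻¹ := by
        intro y hy
        have h2 : enorm3 (X - y) ≤ 2 * enorm3 X := by
          have h3 := enorm3_sub_le X y
          have h4 := enorm3_le_norm y
          rw [mem_closedBall_zero_iff] at hy
          linarith
        have h5 : (2 * enorm3 X)⁻¹ ≤ (enorm3 (X - y))⁻¹ := inv_anti₀ (hb y hy) h2
        refine le_trans ?_ h5
        rw [mul_inv]
        have := inv_pos.2 hXp
        linarith
      have h6 := setIntegral_mono_on (integrableOn_const (μ := volume) (isCompact_closedBall (0 : Fin 3 → ℝ) 1).measure_lt_top.ne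
        (C := (enorm3 X)⁻¹ / 8)) (hc.integrableOn_compact (isCompact_closedBall _ _)) Metric.isClosed_closedBall.measurableSet hle
      refine le_trans (le_of_eq ?_) h6
      rw [setIntegral_const, Measure.real, Real.volume_pi_closedBall _ (by norm_num), smul_eq_mul]
      norm_num
      ring
    rw [max_eq_right (by linarith)]
    exact Real.zero_rpow (by norm_num) |>.le

/-- An approximate minimizer of the Thomas–Fermi problem. -/
lemma exists_tf_density {η : ℝ} (hη : 0 < η) :
    ∃ ρ : (Fin 3 → ℝ) → ℝ, Measurable ρ ∧ (∀ x, 0 ≤ ρ x) ∧ coulombSelf ρ < ⊤ ∧ tfNegIntegral ρ < ⊤ ∧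
      (coulombSelf ρ).toReal + 2 / (15 * Real.pi ^ 2) * (tfNegIntegral ρ).toReal ≤ cTF + η := by
  set S := {e : ENNReal | ∃ ρ : (Fin 3 → ℝ) → ℝ, Measurable ρ ∧ (∀ x, 0 ≤ ρ x) ∧
    coulombSelf ρ < ⊤ ∧
    e = coulombSelf ρ + ENNReal.ofReal (2 / (15 * Real.pi ^ 2)) * tfNegIntegral ρ} with hS
  have hfin : sInf S ≠ ⊤ := by
    refine ne_top_of_le_ne_top ?_ (sInf_le (show _ ∈ S from ⟨rhoTest, measurable_rhoTest, rhoTest_nonneg,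
      coulombSelf_rhoTest, rfl⟩))
    exact ENNReal.add_ne_top.2 ⟨coulombSelf_rhoTest.ne, ENNReal.mul_ne_top (by finiteness) tfNegIntegral_rhoTest.ne⟩
  have hlt : sInf S < sInf S + ENNReal.ofReal η :=
    ENNReal.lt_add_right hfin (by simpa using hη)
  obtain ⟨e, ⟨ρ, h1, h2, h3, rfl⟩, he⟩ := sInf_lt_iff.1 hlt
  have hne : sInf S + ENNReal.ofReal η ≠ ⊤ := by finiteness
  have hπ : 0 < 2 / (15 * Real.pi ^ 2) := by positivity
  have h4 : tfNegIntegral ρ < ⊤ := by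
    rw [lt_top_iff_ne_top]
    intro h
    rw [h, ENNReal.mul_top (by simpa using hπ)] at he
    simp at he
  refine ⟨ρ, h1, h2, h3, h4, ?_⟩
  have h5 := ENNReal.toReal_mono hne he.le
  rw [ENNReal.toReal_add h3.ne (ENNReal.mul_ne_top (by finiteness) h4.ne), ENNReal.toReal_add hfin (by finiteness),
    ENNReal.toReal_mul, ENNReal.toReal_ofReal hπ.le, ENNReal.toReal_ofReal hη.le] at h5
  exact h5

lemma cTF_nonneg : 0 ≤ cTF := ENNReal.toReal_nonneg

/-- The negative part of the effective Thomas–Fermi potential. -/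
def vTF (ρ : (Fin 3 → ℝ) → ℝ) (X : Fin 3 → ℝ) : ℝ :=
  max ((enorm3 X)⁻¹ - ∫ y : Fin 3 → ℝ, ρ y * (enorm3 (X - y))⁻¹) 0

lemma vTF_nonneg (ρ : (Fin 3 → ℝ) → ℝ) (X : Fin 3 → ℝ) : 0 ≤ vTF ρ X := le_max_right _ _

lemma measurable_vTF {ρ : (Fin 3 → ℝ) → ℝ} (hρ : Measurable ρ) : Measurable (vTF ρ) := by
  have hc := continuous_enorm3
  refine Measurable.max (Measurable.sub hc.measurable.inv ?_) measurable_const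
  have : Measurable fun p : (Fin 3 → ℝ) × (Fin 3 → ℝ) => ρ p.2 * (enorm3 (p.1 - p.2))⁻¹ :=
    (hρ.comp measurable_snd).mul ((hc.measurable.comp (measurable_fst.sub measurable_snd)).inv)
  exact (StronglyMeasurable.integral_prod_right this.stronglyMeasurable).measurable

lemma inv_le_add_vTF {ρ : (Fin 3 → ℝ) → ℝ} (hρ : Measurable ρ) (h0 : ∀ x, 0 ≤ ρ x) (X : Fin 3 → ℝ) :
    ENNReal.ofReal (enorm3 X)⁻¹ ≤
      (∫⁻ y, ENNReal.ofReal (ρ y) * ENNReal.ofReal (enorm3 (X - y))⁻¹) + ENNReal.ofReal (vTF ρ X) := by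
  have hc := continuous_enorm3
  have hm : Measurable fun y => ρ y * (enorm3 (X - y))⁻¹ :=
    hρ.mul ((hc.measurable.comp (measurable_const.sub measurable_id)).inv)
  have h1 : ∫ y : Fin 3 → ℝ, ρ y * (enorm3 (X - y))⁻¹ =
      (∫⁻ y, ENNReal.ofReal (ρ y) * ENNReal.ofReal (enorm3 (X - y))⁻¹).toReal := by
    rw [integral_eq_lintegral_of_nonneg_ae (Filter.Eventually.of_forall fun y =>
      mul_nonneg (h0 y) (inv_nonneg.2 (enorm3_nonneg _))) hm.aestronglyMeasurable]
    simp_rw [ENNReal.ofReal_mul (h0 _)]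
  set P := ∫⁻ y, ENNReal.ofReal (ρ y) * ENNReal.ofReal (enorm3 (X - y))⁻¹
  by_cases hP : P = ⊤
  · rw [hP]; simp
  · rw [← ENNReal.ofReal_toReal hP, ← ENNReal.ofReal_add ENNReal.toReal_nonneg (vTF_nonneg _ _)]
    refine ENNReal.ofReal_le_ofReal ?_
    have := le_max_left ((enorm3 X)⁻¹ - ∫ y : Fin 3 → ℝ, ρ y * (enorm3 (X - y))⁻¹) 0
    rw [h1] at this
    rw [vTF, h1]
    linarith

lemma KT_le_PTe_add {T : ℝ} (hT : 0 < T) {ρ : (Fin 3 → ℝ) → ℝ} (hρ : Measurable ρ) (h0 : ∀ x, 0 ≤ ρ x)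
    (X : Fin 3 → ℝ) :
    KT T X ≤ PTe T ρ X + ∫⁻ Y, ENNReal.ofReal (vTF ρ Y) * ENNReal.ofReal (gk T (X - Y)) := by
  have hc := continuous_enorm3
  have hg := continuous_gk T
  have e1 : ∀ X, KT T X = ∫⁻ Y, ENNReal.ofReal (enorm3 Y)⁻¹ * ENNReal.ofReal (gk T (X - Y)) := by
    intro X
    rw [KT_eq_conv hT, ← lintegral_sub_left_eq_self _ X]
    simp
  have e2 : PTe T ρ X = ∫⁻ Y, (∫⁻ y, ENNReal.ofReal (ρ y) * ENNReal.ofReal (enorm3 (Y - y))⁻¹) *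
      ENNReal.ofReal (gk T (X - Y)) := by
    have e3 : ∀ Y, (∫⁻ y, ENNReal.ofReal (ρ y) * ENNReal.ofReal (enorm3 (Y - y))⁻¹) *
        ENNReal.ofReal (gk T (X - Y)) =
        ∫⁻ y, ENNReal.ofReal (ρ y) * (ENNReal.ofReal (enorm3 (Y - y))⁻¹ * ENNReal.ofReal (gk T (X - Y))) := by
      intro Y
      rw [← lintegral_mul_const' _ _ ENNReal.ofReal_ne_top]
      simp_rw [mul_assoc]
    simp_rw [e3]
    rw [lintegral_lintegral_swap]
    · rw [PTe]
      refine lintegral_congr fun y => ?_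
      rw [lintegral_const_mul' _ _ ENNReal.ofReal_ne_top, e1, mul_comm]
      congr 1
      rw [← lintegral_sub_right_eq_self _ y]
      refine lintegral_congr fun Y => ?_
      rw [sub_sub_sub_cancel_right]
    · refine Measurable.aemeasurable ?_
      refine (hρ.comp measurable_snd).ennreal_ofReal.mul (Measurable.fun_mul ?_ ?_)
      · exact (hc.measurable.comp (measurable_fst.sub measurable_snd)).inv.ennreal_ofReal
      · exact (hg.measurable.comp (measurable_const.sub measurable_fst)).ennreal_ofReal
  rw [e1, e2, ← lintegral_add_right]
  · refine lintegral_mono fun Y => ?_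
    simp only []
    rw [← add_mul]
    exact mul_le_mul' (inv_le_add_vTF hρ h0 Y) le_rfl
  · exact (measurable_vTF hρ).ennreal_ofReal.mul (hg.measurable.comp (measurable_const.sub measurable_id)).ennreal_ofReal

lemma gk_shift_le {T η l : ℝ} (hη0 : 0 < η) (hη1 : η < 1) {X U : Fin 3 → ℝ} (h : nsq (X - U) ≤ l ^ 2)
    (Y : Fin 3 → ℝ) :
    gk T (X - Y) ≤ (1 - η) ^ (-(3 : ℝ) / 2) * Real.exp (T ^ 2 * l ^ 2 / η) * gk (T * Real.sqrt (1 - η)) (U - Y) := by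
  have h1 : 0 < 1 - η := by linarith
  have hsq : Real.sqrt (1 - η) ^ 2 = 1 - η := Real.sq_sqrt h1.le
  have hk : (1 - η) * nsq (U - Y) + (1 - 1 / η) * nsq (X - U) ≤ nsq (X - Y) := by
    have : ∀ k, (1 - η) * (U k - Y k) ^ 2 + (1 - 1 / η) * (X k - U k) ^ 2 ≤ (X k - Y k) ^ 2 := by
      intro k
      have h2 : 0 ≤ η * ((U k - Y k) + (X k - U k) / η) ^ 2 := by positivity
      have e : η * ((U k - Y k) + (X k - U k) / η) ^ 2 = η * (U k - Y k) ^ 2 + 2 * (U k - Y k) * (X k - U k)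
        + (X k - U k) ^ 2 / η := by field_simp; ring
      rw [e] at h2
      have e2 : (1 - 1 / η) * (X k - U k) ^ 2 = (X k - U k) ^ 2 - (X k - U k) ^ 2 / η := by ring
      rw [e2]
      nlinarith
    simp only [nsq, Pi.sub_apply, Fin.sum_univ_three]
    linarith [this 0, this 1, this 2]
  unfold gk
  rw [mul_pow, hsq]
  have e1 : (T ^ 2 * (1 - η) / Real.pi) ^ ((3 : ℝ) / 2) = (1 - η) ^ ((3 : ℝ) / 2) * (T ^ 2 / Real.pi) ^ ((3 : ℝ) / 2) := by
    rw [← Real.mul_rpow h1.le (by positivity)]; congr 1; ring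
  have e2 : (1 - η) ^ (-(3 : ℝ) / 2) * (1 - η) ^ ((3 : ℝ) / 2) = 1 := by
    rw [← Real.rpow_add h1]; norm_num
  rw [e1]
  have e3 : (1 - η) ^ (-(3 : ℝ) / 2) * Real.exp (T ^ 2 * l ^ 2 / η) *
      ((1 - η) ^ ((3 : ℝ) / 2) * (T ^ 2 / Real.pi) ^ ((3 : ℝ) / 2) * Real.exp (-(T ^ 2 * (1 - η)) * nsq (U - Y))) =
      (T ^ 2 / Real.pi) ^ ((3 : ℝ) / 2) * Real.exp (T ^ 2 * l ^ 2 / η + -(T ^ 2 * (1 - η)) * nsq (U - Y)) := by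
    rw [Real.exp_add]
    linear_combination (T ^ 2 / Real.pi) ^ ((3 : ℝ) / 2) * Real.exp (T ^ 2 * l ^ 2 / η) *
      Real.exp (-(T ^ 2 * (1 - η)) * nsq (U - Y)) * e2
  rw [e3]
  refine mul_le_mul_of_nonneg_left (Real.exp_le_exp.2 ?_) (by positivity)
  have h3 : T ^ 2 * ((1 - η) * nsq (U - Y) + (1 - 1 / η) * nsq (X - U)) ≤ T ^ 2 * nsq (X - Y) :=
    mul_le_mul_of_nonneg_left hk (sq_nonneg T)
  have h4 : (1 / η) * nsq (X - U) ≤ (1 / η) * l ^ 2 := mul_le_mul_of_nonneg_left h (by positivity)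
  have h5 : T ^ 2 * ((1 / η) * nsq (X - U)) ≤ T ^ 2 * ((1 / η) * l ^ 2) := mul_le_mul_of_nonneg_left h4 (sq_nonneg T)
  have h6 : T ^ 2 * l ^ 2 / η = T ^ 2 * ((1 / η) * l ^ 2) := by ring
  have h7 := mul_nonneg (sq_nonneg T) (nsq_nonneg (X - U))
  rw [h6]
  nlinarith

/-- The Thomas–Fermi potential averaged over a Gaussian. -/
def wTFe (T : ℝ) (ρ : (Fin 3 → ℝ) → ℝ) (U : Fin 3 → ℝ) : ENNReal :=
  ∫⁻ Y, ENNReal.ofReal (vTF ρ Y) * ENNReal.ofReal (gk T (U - Y))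

/-- Real-valued version of `wTFe`. -/
def wTF (T : ℝ) (ρ : (Fin 3 → ℝ) → ℝ) (U : Fin 3 → ℝ) : ℝ := (wTFe T ρ U).toReal

lemma wTF_nonneg (T : ℝ) (ρ : (Fin 3 → ℝ) → ℝ) (U : Fin 3 → ℝ) : 0 ≤ wTF T ρ U := ENNReal.toReal_nonneg

lemma measurable_wTFe (T : ℝ) {ρ : (Fin 3 → ℝ) → ℝ} (hρ : Measurable ρ) : Measurable (wTFe T ρ) := by
  unfold wTFe
  refine Measurable.lintegral_prod_right' (f := fun p : (Fin 3 → ℝ) × (Fin 3 → ℝ) =>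
    ENNReal.ofReal (vTF ρ p.2) * ENNReal.ofReal (gk T (p.1 - p.2))) ?_
  exact ((measurable_vTF hρ).comp measurable_snd).ennreal_ofReal.mul
    ((continuous_gk T).measurable.comp (measurable_fst.sub measurable_snd)).ennreal_ofReal

lemma measurable_wTF (T : ℝ) {ρ : (Fin 3 → ℝ) → ℝ} (hρ : Measurable ρ) : Measurable (wTF T ρ) :=
  (measurable_wTFe T hρ).ennreal_toReal

lemma wTFe_rpow_le {T : ℝ} (hT : 0 < T) {ρ : (Fin 3 → ℝ) → ℝ} (hρ : Measurable ρ) (U : Fin 3 → ℝ) :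
    wTFe T ρ U ^ ((5 : ℝ) / 2) ≤
      ∫⁻ Y, ENNReal.ofReal (vTF ρ Y) ^ ((5 : ℝ) / 2) * ENNReal.ofReal (gk T (U - Y)) := by
  have hv := (measurable_vTF hρ).ennreal_ofReal
  have hg : Measurable fun Y => ENNReal.ofReal (gk T (U - Y)) :=
    ((continuous_gk T).measurable.comp (measurable_const.sub measurable_id)).ennreal_ofReal
  have hpq : ((5 : ℝ) / 2).HolderConjugate (5 / 3) := by
    rw [Real.holderConjugate_iff]; norm_num
  have h := ENNReal.lintegral_mul_le_Lp_mul_Lq volume hpq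
    (f := fun Y => ENNReal.ofReal (vTF ρ Y) * ENNReal.ofReal (gk T (U - Y)) ^ ((2 : ℝ) / 5))
    (g := fun Y => ENNReal.ofReal (gk T (U - Y)) ^ ((3 : ℝ) / 5))
    (hv.mul (hg.pow_const _)).aemeasurable (hg.pow_const _).aemeasurable
  have e1 : ∀ Y, ((fun Y => ENNReal.ofReal (vTF ρ Y) * ENNReal.ofReal (gk T (U - Y)) ^ ((2 : ℝ) / 5)) *
      fun Y => ENNReal.ofReal (gk T (U - Y)) ^ ((3 : ℝ) / 5)) Y = ENNReal.ofReal (vTF ρ Y) * ENNReal.ofReal (gk T (U - Y)) := by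
    intro Y
    simp only [Pi.mul_apply]
    rw [mul_assoc, ← ENNReal.rpow_add_of_nonneg _ _ (by norm_num) (by norm_num)]
    norm_num
  have e2 : ∀ Y, (ENNReal.ofReal (vTF ρ Y) * ENNReal.ofReal (gk T (U - Y)) ^ ((2 : ℝ) / 5)) ^ ((5 : ℝ) / 2)
      = ENNReal.ofReal (vTF ρ Y) ^ ((5 : ℝ) / 2) * ENNReal.ofReal (gk T (U - Y)) := by
    intro Y
    rw [ENNReal.mul_rpow_of_nonneg _ _ (by norm_num), ← ENNReal.rpow_mul]
    norm_num
  have e3 : ∀ Y, (ENNReal.ofReal (gk T (U - Y)) ^ ((3 : ℝ) / 5)) ^ ((5 : ℝ) / 3) = ENNReal.ofReal (gk T (U - Y)) := by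
    intro Y
    rw [← ENNReal.rpow_mul]; norm_num
  simp_rw [e1, e2, e3, lintegral_gk_sub hT, ENNReal.one_rpow, mul_one] at h
  calc wTFe T ρ U ^ ((5 : ℝ) / 2) ≤ ((∫⁻ Y, ENNReal.ofReal (vTF ρ Y) ^ ((5 : ℝ) / 2) *
        ENNReal.ofReal (gk T (U - Y))) ^ (1 / ((5 : ℝ) / 2))) ^ ((5 : ℝ) / 2) :=
        ENNReal.rpow_le_rpow h (by norm_num)
    _ = _ := by rw [← ENNReal.rpow_mul]; norm_num

lemma tfNegIntegral_eq (ρ : (Fin 3 → ℝ) → ℝ) :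
    tfNegIntegral ρ = ∫⁻ Y, ENNReal.ofReal (vTF ρ Y) ^ ((5 : ℝ) / 2) := by
  rw [tfNegIntegral]
  refine lintegral_congr fun Y => ?_
  rw [ENNReal.ofReal_rpow_of_nonneg (vTF_nonneg ρ Y) (by norm_num), vTF]

lemma wTFe_ne_top {T : ℝ} (hT : 0 < T) {ρ : (Fin 3 → ℝ) → ℝ} (hρ : Measurable ρ) (hI : tfNegIntegral ρ < ⊤)
    (U : Fin 3 → ℝ) : wTFe T ρ U ≠ ⊤ := by
  intro h
  have h1 := wTFe_rpow_le hT hρ U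
  rw [h, ENNReal.top_rpow_of_pos (by norm_num), top_le_iff] at h1
  have h2 : ∫⁻ Y, ENNReal.ofReal (vTF ρ Y) ^ ((5 : ℝ) / 2) * ENNReal.ofReal (gk T (U - Y)) ≤
      ∫⁻ Y, ENNReal.ofReal (vTF ρ Y) ^ ((5 : ℝ) / 2) * ENNReal.ofReal ((T ^ 2 / Real.pi) ^ ((3 : ℝ) / 2)) := by
    refine lintegral_mono fun Y => mul_le_mul' le_rfl (ENNReal.ofReal_le_ofReal ?_)
    refine mul_le_of_le_one_right (by positivity) (Real.exp_le_one_iff.2 ?_)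
    have := nsq_nonneg (U - Y)
    nlinarith [mul_nonneg (sq_nonneg T) this]
  rw [h1, lintegral_mul_const' _ _ ENNReal.ofReal_ne_top, ← tfNegIntegral_eq, top_le_iff] at h2
  exact ENNReal.mul_ne_top hI.ne ENNReal.ofReal_ne_top h2

lemma ofReal_wTF {T : ℝ} (hT : 0 < T) {ρ : (Fin 3 → ℝ) → ℝ} (hρ : Measurable ρ) (hI : tfNegIntegral ρ < ⊤)
    (U : Fin 3 → ℝ) : ENNReal.ofReal (wTF T ρ U) = wTFe T ρ U :=
  ENNReal.ofReal_toReal (wTFe_ne_top hT hρ hI U)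

lemma lintegral_wTF_le {T : ℝ} (hT : 0 < T) {ρ : (Fin 3 → ℝ) → ℝ} (hρ : Measurable ρ) (hI : tfNegIntegral ρ < ⊤) :
    ∫⁻ U, ENNReal.ofReal (wTF T ρ U ^ ((5 : ℝ) / 2)) ≤ tfNegIntegral ρ := by
  have hv := (measurable_vTF hρ).ennreal_ofReal
  have e : ∀ U, ENNReal.ofReal (wTF T ρ U ^ ((5 : ℝ) / 2)) = wTFe T ρ U ^ ((5 : ℝ) / 2) := fun U => by
    rw [← ENNReal.ofReal_rpow_of_nonneg (wTF_nonneg _ _ _) (by norm_num), ofReal_wTF hT hρ hI]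
  simp_rw [e]
  refine (lintegral_mono fun U => wTFe_rpow_le hT hρ U).trans ?_
  rw [lintegral_lintegral_swap]
  · rw [tfNegIntegral_eq]
    refine lintegral_mono fun Y => ?_
    simp only []
    rw [lintegral_const_mul' _ _ (by finiteness)]
    simp_rw [gk_sub_comm T _ Y]
    rw [lintegral_gk_sub hT, mul_one]
  · refine Measurable.aemeasurable ?_
    exact ((hv.pow_const _).comp measurable_snd).mul
      ((continuous_gk T).measurable.comp (measurable_fst.sub measurable_snd)).ennreal_ofReal

/-- Pointwise bound on the effective potential by its local average. -/
lemma inv_sub_PT_le {T η l : ℝ} (hT : 0 < T) (hη0 : 0 < η) (hη1 : η < 1) {ρ : (Fin 3 → ℝ) → ℝ}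
    (hρ : Measurable ρ) (h0 : ∀ x, 0 ≤ ρ x) (hD : coulombSelf ρ < ⊤) (hI : tfNegIntegral ρ < ⊤)
    {X U : Fin 3 → ℝ} (hX : X ≠ 0) (h : nsq (X - U) ≤ l ^ 2) :
    (enorm3 X)⁻¹ - PT T ρ X ≤ (1 - η) ^ (-(3 : ℝ) / 2) * Real.exp (T ^ 2 * l ^ 2 / η) *
      wTF (T * Real.sqrt (1 - η)) ρ U + 2 / (T * nsq X) := by
  have h1η : 0 < 1 - η := by linarith
  have hT' : 0 < T * Real.sqrt (1 - η) := by positivity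
  set c := (1 - η) ^ (-(3 : ℝ) / 2) * Real.exp (T ^ 2 * l ^ 2 / η) with hc
  have hc0 : 0 ≤ c := by positivity
  have h1 : ∫⁻ Y, ENNReal.ofReal (vTF ρ Y) * ENNReal.ofReal (gk T (X - Y)) ≤
      ENNReal.ofReal c * wTFe (T * Real.sqrt (1 - η)) ρ U := by
    rw [wTFe, ← lintegral_const_mul' _ _ ENNReal.ofReal_ne_top]
    refine lintegral_mono fun Y => ?_
    simp only []
    rw [mul_left_comm, ← ENNReal.ofReal_mul hc0]
    exact mul_le_mul' le_rfl (ENNReal.ofReal_le_ofReal (gk_shift_le hη0 hη1 h Y))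
  have h2 := (inv_le_KT_add hT hX).trans (add_le_add ((KT_le_PTe_add hT hρ h0 X).trans (add_le_add le_rfl h1)) le_rfl)
  have hn := nsq_pos hX
  rw [← ofReal_wTF hT' hρ hI, ← ENNReal.ofReal_toReal (PTe_ne_top (T := T) hρ h0 hD X),
    ← ENNReal.ofReal_mul hc0, ← ENNReal.ofReal_add ENNReal.toReal_nonneg (mul_nonneg hc0 (wTF_nonneg _ _ _)),
    ← ENNReal.ofReal_add (add_nonneg ENNReal.toReal_nonneg (mul_nonneg hc0 (wTF_nonneg _ _ _))) (by positivity)] at h2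
  have h3 := (ENNReal.ofReal_le_ofReal_iff (add_nonneg (add_nonneg ENNReal.toReal_nonneg
    (mul_nonneg hc0 (wTF_nonneg _ _ _))) (by positivity))).1 h2
  rw [PT]
  linarith

/-- A complex-valued test function on ℝ³. -/
def IsTest (f : (Fin 3 → ℝ) → ℂ) : Prop :=
  ContDiff ℝ (⊤ : ℕ∞) f ∧ HasCompactSupport f

/-- The partial derivative of a complex-valued function. -/
def pdC (k : Fin 3) (f : (Fin 3 → ℝ) → ℂ) (x : Fin 3 → ℝ) : ℂ :=
  fderiv ℝ f x (Pi.single k 1)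

/-- The one-body Pauli kinetic energy density. -/
def kd (A : (Fin 3 → ℝ) → Fin 3 → ℝ) (f : (Fin 3 → ℝ) → Fin 2 → ℂ) (x : Fin 3 → ℝ) : ℝ :=
  ∑ s : Fin 2, ‖∑ k : Fin 3, ∑ t : Fin 2, pauli k s t *
    (-Complex.I * pdC k (fun y => f y t) x + (A x k : ℂ) * f x t)‖ ^ 2

/-- The Fourier transform on `Fin 3 → ℝ`. -/
def fhat (f : (Fin 3 → ℝ) → ℂ) (ξ : Fin 3 → ℝ) : ℂ :=
  ∫ x : Fin 3 → ℝ, Complex.exp (((-2 * Real.pi * ∑ k, ξ k * x k : ℝ) : ℂ) * Complex.I) * f x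

namespace IsTest

variable {f g : (Fin 3 → ℝ) → ℂ}

theorem continuous (hf : IsTest f) : Continuous f := hf.1.continuous

theorem integrable (hf : IsTest f) : Integrable f :=
  hf.continuous.integrable_of_hasCompactSupport hf.2

theorem differentiable (hf : IsTest f) : Differentiable ℝ f :=
  hf.1.differentiable (by simp)

theorem pd (hf : IsTest f) (k : Fin 3) : IsTest (pdC k f) := by
  constructor
  · have := hf.1.fderiv_right (m := (⊤ : ℕ∞)) (by simp)
    exact this.clm_apply contDiff_const
  · exact hf.2.fderiv_apply (𝕜 := ℝ) _

theorem add (hf : IsTest f) (hg : IsTest g) : IsTest (fun x => f x + g x) :=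
  ⟨hf.1.add hg.1, hf.2.add hg.2⟩

theorem mul_left {u : (Fin 3 → ℝ) → ℂ} (hu : ContDiff ℝ (⊤ : ℕ∞) u) (hf : IsTest f) :
    IsTest (fun x => u x * f x) :=
  ⟨hu.mul hf.1, hf.2.mul_left⟩

theorem const_mul (hf : IsTest f) (c : ℂ) : IsTest (fun x => c * f x) :=
  mul_left contDiff_const hf

theorem sum {ι : Type*} (s : Finset ι) {F : ι → (Fin 3 → ℝ) → ℂ} (h : ∀ i ∈ s, IsTest (F i)) :
    IsTest (fun x => ∑ i ∈ s, F i x) := by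
  classical
  induction s using Finset.induction_on with
  | empty =>
    simp only [Finset.sum_empty]
    exact ⟨contDiff_const, HasCompactSupport.zero⟩
  | insert a s ha ih =>
    simp only [Finset.sum_insert ha]
    exact (h a (by simp)).add (ih fun i hi => h i (by simp [hi]))

theorem integrable_normSq (hf : IsTest f) : Integrable (fun x => ‖f x‖ ^ 2) := by
  refine Continuous.integrable_of_hasCompactSupport (hf.continuous.norm.pow 2) ?_
  refine hf.2.mono fun x hx => ?_
  contrapose! hx
  simp only [Function.notMem_support] at hx ⊢
  simp [hx]

end IsTest

theorem fhat_eq_fourier (f : (Fin 3 → ℝ) → ℂ) (ξ : Fin 3 → ℝ) :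
    fhat f ξ = FourierTransform.fourier (fun v : EuclideanSpace ℝ (Fin 3) => f (WithLp.ofLp v))
      (WithLp.toLp 2 ξ) := by
  rw [Real.fourier_eq', fhat, ← (EuclideanSpace.volume_preserving_symm_measurableEquiv_toLp (Fin 3)).integral_comp']
  simp [PiLp.inner_apply, smul_eq_mul, mul_comm]

theorem isTest_euclidean {f : (Fin 3 → ℝ) → ℂ} (hf : IsTest f) :
    ContDiff ℝ (⊤ : ℕ∞) (fun v : EuclideanSpace ℝ (Fin 3) => f (WithLp.ofLp v)) ∧
    HasCompactSupport (fun v : EuclideanSpace ℝ (Fin 3) => f (WithLp.ofLp v)) := by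
  constructor
  · exact hf.1.comp (PiLp.continuousLinearEquiv 2 ℝ (fun _ : Fin 3 => ℝ)).contDiff
  · exact hf.2.comp_homeomorph (PiLp.continuousLinearEquiv 2 ℝ (fun _ : Fin 3 => ℝ)).toHomeomorph

theorem plancherel {f : (Fin 3 → ℝ) → ℂ} (hf : IsTest f) :
    Integrable (fun ξ => ‖fhat f ξ‖ ^ 2) ∧ ∫ ξ, ‖fhat f ξ‖ ^ 2 = ∫ x, ‖f x‖ ^ 2 := by
  obtain ⟨h1, h2⟩ := isTest_euclidean hf
  set S := h2.toSchwartzMap h1 with hS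
  have hP := SchwartzMap.integral_norm_sq_fourier S
  have e := (EuclideanSpace.volume_preserving_symm_measurableEquiv_toLp (Fin 3))
  have hF : ∀ ξ : Fin 3 → ℝ, fhat f ξ = (FourierTransform.fourier S) (WithLp.toLp 2 ξ) := by
    intro ξ
    rw [fhat_eq_fourier, SchwartzMap.fourier_coe]; rfl
  constructor
  · simp_rw [hF]
    have : Integrable (fun v : EuclideanSpace ℝ (Fin 3) => ‖(FourierTransform.fourier S) v‖ ^ 2) := by
      have := (FourierTransform.fourier S).memLp 2
      exact this.integrable_norm_pow (by simp)
    rw [← e.integrable_comp_emb (MeasurableEquiv.measurableEmbedding _)]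
    exact this
  · rw [← e.integral_comp', ← e.integral_comp' (g := fun x => ‖f x‖ ^ 2)]
    simp_rw [hF]
    exact hP

theorem hasFDerivAt_phase (ξ x : Fin 3 → ℝ) : HasFDerivAt
    (fun x : Fin 3 → ℝ => Complex.exp (((-2 * Real.pi * ∑ k, ξ k * x k : ℝ) : ℂ) * Complex.I))
    ((ContinuousLinearMap.smulRight (∑ k, ξ k • (ContinuousLinearMap.proj k : (Fin 3 → ℝ) →L[ℝ] ℝ))
      (Complex.exp (((-2 * Real.pi * ∑ k, ξ k * x k : ℝ) : ℂ) * Complex.I) *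
        (-2 * Real.pi * Complex.I)))) x := by
  have h1 : HasFDerivAt (fun x : Fin 3 → ℝ => ∑ k, ξ k * x k)
      (∑ k, ξ k • (ContinuousLinearMap.proj k : (Fin 3 → ℝ) →L[ℝ] ℝ)) x := by
    have := (∑ k, ξ k • (ContinuousLinearMap.proj k : (Fin 3 → ℝ) →L[ℝ] ℝ)).hasFDerivAt (x := x)
    convert this using 1
    ext y
    simp
  have h2 : HasDerivAt (fun t : ℝ => Complex.exp (((-2 * Real.pi * t : ℝ) : ℂ) * Complex.I))
      (Complex.exp (((-2 * Real.pi * ∑ k, ξ k * x k : ℝ) : ℂ) * Complex.I) *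
        (-2 * Real.pi * Complex.I)) (∑ k, ξ k * x k) := by
    have h3 : HasDerivAt (fun t : ℝ => (-2 * Real.pi * t : ℝ)) (-2 * Real.pi) (∑ k, ξ k * x k) := by
      simpa using (hasDerivAt_id (∑ k, ξ k * x k)).const_mul (-2 * Real.pi)
    have := ((h3.ofReal_comp).mul_const Complex.I).cexp
    convert this using 1
    push_cast; ring
  have := h2.hasFDerivAt.comp x h1
  exact this.congr_fderiv (by ext v; simp [Finset.sum_mul])

theorem contDiff_phase (ξ : Fin 3 → ℝ) : ContDiff ℝ (⊤ : ℕ∞)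
    (fun x : Fin 3 → ℝ => Complex.exp (((-2 * Real.pi * ∑ k, ξ k * x k : ℝ) : ℂ) * Complex.I)) := by
  apply ContDiff.cexp
  apply ContDiff.mul _ contDiff_const
  exact Complex.ofRealCLM.contDiff.comp (contDiff_const.mul
    (ContDiff.sum fun k _ => contDiff_const.mul (contDiff_apply ℝ ℝ k)))

theorem fhat_pd {f : (Fin 3 → ℝ) → ℂ} (hf : IsTest f) (k : Fin 3) (ξ : Fin 3 → ℝ) :
    fhat (pdC k f) ξ = 2 * Real.pi * Complex.I * ξ k * fhat f ξ := by
  set E := (fun x : Fin 3 → ℝ => Complex.exp (((-2 * Real.pi * ∑ k, ξ k * x k : ℝ) : ℂ) * Complex.I)) with hE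
  have hEs : ContDiff ℝ (⊤ : ℕ∞) E := contDiff_phase ξ
  have hE' : ∀ x, fderiv ℝ E x (Pi.single k 1) = E x * (-2 * Real.pi * Complex.I * ξ k) := by
    intro x
    rw [(hasFDerivAt_phase ξ x).fderiv]
    simp [hE, Pi.single_apply]
    ring
  have key := integral_mul_fderiv_eq_neg_fderiv_mul_of_integrable (μ := volume) (𝕜 := ℂ)
    (f := E) (g := f) (v := Pi.single k 1) ?_ ?_ ?_ ?_ ?_
  · unfold fhat
    change ∫ x, E x * fderiv ℝ f x (Pi.single k 1) = _ * ∫ x, E x * f x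
    rw [key, ← integral_neg, ← integral_const_mul]
    congr 1
    ext x
    rw [hE']; ring
  · simp_rw [hE']
    have := (IsTest.mul_left hEs hf).const_mul (-2 * Real.pi * Complex.I * ξ k)
    convert this.integrable using 2
    ring
  · exact (IsTest.mul_left hEs (hf.pd k)).integrable
  · exact (IsTest.mul_left hEs hf).integrable
  · exact fun x _ => (hEs.differentiable (by simp)) x
  · exact fun x _ => hf.differentiable x

theorem fhat_add {f g : (Fin 3 → ℝ) → ℂ} (hf : IsTest f) (hg : IsTest g) (ξ : Fin 3 → ℝ) :
    fhat (fun x => f x + g x) ξ = fhat f ξ + fhat g ξ := by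
  unfold fhat
  rw [← integral_add]
  · congr 1; ext x; ring
  · exact (IsTest.mul_left (contDiff_phase ξ) hf).integrable
  · exact (IsTest.mul_left (contDiff_phase ξ) hg).integrable

theorem fhat_const_mul (f : (Fin 3 → ℝ) → ℂ) (c : ℂ) (ξ : Fin 3 → ℝ) :
    fhat (fun x => c * f x) ξ = c * fhat f ξ := by
  unfold fhat
  rw [← integral_const_mul]
  congr 1; ext x; ring

theorem fhat_sum {ι : Type*} (s : Finset ι) {F : ι → (Fin 3 → ℝ) → ℂ} (h : ∀ i ∈ s, IsTest (F i))
    (ξ : Fin 3 → ℝ) : fhat (fun x => ∑ i ∈ s, F i x) ξ = ∑ i ∈ s, fhat (F i) ξ := by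
  unfold fhat
  rw [← integral_finsetSum]
  · congr 1; ext x; rw [Finset.mul_sum]
  · exact fun i hi => (IsTest.mul_left (contDiff_phase ξ) (h i hi)).integrable

theorem isTest_momentum {f : (Fin 3 → ℝ) → ℂ} (hf : IsTest f) (c : ℝ) (k : Fin 3) :
    IsTest (fun x => -Complex.I * pdC k f x + (c : ℂ) * f x) :=
  ((hf.pd k).const_mul _).add (hf.const_mul _)

theorem fhat_momentum {f : (Fin 3 → ℝ) → ℂ} (hf : IsTest f) (c : ℝ) (k : Fin 3) (ξ : Fin 3 → ℝ) :
    fhat (fun x => -Complex.I * pdC k f x + (c : ℂ) * f x) ξ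
      = ((2 * Real.pi * ξ k + c : ℝ) : ℂ) * fhat f ξ := by
  rw [fhat_add ((hf.pd k).const_mul _) (hf.const_mul _), fhat_const_mul, fhat_const_mul,
    fhat_pd hf]
  push_cast
  ring_nf
  simp

/-- Σ_s |Σ_k p_k (σ_k v)_s|² = |p|² |v|². -/
theorem pauli_norm (p : Fin 3 → ℝ) (v : Fin 2 → ℂ) :
    ∑ s : Fin 2, ‖∑ k : Fin 3, ∑ t : Fin 2, pauli k s t * ((p k : ℂ) * v t)‖ ^ 2
      = (∑ k, p k ^ 2) * ∑ t, ‖v t‖ ^ 2 := by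
  simp only [← Complex.normSq_eq_norm_sq, Fin.sum_univ_two, Fin.sum_univ_three, pauli]
  simp [Complex.normSq_apply]
  ring

theorem kd_const_integral {f : (Fin 3 → ℝ) → Fin 2 → ℂ} (hf : ∀ t, IsTest fun x => f x t)
    (c : Fin 3 → ℝ) :
    Integrable (fun ξ => nsq (fun k => 2 * Real.pi * ξ k + c k) *
      ∑ t, ‖fhat (fun x => f x t) ξ‖ ^ 2) ∧
    ∫ x, kd (fun _ => c) f x = ∫ ξ, nsq (fun k => 2 * Real.pi * ξ k + c k) *
      ∑ t, ‖fhat (fun x => f x t) ξ‖ ^ 2 := by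
  have hT : ∀ s, IsTest fun x => ∑ k : Fin 3, ∑ t : Fin 2, pauli k s t *
    (-Complex.I * pdC k (fun y => f y t) x + (c k : ℂ) * f x t) := fun s =>
    IsTest.sum _ fun k _ => IsTest.sum _ fun t _ => (isTest_momentum (hf t) (c k) k).const_mul _
  have hh : ∀ s ξ, fhat (fun x => ∑ k : Fin 3, ∑ t : Fin 2, pauli k s t *
    (-Complex.I * pdC k (fun y => f y t) x + (c k : ℂ) * f x t)) ξ =
    ∑ k : Fin 3, ∑ t : Fin 2, pauli k s t *
      (((2 * Real.pi * ξ k + c k : ℝ) : ℂ) * fhat (fun x => f x t) ξ) := by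
    intro s ξ
    rw [fhat_sum _ fun k _ => IsTest.sum _ fun t _ =>
      (isTest_momentum (hf t) (c k) k).const_mul _]
    refine Finset.sum_congr rfl fun k _ => ?_
    rw [fhat_sum _ fun t _ => (isTest_momentum (hf t) (c k) k).const_mul _]
    refine Finset.sum_congr rfl fun t _ => ?_
    rw [fhat_const_mul, fhat_momentum (hf t)]
  have e : ∀ ξ, ∑ s, ‖fhat (fun x => ∑ k : Fin 3, ∑ t : Fin 2, pauli k s t *
    (-Complex.I * pdC k (fun y => f y t) x + (c k : ℂ) * f x t)) ξ‖ ^ 2 =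
    nsq (fun k => 2 * Real.pi * ξ k + c k) * ∑ t, ‖fhat (fun x => f x t) ξ‖ ^ 2 := by
    intro ξ
    simp_rw [hh]
    exact pauli_norm (fun k => 2 * Real.pi * ξ k + c k) (fun t => fhat (fun x => f x t) ξ)
  constructor
  · simp_rw [← e]
    exact integrable_finsetSum _ fun s _ => (plancherel (hT s)).1
  · simp_rw [← e]
    rw [integral_finsetSum _ fun s _ => (plancherel (hT s)).1]
    unfold kd
    rw [integral_finsetSum _ fun s _ => (hT s).integrable_normSq]
    exact Finset.sum_congr rfl fun s _ => (plancherel (hT s)).2.symm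

theorem kd_const_integral' {f : (Fin 3 → ℝ) → Fin 2 → ℂ} (hf : ∀ t, IsTest fun x => f x t)
    (c : Fin 3 → ℝ) :
    ∫ x, kd (fun _ => c) f x = ∑ t, ∑ k, ∫ x,
      ‖-Complex.I * pdC k (fun y => f y t) x + (c k : ℂ) * f x t‖ ^ 2 := by
  rw [(kd_const_integral hf c).2]
  have h := fun t k => plancherel (isTest_momentum (hf t) (c k) k)
  simp_rw [← (h _ _).2]
  simp_rw [← integral_finsetSum Finset.univ fun k _ => (h _ k).1]
  rw [← integral_finsetSum _ fun t _ => integrable_finsetSum _ fun k _ => (h t k).1]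
  congr 1
  ext ξ
  rw [nsq, Finset.mul_sum]
  refine Finset.sum_congr rfl fun t _ => ?_
  rw [Finset.sum_mul]
  refine Finset.sum_congr rfl fun k _ => ?_
  rw [fhat_momentum (hf t), norm_mul, mul_pow, Complex.norm_real, Real.norm_eq_abs, sq_abs]

theorem integral_max_one_sub_nsq :
    ∫ x : Fin 3 → ℝ, max (1 - nsq x) 0 = 8 * Real.pi / 15 := by
  have e := (EuclideanSpace.volume_preserving_symm_measurableEquiv_toLp (Fin 3))
  rw [← e.integral_comp']
  have h1 : ∀ v : EuclideanSpace ℝ (Fin 3),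
      max (1 - nsq ((MeasurableEquiv.toLp 2 (Fin 3 → ℝ)).symm v)) 0 =
        (fun t : ℝ => max (1 - t ^ 2) 0) ‖v‖ := by
    intro v
    simp [EuclideanSpace.norm_eq, nsq, Real.sq_sqrt, Finset.sum_nonneg, sq_nonneg]
  rw [integral_congr_ae (Filter.Eventually.of_forall h1)]
  refine (integral_fun_norm_addHaar (volume : Measure (EuclideanSpace ℝ (Fin 3)))
    (fun t : ℝ => max (1 - t ^ 2) 0)).trans ?_
  have h2 : volume.real (Metric.ball (0 : EuclideanSpace ℝ (Fin 3)) 1) = Real.pi * 4 / 3 := by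
    rw [measureReal_def, EuclideanSpace.volume_ball_fin_three]
    rw [ENNReal.ofReal_one, one_pow, one_mul, ENNReal.toReal_ofReal (by positivity)]
  have h3 : ∫ y in Set.Ioi (0 : ℝ), y ^ (Module.finrank ℝ (EuclideanSpace ℝ (Fin 3)) - 1) •
      max (1 - y ^ 2) 0 = 2 / 15 := by
    have : ∫ y in Set.Ioi (0 : ℝ), y ^ (Module.finrank ℝ (EuclideanSpace ℝ (Fin 3)) - 1) •
      max (1 - y ^ 2) 0 = ∫ y in Set.Ioc (0 : ℝ) 1, (y ^ 2 - y ^ 4) := by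
      symm
      rw [← integral_indicator measurableSet_Ioc, ← integral_indicator measurableSet_Ioi]
      congr 1
      ext y
      by_cases hy : 0 < y
      · by_cases hy1 : y ≤ 1
        · rw [Set.indicator_of_mem (show y ∈ Set.Ioc (0 : ℝ) 1 from ⟨hy, hy1⟩), Set.indicator_of_mem (show y ∈ Set.Ioi (0 : ℝ) from hy),
            max_eq_left (by nlinarith)]
          simp; ring
        · rw [Set.indicator_of_notMem (fun h => hy1 h.2), Set.indicator_of_mem (show y ∈ Set.Ioi (0 : ℝ) from hy),
            max_eq_right (by nlinarith)]
          simp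
      · rw [Set.indicator_of_notMem (fun h => hy h.1), Set.indicator_of_notMem (show y ∉ Set.Ioi (0 : ℝ) from hy)]
    rw [this, ← intervalIntegral.integral_of_le zero_le_one]
    rw [intervalIntegral.integral_sub (by simp) (by simp)]
    simp
    norm_num
  rw [h2, h3]
  simp
  ring

/-- The momentum-space volume of the semiclassical kinetic cutoff. -/
theorem integral_max_momentum {a b : ℝ} (ha : 0 < a) (hb : 0 ≤ b) (c : Fin 3 → ℝ) :
    ∫ ξ : Fin 3 → ℝ, max (b - a * nsq (fun k => 2 * Real.pi * ξ k + c k)) 0 =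
      1 / (15 * Real.pi ^ 2) * (b ^ ((5 : ℝ) / 2) * a ^ (-(3 : ℝ) / 2)) := by
  have h1 : ∫ ξ : Fin 3 → ℝ, max (b - a * nsq (fun k => 2 * Real.pi * ξ k + c k)) 0 =
      ((2 * Real.pi) ^ 3)⁻¹ * ∫ p : Fin 3 → ℝ, max (b - a * nsq p) 0 := by
    have := Measure.integral_comp_smul (volume : Measure (Fin 3 → ℝ))
      (fun p => max (b - a * nsq (p + c)) 0) (2 * Real.pi)
    rw [abs_of_nonneg (by positivity)] at this
    simp only [Module.finrank_fin_fun, smul_eq_mul] at this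
    rw [integral_add_right_eq_self (fun p => max (b - a * nsq p) 0)] at this
    rw [← this]
    rfl
  rcases hb.eq_or_lt with rfl | hb
  · have : ∀ p : Fin 3 → ℝ, max (0 - a * nsq p) 0 = 0 := by
      intro p
      have := mul_nonneg ha.le (nsq_nonneg p)
      exact max_eq_right (by linarith)
    rw [h1]; simp_rw [this]
    simp
  have h2 : ∫ p : Fin 3 → ℝ, max (b - a * nsq p) 0 =
      (Real.sqrt (b / a)) ^ 3 * (b * (8 * Real.pi / 15)) := by
    have hs : 0 < Real.sqrt (b / a) := by positivity
    have := Measure.integral_comp_smul (volume : Measure (Fin 3 → ℝ))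
      (fun p => max (b - a * nsq p) 0) (Real.sqrt (b / a))
    rw [abs_of_nonneg (by positivity)] at this
    simp only [Module.finrank_fin_fun, smul_eq_mul] at this
    have h3 : ∀ x : Fin 3 → ℝ, max (b - a * nsq (Real.sqrt (b / a) • x)) 0 =
        b * max (1 - nsq x) 0 := by
      intro x
      rw [nsq_smul, Real.sq_sqrt (by positivity), mul_max_of_nonneg _ _ hb.le]
      congr 1
      · field_simp
      · simp
    simp_rw [h3] at this
    rw [integral_const_mul, integral_max_one_sub_nsq] at this
    rw [this]
    field_simp
  rw [h1, h2]
  have h4 : (Real.sqrt (b / a)) ^ 3 * b = b ^ ((5 : ℝ) / 2) * a ^ (-(3 : ℝ) / 2) := by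
    rw [Real.sqrt_eq_rpow, ← Real.rpow_natCast, ← Real.rpow_mul (by positivity),
      Real.div_rpow hb.le ha.le, div_eq_mul_inv, ← Real.rpow_neg ha.le]
    have : b ^ ((5 : ℝ) / 2) = b ^ ((3 : ℝ) / 2) * b := by
      rw [← Real.rpow_add_one hb.ne']; norm_num
    rw [this]; norm_num; ring
  rw [← h4]
  field_simp
  ring

theorem continuous_fhat {f : (Fin 3 → ℝ) → ℂ} (hf : IsTest f) : Continuous (fhat f) := by
  refine continuous_of_dominated (bound := fun x => ‖f x‖) ?_ ?_ hf.integrable.norm ?_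
  · intro ξ
    exact (IsTest.mul_left (contDiff_phase ξ) hf).continuous.aestronglyMeasurable
  · intro ξ
    filter_upwards with x
    rw [norm_mul, Complex.norm_exp_ofReal_mul_I, one_mul]
  · filter_upwards with x
    fun_prop

theorem hasCompactSupport_max_momentum {a : ℝ} (ha : 0 < a) (b : ℝ) (c : Fin 3 → ℝ) :
    HasCompactSupport fun ξ : Fin 3 → ℝ =>
      max (b - a * nsq (fun k => 2 * Real.pi * ξ k + c k)) 0 := by
  refine HasCompactSupport.of_support_subset_isCompact
    (isCompact_closedBall (0 : Fin 3 → ℝ) (Real.sqrt (|b| / a) + ‖c‖)) ?_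
  intro ξ hξ
  rw [mem_closedBall_zero_iff]
  by_contra hlt
  apply hξ
  push Not at hlt
  refine max_eq_right ?_
  set p := (fun k => 2 * Real.pi * ξ k + c k) with hp
  have h1 : Real.sqrt (|b| / a) ≤ ‖p‖ := by
    have : (2 * Real.pi) • ξ = p - c := by ext k; simp [hp]
    have h2 : ‖(2 * Real.pi) • ξ‖ ≤ ‖p‖ + ‖c‖ := by rw [this]; exact norm_sub_le _ _
    rw [norm_smul, Real.norm_eq_abs, abs_of_pos (by positivity)] at h2
    nlinarith [Real.pi_gt_three, norm_nonneg ξ]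
  have h3 : |b| / a ≤ nsq p := by
    have := Real.sqrt_le_iff.1 (h1.trans (norm_le_enorm3 p))
    rw [enorm3_sq] at this
    exact this.2
  rw [div_le_iff₀ ha] at h3
  linarith [le_abs_self b]

theorem continuous_max_momentum (a b : ℝ) (c : Fin 3 → ℝ) :
    Continuous fun ξ : Fin 3 → ℝ => max (b - a * nsq (fun k => 2 * Real.pi * ξ k + c k)) 0 := by
  unfold nsq
  fun_prop

/-- The one-body form of the Berezin–Li–Yau lower bound. -/
theorem kd_const_lower {f : (Fin 3 → ℝ) → Fin 2 → ℂ} (hf : ∀ t, IsTest fun x => f x t)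
    {a : ℝ} (ha : 0 < a) (b : ℝ) (c : Fin 3 → ℝ) :
    b * ∫ x, ∑ t, ‖f x t‖ ^ 2 ≤ a * (∫ x, kd (fun _ => c) f x) +
      ∫ ξ, max (b - a * nsq (fun k => 2 * Real.pi * ξ k + c k)) 0 *
        ∑ t, ‖fhat (fun x => f x t) ξ‖ ^ 2 := by
  obtain ⟨h1, h2⟩ := kd_const_integral hf c
  have h3 : ∫ x, ∑ t, ‖f x t‖ ^ 2 = ∫ ξ, ∑ t, ‖fhat (fun x => f x t) ξ‖ ^ 2 := by
    rw [integral_finsetSum _ fun t _ => (hf t).integrable_normSq,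
      integral_finsetSum _ fun t _ => (plancherel (hf t)).1]
    exact Finset.sum_congr rfl fun t _ => (plancherel (hf t)).2.symm
  have h4 : Integrable (fun ξ => max (b - a * nsq (fun k => 2 * Real.pi * ξ k + c k)) 0 *
      ∑ t, ‖fhat (fun x => f x t) ξ‖ ^ 2) := by
    refine Continuous.integrable_of_hasCompactSupport ?_
      ((hasCompactSupport_max_momentum ha b c).mul_right)
    exact (continuous_max_momentum a b c).mul (continuous_finsetSum _ fun t _ =>
      (continuous_fhat (hf t)).norm.pow 2)
  rw [h2, h3, ← integral_const_mul, ← integral_const_mul, ← integral_add (h1.const_mul a) h4]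
  refine integral_mono ((integrable_finsetSum _ fun t _ => (plancherel (hf t)).1).const_mul b)
    ((h1.const_mul a).add h4) fun ξ => ?_
  have hs : 0 ≤ ∑ t, ‖fhat (fun x => f x t) ξ‖ ^ 2 := Finset.sum_nonneg fun t _ => by positivity
  have := le_max_left (b - a * nsq (fun k => 2 * Real.pi * ξ k + c k)) 0
  dsimp only
  nlinarith [mul_le_mul_of_nonneg_right this hs]

theorem norm_fderiv_sq_le (φ : (Fin 3 → ℝ) → ℂ) (x : Fin 3 → ℝ) :
    ‖fderiv ℝ φ x‖ ^ 2 ≤ 3 * ∑ k, ‖pdC k φ x‖ ^ 2 := by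
  have h1 : ‖fderiv ℝ φ x‖ ≤ ∑ k, ‖pdC k φ x‖ := by
    refine ContinuousLinearMap.opNorm_le_bound _ (Finset.sum_nonneg fun k _ => norm_nonneg _) ?_
    intro v
    have hv : v = ∑ k, v k • (Pi.single k 1 : Fin 3 → ℝ) := by
      ext j; simp [Finset.sum_apply, Pi.single_apply]
    conv_lhs => rw [hv]
    rw [map_sum, Finset.sum_mul]
    refine (norm_sum_le _ _).trans (Finset.sum_le_sum fun k _ => ?_)
    rw [map_smul, norm_smul, mul_comm]
    exact mul_le_mul_of_nonneg_left (norm_le_pi_norm v k) (norm_nonneg _)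
  refine (pow_le_pow_left₀ (norm_nonneg _) h1 2).trans ?_

  rw [Fin.sum_univ_three, Fin.sum_univ_three]
  nlinarith [sq_nonneg (‖pdC 0 φ x‖ - ‖pdC 1 φ x‖), sq_nonneg (‖pdC 0 φ x‖ - ‖pdC 2 φ x‖),
    sq_nonneg (‖pdC 1 φ x‖ - ‖pdC 2 φ x‖)]

theorem sobolev : ∃ CS : ℝ, 0 < CS ∧ ∀ φ : (Fin 3 → ℝ) → ℂ, IsTest φ →
    ∫ x, ‖φ x‖ ^ 6 ≤ CS * (∫ x, ∑ k, ‖pdC k φ x‖ ^ 2) ^ 3 := by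
  set C := SNormLESNormFDerivOfEqConst ℂ (volume : Measure (Fin 3 → ℝ)) ((2 : NNReal) : ℝ) with hC
  refine ⟨(C + 1) ^ 6 * 27, by positivity, fun φ hφ => ?_⟩
  have h := eLpNorm_le_eLpNorm_fderiv_of_eq (volume : Measure (Fin 3 → ℝ))
    (hφ.1.of_le (by exact_mod_cast le_top)) hφ.2 (p := 2) (p' := 6) (by norm_num) (by simp) (by norm_num)
  have hf1 : Continuous (fderiv ℝ φ) := hφ.1.continuous_fderiv (by simp)
  have hm1 : MemLp φ 6 := hφ.continuous.memLp_of_hasCompactSupport hφ.2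
  have hm2 : MemLp (fderiv ℝ φ) 2 := hf1.memLp_of_hasCompactSupport (hφ.2.fderiv (𝕜 := ℝ))
  have e1 : eLpNorm φ ((6 : NNReal) : ENNReal) volume = ENNReal.ofReal ((∫ x, ‖φ x‖ ^ 6) ^ ((6 : ℝ)⁻¹)) := by
    have := hm1.eLpNorm_eq_integral_rpow_norm (by simp) (by simp)
    simp only [ENNReal.toReal_ofNat] at this
    simpa using this
  have e2 : eLpNorm (fderiv ℝ φ) ((2 : NNReal) : ENNReal) volume =
      ENNReal.ofReal ((∫ x, ‖fderiv ℝ φ x‖ ^ 2) ^ ((2 : ℝ)⁻¹)) := by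
    have := hm2.eLpNorm_eq_integral_rpow_norm (by simp) (by simp)
    simp only [ENNReal.toReal_ofNat] at this
    simpa using this
  rw [e1, e2, ← hC] at h
  set X := ∫ x, ‖φ x‖ ^ 6 with hX
  set Y := ∫ x, ‖fderiv ℝ φ x‖ ^ 2 with hY
  have hX0 : 0 ≤ X := integral_nonneg fun x => by positivity
  have hY0 : 0 ≤ Y := integral_nonneg fun x => by positivity
  have h' : X ^ ((6 : ℝ)⁻¹) ≤ C * Y ^ ((2 : ℝ)⁻¹) := by
    rw [← ENNReal.ofReal_coe_nnreal, ← ENNReal.ofReal_mul (show (0 : ℝ) ≤ C from C.2)] at h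
    exact (ENNReal.ofReal_le_ofReal_iff (by positivity)).1 h
  have h2 : X ≤ C ^ 6 * Y ^ 3 := by
    have := pow_le_pow_left₀ (by positivity) h' 6
    rw [mul_pow, ← Real.rpow_natCast (X ^ _), ← Real.rpow_mul hX0,
      ← Real.rpow_natCast (Y ^ _), ← Real.rpow_mul hY0] at this
    norm_num at this
    exact_mod_cast this
  have h3 : Y ≤ 3 * ∫ x, ∑ k, ‖pdC k φ x‖ ^ 2 := by
    rw [← integral_const_mul]
    refine integral_mono_of_nonneg (Filter.Eventually.of_forall fun x => by positivity) ?_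
      (Filter.Eventually.of_forall fun x => norm_fderiv_sq_le φ x)
    exact (integrable_finsetSum _ fun k _ => (hφ.pd k).integrable_normSq).const_mul 3
  calc X ≤ C ^ 6 * Y ^ 3 := h2
    _ ≤ (C + 1) ^ 6 * (3 * ∫ x, ∑ k, ‖pdC k φ x‖ ^ 2) ^ 3 := by
      gcongr
      linarith
    _ = _ := by ring

/-- The squared gradient of a real function. -/
def gsq (h : (Fin 3 → ℝ) → ℝ) (x : Fin 3 → ℝ) : ℝ :=
  ∑ k, (fderiv ℝ h x (Pi.single k 1)) ^ 2

theorem gsq_nonneg (h : (Fin 3 → ℝ) → ℝ) (x : Fin 3 → ℝ) : 0 ≤ gsq h x :=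
  Finset.sum_nonneg fun _ _ => sq_nonneg _

theorem continuous_gsq {h : (Fin 3 → ℝ) → ℝ} (hh : ContDiff ℝ (⊤ : ℕ∞) h) : Continuous (gsq h) := by
  have := hh.continuous_fderiv (by simp)
  unfold gsq
  fun_prop

theorem sq_fderiv_le (h : (Fin 3 → ℝ) → ℝ) (x v : Fin 3 → ℝ) :
    (fderiv ℝ h x v) ^ 2 ≤ nsq v * gsq h x := by
  have hv : v = ∑ k, v k • (Pi.single k 1 : Fin 3 → ℝ) := by
    ext j; simp [Finset.sum_apply, Pi.single_apply]
  have : fderiv ℝ h x v = ∑ k, v k * fderiv ℝ h x (Pi.single k 1) := by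
    conv_lhs => rw [hv]
    simp [map_sum]
  rw [this]
  exact Finset.sum_mul_sq_le_sq_mul_sq _ _ _

theorem sq_intervalIntegral_le {φ : ℝ → ℝ} (hφ : Continuous φ) :
    (∫ t in (0 : ℝ)..1, φ t) ^ 2 ≤ ∫ t in (0 : ℝ)..1, φ t ^ 2 := by
  set m := ∫ t in (0 : ℝ)..1, φ t with hm
  have h : 0 ≤ ∫ t in (0 : ℝ)..1, (φ t - m) ^ 2 :=
    intervalIntegral.integral_nonneg zero_le_one fun t _ => sq_nonneg _
  have e : ∫ t in (0 : ℝ)..1, (φ t - m) ^ 2 = (∫ t in (0 : ℝ)..1, φ t ^ 2) - m ^ 2 := by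
    have : ∀ t, (φ t - m) ^ 2 = φ t ^ 2 - 2 * m * φ t + m ^ 2 := fun t => by ring
    simp_rw [this]
    rw [intervalIntegral.integral_add, intervalIntegral.integral_sub,
      intervalIntegral.integral_const_mul, ← hm]
    · simp; ring
    all_goals exact Continuous.intervalIntegrable (by fun_prop) _ _
  linarith

theorem sq_sub_le_lintegral {h : (Fin 3 → ℝ) → ℝ} (hh : ContDiff ℝ (⊤ : ℕ∞) h)
    (x y : Fin 3 → ℝ) : ENNReal.ofReal ((h x - h y) ^ 2) ≤
      ENNReal.ofReal (nsq (x - y)) *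
        ∫⁻ t in Set.Icc (0 : ℝ) 1, ENNReal.ofReal (gsq h ((1 - t) • y + t • x)) := by
  have hl : ∀ t : ℝ, HasDerivAt (fun t : ℝ => (1 - t) • y + t • x) (x - y) t := by
    intro t
    have h1 := (((hasDerivAt_id t).const_sub 1).smul_const y).fun_add
      ((hasDerivAt_id t).smul_const x)
    refine h1.congr_deriv ?_
    simp; abel
  have hd : ∀ t : ℝ, HasDerivAt (fun t : ℝ => h ((1 - t) • y + t • x))
      (fderiv ℝ h ((1 - t) • y + t • x) (x - y)) t := by
    intro t
    exact ((hh.differentiable (by simp)).differentiableAt.hasFDerivAt).comp_hasDerivAt t (hl t)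
  have hcf := hh.continuous_fderiv (by simp)
  have hc : Continuous fun t : ℝ => fderiv ℝ h ((1 - t) • y + t • x) (x - y) := by fun_prop
  have hg := continuous_gsq hh
  have hc' : Continuous fun t : ℝ => gsq h ((1 - t) • y + t • x) := by fun_prop
  have h1 : h x - h y = ∫ t in (0 : ℝ)..1, fderiv ℝ h ((1 - t) • y + t • x) (x - y) := by
    rw [intervalIntegral.integral_eq_sub_of_hasDerivAt (fun t _ => hd t)
      (hc.intervalIntegrable _ _)]
    simp
  have h2 : (h x - h y) ^ 2 ≤ nsq (x - y) * ∫ t in Set.Icc (0 : ℝ) 1, gsq h ((1 - t) • y + t • x) := by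
    rw [h1]
    refine (sq_intervalIntegral_le hc).trans ?_
    rw [integral_Icc_eq_integral_Ioc, ← intervalIntegral.integral_of_le zero_le_one,
      ← intervalIntegral.integral_const_mul]
    refine intervalIntegral.integral_mono_on zero_le_one ((hc.pow 2).intervalIntegrable _ _)
      ((hc'.const_mul _).intervalIntegrable _ _) fun t _ => sq_fderiv_le _ _ _
  calc _ ≤ _ := ENNReal.ofReal_le_ofReal h2
    _ = _ := by
      rw [ENNReal.ofReal_mul (nsq_nonneg _), ofReal_integral_eq_lintegral_ofReal]
      · exact hc'.continuousOn.integrableOn_compact isCompact_Icc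
      · exact Filter.Eventually.of_forall fun t => gsq_nonneg _ _

theorem lintegral_comp_smul_add {G : (Fin 3 → ℝ) → ENNReal} (hG : Measurable G) {t : ℝ}
    (ht : 0 < t) (z : Fin 3 → ℝ) :
    ∫⁻ x, G (z + t • x) = ENNReal.ofReal ((t ^ 3)⁻¹) * ∫⁻ x, G x := by
  have h1 : ∫⁻ x, G (z + t • x) = ∫⁻ x, G (z + x) ∂(Measure.map (t • ·) volume) := by
    rw [lintegral_map (by fun_prop) (by fun_prop)]
  rw [h1, Measure.map_addHaar_smul _ ht.ne', lintegral_smul_measure, smul_eq_mul,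
    lintegral_add_left_eq_self G z, abs_of_nonneg (by positivity)]
  simp

/-- The Poincaré inequality on a cube, with an arbitrary point value in place of the mean. -/
theorem poincare {h : (Fin 3 → ℝ) → ℝ} (hh : ContDiff ℝ (⊤ : ℕ∞) h) (u : Fin 3 → ℝ) {R : ℝ}
    (hR : 0 < R) : ∃ c : ℝ, ∫ x in Metric.closedBall u R, (h x - c) ^ 2 ≤
      96 * R ^ 2 * ∫ x in Metric.closedBall u R, gsq h x := by
  set Q := Metric.closedBall u R with hQ
  have hQm : MeasurableSet Q := Metric.isClosed_closedBall.measurableSet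
  have hQc : IsCompact Q := isCompact_closedBall u R
  have hQconv : Convex ℝ Q := convex_closedBall u R
  have hg := continuous_gsq hh
  set G : (Fin 3 → ℝ) → ENNReal := Q.indicator fun x => ENNReal.ofReal (gsq h x) with hG
  have hGm : Measurable G := Measurable.indicator (by fun_prop) hQm
  set J := ∫⁻ x in Q, ENNReal.ofReal (gsq h x) with hJ
  have hJG : ∫⁻ x, G x = J := lintegral_indicator hQm _
  have hvol0 : volume Q ≠ 0 := (Metric.measure_closedBall_pos _ u hR).ne'
  have hvolt : volume Q ≠ ⊤ := hQc.measure_lt_top.ne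
  have hseg : ∀ x ∈ Q, ∀ y ∈ Q, ∀ t ∈ Set.Icc (0 : ℝ) 1, (1 - t) • y + t • x ∈ Q :=
    fun x hx y hy t ht => hQconv hy hx (by linarith [ht.2]) ht.1 (by ring)
  have hmeas : Measurable fun p : (Fin 3 → ℝ) × (Fin 3 → ℝ) × ℝ =>
      G ((1 - p.2.2) • p.1 + p.2.2 • p.2.1) := by
    apply hGm.comp; fun_prop
  have key : ∀ t ∈ Set.Icc (0 : ℝ) 1,
      ∫⁻ y in Q, ∫⁻ x in Q, G ((1 - t) • y + t • x) ≤ 8 * volume Q * J := by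
    intro t ht
    have bd : ∀ s : ℝ, 1 / 2 ≤ s → ENNReal.ofReal ((s ^ 3)⁻¹) ≤ 8 := by
      intro s hs
      have h2 : (1 / 2 : ℝ) ^ 3 ≤ s ^ 3 := pow_le_pow_left₀ (by norm_num) hs 3
      have : (s ^ 3)⁻¹ ≤ 8 := by
        calc (s ^ 3)⁻¹ ≤ ((1 / 2 : ℝ) ^ 3)⁻¹ := inv_anti₀ (by norm_num) h2
          _ = 8 := by norm_num
      exact (ENNReal.ofReal_le_ofReal this).trans (by simp)
    have inner : ∀ s : ℝ, 1 / 2 ≤ s → ∀ z, ∫⁻ x in Q, G (z + s • x) ≤ 8 * J := by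
      intro s hs z
      calc _ ≤ ∫⁻ x, G (z + s • x) := setLIntegral_le_lintegral _ _
        _ = ENNReal.ofReal ((s ^ 3)⁻¹) * J := by
          rw [lintegral_comp_smul_add hGm (by linarith), hJG]
        _ ≤ _ := by gcongr; exact bd s hs
    rcases le_total (1 / 2) t with h | h
    · calc _ ≤ ∫⁻ y in Q, 8 * J := lintegral_mono fun y => inner t h _
        _ = _ := by rw [setLIntegral_const]; ring
    · rw [lintegral_lintegral_swap]
      · calc _ ≤ ∫⁻ y in Q, 8 * J := by
              refine lintegral_mono fun x => ?_
              simp_rw [add_comm ((1 - t) • _) _]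
              exact inner (1 - t) (by linarith) _
          _ = _ := by rw [setLIntegral_const]; ring
      · exact (hGm.comp (by fun_prop)).aemeasurable
  have main : ∫⁻ y in Q, ∫⁻ x in Q, ENNReal.ofReal ((h x - h y) ^ 2) ≤
      ENNReal.ofReal (12 * R ^ 2) * (8 * volume Q * J) := by
    calc _ ≤ ∫⁻ y in Q, ∫⁻ x in Q, ENNReal.ofReal (12 * R ^ 2) *
            ∫⁻ t in Set.Icc (0 : ℝ) 1, G ((1 - t) • y + t • x) := by
          refine setLIntegral_mono' hQm fun y hy => setLIntegral_mono' hQm fun x hx => ?_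
          refine (sq_sub_le_lintegral hh x y).trans ?_
          gcongr ENNReal.ofReal ?_ * ?_
          · refine (nsq_le_norm _).trans ?_
            have hx' := mem_closedBall_iff_norm.1 hx
            have hy' := mem_closedBall_iff_norm.1 hy
            have : ‖x - y‖ ≤ 2 * R := by
              have := norm_sub_le (x - u) (y - u)
              rw [sub_sub_sub_cancel_right] at this
              linarith
            nlinarith [norm_nonneg (x - y)]
          · refine setLIntegral_mono' measurableSet_Icc fun t ht => ?_
            rw [hG, Set.indicator_of_mem (hseg x hx y hy t ht)]
      _ = ENNReal.ofReal (12 * R ^ 2) * ∫⁻ y in Q, ∫⁻ x in Q,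
            ∫⁻ t in Set.Icc (0 : ℝ) 1, G ((1 - t) • y + t • x) := by
          simp_rw [lintegral_const_mul' _ _ ENNReal.ofReal_ne_top]
      _ = ENNReal.ofReal (12 * R ^ 2) * ∫⁻ t in Set.Icc (0 : ℝ) 1, ∫⁻ y in Q, ∫⁻ x in Q,
            G ((1 - t) • y + t • x) := by
          congr 1
          have e1 : ∀ y, ∫⁻ x in Q, ∫⁻ t in Set.Icc (0 : ℝ) 1, G ((1 - t) • y + t • x) =
              ∫⁻ t in Set.Icc (0 : ℝ) 1, ∫⁻ x in Q, G ((1 - t) • y + t • x) := by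
            intro y
            refine lintegral_lintegral_swap (Measurable.aemeasurable ?_)
            exact hGm.comp (by fun_prop)
          simp_rw [e1]
          refine lintegral_lintegral_swap (Measurable.aemeasurable ?_)
          have : Measurable fun p : ((Fin 3 → ℝ) × ℝ) × (Fin 3 → ℝ) =>
              G ((1 - p.1.2) • p.1.1 + p.1.2 • p.2) := hGm.comp (by fun_prop)
          exact this.lintegral_prod_right'
      _ ≤ ENNReal.ofReal (12 * R ^ 2) * ∫⁻ t in Set.Icc (0 : ℝ) 1, 8 * volume Q * J := by
          exact mul_le_mul' le_rfl (setLIntegral_mono' measurableSet_Icc key)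
      _ = _ := by simp
  obtain ⟨y, hy, hle⟩ := exists_le_setLAverage (μ := volume) (s := Q)
    (f := fun y => ∫⁻ x in Q, ENNReal.ofReal ((h x - h y) ^ 2)) hvol0 hvolt (by
      apply Measurable.aemeasurable
      have : Measurable fun p : (Fin 3 → ℝ) × (Fin 3 → ℝ) => ENNReal.ofReal ((h p.2 - h p.1) ^ 2) := by
        have := hh.continuous
        fun_prop
      exact this.lintegral_prod_right')
  refine ⟨h y, ?_⟩
  rw [setLAverage_eq] at hle
  have hle2 : ∫⁻ x in Q, ENNReal.ofReal ((h x - h y) ^ 2) ≤ ENNReal.ofReal (96 * R ^ 2) * J := by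
    refine hle.trans ?_
    rw [ENNReal.div_le_iff hvol0 hvolt]
    refine main.trans (le_of_eq ?_)
    rw [show (96 : ℝ) * R ^ 2 = 8 * (12 * R ^ 2) by ring, ENNReal.ofReal_mul (by norm_num : (0:ℝ) ≤ 8)]
    simp only [ENNReal.ofReal_ofNat]
    ring
  have hc := hh.continuous
  rw [← ofReal_integral_eq_lintegral_ofReal, hJ, ← ofReal_integral_eq_lintegral_ofReal,
    ← ENNReal.ofReal_mul (by positivity)] at hle2
  · exact (ENNReal.ofReal_le_ofReal_iff (mul_nonneg (by positivity)
      (integral_nonneg fun x => gsq_nonneg _ _))).1 hle2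
  · exact hg.continuousOn.integrableOn_compact hQc
  · exact Filter.Eventually.of_forall fun t => gsq_nonneg _ _
  · exact Continuous.continuousOn (by fun_prop) |>.integrableOn_compact hQc
  · exact Filter.Eventually.of_forall fun t => sq_nonneg _

theorem gsq_mul_le {f g : (Fin 3 → ℝ) → ℝ} {x : Fin 3 → ℝ} (hf : DifferentiableAt ℝ f x)
    (hg : DifferentiableAt ℝ g x) :
    gsq (fun y => f y * g y) x ≤ 2 * (f x ^ 2 * gsq g x) + 2 * (g x ^ 2 * gsq f x) := by
  unfold gsq
  simp_rw [Finset.mul_sum]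
  rw [← Finset.sum_add_distrib]
  refine Finset.sum_le_sum fun k _ => ?_
  rw [fderiv_fun_mul hf hg]
  simp
  nlinarith [sq_nonneg (f x * fderiv ℝ g x (Pi.single k 1) - g x * fderiv ℝ f x (Pi.single k 1))]

theorem gsq_sub_const (f : (Fin 3 → ℝ) → ℝ) (c : ℝ) (x : Fin 3 → ℝ) :
    gsq (fun y => f y - c) x = gsq f x := by
  unfold gsq
  simp [fderiv_sub_const]

theorem gsq_of_zero_outside {f : (Fin 3 → ℝ) → ℝ} {u : Fin 3 → ℝ} {R : ℝ}
    (h : ∀ x, x ∉ Metric.closedBall u R → f x = 0) {x : Fin 3 → ℝ}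
    (hx : x ∉ Metric.closedBall u R) : gsq f x = 0 := by
  have : f =ᶠ[nhds x] fun _ => 0 := by
    filter_upwards [Metric.isClosed_closedBall.isOpen_compl.mem_nhds hx] with y hy using h y hy
  unfold gsq
  rw [this.fderiv_eq]
  simp

theorem gsq_comp_affine {f : (Fin 3 → ℝ) → ℝ} (hf : Differentiable ℝ f) (u : Fin 3 → ℝ) (s : ℝ)
    (x : Fin 3 → ℝ) : gsq (fun y => f (s • (y - u))) x = s ^ 2 * gsq f (s • (x - u)) := by
  unfold gsq
  rw [Finset.mul_sum]
  refine Finset.sum_congr rfl fun k _ => ?_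
  have h1 : HasFDerivAt (fun y : Fin 3 → ℝ => s • (y - u))
      (s • ContinuousLinearMap.id ℝ (Fin 3 → ℝ)) x :=
    ((hasFDerivAt_id x).sub_const u).const_smul s
  have h2 := ((hf (s • (x - u))).hasFDerivAt).comp x h1
  have h3 : fderiv ℝ (fun y => f (s • (y - u))) x =
    (fderiv ℝ f (s • (x - u))).comp (s • ContinuousLinearMap.id ℝ (Fin 3 → ℝ)) := h2.fderiv
  rw [h3]
  simp [mul_pow]

theorem exists_cutoff : ∃ K : ℝ, 0 < K ∧ ∀ (u : Fin 3 → ℝ) (s : ℝ), 0 < s →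
    ∃ χ : (Fin 3 → ℝ) → ℝ, ContDiff ℝ (⊤ : ℕ∞) χ ∧ (∀ x, 0 ≤ χ x) ∧ (∀ x, χ x ≤ 1) ∧
      (∀ x ∈ Metric.closedBall u s, χ x = 1) ∧
      (∀ x, x ∉ Metric.closedBall u (2 * s) → χ x = 0) ∧ ∀ x, gsq χ x ≤ K / s ^ 2 := by
  set b : ContDiffBump (0 : Fin 3 → ℝ) := ⟨1, 2, one_pos, by norm_num⟩ with hb
  have hbs : ContDiff ℝ (⊤ : ℕ∞) (b : (Fin 3 → ℝ) → ℝ) := b.contDiff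
  have hz : ∀ x, x ∉ Metric.closedBall (0 : Fin 3 → ℝ) 2 → b x = 0 := by
    intro x hx
    refine b.zero_of_le_dist ?_
    rw [Metric.mem_closedBall, not_le] at hx
    exact hx.le
  obtain ⟨K, hK⟩ := (isCompact_closedBall (0 : Fin 3 → ℝ) 2).exists_bound_of_continuousOn
    (continuous_gsq hbs).continuousOn
  have hK' : ∀ x, gsq b x ≤ |K| + 1 := by
    intro x
    by_cases hx : x ∈ Metric.closedBall (0 : Fin 3 → ℝ) 2
    · have := hK x hx
      rw [Real.norm_eq_abs] at this
      linarith [le_abs_self (gsq b x), le_abs_self K]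
    · rw [gsq_of_zero_outside hz hx]; positivity
  refine ⟨|K| + 1, by positivity, fun u s hs => ⟨fun x => b (s⁻¹ • (x - u)), ?_, ?_, ?_, ?_, ?_, ?_⟩⟩
  · exact hbs.comp (by fun_prop)
  · exact fun x => b.nonneg
  · exact fun x => b.le_one
  · intro x hx
    refine b.one_of_mem_closedBall ?_
    rw [mem_closedBall_zero_iff, norm_smul, norm_inv, Real.norm_of_nonneg hs.le,
      inv_mul_le_iff₀ hs]
    rw [mem_closedBall_iff_norm] at hx
    have h1 : b.rIn = 1 := rfl
    rwa [h1, mul_one]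
  · intro x hx
    apply hz
    rw [mem_closedBall_zero_iff, norm_smul, norm_inv, Real.norm_of_nonneg hs.le,
      inv_mul_le_iff₀ hs]
    rw [mem_closedBall_iff_norm] at hx
    linarith
  · intro x
    rw [gsq_comp_affine (hbs.differentiable (by simp)), inv_pow, div_eq_inv_mul]
    exact mul_le_mul_of_nonneg_left (hK' _) (by positivity)

theorem pdC_ofReal {f : (Fin 3 → ℝ) → ℝ} (hf : Differentiable ℝ f) (k : Fin 3) (x : Fin 3 → ℝ) :
    pdC k (fun y => (f y : ℂ)) x = (fderiv ℝ f x (Pi.single k 1) : ℝ) := by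
  unfold pdC
  have := (Complex.ofRealCLM.hasFDerivAt).comp x (hf x).hasFDerivAt
  have h2 : fderiv ℝ (fun y => (f y : ℂ)) x = Complex.ofRealCLM.comp (fderiv ℝ f x) := this.fderiv
  rw [h2]; rfl

theorem isTest_ofReal {f : (Fin 3 → ℝ) → ℝ} (hf : ContDiff ℝ (⊤ : ℕ∞) f) {u : Fin 3 → ℝ} {R : ℝ}
    (h : ∀ x, x ∉ Metric.closedBall u R → f x = 0) : IsTest fun x => (f x : ℂ) := by
  refine ⟨Complex.ofRealCLM.contDiff.comp hf, ?_⟩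
  exact HasCompactSupport.intro (isCompact_closedBall u R) fun x hx => by simp [h x hx]

theorem local_L6 : ∃ C : ℝ, 0 < C ∧ ∀ h : (Fin 3 → ℝ) → ℝ, ContDiff ℝ (⊤ : ℕ∞) h →
    ∀ (u : Fin 3 → ℝ) (s : ℝ), 0 < s → ∃ c : ℝ, ∫ x in Metric.closedBall u s, (h x - c) ^ 6 ≤
      C * (∫ x in Metric.closedBall u (2 * s), gsq h x) ^ 3 := by
  obtain ⟨CS, hCS, hS⟩ := sobolev
  obtain ⟨K, hK, hcut⟩ := exists_cutoff
  refine ⟨CS * (2 + 768 * K) ^ 3, by positivity, fun h hh u s hs => ?_⟩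
  obtain ⟨χ, hχs, hχ0, hχ1, hχone, hχz, hχg⟩ := hcut u s hs
  obtain ⟨c, hc⟩ := poincare hh u (R := 2 * s) (by positivity)
  refine ⟨c, ?_⟩
  set J := ∫ x in Metric.closedBall u (2 * s), gsq h x with hJ
  have hcpt : IsCompact (Metric.closedBall u (2 * s)) := isCompact_closedBall _ _
  set φ : (Fin 3 → ℝ) → ℝ := fun x => χ x * (h x - c) with hφ
  have hφs : ContDiff ℝ (⊤ : ℕ∞) φ := hχs.mul (hh.sub contDiff_const)
  have hφz : ∀ x, x ∉ Metric.closedBall u (2 * s) → φ x = 0 := fun x hx => by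
    simp [hφ, hχz x hx]
  have hT := isTest_ofReal hφs hφz
  have h1 := hS _ hT
  have hJ0 : 0 ≤ J := integral_nonneg fun x => gsq_nonneg _ _
  have h2 : ∫ x, ∑ k, ‖pdC k (fun x => (φ x : ℂ)) x‖ ^ 2 ≤ (2 + 768 * K) * J := by
    have e1 : ∀ x, ∑ k, ‖pdC k (fun x => (φ x : ℂ)) x‖ ^ 2 = gsq φ x := by
      intro x
      unfold gsq
      refine Finset.sum_congr rfl fun k _ => ?_
      rw [pdC_ofReal (hφs.differentiable (by simp)), Complex.norm_real, Real.norm_eq_abs, sq_abs]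
    simp_rw [e1]
    rw [← setIntegral_eq_integral_of_forall_compl_eq_zero
      (s := Metric.closedBall u (2 * s)) (fun x hx => gsq_of_zero_outside hφz hx)]
    have hcont := hh.continuous
    have hcg := continuous_gsq hh
    have h3 : ∫ x in Metric.closedBall u (2 * s), gsq φ x ≤
        ∫ x in Metric.closedBall u (2 * s), (2 * gsq h x + 2 * (K / s ^ 2) * (h x - c) ^ 2) := by
      refine setIntegral_mono_on ((continuous_gsq hφs).continuousOn.integrableOn_compact hcpt)
        (Continuous.continuousOn (by fun_prop) |>.integrableOn_compact hcpt)
        Metric.isClosed_closedBall.measurableSet fun x _ => ?_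
      refine (gsq_mul_le ((hχs.differentiable (by simp)) x)
        ((hh.differentiable (by simp)).sub_const c x)).trans ?_
      rw [gsq_sub_const]
      have a1 : χ x ^ 2 * gsq h x ≤ gsq h x :=
        mul_le_of_le_one_left (gsq_nonneg _ _) (pow_le_one₀ (hχ0 x) (hχ1 x))
      have a2 : (h x - c) ^ 2 * gsq χ x ≤ (h x - c) ^ 2 * (K / s ^ 2) :=
        mul_le_mul_of_nonneg_left (hχg x) (sq_nonneg _)
      linarith
    refine h3.trans ?_
    rw [integral_add (Continuous.continuousOn (by fun_prop) |>.integrableOn_compact hcpt)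
      (Continuous.continuousOn (by fun_prop) |>.integrableOn_compact hcpt),
      integral_const_mul, integral_const_mul, ← hJ]
    have h4 : 2 * (K / s ^ 2) * ∫ x in Metric.closedBall u (2 * s), (h x - c) ^ 2 ≤
        2 * (K / s ^ 2) * (96 * (2 * s) ^ 2 * J) := mul_le_mul_of_nonneg_left hc (by positivity)
    have h5 : 2 * (K / s ^ 2) * (96 * (2 * s) ^ 2 * J) = 768 * K * J := by
      field_simp; ring
    linarith
  calc ∫ x in Metric.closedBall u s, (h x - c) ^ 6
      = ∫ x in Metric.closedBall u s, ‖(φ x : ℂ)‖ ^ 6 := by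
        refine setIntegral_congr_fun Metric.isClosed_closedBall.measurableSet fun x hx => ?_
        simp only [hφ, hχone x hx, one_mul, Complex.norm_real, Real.norm_eq_abs]
        rw [Even.pow_abs (by decide)]
    _ ≤ ∫ x, ‖(φ x : ℂ)‖ ^ 6 := by
        refine setIntegral_le_integral ?_ (Filter.Eventually.of_forall fun x => by positivity)
        refine Continuous.integrable_of_hasCompactSupport (hT.continuous.norm.pow 6) ?_
        exact HasCompactSupport.intro hcpt fun x hx => by simp [hφz x hx]
    _ ≤ _ := h1
    _ ≤ CS * ((2 + 768 * K) * J) ^ 3 := by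
        gcongr
    _ = _ := by ring

theorem sobolev_momentum : ∃ C : ℝ, 0 < C ∧ ∀ (f : (Fin 3 → ℝ) → ℂ), IsTest f → ∀ c : Fin 3 → ℝ,
    ∫ x, ‖f x‖ ^ 6 ≤ C * (∑ k, ∫ x, ‖-Complex.I * pdC k f x + (c k : ℂ) * f x‖ ^ 2) ^ 3 := by
  obtain ⟨CS, hCS, hS⟩ := sobolev
  refine ⟨CS, hCS, fun f hf c => ?_⟩
  set ξ : Fin 3 → ℝ := fun k => -c k / (2 * Real.pi) with hξ
  set E := (fun x : Fin 3 → ℝ =>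
    Complex.exp (((-2 * Real.pi * ∑ k, ξ k * x k : ℝ) : ℂ) * Complex.I)) with hE
  have hEs : ContDiff ℝ (⊤ : ℕ∞) E := contDiff_phase ξ
  have hE1 : ∀ x, ‖E x‖ = 1 := fun x => Complex.norm_exp_ofReal_mul_I _
  have hpi : (Real.pi : ℂ) ≠ 0 := by exact_mod_cast Real.pi_ne_zero
  have hE' : ∀ x k, fderiv ℝ E x (Pi.single k 1) = E x * (Complex.I * c k) := by
    intro x k
    rw [(hasFDerivAt_phase ξ x).fderiv]
    simp only [ContinuousLinearMap.smulRight_apply, FunLike.coe_sum, Finset.sum_apply,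
      smul_apply, ContinuousLinearMap.proj_apply, Pi.single_apply, smul_eq_mul,
      mul_ite, mul_one, mul_zero, Finset.sum_ite_eq', Finset.mem_univ, if_true,
      Complex.real_smul]
    simp only [hξ, hE]
    push_cast
    field_simp
  have hT : IsTest fun x => E x * f x := hf.mul_left hEs
  have h1 := hS _ hT
  have h2 : ∀ k x, ‖pdC k (fun x => E x * f x) x‖ = ‖-Complex.I * pdC k f x + (c k : ℂ) * f x‖ := by
    intro k x
    have h3 : pdC k (fun x => E x * f x) x =
        E x * (Complex.I * (-Complex.I * pdC k f x + (c k : ℂ) * f x)) := by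
      unfold pdC
      rw [fderiv_fun_mul ((hEs.differentiable (by simp)) x) (hf.differentiable x)]
      simp only [add_apply, smul_apply, smul_eq_mul, hE']
      linear_combination (E x * (fderiv ℝ f x) (Pi.single k 1)) * Complex.I_mul_I
    rw [h3, norm_mul, hE1, one_mul, norm_mul, Complex.norm_I, one_mul]
  simp only [h2, norm_mul, hE1, one_mul] at h1
  rw [integral_finsetSum _ fun k _ => (isTest_momentum hf (c k) k).integrable_normSq] at h1
  exact h1

theorem kd_eq {A : (Fin 3 → ℝ) → Fin 3 → ℝ} {f : (Fin 3 → ℝ) → Fin 2 → ℂ} {x : Fin 3 → ℝ}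
    (ha : ∀ k t, pdC k (fun y => f y t) x = 0) (hf : ∀ t, f x t = 0) : kd A f x = 0 := by
  unfold kd
  simp [ha, hf]

theorem kd_lower_pointwise (A : (Fin 3 → ℝ) → Fin 3 → ℝ) (c : Fin 3 → ℝ)
    (f : (Fin 3 → ℝ) → Fin 2 → ℂ) (x : Fin 3 → ℝ) {ε : ℝ} (hε : 0 < ε) :
    (1 - ε / 2) * kd (fun _ => c) f x ≤
      kd A f x + 2 / ε * (nsq (A x - c) * ∑ t, ‖f x t‖ ^ 2) := by
  have h1 := pauli_norm (A x - c) (f x)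
  unfold nsq
  rw [← h1]
  unfold kd
  rw [Finset.mul_sum, Finset.mul_sum, ← Finset.sum_add_distrib]
  refine Finset.sum_le_sum fun s _ => ?_
  set b := ∑ k : Fin 3, ∑ t : Fin 2, pauli k s t *
    (-Complex.I * pdC k (fun y => f y t) x + (c k : ℂ) * f x t)
  set e := ∑ k : Fin 3, ∑ t : Fin 2, pauli k s t * (((A x - c) k : ℂ) * f x t)
  have h2 : ∑ k : Fin 3, ∑ t : Fin 2, pauli k s t *
      (-Complex.I * pdC k (fun y => f y t) x + (A x k : ℂ) * f x t) = b + e := by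
    simp only [b, e, ← Finset.sum_add_distrib]
    refine Finset.sum_congr rfl fun k _ => Finset.sum_congr rfl fun t _ => ?_
    simp only [Pi.sub_apply]; push_cast; ring
  rw [h2]
  have h3 : ‖b‖ ≤ ‖b + e‖ + ‖e‖ := by
    have := norm_sub_le (b + e) e
    simpa using this
  have h4 : ‖b‖ ^ 2 ≤ (‖b + e‖ + ‖e‖) ^ 2 := by gcongr
  rcases le_or_gt 2 ε with h5 | h5
  · nlinarith [sq_nonneg ‖b‖, sq_nonneg ‖b + e‖, mul_nonneg (div_nonneg zero_le_two hε.le) (sq_nonneg ‖e‖)]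
  · have h6 : 0 < 1 - ε / 2 := by linarith
    set p := ‖b + e‖
    set q := ‖e‖
    have h7 : (1 - ε / 2) * (p + q) ^ 2 ≤ p ^ 2 + 2 / ε * q ^ 2 := by
      have : p ^ 2 + 2 / ε * q ^ 2 - (1 - ε / 2) * (p + q) ^ 2 =
          (ε / 2 * p - (1 - ε / 2) * q) ^ 2 * (2 / ε) + q ^ 2 := by
        field_simp; ring
      have h8 : 0 ≤ (ε / 2 * p - (1 - ε / 2) * q) ^ 2 * (2 / ε) + q ^ 2 := by positivity
      linarith
    calc _ ≤ (1 - ε / 2) * (p + q) ^ 2 := mul_le_mul_of_nonneg_left h4 h6.le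
      _ ≤ _ := h7

theorem gradSq_eq_sum_gsq {A : (Fin 3 → ℝ) → Fin 3 → ℝ} (hA : ContDiff ℝ (⊤ : ℕ∞) A)
    (x : Fin 3 → ℝ) : gradSq A x = ∑ j, gsq (fun y => A y j) x := by
  unfold gradSq gsq pdVec
  rw [Finset.sum_comm]
  refine Finset.sum_congr rfl fun j _ => Finset.sum_congr rfl fun i _ => ?_
  rw [fderiv_apply ((hA.differentiable (by simp)) x) j]
  rfl

theorem gradSq_nonneg (A : (Fin 3 → ℝ) → Fin 3 → ℝ) (x : Fin 3 → ℝ) : 0 ≤ gradSq A x :=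
  Finset.sum_nonneg fun _ _ => Finset.sum_nonneg fun _ _ => sq_nonneg _

theorem continuous_gradSq {A : (Fin 3 → ℝ) → Fin 3 → ℝ} (hA : ContDiff ℝ (⊤ : ℕ∞) A) :
    Continuous (gradSq A) := by
  have : gradSq A = fun x => ∑ j, gsq (fun y => A y j) x := funext (gradSq_eq_sum_gsq hA)
  rw [this]
  exact continuous_finsetSum _ fun j _ => continuous_gsq (contDiff_pi.1 hA j)

theorem integral_nsq_pow_three : ∃ C : ℝ, 0 < C ∧ ∀ A : (Fin 3 → ℝ) → Fin 3 → ℝ,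
    ContDiff ℝ (⊤ : ℕ∞) A → ∀ (u : Fin 3 → ℝ) (s : ℝ), 0 < s → ∃ c : Fin 3 → ℝ,
    ∫ x in Metric.closedBall u s, nsq (A x - c) ^ 3 ≤
      C * (∫ x in Metric.closedBall u (2 * s), gradSq A x) ^ 3 := by
  obtain ⟨C, hC, hL⟩ := local_L6
  refine ⟨9 * C, by positivity, fun A hA u s hs => ?_⟩
  have hj : ∀ j, ContDiff ℝ (⊤ : ℕ∞) fun x => A x j := fun j => contDiff_pi.1 hA j
  choose c hc using fun j => hL _ (hj j) u s hs
  refine ⟨c, ?_⟩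
  have hcpt := isCompact_closedBall u s
  have hcpt2 := isCompact_closedBall u (2 * s)
  have hcont : ∀ j, Continuous fun x => A x j := fun j => (hj j).continuous
  have hAc := hA.continuous
  have h1 : ∫ x in Metric.closedBall u s, nsq (A x - c) ^ 3 ≤
      ∫ x in Metric.closedBall u s, 9 * ∑ j, (A x j - c j) ^ 6 := by
    refine setIntegral_mono ?_ ?_ fun x => ?_
    · have := continuous_nsq
      exact Continuous.continuousOn (by fun_prop) |>.integrableOn_compact hcpt
    · exact Continuous.continuousOn (by fun_prop) |>.integrableOn_compact hcpt
    · simp only [nsq, Fin.sum_univ_three, Pi.sub_apply]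
      have : ∀ a b c : ℝ, 0 ≤ a → 0 ≤ b → 0 ≤ c → (a + b + c) ^ 3 ≤ 9 * (a ^ 3 + b ^ 3 + c ^ 3) := by
        intro a b c ha hb hc
        nlinarith [mul_nonneg (add_nonneg ha hb) (sq_nonneg (a - b)),
          mul_nonneg (add_nonneg hb hc) (sq_nonneg (b - c)),
          mul_nonneg (add_nonneg ha hc) (sq_nonneg (a - c)),
          mul_nonneg ha (sq_nonneg (b - c)), mul_nonneg hb (sq_nonneg (a - c)),
          mul_nonneg hc (sq_nonneg (a - b))]
      have := this _ _ _ (sq_nonneg (A x 0 - c 0)) (sq_nonneg (A x 1 - c 1))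
        (sq_nonneg (A x 2 - c 2))
      simpa only [← pow_mul] using this
  have hg : ∀ j, Continuous (gsq fun y => A y j) := fun j => continuous_gsq (hj j)
  have hF : ∀ j, IntegrableOn (gsq fun y => A y j) (Metric.closedBall u (2 * s)) := fun j =>
    (hg j).continuousOn.integrableOn_compact hcpt2
  have h2 : ∀ j, ∫ x in Metric.closedBall u (2 * s), gsq (fun y => A y j) x ≤
      ∫ x in Metric.closedBall u (2 * s), gradSq A x := by
    intro j
    refine setIntegral_mono (hF j)
      ((continuous_gradSq hA).continuousOn.integrableOn_compact hcpt2) fun x => ?_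
    rw [gradSq_eq_sum_gsq hA]
    exact Finset.single_le_sum (f := fun j => gsq (fun y => A y j) x) (fun i _ => gsq_nonneg _ _)
      (Finset.mem_univ j)
  set F := ∫ x in Metric.closedBall u (2 * s), gradSq A x
  have hsum : ∑ j, ∫ x in Metric.closedBall u (2 * s), gsq (fun y => A y j) x = F := by
    rw [← integral_finsetSum _ fun j _ => hF j]
    simp only [F, gradSq_eq_sum_gsq hA]
  rw [integral_const_mul, integral_finsetSum _ fun j _ =>
    Continuous.continuousOn (by fun_prop) |>.integrableOn_compact hcpt] at h1
  have h3 : ∀ j, 0 ≤ ∫ x in Metric.closedBall u (2 * s), gsq (fun y => A y j) x := fun j =>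
    integral_nonneg fun x => gsq_nonneg _ _
  have h4 : ∑ j, ∫ x in Metric.closedBall u s, (A x j - c j) ^ 6 ≤ C * F ^ 3 := by
    calc _ ≤ ∑ j, C * (∫ x in Metric.closedBall u (2 * s), gsq (fun y => A y j) x) ^ 3 :=
          Finset.sum_le_sum fun j _ => hc j
      _ ≤ C * F ^ 3 := by
          rw [← Finset.mul_sum, ← hsum]
          refine mul_le_mul_of_nonneg_left ?_ hC.le
          simp only [Fin.sum_univ_three]
          have a := h3 0
          have b := h3 1
          have d := h3 2
          generalize (∫ x in Metric.closedBall u (2 * s), gsq (fun y => A y 0) x) = X at *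
          generalize (∫ x in Metric.closedBall u (2 * s), gsq (fun y => A y 1) x) = Y at *
          generalize (∫ x in Metric.closedBall u (2 * s), gsq (fun y => A y 2) x) = W at *
          have : (X + Y + W) ^ 3 - (X ^ 3 + Y ^ 3 + W ^ 3) = 3 * ((X + Y) * (Y + W) * (X + W)) := by
            ring
          have : 0 ≤ 3 * ((X + Y) * (Y + W) * (X + W)) := by positivity
          linarith
  linarith [h1, h4]

theorem continuous_kd {A : (Fin 3 → ℝ) → Fin 3 → ℝ} (hA : Continuous A)
    {f : (Fin 3 → ℝ) → Fin 2 → ℂ} (hf : ∀ t, IsTest fun x => f x t) : Continuous (kd A f) := by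
  have h1 := fun k t => ((hf t).pd k).continuous
  have h2 := fun t => (hf t).continuous
  unfold kd
  fun_prop

theorem pdC_of_zero_outside {f : (Fin 3 → ℝ) → ℂ} {u : Fin 3 → ℝ} {R : ℝ}
    (h : ∀ x, x ∉ Metric.closedBall u R → f x = 0) {x : Fin 3 → ℝ}
    (hx : x ∉ Metric.closedBall u R) (k : Fin 3) : pdC k f x = 0 := by
  have : f =ᶠ[nhds x] fun _ => 0 := by
    filter_upwards [Metric.isClosed_closedBall.isOpen_compl.mem_nhds hx] with y hy using h y hy
  unfold pdC
  rw [this.fderiv_eq]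
  simp

theorem kd_of_zero_outside {A : (Fin 3 → ℝ) → Fin 3 → ℝ} {f : (Fin 3 → ℝ) → Fin 2 → ℂ}
    {u : Fin 3 → ℝ} {R : ℝ} (h : ∀ x, x ∉ Metric.closedBall u R → ∀ t, f x t = 0) {x : Fin 3 → ℝ}
    (hx : x ∉ Metric.closedBall u R) : kd A f x = 0 :=
  kd_eq (fun k t => pdC_of_zero_outside (fun y hy => h y hy t) hx k) (h x hx)

theorem kd_nonneg (A : (Fin 3 → ℝ) → Fin 3 → ℝ) (f : (Fin 3 → ℝ) → Fin 2 → ℂ)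
    (x : Fin 3 → ℝ) : 0 ≤ kd A f x := Finset.sum_nonneg fun _ _ => sq_nonneg _

theorem three_mul_sq_mul_le {q n w : ℝ} (hq : 0 < q) (hn : 0 ≤ n) (hw : 0 ≤ w) :
    3 * (n ^ 2 * w) ≤ 2 * (q ^ 3 * n ^ 3) + (q ^ 3)⁻¹ ^ 2 * w ^ 3 := by
  have h : ∀ a b : ℝ, 0 ≤ a → 0 ≤ b → 3 * (a ^ 2 * b) ≤ 2 * a ^ 3 + b ^ 3 := by
    intro a b ha hb
    nlinarith [mul_nonneg (add_nonneg (add_nonneg ha ha) hb) (sq_nonneg (a - b))]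
  have h1 := h (q * n) (w / q ^ 2) (by positivity) (by positivity)
  have h2 : (q * n) ^ 2 * (w / q ^ 2) = n ^ 2 * w := by field_simp
  have h3 : 2 * (q * n) ^ 3 + (w / q ^ 2) ^ 3 = 2 * (q ^ 3 * n ^ 3) + (q ^ 3)⁻¹ ^ 2 * w ^ 3 := by
    field_simp
  rw [h2, h3] at h1
  exact h1

/-- Replacing a vector potential by a constant one on a cube. -/
theorem kd_local_lower : ∃ C : ℝ, 0 < C ∧ ∀ A : (Fin 3 → ℝ) → Fin 3 → ℝ,
    ContDiff ℝ (⊤ : ℕ∞) A → ∀ (u : Fin 3 → ℝ) (s : ℝ), 0 < s → ∃ c : Fin 3 → ℝ,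
    ∀ f : (Fin 3 → ℝ) → Fin 2 → ℂ, (∀ t, IsTest fun x => f x t) →
      (∀ x, x ∉ Metric.closedBall u s → ∀ t, f x t = 0) → ∀ ε : ℝ, 0 < ε →
      (1 - ε) * ∫ x, kd (fun _ => c) f x ≤ (∫ x, kd A f x) + C / ε ^ 3 *
        (∫ x in Metric.closedBall u (2 * s), gradSq A x) ^ 2 * ∫ x, ∑ t, ‖f x t‖ ^ 2 := by
  obtain ⟨CN, hCN, hN⟩ := integral_nsq_pow_three
  obtain ⟨CS, hCS, hS⟩ := sobolev_momentum
  set C0 : ℝ := 2 * CN + 4 * CS with hC0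
  have hC0p : 0 < C0 := by positivity
  refine ⟨2 * C0, by positivity, fun A hA u s hs => ?_⟩
  obtain ⟨c, hc⟩ := hN A hA u s hs
  refine ⟨c, fun f hf hz ε hε => ?_⟩
  have hAc := hA.continuous
  have hfc := fun t => (hf t).continuous
  have hcpt := isCompact_closedBall u s
  have hms : MeasurableSet (Metric.closedBall u s) := Metric.isClosed_closedBall.measurableSet
  set F := ∫ x in Metric.closedBall u (2 * s), gradSq A x
  have hF0 : 0 ≤ F := integral_nonneg fun x => gradSq_nonneg A x
  set K := ∫ x, kd (fun _ => c) f x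
  have hK0 : 0 ≤ K := integral_nonneg fun x => kd_nonneg _ _ x
  set w : (Fin 3 → ℝ) → ℝ := fun x => ∑ t, ‖f x t‖ ^ 2 with hw
  set n : (Fin 3 → ℝ) → ℝ := fun x => nsq (A x - c) with hn
  have hwc : Continuous w := by simp only [hw]; fun_prop
  have hnc : Continuous n := by have := continuous_nsq; simp only [hn]; fun_prop
  have hw0 : ∀ x, 0 ≤ w x := fun x => Finset.sum_nonneg fun _ _ => sq_nonneg _
  have hn0 : ∀ x, 0 ≤ n x := fun x => nsq_nonneg _
  have hwz : ∀ x, x ∉ Metric.closedBall u s → w x = 0 := fun x hx => by simp [hw, hz x hx]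
  have h_mono_int : ∀ g : (Fin 3 → ℝ) → ℝ, Continuous g → (∀ x, x ∉ Metric.closedBall u s → g x = 0) →
      Integrable g := fun g hg hgz =>
    hg.integrable_of_hasCompactSupport (HasCompactSupport.intro hcpt hgz)
  have hres : ∀ g : (Fin 3 → ℝ) → ℝ, (∀ x, x ∉ Metric.closedBall u s → g x = 0) →
      ∫ x in Metric.closedBall u s, g x = ∫ x, g x := fun g hgz =>
    setIntegral_eq_integral_of_forall_compl_eq_zero hgz
  have hw3 : ∫ x, w x ^ 3 ≤ 4 * CS * K ^ 3 := by
    have hK : K = ∑ t, ∑ k, ∫ x, ‖-Complex.I * pdC k (fun y => f y t) x + (c k : ℂ) * f x t‖ ^ 2 :=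
      kd_const_integral' hf c
    have h6 : ∀ t, Integrable fun x => ‖f x t‖ ^ 6 := fun t =>
      h_mono_int _ (by fun_prop) fun x hx => by simp [hz x hx]
    have h1 : ∫ x, w x ^ 3 ≤ ∫ x, 4 * (‖f x 0‖ ^ 6 + ‖f x 1‖ ^ 6) := by
      refine integral_mono (h_mono_int _ (by fun_prop) fun x hx => by simp [hwz x hx])
        (((h6 0).add (h6 1)).const_mul 4) fun x => ?_
      simp only [hw, Fin.sum_univ_two]
      have : ∀ a b : ℝ, 0 ≤ a → 0 ≤ b → (a + b) ^ 3 ≤ 4 * (a ^ 3 + b ^ 3) := by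
        intro a b ha hb
        nlinarith [mul_nonneg (add_nonneg ha hb) (sq_nonneg (a - b))]
      simpa only [← pow_mul] using this _ _ (sq_nonneg ‖f x 0‖) (sq_nonneg ‖f x 1‖)
    rw [integral_const_mul, integral_add (h6 0) (h6 1)] at h1
    have h2 := hS _ (hf 0) c
    have h3 := hS _ (hf 1) c
    rw [Fin.sum_univ_two] at hK
    rw [hK]
    have hX : 0 ≤ ∑ k, ∫ x, ‖-Complex.I * pdC k (fun y => f y 0) x + (c k : ℂ) * f x 0‖ ^ 2 :=
      Finset.sum_nonneg fun k _ => integral_nonneg fun x => sq_nonneg _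
    have hY : 0 ≤ ∑ k, ∫ x, ‖-Complex.I * pdC k (fun y => f y 1) x + (c k : ℂ) * f x 1‖ ^ 2 :=
      Finset.sum_nonneg fun k _ => integral_nonneg fun x => sq_nonneg _
    generalize (∑ k, ∫ x, ‖-Complex.I * pdC k (fun y => f y 0) x + (c k : ℂ) * f x 0‖ ^ 2) = X at *
    generalize (∑ k, ∫ x, ‖-Complex.I * pdC k (fun y => f y 1) x + (c k : ℂ) * f x 1‖ ^ 2) = Y at *
    have h4 : X ^ 3 + Y ^ 3 ≤ (X + Y) ^ 3 := by
      have : 0 ≤ 3 * (X * Y * (X + Y)) := by positivity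
      nlinarith
    nlinarith [mul_le_mul_of_nonneg_left h4 hCS.le]
  have hn2w : ∀ τ : ℝ, 0 < τ → ∫ x, n x ^ 2 * w x ≤ C0 * (F + τ) ^ 2 * (K + τ) := by
    intro τ hτ
    have hq3 : 0 < (K + τ) / (F + τ) := by positivity
    set q := ((K + τ) / (F + τ)) ^ ((1 : ℝ) / 3) with hq
    have hqp : 0 < q := by positivity
    have hq3 : q ^ 3 = (K + τ) / (F + τ) := by
      rw [hq, ← Real.rpow_natCast, ← Real.rpow_mul hq3.le]; norm_num
    have hi1 : IntegrableOn (fun x => n x ^ 3) (Metric.closedBall u s) :=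
      (Continuous.continuousOn (by fun_prop)).integrableOn_compact hcpt
    have hi2 : IntegrableOn (fun x => w x ^ 3) (Metric.closedBall u s) :=
      (Continuous.continuousOn (by fun_prop)).integrableOn_compact hcpt
    have h1 : ∫ x in Metric.closedBall u s, 3 * (n x ^ 2 * w x) ≤
        ∫ x in Metric.closedBall u s, (2 * (q ^ 3 * n x ^ 3) + (q ^ 3)⁻¹ ^ 2 * w x ^ 3) := by
      refine setIntegral_mono ((Continuous.continuousOn (by fun_prop)).integrableOn_compact hcpt)
        ((Continuous.continuousOn (by fun_prop)).integrableOn_compact hcpt) fun x => ?_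
      exact three_mul_sq_mul_le hqp (hn0 x) (hw0 x)
    rw [integral_const_mul, integral_add ((hi1.const_mul _).const_mul _) (hi2.const_mul _),
      integral_const_mul, integral_const_mul, integral_const_mul, hq3,
      hres (fun x => n x ^ 2 * w x) (fun x hx => by simp [hwz x hx]),
      hres (fun x => w x ^ 3) (fun x hx => by simp [hwz x hx])] at h1
    have h2 : 2 * ((K + τ) / (F + τ) * ∫ x in Metric.closedBall u s, n x ^ 3) ≤
        2 * ((K + τ) / (F + τ) * (CN * (F + τ) ^ 3)) := by
      gcongr
      refine hc.trans ?_
      gcongr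
      linarith
    have h3 : ((K + τ) / (F + τ))⁻¹ ^ 2 * ∫ x, w x ^ 3 ≤
        ((K + τ) / (F + τ))⁻¹ ^ 2 * (4 * CS * (K + τ) ^ 3) := by
      gcongr
      refine hw3.trans ?_
      gcongr
      linarith
    have h4 : 2 * ((K + τ) / (F + τ) * (CN * (F + τ) ^ 3)) +
        ((K + τ) / (F + τ))⁻¹ ^ 2 * (4 * CS * (K + τ) ^ 3) = C0 * (F + τ) ^ 2 * (K + τ) := by
      have : 0 < K + τ := by positivity
      have : 0 < F + τ := by positivity
      rw [hC0]
      field_simp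
    have h5 : 0 ≤ ∫ x, n x ^ 2 * w x := integral_nonneg fun x => mul_nonneg (sq_nonneg _) (hw0 x)
    linarith
  set W := ∫ x, w x
  have hkint : ∀ B : (Fin 3 → ℝ) → Fin 3 → ℝ, Continuous B → Integrable (kd B f) := fun B hB =>
    h_mono_int _ (continuous_kd hB hf) fun x hx => kd_of_zero_outside hz hx
  have hmain : (1 - ε / 2) * K ≤ (∫ x, kd A f x) + 2 / ε * ∫ x, n x * w x := by
    have hi : Integrable fun x => n x * w x :=
      h_mono_int _ (by fun_prop) fun x hx => by simp [hwz x hx]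
    rw [← integral_const_mul, ← integral_const_mul, ← integral_add (hkint A hAc) (hi.const_mul _)]
    exact integral_mono ((hkint _ continuous_const).const_mul _)
      ((hkint A hAc).add (hi.const_mul _)) fun x => kd_lower_pointwise A c f x hε
  have hτ : ∀ τ : ℝ, 0 < τ → (1 - ε) * K ≤ (∫ x, kd A f x) +
      (2 * C0 / ε ^ 3 * (F + τ) ^ 2 * W + ε / 2 * τ) := by
    intro τ hτ
    have h1 := hn2w τ hτ
    set γ := 2 * C0 * (F + τ) ^ 2 / ε ^ 2 with hγ
    have hγp : 0 < γ := by positivity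
    have h2 : ∫ x, n x * w x ≤ ∫ x, (γ / 2 * w x + 1 / (2 * γ) * (n x ^ 2 * w x)) := by
      refine integral_mono (h_mono_int _ (by fun_prop) fun x hx => by simp [hwz x hx])
        (h_mono_int _ (by fun_prop) fun x hx => by simp [hwz x hx]) fun x => ?_
      have : γ / 2 * w x + 1 / (2 * γ) * (n x ^ 2 * w x) - n x * w x =
          w x * (γ - n x) ^ 2 / (2 * γ) := by field_simp; ring
      have h3 : 0 ≤ w x * (γ - n x) ^ 2 / (2 * γ) := by have := hw0 x; positivity
      change n x * w x ≤ γ / 2 * w x + 1 / (2 * γ) * (n x ^ 2 * w x)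
      linarith
    rw [integral_add ((h_mono_int _ hwc hwz).const_mul _) ((h_mono_int _ (by fun_prop) fun x hx => by
      simp [hwz x hx]).const_mul _), integral_const_mul, integral_const_mul] at h2
    have h4 : 2 / ε * ∫ x, n x * w x ≤
        2 / ε * (γ / 2 * W + 1 / (2 * γ) * (C0 * (F + τ) ^ 2 * (K + τ))) := by
      refine mul_le_mul_of_nonneg_left (h2.trans ?_) (by positivity)
      gcongr
    have h5 : 2 / ε * (γ / 2 * W + 1 / (2 * γ) * (C0 * (F + τ) ^ 2 * (K + τ))) =
        2 * C0 / ε ^ 3 * (F + τ) ^ 2 * W + ε / 2 * (K + τ) := by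
      have : 0 < F + τ := by positivity
      rw [hγ]; field_simp
    linarith
  have hlim : Filter.Tendsto (fun τ : ℝ => (∫ x, kd A f x) +
      (2 * C0 / ε ^ 3 * (F + τ) ^ 2 * W + ε / 2 * τ)) (nhdsWithin 0 (Set.Ioi 0))
      (nhds ((∫ x, kd A f x) + (2 * C0 / ε ^ 3 * (F + 0) ^ 2 * W + ε / 2 * 0))) :=
    (Continuous.tendsto (by fun_prop) 0).mono_left nhdsWithin_le_nhds
  have := ge_of_tendsto hlim (by filter_upwards [self_mem_nhdsWithin] with τ h using hτ τ h)
  simpa using this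

/-- The localized kinetic energy density `t(G)` built from one-body densities. -/
def tden (τ : (Fin 3 → ℝ) → ℝ) (J : Fin 3 → (Fin 3 → ℝ) → ℝ) (ρ : (Fin 3 → ℝ) → ℝ)
    (G : (Fin 3 → ℝ) → ℝ) (x : Fin 3 → ℝ) : ℝ :=
  G x ^ 2 * τ x + G x * (∑ k, fderiv ℝ G x (Pi.single k 1) * J k x) + gsq G x * ρ x

/-- Positivity of the quadratic form of one-body densities. -/
def DensPos (τ : (Fin 3 → ℝ) → ℝ) (J : Fin 3 → (Fin 3 → ℝ) → ℝ) (ρ : (Fin 3 → ℝ) → ℝ) : Prop :=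
  ∀ x (s : ℝ) (v : Fin 3 → ℝ), 0 ≤ s ^ 2 * τ x + s * (∑ k, v k * J k x) + (∑ k, v k ^ 2) * ρ x

theorem DensPos.rho_nonneg {τ : (Fin 3 → ℝ) → ℝ} {J : Fin 3 → (Fin 3 → ℝ) → ℝ}
    {ρ : (Fin 3 → ℝ) → ℝ} (h : DensPos τ J ρ) (x : Fin 3 → ℝ) : 0 ≤ ρ x := by
  have := h x 0 ![1, 0, 0]
  simpa [Fin.sum_univ_three] using this

theorem DensPos.tden_nonneg {τ : (Fin 3 → ℝ) → ℝ} {J : Fin 3 → (Fin 3 → ℝ) → ℝ}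
    {ρ : (Fin 3 → ℝ) → ℝ} (h : DensPos τ J ρ) (G : (Fin 3 → ℝ) → ℝ) (x : Fin 3 → ℝ) :
    0 ≤ tden τ J ρ G x :=
  h x (G x) fun k => fderiv ℝ G x (Pi.single k 1)

/-- The currents of the state multiplied by `G`. -/
def curG (J : Fin 3 → (Fin 3 → ℝ) → ℝ) (ρ : (Fin 3 → ℝ) → ℝ) (G : (Fin 3 → ℝ) → ℝ) (k : Fin 3)
    (x : Fin 3 → ℝ) : ℝ :=
  G x ^ 2 * J k x + 2 * (G x * fderiv ℝ G x (Pi.single k 1) * ρ x)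

theorem tden_mul (τ : (Fin 3 → ℝ) → ℝ) (J : Fin 3 → (Fin 3 → ℝ) → ℝ) (ρ : (Fin 3 → ℝ) → ℝ)
    {g G : (Fin 3 → ℝ) → ℝ} {x : Fin 3 → ℝ} (hg : DifferentiableAt ℝ g x)
    (hG : DifferentiableAt ℝ G x) : tden τ J ρ (fun y => g y * G y) x =
      tden (tden τ J ρ G) (curG J ρ G) (fun y => G y ^ 2 * ρ y) g x := by
  unfold tden curG gsq
  rw [fderiv_fun_mul hg hG]
  simp only [add_apply, smul_apply, smul_eq_mul, Fin.sum_univ_three]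
  ring

theorem DensPos.mul {τ : (Fin 3 → ℝ) → ℝ} {J : Fin 3 → (Fin 3 → ℝ) → ℝ}
    {ρ : (Fin 3 → ℝ) → ℝ} (h : DensPos τ J ρ) (G : (Fin 3 → ℝ) → ℝ) :
    DensPos (tden τ J ρ G) (curG J ρ G) (fun y => G y ^ 2 * ρ y) := by
  intro x s v
  have := h x (s * G x) fun k => s * fderiv ℝ G x (Pi.single k 1) + v k * G x
  convert this using 1
  unfold tden curG gsq
  simp only [Fin.sum_univ_three]
  ring

theorem DensPos.ims {τ : (Fin 3 → ℝ) → ℝ} {J : Fin 3 → (Fin 3 → ℝ) → ℝ}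
    {ρ : (Fin 3 → ℝ) → ℝ} (h : DensPos τ J ρ) (g : (Fin 3 → ℝ) → ℝ) (x : Fin 3 → ℝ) {ε : ℝ}
    (hε : 0 < ε) : tden τ J ρ g x ≤ (1 + ε) * (g x ^ 2 * τ x) + (1 + 1 / ε) * (gsq g x * ρ x) := by
  have := h x (Real.sqrt ε * g x) fun k => -(fderiv ℝ g x (Pi.single k 1) / Real.sqrt ε)
  have hs : 0 < Real.sqrt ε := Real.sqrt_pos.2 hε
  have hs2 : Real.sqrt ε ^ 2 = ε := Real.sq_sqrt hε.le
  have h1 : (Real.sqrt ε * g x) ^ 2 * τ x + Real.sqrt ε * g x *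
      (∑ k, -(fderiv ℝ g x (Pi.single k 1) / Real.sqrt ε) * J k x) +
      (∑ k, (-(fderiv ℝ g x (Pi.single k 1) / Real.sqrt ε)) ^ 2) * ρ x =
      ε * (g x ^ 2 * τ x) - g x * (∑ k, fderiv ℝ g x (Pi.single k 1) * J k x) +
        1 / ε * (gsq g x * ρ x) := by
    unfold gsq
    generalize Real.sqrt ε = q at *
    subst hs2
    simp only [Fin.sum_univ_three]
    field_simp
    ring
  rw [h1] at this
  unfold tden
  linarith

theorem exists_unit_bump : ∃ g : (Fin 3 → ℝ) → ℝ, ContDiff ℝ (⊤ : ℕ∞) g ∧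
    (∀ x, x ∉ Metric.closedBall (0 : Fin 3 → ℝ) 1 → g x = 0) ∧ ∫ x, g x ^ 2 = 1 := by
  set b : ContDiffBump (0 : Fin 3 → ℝ) := ⟨1 / 2, 1, by norm_num, by norm_num⟩ with hb
  have hbs : ContDiff ℝ (⊤ : ℕ∞) (b : (Fin 3 → ℝ) → ℝ) := b.contDiff
  have hz : ∀ x, x ∉ Metric.closedBall (0 : Fin 3 → ℝ) 1 → b x = 0 := by
    intro x hx
    apply b.zero_of_le_dist
    rw [Metric.mem_closedBall, not_le] at hx
    exact hx.le
  have hc := hbs.continuous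
  have hpos : 0 < ∫ x, b x ^ 2 := by
    refine Continuous.integral_pos_of_hasCompactSupport_nonneg_nonzero (x := 0) (by fun_prop)
      (HasCompactSupport.intro (isCompact_closedBall 0 1) fun x hx => by simp [hz x hx])
      (fun x => sq_nonneg _) ?_
    rw [b.one_of_mem_closedBall (by simp [b.rIn_pos.le])]
    norm_num
  refine ⟨fun x => (Real.sqrt (∫ x, b x ^ 2))⁻¹ * b x, contDiff_const.mul hbs,
    fun x hx => by simp [hz x hx], ?_⟩
  simp_rw [mul_pow]
  rw [integral_const_mul, inv_pow, Real.sq_sqrt hpos.le, inv_mul_cancel₀ hpos.ne']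

/-- The rescaled and translated localization function. -/
def gw (g : (Fin 3 → ℝ) → ℝ) (s : ℝ) (w x : Fin 3 → ℝ) : ℝ :=
  s ^ (-(3 : ℝ) / 2) * g (s⁻¹ • (x - w))

section gw
variable {g : (Fin 3 → ℝ) → ℝ} (hg : ContDiff ℝ (⊤ : ℕ∞) g)
  (hz : ∀ x, x ∉ Metric.closedBall (0 : Fin 3 → ℝ) 1 → g x = 0) {s : ℝ} (hs : 0 < s)

theorem contDiff_gw (hg : ContDiff ℝ (⊤ : ℕ∞) g) (w : Fin 3 → ℝ) :
    ContDiff ℝ (⊤ : ℕ∞) (gw g s w) :=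
  contDiff_const.mul (hg.comp (by fun_prop))

theorem gw_zero (hz : ∀ x, x ∉ Metric.closedBall (0 : Fin 3 → ℝ) 1 → g x = 0) (hs : 0 < s)
    {w x : Fin 3 → ℝ} (hx : x ∉ Metric.closedBall w s) : gw g s w x = 0 := by
  unfold gw
  rw [hz, mul_zero]
  rw [mem_closedBall_zero_iff, norm_smul, norm_inv, Real.norm_of_nonneg hs.le,
    inv_mul_le_iff₀ hs, mul_one]
  rwa [mem_closedBall_iff_norm] at hx

theorem rpow_neg_sq (hs : 0 < s) : (s ^ (-(3 : ℝ) / 2)) ^ 2 = (s ^ 3)⁻¹ := by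
  rw [← Real.rpow_natCast, ← Real.rpow_mul hs.le, ← Real.rpow_natCast, ← Real.rpow_neg hs.le]
  norm_num

theorem gw_sq (hs : 0 < s) (w x : Fin 3 → ℝ) :
    gw g s w x ^ 2 = (s ^ 3)⁻¹ * g (s⁻¹ • (x - w)) ^ 2 := by
  unfold gw
  rw [mul_pow, rpow_neg_sq hs]

theorem fderiv_gw (hg : ContDiff ℝ (⊤ : ℕ∞) g) (w x : Fin 3 → ℝ) :
    fderiv ℝ (gw g s w) x = (s ^ (-(3 : ℝ) / 2) * s⁻¹) • fderiv ℝ g (s⁻¹ • (x - w)) := by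
  have h1 : HasFDerivAt (fun y : Fin 3 → ℝ => s⁻¹ • (y - w))
      (s⁻¹ • ContinuousLinearMap.id ℝ (Fin 3 → ℝ)) x :=
    ((hasFDerivAt_id x).sub_const w).const_smul s⁻¹
  have h2 := ((hg.differentiable (by simp)) (s⁻¹ • (x - w))).hasFDerivAt.comp x h1
  have h3 := h2.const_mul (s ^ (-(3 : ℝ) / 2))
  have h4 : fderiv ℝ (gw g s w) x = _ := h3.fderiv
  rw [h4]
  ext v
  simp [mul_assoc]

theorem gsq_gw (hg : ContDiff ℝ (⊤ : ℕ∞) g) (hs : 0 < s) (w x : Fin 3 → ℝ) :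
    gsq (gw g s w) x = (s ^ 3)⁻¹ * ((s ^ 2)⁻¹ * gsq g (s⁻¹ • (x - w))) := by
  unfold gsq
  rw [Finset.mul_sum, Finset.mul_sum]
  refine Finset.sum_congr rfl fun k _ => ?_
  rw [fderiv_gw hg, smul_apply, smul_eq_mul, mul_pow, mul_pow, rpow_neg_sq hs, inv_pow]
  ring

theorem integral_comp_scale (h : (Fin 3 → ℝ) → ℝ) (hs : 0 < s) (x : Fin 3 → ℝ) :
    ∫ w, (s ^ 3)⁻¹ * h (s⁻¹ • (x - w)) = ∫ y, h y := by
  rw [integral_const_mul, integral_sub_left_eq_self (fun w => h (s⁻¹ • w)) volume x,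
    Measure.integral_comp_inv_smul]
  simp only [Module.finrank_fin_fun, smul_eq_mul]
  rw [abs_of_pos (by positivity), inv_mul_cancel_left₀ (by positivity)]
end gw

/-- Fubini for a bounded continuous kernel against an integrable function. -/
theorem kernel_swap {k : (Fin 3 → ℝ) → (Fin 3 → ℝ) → ℝ}
    (hk : Continuous fun p : (Fin 3 → ℝ) × (Fin 3 → ℝ) => k p.1 p.2) {B : ℝ}
    (hB : ∀ w x, |k w x| ≤ B) {H : (Fin 3 → ℝ) → ℝ} (hH : Integrable H) (u : Fin 3 → ℝ) (R : ℝ) :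
    IntegrableOn (fun w => ∫ x, k w x * H x) (Metric.closedBall u R) ∧
    Integrable (fun x => (∫ w in Metric.closedBall u R, k w x) * H x) ∧
    (∀ w, Integrable fun x => k w x * H x) ∧
    ∫ w in Metric.closedBall u R, ∫ x, k w x * H x =
      ∫ x, (∫ w in Metric.closedBall u R, k w x) * H x := by
  have h1 : Integrable (fun p : (Fin 3 → ℝ) × (Fin 3 → ℝ) => k p.1 p.2 * H p.2)
      ((volume.restrict (Metric.closedBall u R)).prod volume) := by
    have : IsFiniteMeasure (volume.restrict (Metric.closedBall u R)) :=
      ⟨by rw [Measure.restrict_apply_univ]; exact (isCompact_closedBall u R).measure_lt_top⟩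
    exact (hH.comp_snd _).bdd_mul hk.aestronglyMeasurable
      (Filter.Eventually.of_forall fun p => hB p.1 p.2)
  refine ⟨h1.integral_prod_left, ?_, fun w => ?_, ?_⟩
  · have := h1.integral_prod_right
    simpa only [integral_mul_const] using this
  · exact hH.bdd_mul (Continuous.aestronglyMeasurable (by fun_prop))
      (Filter.Eventually.of_forall fun p => hB w p)
  · have := integral_integral_swap (f := fun w x => k w x * H x) h1
    simpa only [integral_mul_const] using this

section gw
variable {g : (Fin 3 → ℝ) → ℝ} {s : ℝ}

theorem exists_bound_of_zero_outside {h : (Fin 3 → ℝ) → ℝ} (hc : Continuous h)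
    {u : Fin 3 → ℝ} {R : ℝ} (hz : ∀ x, x ∉ Metric.closedBall u R → h x = 0) :
    ∃ B : ℝ, 0 ≤ B ∧ ∀ x, |h x| ≤ B := by
  obtain ⟨K, hK⟩ := (isCompact_closedBall u R).exists_bound_of_continuousOn hc.continuousOn
  refine ⟨|K|, abs_nonneg _, fun x => ?_⟩
  by_cases hx : x ∈ Metric.closedBall u R
  · exact (hK x hx).trans (le_abs_self K)
  · rw [hz x hx, abs_zero]; exact abs_nonneg _

theorem continuous_fderiv_single (hg : ContDiff ℝ (⊤ : ℕ∞) g) (k : Fin 3) :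
    Continuous fun x => fderiv ℝ g x (Pi.single k 1) :=
  (hg.continuous_fderiv (by simp)).clm_apply continuous_const

theorem setIntegral_gw_sq_eq (hgi : ∫ x, g x ^ 2 = 1)
    (hz : ∀ x, x ∉ Metric.closedBall (0 : Fin 3 → ℝ) 1 → g x = 0) (hs : 0 < s)
    {u x : Fin 3 → ℝ} {R : ℝ} (hx : ∀ w, x ∈ Metric.closedBall w s → w ∈ Metric.closedBall u R) :
    ∫ w in Metric.closedBall u R, gw g s w x ^ 2 = 1 := by
  rw [setIntegral_eq_integral_of_forall_compl_eq_zero]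
  · simp_rw [gw_sq hs]
    rw [integral_comp_scale (fun y => g y ^ 2) hs, hgi]
  · intro w hw
    rw [gw_zero hz hs (fun h => hw (hx w h))]
    norm_num

theorem integrable_gw_sq (hg : ContDiff ℝ (⊤ : ℕ∞) g)
    (hz : ∀ x, x ∉ Metric.closedBall (0 : Fin 3 → ℝ) 1 → g x = 0) (hs : 0 < s) (x : Fin 3 → ℝ) :
    Integrable fun w => gw g s w x ^ 2 := by
  have := hg.continuous
  refine Continuous.integrable_of_hasCompactSupport (by unfold gw; fun_prop) ?_
  refine HasCompactSupport.intro (isCompact_closedBall x s) fun w hw => ?_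
  rw [gw_zero hz hs (fun h => hw (Metric.mem_closedBall_comm.1 h))]
  norm_num

theorem integrable_gsq_gw (hg : ContDiff ℝ (⊤ : ℕ∞) g)
    (hz : ∀ x, x ∉ Metric.closedBall (0 : Fin 3 → ℝ) 1 → g x = 0) (hs : 0 < s) (x : Fin 3 → ℝ) :
    Integrable fun w => gsq (gw g s w) x := by
  have := continuous_gsq hg
  refine Continuous.integrable_of_hasCompactSupport (by simp_rw [gsq_gw hg hs]; fun_prop) ?_
  refine HasCompactSupport.intro (isCompact_closedBall x s) fun w hw => ?_
  exact gsq_of_zero_outside (fun y hy => gw_zero hz hs hy)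
    (fun h => hw (Metric.mem_closedBall_comm.1 h))

theorem setIntegral_gw_sq_le (hg : ContDiff ℝ (⊤ : ℕ∞) g) (hgi : ∫ x, g x ^ 2 = 1)
    (hz : ∀ x, x ∉ Metric.closedBall (0 : Fin 3 → ℝ) 1 → g x = 0) (hs : 0 < s)
    (u x : Fin 3 → ℝ) (R : ℝ) :
    ∫ w in Metric.closedBall u R, gw g s w x ^ 2 ≤ 1 := by
  refine (setIntegral_le_integral (integrable_gw_sq hg hz hs x)
    (Filter.Eventually.of_forall fun w => sq_nonneg _)).trans_eq ?_
  simp_rw [gw_sq hs]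
  rw [integral_comp_scale (fun y => g y ^ 2) hs, hgi]

theorem setIntegral_gsq_gw_le (hg : ContDiff ℝ (⊤ : ℕ∞) g)
    (hz : ∀ x, x ∉ Metric.closedBall (0 : Fin 3 → ℝ) 1 → g x = 0) (hs : 0 < s)
    (u x : Fin 3 → ℝ) (R : ℝ) :
    ∫ w in Metric.closedBall u R, gsq (gw g s w) x ≤
      (s ^ 2)⁻¹ * (∫ y, gsq g y) * (Metric.closedBall u (R + s)).indicator 1 x := by
  by_cases hx : x ∈ Metric.closedBall u (R + s)
  · rw [Set.indicator_of_mem hx, Pi.one_apply, mul_one]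
    refine (setIntegral_le_integral (integrable_gsq_gw hg hz hs x)
      (Filter.Eventually.of_forall fun w => gsq_nonneg _ _)).trans_eq ?_
    simp_rw [gsq_gw hg hs]
    rw [integral_comp_scale (fun y => (s ^ 2)⁻¹ * gsq g y) hs, integral_const_mul]
  · rw [Set.indicator_of_notMem hx, mul_zero]
    refine (setIntegral_eq_zero_of_forall_eq_zero fun w hw => ?_).le
    refine gsq_of_zero_outside (fun y hy => gw_zero hz hs hy) fun h => hx ?_
    rw [Metric.mem_closedBall] at *
    linarith [dist_triangle x w u]

/-- Integrated IMS localization bound. -/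
theorem ims_integrated {τ ρ : (Fin 3 → ℝ) → ℝ} {J : Fin 3 → (Fin 3 → ℝ) → ℝ}
    (hpos : DensPos τ J ρ) (hτ : Integrable τ) (hJ : ∀ k, Integrable (J k)) (hρ : Integrable ρ)
    (hg : ContDiff ℝ (⊤ : ℕ∞) g) (hgi : ∫ x, g x ^ 2 = 1)
    (hz : ∀ x, x ∉ Metric.closedBall (0 : Fin 3 → ℝ) 1 → g x = 0) (hs : 0 < s)
    (u : Fin 3 → ℝ) (R : ℝ) {ε : ℝ} (hε : 0 < ε) :
    IntegrableOn (fun w => ∫ x, tden τ J ρ (gw g s w) x) (Metric.closedBall u R) ∧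
    ∫ w in Metric.closedBall u R, ∫ x, tden τ J ρ (gw g s w) x ≤ (1 + ε) * (∫ x, τ x) +
      (1 + 1 / ε) * ((s ^ 2)⁻¹ * (∫ y, gsq g y)) * ∫ x in Metric.closedBall u (R + s), ρ x := by
  have hgc := hg.continuous
  have hgsc := continuous_gsq hg
  have hdc := fun k => continuous_fderiv_single hg k
  obtain ⟨B1, -, hB1⟩ := exists_bound_of_zero_outside (u := 0) (R := 1) (h := fun x => (s ^ 3)⁻¹ * g x ^ 2)
    (by fun_prop) (fun x hx => by simp [hz x hx])
  choose B2 _ hB2 using fun k => exists_bound_of_zero_outside (u := 0) (R := 1)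
    (h := fun x => s ^ (-(3 : ℝ) / 2) * g x * ((s ^ (-(3 : ℝ) / 2) * s⁻¹) * fderiv ℝ g x (Pi.single k 1)))
    (by have := hdc k; fun_prop) (fun x hx => by simp [hz x hx])
  obtain ⟨B3, -, hB3⟩ := exists_bound_of_zero_outside (u := 0) (R := 1)
    (h := fun x => (s ^ 3)⁻¹ * ((s ^ 2)⁻¹ * gsq g x))
    (by fun_prop) (fun x hx => by rw [gsq_of_zero_outside hz hx]; simp)
  obtain ⟨a1, a2, a3, a4⟩ := kernel_swap (k := fun w x => gw g s w x ^ 2)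
    (by unfold gw; fun_prop) (fun w x => by rw [gw_sq hs]; exact hB1 _) hτ u R
  have hb := fun k => kernel_swap
    (k := fun w x => gw g s w x * fderiv ℝ (gw g s w) x (Pi.single k 1))
    (by have := hdc k; simp only [fderiv_gw hg, smul_apply, smul_eq_mul]; unfold gw; fun_prop)
    (fun w x => by simp only [fderiv_gw hg, smul_apply, smul_eq_mul]; exact hB2 k _) (hJ k) u R
  obtain ⟨c1, c2, c3, c4⟩ := kernel_swap (k := fun w x => gsq (gw g s w) x)
    (by simp_rw [gsq_gw hg hs]; fun_prop) (fun w x => by rw [gsq_gw hg hs]; exact hB3 _) hρ u R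
  have hform : ∀ w x, tden τ J ρ (gw g s w) x = gw g s w x ^ 2 * τ x +
      (∑ k, gw g s w x * fderiv ℝ (gw g s w) x (Pi.single k 1) * J k x) +
      gsq (gw g s w) x * ρ x := by
    intro w x
    unfold tden
    rw [Finset.mul_sum]
    simp only [mul_assoc]
  have hbi : ∀ w, Integrable fun x =>
      ∑ k, gw g s w x * fderiv ℝ (gw g s w) x (Pi.single k 1) * J k x := fun w =>
    integrable_finsetSum _ fun k _ => (hb k).2.2.1 w
  have htI : ∀ w, Integrable fun x => tden τ J ρ (gw g s w) x := by
    intro w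
    simp_rw [hform]
    exact ((a3 w).add (hbi w)).add (c3 w)
  have hIon : IntegrableOn (fun w => ∫ x, tden τ J ρ (gw g s w) x) (Metric.closedBall u R) := by
    have : ∀ w, ∫ x, tden τ J ρ (gw g s w) x = (∫ x, gw g s w x ^ 2 * τ x) +
        (∑ k, ∫ x, gw g s w x * fderiv ℝ (gw g s w) x (Pi.single k 1) * J k x) +
        ∫ x, gsq (gw g s w) x * ρ x := by
      intro w
      simp_rw [hform]
      rw [integral_add ((a3 w).fun_add (hbi w)) (c3 w), integral_add (a3 w) (hbi w),
        integral_finsetSum _ fun k _ => (hb k).2.2.1 w]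
    simp_rw [this]
    exact (a1.add (integrable_finsetSum _ fun k _ => (hb k).1)).add c1
  refine ⟨hIon, ?_⟩
  have hτ0 : ∀ x, 0 ≤ τ x := fun x => by
    have := hpos x 1 0
    simpa using this
  have hρ0 := hpos.rho_nonneg
  calc ∫ w in Metric.closedBall u R, ∫ x, tden τ J ρ (gw g s w) x
      ≤ ∫ w in Metric.closedBall u R, ((1 + ε) * (∫ x, gw g s w x ^ 2 * τ x) +
          (1 + 1 / ε) * ∫ x, gsq (gw g s w) x * ρ x) := by
        refine integral_mono hIon ((a1.const_mul _).add (c1.const_mul _)) fun w => ?_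
        simp only
        rw [← integral_const_mul, ← integral_const_mul,
          ← integral_add ((a3 w).const_mul _) ((c3 w).const_mul _)]
        exact integral_mono (htI w) (((a3 w).const_mul _).add ((c3 w).const_mul _)) fun x =>
          hpos.ims _ x hε
    _ = (1 + ε) * (∫ x, (∫ w in Metric.closedBall u R, gw g s w x ^ 2) * τ x) +
          (1 + 1 / ε) * ∫ x, (∫ w in Metric.closedBall u R, gsq (gw g s w) x) * ρ x := by
        rw [integral_add (a1.const_mul _) (c1.const_mul _), integral_const_mul, integral_const_mul,
          a4, c4]
    _ ≤ _ := by
        have h1 : ∫ x, (∫ w in Metric.closedBall u R, gw g s w x ^ 2) * τ x ≤ ∫ x, τ x :=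
          integral_mono a2 hτ fun x => mul_le_of_le_one_left (hτ0 x)
            (setIntegral_gw_sq_le hg hgi hz hs u x R)
        have h2 : ∫ x, (∫ w in Metric.closedBall u R, gsq (gw g s w) x) * ρ x ≤
            ((s ^ 2)⁻¹ * (∫ y, gsq g y)) * ∫ x in Metric.closedBall u (R + s), ρ x := by
          rw [← integral_const_mul, ← integral_indicator Metric.isClosed_closedBall.measurableSet]
          refine integral_mono c2
            ((hρ.const_mul _).indicator Metric.isClosed_closedBall.measurableSet) fun x => ?_
          have := mul_le_mul_of_nonneg_right (setIntegral_gsq_gw_le hg hz hs u x R) (hρ0 x)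
          refine this.trans_eq ?_
          by_cases hx : x ∈ Metric.closedBall u (R + s) <;> simp [hx]
        have h3 := mul_le_mul_of_nonneg_left h1 (by positivity : 0 ≤ 1 + ε)
        have h4 := mul_le_mul_of_nonneg_left h2 (by positivity : 0 ≤ 1 + 1 / ε)
        rw [mul_assoc (1 + 1 / ε)]
        linarith
end gw

theorem volume_real_closedBall3 (u : Fin 3 → ℝ) {R : ℝ} (hR : 0 ≤ R) :
    volume.real (Metric.closedBall u R) = (2 * R) ^ 3 := by
  rw [Measure.real, Real.volume_pi_closedBall u hR, ENNReal.toReal_ofReal (by positivity)]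
  simp

theorem setIntegral_closedBall_translate (h : (Fin 3 → ℝ) → ℝ) (w : Fin 3 → ℝ) (t : ℝ) :
    ∫ x in Metric.closedBall w t, h x = ∫ y in Metric.closedBall (0 : Fin 3 → ℝ) t, h (w + y) := by
  rw [← integral_indicator Metric.isClosed_closedBall.measurableSet,
    ← integral_indicator Metric.isClosed_closedBall.measurableSet,
    ← integral_add_left_eq_self _ w]
  refine integral_congr_ae (Filter.Eventually.of_forall fun y => ?_)
  simp only [Set.indicator, Metric.mem_closedBall, dist_zero_right, dist_self_add_left]

theorem continuous_setIntegral_closedBall {h : (Fin 3 → ℝ) → ℝ} (hh : Continuous h) (t : ℝ) :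
    Continuous fun w => ∫ x in Metric.closedBall w t, h x := by
  simp_rw [setIntegral_closedBall_translate h]
  exact continuous_parametric_integral_of_continuous (by fun_prop) (isCompact_closedBall _ _)

theorem setIntegral_closedBall_mono {h : (Fin 3 → ℝ) → ℝ} (hh : Continuous h) (h0 : ∀ x, 0 ≤ h x)
    {u w : Fin 3 → ℝ} {s t : ℝ} (hst : Metric.closedBall u s ⊆ Metric.closedBall w t) :
    ∫ x in Metric.closedBall u s, h x ≤ ∫ x in Metric.closedBall w t, h x :=
  setIntegral_mono_set (hh.continuousOn.integrableOn_compact (isCompact_closedBall w t))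
    (Filter.Eventually.of_forall h0) (Filter.Eventually.of_forall hst)

theorem setIntegral_closedBall_nonneg {h : (Fin 3 → ℝ) → ℝ} (h0 : ∀ x, 0 ≤ h x)
    (u : Fin 3 → ℝ) (s : ℝ) : 0 ≤ ∫ x in Metric.closedBall u s, h x :=
  integral_nonneg h0

/-- Averaging local integrals over the centers. -/
theorem setIntegral_setIntegral_closedBall_le {h : (Fin 3 → ℝ) → ℝ} (hh : Continuous h)
    (h0 : ∀ x, 0 ≤ h x) (u : Fin 3 → ℝ) (R : ℝ) {t : ℝ} (ht : 0 ≤ t) :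
    ∫ w in Metric.closedBall u R, ∫ x in Metric.closedBall w t, h x ≤
      (2 * t) ^ 3 * ∫ x in Metric.closedBall u (R + t), h x := by
  simp_rw [setIntegral_closedBall_translate h]
  have hfin : ∀ (v : Fin 3 → ℝ) (r : ℝ),
      IsFiniteMeasure (volume.restrict (Metric.closedBall v r)) := fun v r =>
    ⟨by rw [Measure.restrict_apply_univ]; exact (isCompact_closedBall v r).measure_lt_top⟩
  have := hfin u R
  have := hfin 0 t
  rw [integral_integral_swap]
  · calc ∫ y in Metric.closedBall (0 : Fin 3 → ℝ) t, ∫ w in Metric.closedBall u R, h (w + y)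
        ≤ ∫ y in Metric.closedBall (0 : Fin 3 → ℝ) t, ∫ x in Metric.closedBall u (R + t), h x := by
          refine setIntegral_mono_on ?_ ?_ Metric.isClosed_closedBall.measurableSet fun y hy => ?_
          · exact (continuous_parametric_integral_of_continuous
              (f := fun (y : Fin 3 → ℝ) w => h (w + y)) (by fun_prop)
              (isCompact_closedBall _ _)).continuousOn.integrableOn_compact (isCompact_closedBall _ _)
          · exact continuous_const.continuousOn.integrableOn_compact (isCompact_closedBall _ _)
          · have he : ∫ w in Metric.closedBall u R, h (w + y) =
                ∫ x in Metric.closedBall (u + y) R, h x := by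
              rw [setIntegral_closedBall_translate h (u + y),
                setIntegral_closedBall_translate (fun w => h (w + y)) u]
              simp only [add_right_comm]
            rw [he]
            refine setIntegral_closedBall_mono hh h0 fun z hz => ?_
            rw [Metric.mem_closedBall] at *
            rw [dist_zero_right] at hy
            have := dist_triangle z (u + y) u
            rw [dist_self_add_left] at this
            linarith
      _ = _ := by
          rw [setIntegral_const, volume_real_closedBall3 _ ht, smul_eq_mul,
            ← setIntegral_closedBall_translate h u]
  · have h2 : IntegrableOn (fun p : (Fin 3 → ℝ) × (Fin 3 → ℝ) => h (p.1 + p.2))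
        (Metric.closedBall u R ×ˢ Metric.closedBall 0 t) (volume.prod volume) :=
      (Continuous.continuousOn (by fun_prop)).integrableOn_compact
        ((isCompact_closedBall _ _).prod (isCompact_closedBall _ _))
    rwa [IntegrableOn, ← Measure.prod_restrict] at h2

/-- One-body densities of a state whose localized energies satisfy the semiclassical lower bound. -/
structure OneBody (C0 : ℝ) (A : (Fin 3 → ℝ) → Fin 3 → ℝ) (τ : (Fin 3 → ℝ) → ℝ)
    (J : Fin 3 → (Fin 3 → ℝ) → ℝ) (ρ : (Fin 3 → ℝ) → ℝ) : Prop where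
  smooth : ContDiff ℝ (⊤ : ℕ∞) A
  cont_kin : Continuous τ
  cont_cur : ∀ k, Continuous (J k)
  cont_den : Continuous ρ
  zero : ∃ R, ∀ x, x ∉ Metric.closedBall (0 : Fin 3 → ℝ) R → τ x = 0 ∧ (∀ k, J k x = 0) ∧ ρ x = 0
  pos : DensPos τ J ρ
  loc : ∀ G, ContDiff ℝ (⊤ : ℕ∞) G → ∀ u s, 0 < s → (∀ x, x ∉ Metric.closedBall u s → G x = 0) →
    ∀ ε η b, 0 < ε → ε < 1 → 0 < η → 0 ≤ b →
    b * ∫ x, G x ^ 2 * ρ x ≤ η * (∫ x, tden τ J ρ G x) +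
      η * (C0 / ε ^ 3 * (∫ x in Metric.closedBall u (2 * s), gradSq A x) ^ 2) *
        (∫ x, G x ^ 2 * ρ x) +
      2 / (15 * Real.pi ^ 2) * (((1 - ε) * η) ^ (-(3 : ℝ) / 2) * b ^ ((5 : ℝ) / 2)) *
        ∫ x, G x ^ 2

theorem continuous_tden {τ : (Fin 3 → ℝ) → ℝ} {J : Fin 3 → (Fin 3 → ℝ) → ℝ}
    {ρ G : (Fin 3 → ℝ) → ℝ} (hτ : Continuous τ) (hJ : ∀ k, Continuous (J k)) (hρ : Continuous ρ)
    (hG : ContDiff ℝ (⊤ : ℕ∞) G) : Continuous (tden τ J ρ G) := by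
  have h1 := hG.continuous
  have h2 := continuous_gsq hG
  have h3 := continuous_fderiv_single hG
  unfold tden
  fun_prop

theorem tden_of_zero_outside {τ : (Fin 3 → ℝ) → ℝ} {J : Fin 3 → (Fin 3 → ℝ) → ℝ}
    {ρ G : (Fin 3 → ℝ) → ℝ} {u : Fin 3 → ℝ} {R : ℝ}
    (hz : ∀ x, x ∉ Metric.closedBall u R → G x = 0) {x : Fin 3 → ℝ}
    (hx : x ∉ Metric.closedBall u R) : tden τ J ρ G x = 0 := by
  unfold tden
  rw [hz x hx, gsq_of_zero_outside hz hx]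
  simp

theorem setIntegral_sq_le {G : (Fin 3 → ℝ) → ℝ} {u : Fin 3 → ℝ} {R b : ℝ} (hR : 0 ≤ R)
    (hG : Continuous G) (hz : ∀ x, x ∉ Metric.closedBall u R → G x = 0) (hb : ∀ x, |G x| ≤ b) :
    ∫ x, G x ^ 2 ≤ b ^ 2 * (2 * R) ^ 3 := by
  rw [← setIntegral_eq_integral_of_forall_compl_eq_zero (s := Metric.closedBall u R)
    (fun x hx => by rw [hz x hx]; norm_num)]
  calc ∫ x in Metric.closedBall u R, G x ^ 2 ≤ ∫ x in Metric.closedBall u R, b ^ 2 := by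
        refine setIntegral_mono_on ?_ ?_ Metric.isClosed_closedBall.measurableSet fun x _ => ?_
        · exact (Continuous.continuousOn (by fun_prop)).integrableOn_compact
            (isCompact_closedBall _ _)
        · exact continuous_const.continuousOn.integrableOn_compact (isCompact_closedBall _ _)
        · exact sq_le_sq' (abs_le.1 (hb x)).1 (abs_le.1 (hb x)).2
    _ = _ := by
        rw [setIntegral_const, volume_real_closedBall3 _ hR, smul_eq_mul, mul_comm]

/-- The local magnetic lower bound with field exponent `β` and field domain factor `K`. -/
def LocalBound (C0 β K : ℝ) : Prop :=
  ∃ C, 0 < C ∧ ∀ A τ J ρ, OneBody C0 A τ J ρ → ∀ u R, 0 < R → ∀ G, ContDiff ℝ (⊤ : ℕ∞) G →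
    (∀ x, x ∉ Metric.closedBall u R → G x = 0) → ∀ b, (∀ x, |G x| ≤ b) → ∀ V, 0 < V →
    V * ∫ x, G x ^ 2 * ρ x ≤ (∫ x, tden τ J ρ G x) + C * b ^ 2 * V *
      (1 + V ^ ((3 : ℝ) / 2) * R ^ 3 +
        (R * ∫ x in Metric.closedBall u (K * R), gradSq A x) ^ β)

theorem localBound_three {C0 : ℝ} (hC0 : 0 ≤ C0) : LocalBound C0 3 2 := by
  refine ⟨24 * (1 + 8 * C0) ^ ((5 : ℝ) / 2), by positivity, ?_⟩
  intro A τ J ρ h u R hR G hG hz b hb V hV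
  set F := ∫ x in Metric.closedBall u (2 * R), gradSq A x with hF
  have hF0 : 0 ≤ F := setIntegral_closedBall_nonneg (gradSq_nonneg A) _ _
  set M := ∫ x, G x ^ 2 * ρ x with hM
  have hM0 : 0 ≤ M := integral_nonneg fun x => mul_nonneg (sq_nonneg _) (h.pos.rho_nonneg x)
  set T := ∫ x, tden τ J ρ G x with hT
  have hT0 : 0 ≤ T := integral_nonneg fun x => h.pos.tden_nonneg G x
  have hI := setIntegral_sq_le hR.le hG.continuous hz hb
  have hI0 : 0 ≤ ∫ x, G x ^ 2 := integral_nonneg fun x => sq_nonneg _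
  have key : ∃ η, 0 < η ∧ η ≤ 1 ∧ η * F ^ 2 ≤ V ∧
      η ^ (-(3 : ℝ) / 2) * V ^ ((5 : ℝ) / 2) ≤ V * (V ^ ((3 : ℝ) / 2) + F ^ 3) := by
    have e1 : V ^ ((5 : ℝ) / 2) = V * V ^ ((3 : ℝ) / 2) := by
      rw [show (5 : ℝ) / 2 = 1 + 3 / 2 by norm_num, Real.rpow_add hV, Real.rpow_one]
    rcases le_or_gt (F ^ 2) V with h1 | h1
    · refine ⟨1, one_pos, le_rfl, by linarith, ?_⟩
      rw [Real.one_rpow, one_mul, e1]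
      have : 0 ≤ F ^ 3 := by positivity
      gcongr
      linarith
    · have hFp : 0 < F := by
        rcases hF0.eq_or_lt with h2 | h2
        · rw [← h2] at h1; norm_num at h1; linarith
        · exact h2
      refine ⟨V / F ^ 2, by positivity, (div_le_one (by positivity)).2 h1.le, ?_, ?_⟩
      · rw [div_mul_cancel₀ _ (by positivity)]
      · rw [e1, Real.div_rpow hV.le (by positivity), ← Real.rpow_natCast F 2, ← Real.rpow_mul hF0,
          neg_div, Real.rpow_neg hV.le]
        rw [show ((2 : ℕ) : ℝ) * -(3 / 2) = -((3 : ℕ) : ℝ) by norm_num, Real.rpow_neg hF0,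
          Real.rpow_natCast]
        have : 0 < V ^ ((3 : ℝ) / 2) := by positivity
        have e2 : (V ^ ((3 : ℝ) / 2))⁻¹ / (F ^ 3)⁻¹ * (V * V ^ ((3 : ℝ) / 2)) = V * F ^ 3 := by
          field_simp
        rw [e2]
        gcongr
        linarith
  obtain ⟨η, hη, hη1, hηF, hηV⟩ := key
  have hl := h.loc G hG u R hR hz (1 / 2) η (V * (1 + 8 * C0)) (by norm_num) (by norm_num) hη
    (by positivity)
  rw [← hF, ← hM, ← hT] at hl
  have e3 : ((1 - 1 / 2) * η) ^ (-(3 : ℝ) / 2) ≤ 3 * η ^ (-(3 : ℝ) / 2) := by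
    rw [Real.mul_rpow (by norm_num) hη.le]
    gcongr
    rw [show (1 - 1 / 2 : ℝ) = 2⁻¹ by norm_num, Real.inv_rpow (by norm_num), ← Real.rpow_neg
      (by norm_num), show -(-(3 : ℝ) / 2) = 3 / 2 by norm_num]
    rw [show (3 : ℝ) / 2 = ((3 : ℕ) : ℝ) * (1 / 2) by norm_num, Real.rpow_mul (by norm_num),
      ← Real.sqrt_eq_rpow, Real.rpow_natCast]
    exact Real.sqrt_le_iff.2 (by norm_num)
  have e4 : 2 / (15 * Real.pi ^ 2) ≤ 1 := by
    rw [div_le_one (by positivity)]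
    nlinarith [Real.pi_gt_three]
  have e5 : 2 / (15 * Real.pi ^ 2) * (((1 - 1 / 2) * η) ^ (-(3 : ℝ) / 2) *
      (V * (1 + 8 * C0)) ^ ((5 : ℝ) / 2)) * ∫ x, G x ^ 2 ≤
      1 * ((3 * η ^ (-(3 : ℝ) / 2)) * (V * (1 + 8 * C0)) ^ ((5 : ℝ) / 2)) *
        (b ^ 2 * (2 * R) ^ 3) := by
    gcongr
  have e6 : 1 * ((3 * η ^ (-(3 : ℝ) / 2)) * (V * (1 + 8 * C0)) ^ ((5 : ℝ) / 2)) *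
        (b ^ 2 * (2 * R) ^ 3) = 24 * (1 + 8 * C0) ^ ((5 : ℝ) / 2) * b ^ 2 * R ^ 3 *
          (η ^ (-(3 : ℝ) / 2) * V ^ ((5 : ℝ) / 2)) := by
    rw [Real.mul_rpow hV.le (by positivity)]
    ring
  have e7 : 24 * (1 + 8 * C0) ^ ((5 : ℝ) / 2) * b ^ 2 * R ^ 3 *
          (η ^ (-(3 : ℝ) / 2) * V ^ ((5 : ℝ) / 2)) ≤ 24 * (1 + 8 * C0) ^ ((5 : ℝ) / 2) * b ^ 2 *
          R ^ 3 * (V * (V ^ ((3 : ℝ) / 2) + F ^ 3)) := by gcongr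
  have e8 : η * (C0 / (1 / 2) ^ 3 * F ^ 2) * M ≤ 8 * C0 * V * M := by
    have : η * (C0 / (1 / 2) ^ 3 * F ^ 2) = 8 * C0 * (η * F ^ 2) := by ring
    rw [this]
    gcongr
  have e9 : η * T ≤ T := mul_le_of_le_one_left hT0 hη1
  have e10 : (R * F) ^ (3 : ℝ) = R ^ 3 * F ^ 3 := by
    rw [← mul_pow, ← Real.rpow_natCast]; norm_num
  rw [e10]
  have e11 : 0 ≤ 24 * (1 + 8 * C0) ^ ((5 : ℝ) / 2) * b ^ 2 * V := by positivity
  nlinarith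

theorem exists_scale {R V F β : ℝ} (hR : 0 < R) (hV : 0 < V) (hF : 0 ≤ F) (hβ : 1 ≤ β) :
    ∃ s, 0 < s ∧ s ≤ R ∧ s ^ 2 * V ≤ 1 ∧
      R ^ 3 / s ^ 3 ≤ 1 + V ^ ((3 : ℝ) / 2) * R ^ 3 + (R * F) ^ (3 * β / (3 + β)) ∧
      (s * F) ^ β ≤ (R * F) ^ (3 * β / (3 + β)) := by
  set γ := β / (3 + β) with hγ
  set X := (R * F) ^ γ with hX
  have hRF : 0 ≤ R * F := by positivity
  have hX0 : 0 ≤ X := by positivity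
  set m := max 1 (max (Real.sqrt V * R) X) with hm
  have hm1 : 1 ≤ m := le_max_left _ _
  have hm2 : Real.sqrt V * R ≤ m := (le_max_left _ _).trans (le_max_right _ _)
  have hm3 : X ≤ m := (le_max_right _ _).trans (le_max_right _ _)
  have hm0 : 0 < m := by linarith
  have hX3 : X ^ 3 = (R * F) ^ (3 * β / (3 + β)) := by
    rw [hX, ← Real.rpow_natCast, ← Real.rpow_mul hRF, hγ]
    congr 1
    push_cast
    ring
  have hsq : Real.sqrt V ^ 2 = V := Real.sq_sqrt hV.le
  have hs3 : Real.sqrt V ^ 3 = V ^ ((3 : ℝ) / 2) := by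
    rw [Real.sqrt_eq_rpow, ← Real.rpow_natCast, ← Real.rpow_mul hV.le]
    norm_num
  refine ⟨R / m, by positivity, div_le_self hR.le hm1, ?_, ?_, ?_⟩
  · have : (R / m) ^ 2 * V = (Real.sqrt V * R / m) ^ 2 := by
      rw [div_pow, div_pow, mul_pow, hsq]; ring
    rw [this]
    exact pow_le_one₀ (by positivity) ((div_le_one hm0).2 hm2)
  · have e1 : R ^ 3 / (R / m) ^ 3 = m ^ 3 := by
      field_simp
    have e2 : 0 ≤ Real.sqrt V * R := by positivity
    have e3 : m ^ 3 ≤ 1 + (Real.sqrt V * R) ^ 3 + X ^ 3 := by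
      have p1 : 0 ≤ (Real.sqrt V * R) ^ 3 := by positivity
      have p2 : 0 ≤ X ^ 3 := by positivity
      rcases max_choice 1 (max (Real.sqrt V * R) X) with h | h
      · rw [hm, h]; linarith
      · rcases max_choice (Real.sqrt V * R) X with h' | h' <;> rw [hm, h, h'] <;> linarith
    rw [e1, ← hX3, ← hs3, ← mul_pow]
    exact e3
  · rcases hRF.eq_or_lt with h0 | h0
    · have : F = 0 := by
        rcases mul_eq_zero.1 h0.symm with h | h
        · exact absurd h hR.ne'
        · exact h
      rw [this, mul_zero, Real.zero_rpow (by linarith)]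
      positivity
    · have e1 : R / m * F ≤ (R * F) ^ (1 - γ) := by
        rw [Real.rpow_sub h0, Real.rpow_one, ← hX, div_mul_eq_mul_div]
        have : 0 < X := by positivity
        gcongr
      calc (R / m * F) ^ β ≤ ((R * F) ^ (1 - γ)) ^ β := by gcongr
        _ = _ := by
          rw [← Real.rpow_mul hRF]
          congr 1
          rw [hγ]
          have : (3 + β) ≠ 0 := by linarith
          field_simp
          ring

theorem LocalBound.step {C0 β K : ℝ} (hβ : 1 ≤ β) (hK : 1 ≤ K) (hP : LocalBound C0 β K) :
    LocalBound C0 (3 * β / (3 + β)) (K + 2) := by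
  obtain ⟨C, hC, hP⟩ := hP
  obtain ⟨g, hg, hz, hgi⟩ := exists_unit_bump
  obtain ⟨gm, hgm0, hgm⟩ := exists_bound_of_zero_outside hg.continuous hz
  set Kg := ∫ y, gsq g y with hKg
  have hKg0 : 0 ≤ Kg := integral_nonneg fun y => gsq_nonneg g y
  set c2 := (2 * (Kg + 1)) ^ ((3 : ℝ) / 2) with hc2
  have hc20 : 0 ≤ c2 := by positivity
  set C' := C * gm ^ 2 * (Kg + 1) * ((1 + c2) * 64 + (2 * K) ^ 3) with hC'
  have hC'0 : 0 ≤ C' := by positivity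
  refine ⟨C' * 2 + 1, by positivity, ?_⟩
  intro A τ J ρ h u R hR G hG hGz b hb V hV
  set F := ∫ x in Metric.closedBall u ((K + 2) * R), gradSq A x with hF
  have hgc := continuous_gradSq h.smooth
  have hF0 : 0 ≤ F := setIntegral_closedBall_nonneg (gradSq_nonneg A) _ _
  set M := ∫ x, G x ^ 2 * ρ x with hM
  have hM0 : 0 ≤ M := integral_nonneg fun x => mul_nonneg (sq_nonneg _) (h.pos.rho_nonneg x)
  set T := ∫ x, tden τ J ρ G x with hT
  have hT0 : 0 ≤ T := integral_nonneg fun x => h.pos.tden_nonneg G x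
  obtain ⟨s, hs, hsR, hsV, hs3, hsF⟩ := exists_scale hR hV hF0 hβ
  have hcomp : ∀ {f : (Fin 3 → ℝ) → ℝ}, Continuous f →
      (∀ x, x ∉ Metric.closedBall u R → f x = 0) → Integrable f := fun hf hfz =>
    hf.integrable_of_hasCompactSupport (HasCompactSupport.intro (isCompact_closedBall u R) hfz)
  have hGc := hG.continuous
  have hdG := continuous_fderiv_single hG
  have hcd := h.cont_den
  have hcJ := h.cont_cur
  have hρi : Integrable fun y => G y ^ 2 * ρ y :=
    hcomp (by fun_prop) fun x hx => by rw [hGz x hx]; simp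
  have hJi : ∀ k, Integrable (curG J ρ G k) := fun k =>
    hcomp (by unfold curG; have := hdG k; have := hcJ k; fun_prop) fun x hx => by
      unfold curG; rw [hGz x hx]; simp
  have hτi : Integrable (tden τ J ρ G) :=
    hcomp (continuous_tden h.cont_kin h.cont_cur h.cont_den hG) fun x hx =>
      tden_of_zero_outside hGz hx
  obtain ⟨hi1, hi2⟩ := ims_integrated (h.pos.mul G) hτi hJi hρi hg hgi hz hs u (R + s) one_pos
  have hform : ∀ w x, tden (tden τ J ρ G) (curG J ρ G) (fun y => G y ^ 2 * ρ y) (gw g s w) x =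
      tden τ J ρ (fun y => gw g s w y * G y) x := fun w x =>
    (tden_mul τ J ρ ((contDiff_gw hg w).differentiable (by simp) x)
      (hG.differentiable (by simp) x)).symm
  simp_rw [hform] at hi1 hi2
  have hMle : ∫ x in Metric.closedBall u (R + s + s), G x ^ 2 * ρ x ≤ M :=
    setIntegral_le_integral hρi (Filter.Eventually.of_forall fun x =>
      mul_nonneg (sq_nonneg _) (h.pos.rho_nonneg x))
  obtain ⟨Bg, -, hBg⟩ := exists_bound_of_zero_outside (u := 0) (R := 1)
    (h := fun x => (s ^ 3)⁻¹ * g x ^ 2)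
    (by have := hg.continuous; fun_prop) (fun x hx => by simp [hz x hx])
  obtain ⟨k1, k2, k3, k4⟩ := kernel_swap (k := fun w x => gw g s w x ^ 2)
    (by have := hg.continuous; unfold gw; fun_prop) (fun w x => by rw [gw_sq hs]; exact hBg _)
    hρi u (R + s)
  have hMeq : ∫ x, (∫ w in Metric.closedBall u (R + s), gw g s w x ^ 2) * (G x ^ 2 * ρ x) = M := by
    rw [hM]
    refine integral_congr_ae (Filter.Eventually.of_forall fun x => ?_)
    simp only
    by_cases hx : x ∈ Metric.closedBall u R
    · rw [setIntegral_gw_sq_eq hgi hz hs, one_mul]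
      intro w hw
      rw [Metric.mem_closedBall] at *
      rw [dist_comm] at hw
      linarith [dist_triangle w x u]
    · rw [hGz x hx]; simp
  rw [hMeq] at k4
  set V' := 2 * (Kg + 1) / s ^ 2 with hV'
  have hV'0 : 0 < V' := by positivity
  have hV's : V' ^ ((3 : ℝ) / 2) * s ^ 3 = c2 := by
    rw [hV', Real.div_rpow (by positivity) (by positivity), ← hc2, ← Real.rpow_natCast s 2,
      ← Real.rpow_mul hs.le, show ((2 : ℕ) : ℝ) * (3 / 2) = ((3 : ℕ) : ℝ) by norm_num,
      Real.rpow_natCast, div_mul_cancel₀ _ (by positivity)]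
  set Fw : (Fin 3 → ℝ) → ℝ := fun w => ∫ x in Metric.closedBall w (K * s), gradSq A x with hFw
  have hFwc : Continuous Fw := continuous_setIntegral_closedBall hgc _
  have hFw0 : ∀ w, 0 ≤ Fw w := fun w => setIntegral_closedBall_nonneg (gradSq_nonneg A) _ _
  have hFwF : ∀ w ∈ Metric.closedBall u (R + s), Fw w ≤ F := fun w hw => by
    refine setIntegral_closedBall_mono hgc (gradSq_nonneg A) (Metric.closedBall_subset_closedBall' ?_)
    rw [Metric.mem_closedBall] at hw
    have : K * s ≤ K * R := by gcongr
    linarith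
  have hpw : ∀ w ∈ Metric.closedBall u (R + s), V' * ∫ x, gw g s w x ^ 2 * (G x ^ 2 * ρ x) ≤
      (∫ x, tden τ J ρ (fun y => gw g s w y * G y) x) +
      C * (b ^ 2 * ((s ^ 3)⁻¹ * gm ^ 2)) * V' * (1 + c2 + s ^ β * (F ^ (β - 1) * Fw w)) := by
    intro w hw
    have hrs : 0 < s ^ (-(3 : ℝ) / 2) := by positivity
    have := hP A τ J ρ h w s hs (fun y => gw g s w y * G y) ((contDiff_gw hg w).mul hG)
      (fun x hx => by rw [gw_zero hz hs hx, zero_mul]) (s ^ (-(3 : ℝ) / 2) * gm * b)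
      (fun x => by
        rw [abs_mul]
        have h1 : |gw g s w x| ≤ s ^ (-(3 : ℝ) / 2) * gm := by
          unfold gw
          rw [abs_mul, abs_of_pos hrs]
          gcongr
          exact hgm _
        have := hb x
        gcongr) V' hV'0
    rw [hV's] at this
    have e1 : (s ^ (-(3 : ℝ) / 2) * gm * b) ^ 2 = b ^ 2 * ((s ^ 3)⁻¹ * gm ^ 2) := by
      rw [mul_pow, mul_pow, rpow_neg_sq hs]; ring
    rw [e1] at this
    simp only [mul_pow, mul_assoc] at this ⊢
    refine this.trans ?_
    have e2 : (s * ∫ x in Metric.closedBall w (K * s), gradSq A x) ^ β ≤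
        s ^ β * (F ^ (β - 1) * Fw w) := by
      rw [Real.mul_rpow hs.le (hFw0 w)]
      gcongr
      rcases (hFw0 w).eq_or_lt with h0 | h0
      · change Fw w ^ β ≤ _
        rw [← h0, Real.zero_rpow (by linarith), mul_zero]
      · change Fw w ^ β ≤ _
        calc Fw w ^ β = Fw w ^ (β - 1) * Fw w := by
              rw [Real.rpow_sub h0, Real.rpow_one, div_mul_cancel₀ _ h0.ne']
          _ ≤ _ := by
              have := hFwF w hw
              gcongr
    gcongr
  have h_mono_int : V' * M ≤ (∫ w in Metric.closedBall u (R + s),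
      ∫ x, tden τ J ρ (fun y => gw g s w y * G y) x) +
      C * (b ^ 2 * ((s ^ 3)⁻¹ * gm ^ 2)) * V' * ((1 + c2) * (2 * (R + s)) ^ 3 +
        s ^ β * (F ^ (β - 1) * ∫ w in Metric.closedBall u (R + s), Fw w)) := by
    have hc : ∀ {f : (Fin 3 → ℝ) → ℝ}, Continuous f →
        IntegrableOn f (Metric.closedBall u (R + s)) := fun hf =>
      hf.continuousOn.integrableOn_compact (isCompact_closedBall _ _)
    have i2 : IntegrableOn (fun w => C * (b ^ 2 * ((s ^ 3)⁻¹ * gm ^ 2)) * V' *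
        (1 + c2 + s ^ β * (F ^ (β - 1) * Fw w))) (Metric.closedBall u (R + s)) :=
      hc (by fun_prop)
    have := setIntegral_mono_on (k1.const_mul V') (hi1.fun_add i2)
      Metric.isClosed_closedBall.measurableSet hpw
    rw [integral_const_mul, k4, integral_add hi1 i2, integral_const_mul,
      integral_add (hc continuous_const) (hc (by fun_prop)), setIntegral_const,
      volume_real_closedBall3 _ (by positivity), smul_eq_mul, integral_const_mul,
      integral_const_mul, mul_comm _ (1 + c2)] at this
    exact this
  have hFint : ∫ w in Metric.closedBall u (R + s), Fw w ≤ (2 * (K * s)) ^ 3 * F := by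
    refine (setIntegral_setIntegral_closedBall_le hgc (gradSq_nonneg A) u (R + s)
      (by positivity)).trans ?_
    gcongr
    refine setIntegral_closedBall_mono hgc (gradSq_nonneg A) (Metric.closedBall_subset_closedBall ?_)
    have : K * s ≤ K * R := by gcongr
    linarith
  have hFb : F ^ (β - 1) * F ≤ F ^ β := by
    rcases hF0.eq_or_lt with h0 | h0
    · rw [← h0, mul_zero, Real.zero_rpow (by linarith)]
    · rw [Real.rpow_sub h0, Real.rpow_one, div_mul_cancel₀ _ h0.ne']
  set Y := (R * F) ^ (3 * β / (3 + β)) with hY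
  have hY0 : 0 ≤ Y := by positivity
  have hbr : (1 + c2) * (2 * (R + s)) ^ 3 +
        s ^ β * (F ^ (β - 1) * ∫ w in Metric.closedBall u (R + s), Fw w) ≤
      s ^ 3 * (((1 + c2) * 64 + (2 * K) ^ 3) * (2 * (1 + V ^ ((3 : ℝ) / 2) * R ^ 3 + Y))) := by
    have e1 : (1 + c2) * (2 * (R + s)) ^ 3 ≤ (1 + c2) * (64 * R ^ 3) := by
      have : (2 * (R + s)) ^ 3 ≤ (2 * (R + R)) ^ 3 := by gcongr
      gcongr
      refine this.trans_eq (by ring)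
    have e2 : R ^ 3 ≤ s ^ 3 * (1 + V ^ ((3 : ℝ) / 2) * R ^ 3 + Y) := by
      rwa [div_le_iff₀' (by positivity)] at hs3
    have e3 : s ^ β * (F ^ (β - 1) * ∫ w in Metric.closedBall u (R + s), Fw w) ≤
        (2 * K) ^ 3 * (s ^ 3 * Y) := by
      calc _ ≤ s ^ β * (F ^ (β - 1) * ((2 * (K * s)) ^ 3 * F)) := by gcongr
        _ = (2 * (K * s)) ^ 3 * s ^ β * (F ^ (β - 1) * F) := by ring
        _ ≤ (2 * (K * s)) ^ 3 * s ^ β * F ^ β := by gcongr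
        _ = (2 * K) ^ 3 * s ^ 3 * (s * F) ^ β := by
            rw [Real.mul_rpow hs.le hF0]; ring
        _ ≤ (2 * K) ^ 3 * s ^ 3 * Y := by gcongr
        _ = _ := by ring
    have e4 : 0 ≤ V ^ ((3 : ℝ) / 2) * R ^ 3 := by positivity
    have e5 : (1 + c2) * (64 * R ^ 3) ≤
        (1 + c2) * (64 * (s ^ 3 * (1 + V ^ ((3 : ℝ) / 2) * R ^ 3 + Y))) := by gcongr
    have e6 : (2 * K) ^ 3 * (s ^ 3 * Y) ≤
        (2 * K) ^ 3 * (s ^ 3 * (1 + V ^ ((3 : ℝ) / 2) * R ^ 3 + Y)) := by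
      gcongr
      linarith
    have e7 : 0 ≤ ((1 + c2) * 64 + (2 * K) ^ 3) *
      (s ^ 3 * (1 + V ^ ((3 : ℝ) / 2) * R ^ 3 + Y)) := by positivity
    linarith
  set W := 1 + V ^ ((3 : ℝ) / 2) * R ^ 3 + Y with hW
  have hW0 : 0 ≤ W := by positivity
  have hfin : V' * M ≤ (1 + 1) * T + (1 + 1 / 1) * ((s ^ 2)⁻¹ * Kg) * M +
      C * (b ^ 2 * ((s ^ 3)⁻¹ * gm ^ 2)) * V' *
        (s ^ 3 * (((1 + c2) * 64 + (2 * K) ^ 3) * (2 * W))) := by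
    refine h_mono_int.trans (add_le_add (hi2.trans ?_) ?_) <;> gcongr
  have e8 : C * (b ^ 2 * ((s ^ 3)⁻¹ * gm ^ 2)) * V' *
        (s ^ 3 * (((1 + c2) * 64 + (2 * K) ^ 3) * (2 * W))) =
      (s ^ 2)⁻¹ * (2 * (C' * 2 * b ^ 2 * W)) := by
    rw [hC', hV']
    field_simp
  rw [e8] at hfin
  have e9 : (s ^ 2)⁻¹ * (2 * M) ≤ 2 * T + (s ^ 2)⁻¹ * (2 * (C' * 2 * b ^ 2 * W)) := by
    have : V' * M = (s ^ 2)⁻¹ * (2 * M) + (1 + 1 / 1) * ((s ^ 2)⁻¹ * Kg) * M := by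
      rw [hV']; field_simp; ring
    linarith
  have e10 : M ≤ s ^ 2 * T + C' * 2 * b ^ 2 * W := by
    have := mul_le_mul_of_nonneg_left e9 (by positivity : 0 ≤ s ^ 2)
    have hne : s ^ 2 ≠ 0 := by positivity
    rw [mul_add, mul_inv_cancel_left₀ hne, mul_inv_cancel_left₀ hne] at this
    linarith
  calc V * M ≤ V * (s ^ 2 * T + C' * 2 * b ^ 2 * W) := by gcongr
    _ = s ^ 2 * V * T + C' * 2 * b ^ 2 * V * W := by ring
    _ ≤ 1 * T + (C' * 2 + 1) * b ^ 2 * V * W := by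
        gcongr
        linarith
    _ = _ := by rw [one_mul]

theorem localBound_one {C0 : ℝ} (hC0 : 0 ≤ C0) : LocalBound C0 1 6 := by
  have h1 := (localBound_three hC0).step (by norm_num) (by norm_num)
  norm_num at h1
  have h2 := h1.step (by norm_num) (by norm_num)
  norm_num at h2
  exact h2

/-- The Pauli–Dirac vector `σ·(-i∇ + A) f`. -/
def dirac (A : (Fin 3 → ℝ) → Fin 3 → ℝ) (f : (Fin 3 → ℝ) → Fin 2 → ℂ) (x : Fin 3 → ℝ)
    (s : Fin 2) : ℂ :=
  ∑ k : Fin 3, ∑ t : Fin 2, pauli k s t *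
    (-Complex.I * pdC k (fun y => f y t) x + (A x k : ℂ) * f x t)

/-- The current density of a spinor. -/
def jd (A : (Fin 3 → ℝ) → Fin 3 → ℝ) (f : (Fin 3 → ℝ) → Fin 2 → ℂ) (k : Fin 3)
    (x : Fin 3 → ℝ) : ℝ :=
  ∑ s : Fin 2, 2 * (starRingEnd ℂ (dirac A f x s) *
    ∑ t, pauli k s t * (-Complex.I * f x t)).re

theorem sum_norm_add_sq (q : ℝ) (v : Fin 3 → ℝ) (a z : Fin 2 → ℂ) :
    ∑ s : Fin 2, ‖(q : ℂ) * a s + ∑ k : Fin 3, ∑ t : Fin 2, pauli k s t *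
      ((v k : ℂ) * (-Complex.I * z t))‖ ^ 2 =
    q ^ 2 * (∑ s, ‖a s‖ ^ 2) + q * (∑ k, v k * ∑ s : Fin 2, 2 * (starRingEnd ℂ (a s) *
      ∑ t, pauli k s t * (-Complex.I * z t)).re) + (∑ k, v k ^ 2) * ∑ t, ‖z t‖ ^ 2 := by
  have h1 : ∀ s : Fin 2, ‖(q : ℂ) * a s + ∑ k : Fin 3, ∑ t : Fin 2, pauli k s t *
      ((v k : ℂ) * (-Complex.I * z t))‖ ^ 2 = q ^ 2 * ‖a s‖ ^ 2 + q * (∑ k, v k * (2 *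
      (starRingEnd ℂ (a s) * ∑ t, pauli k s t * (-Complex.I * z t)).re)) +
      ‖∑ k : Fin 3, ∑ t : Fin 2, pauli k s t * ((v k : ℂ) * (-Complex.I * z t))‖ ^ 2 := by
    intro s
    have e1 : ∑ k : Fin 3, ∑ t : Fin 2, pauli k s t * ((v k : ℂ) * (-Complex.I * z t)) =
        ∑ k, (v k : ℂ) * ∑ t, pauli k s t * (-Complex.I * z t) := by
      simp only [Finset.mul_sum]
      exact Finset.sum_congr rfl fun k _ => Finset.sum_congr rfl fun t _ => by ring
    rw [e1]
    generalize (fun k => ∑ t, pauli k s t * (-Complex.I * z t)) = w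
    simp only [← Complex.normSq_eq_norm_sq, Fin.sum_univ_three, Complex.normSq_apply,
      Complex.add_re, Complex.add_im, Complex.mul_re, Complex.mul_im, Complex.ofReal_re,
      Complex.ofReal_im, Complex.conj_re, Complex.conj_im]
    ring
  simp_rw [h1, Finset.sum_add_distrib, ← Finset.mul_sum]
  rw [pauli_norm v fun t => -Complex.I * z t]
  congr 1
  · congr 2
    simp_rw [Finset.mul_sum]
    rw [Finset.sum_comm]
  · congr 1
    exact Finset.sum_congr rfl fun t _ => by simp

theorem dirac_smul {A : (Fin 3 → ℝ) → Fin 3 → ℝ} {f : (Fin 3 → ℝ) → Fin 2 → ℂ}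
    {G : (Fin 3 → ℝ) → ℝ} {x : Fin 3 → ℝ} (hG : DifferentiableAt ℝ G x)
    (hf : ∀ t, DifferentiableAt ℝ (fun x => f x t) x) (s : Fin 2) :
    dirac A (fun y t => (G y : ℂ) * f y t) x s = (G x : ℂ) * dirac A f x s +
      ∑ k : Fin 3, ∑ t : Fin 2, pauli k s t *
        ((fderiv ℝ G x (Pi.single k 1) : ℂ) * (-Complex.I * f x t)) := by
  have h1 : ∀ k t, pdC k (fun y => (G y : ℂ) * f y t) x =
      (G x : ℂ) * pdC k (fun y => f y t) x + (fderiv ℝ G x (Pi.single k 1) : ℂ) * f x t := by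
    intro k t
    have hGc : HasFDerivAt (fun y => (G y : ℂ)) (Complex.ofRealCLM.comp (fderiv ℝ G x)) x :=
      Complex.ofRealCLM.hasFDerivAt.comp x hG.hasFDerivAt
    unfold pdC
    rw [fderiv_fun_mul hGc.differentiableAt (hf t), hGc.fderiv]
    simp [mul_comm]
  unfold dirac
  simp_rw [h1, Finset.mul_sum, ← Finset.sum_add_distrib]
  exact Finset.sum_congr rfl fun k _ => Finset.sum_congr rfl fun t _ => by ring

theorem kd_smul {A : (Fin 3 → ℝ) → Fin 3 → ℝ} {f : (Fin 3 → ℝ) → Fin 2 → ℂ}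
    {G : (Fin 3 → ℝ) → ℝ} {x : Fin 3 → ℝ} (hG : DifferentiableAt ℝ G x)
    (hf : ∀ t, DifferentiableAt ℝ (fun x => f x t) x) :
    kd A (fun y t => (G y : ℂ) * f y t) x = G x ^ 2 * kd A f x +
      G x * (∑ k, fderiv ℝ G x (Pi.single k 1) * jd A f k x) + gsq G x * ∑ t, ‖f x t‖ ^ 2 := by
  change ∑ s, ‖dirac A _ x s‖ ^ 2 = _
  simp_rw [dirac_smul hG hf]
  exact sum_norm_add_sq _ (fun k => fderiv ℝ G x (Pi.single k 1)) (dirac A f x) (f x)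

theorem kd_pos (A : (Fin 3 → ℝ) → Fin 3 → ℝ) (f : (Fin 3 → ℝ) → Fin 2 → ℂ) (x : Fin 3 → ℝ)
    (s : ℝ) (v : Fin 3 → ℝ) : 0 ≤ s ^ 2 * kd A f x + s * (∑ k, v k * jd A f k x) +
      (∑ k, v k ^ 2) * ∑ t, ‖f x t‖ ^ 2 := by
  have := sum_norm_add_sq s v (dirac A f x) (f x)
  unfold jd
  change 0 ≤ s ^ 2 * (∑ s, ‖dirac A f x s‖ ^ 2) + _ + _
  rw [← this]
  exact Finset.sum_nonneg fun _ _ => sq_nonneg _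

theorem continuous_parametric_of_zero {Y X E : Type*} [NormedAddCommGroup E] [NormedSpace ℝ E]
    [TopologicalSpace Y] [T2Space Y] [MeasurableSpace Y] [OpensMeasurableSpace Y]
    {μ : Measure Y} [IsLocallyFiniteMeasure μ] [TopologicalSpace X] [FirstCountableTopology X]
    [LocallyCompactSpace X]
    [SecondCountableTopologyEither Y E]
    {h : Y → X → E} (hc : Continuous fun p : Y × X => h p.1 p.2) {K : Set Y} (hK : IsCompact K)
    (hz : ∀ y, y ∉ K → ∀ x, h y x = 0) : Continuous fun x => ∫ y, h y x ∂μ := by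
  have : ∀ x, ∫ y, h y x ∂μ = ∫ y in K, h y x ∂μ := fun x =>
    (setIntegral_eq_integral_of_forall_compl_eq_zero fun y hy => hz y hy x).symm
  simp_rw [this]
  exact continuous_parametric_integral_of_continuous (f := fun x y => h y x)
    (hc.comp continuous_swap) hK

/-- A smooth compactly supported family of spinors obeying the Pauli principle. -/
structure Family (n : ℕ) {ι : Type} [Fintype ι]
    (ψ : ι → (Fin n → Fin 3 → ℝ) → (Fin 3 → ℝ) → Fin 2 → ℂ) : Prop where
  smooth : ∀ i t, ContDiff ℝ (⊤ : ℕ∞) fun p : (Fin n → Fin 3 → ℝ) × (Fin 3 → ℝ) => ψ i p.1 p.2 t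
  zero : ∃ R, (∀ i y, y ∉ Metric.closedBall (0 : Fin n → Fin 3 → ℝ) R → ∀ x t, ψ i y x t = 0) ∧
    ∀ i y x, x ∉ Metric.closedBall (0 : Fin 3 → ℝ) R → ∀ t, ψ i y x t = 0
  exclusion : ∀ (t : Fin 2) (F : (Fin 3 → ℝ) → ℂ), Continuous F → HasCompactSupport F →
    ∑ i, ∫ y, ‖∫ x, F x * ψ i y x t‖ ^ 2 ≤ ∫ x, ‖F x‖ ^ 2

namespace Family
variable {n : ℕ} {ι : Type} [Fintype ι]
  {ψ : ι → (Fin n → Fin 3 → ℝ) → (Fin 3 → ℝ) → Fin 2 → ℂ}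

theorem isTest (h : Family n ψ) (i : ι) (y : Fin n → Fin 3 → ℝ) (t : Fin 2) :
    IsTest fun x => ψ i y x t := by
  obtain ⟨R, -, hR⟩ := h.zero
  exact ⟨(h.smooth i t).comp (contDiff_const.prodMk contDiff_id),
    HasCompactSupport.intro (isCompact_closedBall 0 R) fun x hx => hR i y x hx t⟩

theorem continuous_pd (h : Family n ψ) (i : ι) (t : Fin 2) (k : Fin 3) :
    Continuous fun p : (Fin n → Fin 3 → ℝ) × (Fin 3 → ℝ) => pdC k (fun x => ψ i p.1 x t) p.2 := by
  have h1 : ∀ p : (Fin n → Fin 3 → ℝ) × (Fin 3 → ℝ), pdC k (fun x => ψ i p.1 x t) p.2 =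
      fderiv ℝ (fun p : (Fin n → Fin 3 → ℝ) × (Fin 3 → ℝ) => ψ i p.1 p.2 t) p
        (0, Pi.single k 1) := by
    intro p
    have h2 : HasFDerivAt (fun x : Fin 3 → ℝ => (p.1, x))
        (ContinuousLinearMap.inr ℝ (Fin n → Fin 3 → ℝ) (Fin 3 → ℝ)) p.2 :=
      hasFDerivAt_prodMk_right p.1 p.2
    have h3 := ((h.smooth i t).differentiable (by simp) p).hasFDerivAt.comp p.2 h2
    unfold pdC
    have h4 := h3.fderiv
    simp only [Function.comp_def] at h4
    rw [h4]
    simp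
  simp_rw [h1]
  exact ((h.smooth i t).continuous_fderiv (by simp)).clm_apply continuous_const

theorem continuous_dirac (h : Family n ψ) {A : (Fin 3 → ℝ) → Fin 3 → ℝ} (hA : Continuous A)
    (i : ι) (s : Fin 2) :
    Continuous fun p : (Fin n → Fin 3 → ℝ) × (Fin 3 → ℝ) => dirac A (ψ i p.1) p.2 s := by
  have h1 := fun t k => h.continuous_pd i t k
  have h2 := fun t => (h.smooth i t).continuous
  unfold dirac
  refine continuous_finsetSum _ fun k _ => continuous_finsetSum _ fun t _ => ?_
  have := h1 t k
  have := h2 t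
  fun_prop

theorem continuous_kd (h : Family n ψ) {A : (Fin 3 → ℝ) → Fin 3 → ℝ} (hA : Continuous A) (i : ι) :
    Continuous fun p : (Fin n → Fin 3 → ℝ) × (Fin 3 → ℝ) => kd A (ψ i p.1) p.2 :=
  continuous_finsetSum _ fun s _ => (h.continuous_dirac hA i s).norm.pow 2

theorem continuous_jd (h : Family n ψ) {A : (Fin 3 → ℝ) → Fin 3 → ℝ} (hA : Continuous A) (i : ι)
    (k : Fin 3) :
    Continuous fun p : (Fin n → Fin 3 → ℝ) × (Fin 3 → ℝ) => jd A (ψ i p.1) k p.2 := by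
  unfold jd
  refine continuous_finsetSum _ fun s _ => ?_
  have h1 := h.continuous_dirac hA i s
  have h2 := fun t => (h.smooth i t).continuous
  have h3 : Continuous fun p : (Fin n → Fin 3 → ℝ) × (Fin 3 → ℝ) =>
      ∑ t, pauli k s t * (-Complex.I * ψ i p.1 p.2 t) :=
    continuous_finsetSum _ fun t _ => by have := h2 t; fun_prop
  exact continuous_const.mul (Complex.continuous_re.comp
    ((Complex.continuous_conj.comp h1).mul h3))

theorem continuous_normSq (h : Family n ψ) (i : ι) :
    Continuous fun p : (Fin n → Fin 3 → ℝ) × (Fin 3 → ℝ) => ∑ t, ‖ψ i p.1 p.2 t‖ ^ 2 :=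
  continuous_finsetSum _ fun t _ => (h.smooth i t).continuous.norm.pow 2

/-- The kinetic energy density of a family. -/
def kin (A : (Fin 3 → ℝ) → Fin 3 → ℝ) (ψ : ι → (Fin n → Fin 3 → ℝ) → (Fin 3 → ℝ) → Fin 2 → ℂ)
    (x : Fin 3 → ℝ) : ℝ := ∑ i, ∫ y, kd A (ψ i y) x

/-- The current density of a family. -/
def cur (A : (Fin 3 → ℝ) → Fin 3 → ℝ) (ψ : ι → (Fin n → Fin 3 → ℝ) → (Fin 3 → ℝ) → Fin 2 → ℂ)
    (k : Fin 3) (x : Fin 3 → ℝ) : ℝ := ∑ i, ∫ y, jd A (ψ i y) k x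

/-- The particle density of a family. -/
def den (ψ : ι → (Fin n → Fin 3 → ℝ) → (Fin 3 → ℝ) → Fin 2 → ℂ) (x : Fin 3 → ℝ) : ℝ :=
  ∑ i, ∫ y, ∑ t, ‖ψ i y x t‖ ^ 2

theorem compact_fubini {h : (Fin n → Fin 3 → ℝ) → (Fin 3 → ℝ) → ℝ}
    (hc : Continuous fun p : (Fin n → Fin 3 → ℝ) × (Fin 3 → ℝ) => h p.1 p.2) {R : ℝ}
    (h1 : ∀ y, y ∉ Metric.closedBall (0 : Fin n → Fin 3 → ℝ) R → ∀ x, h y x = 0)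
    {K : Set (Fin 3 → ℝ)} (hK : IsCompact K) (h2 : ∀ y, ∀ x, x ∉ K → h y x = 0) :
    (∀ x, Integrable fun y => h y x) ∧ (∀ y, Integrable fun x => h y x) ∧
    Integrable (fun y => ∫ x, h y x) ∧ Integrable (fun x => ∫ y, h y x) ∧
    ∫ x, ∫ y, h y x = ∫ y, ∫ x, h y x := by
  have hB := isCompact_closedBall (0 : Fin n → Fin 3 → ℝ) R
  refine ⟨fun x => ?_, fun y => ?_, ?_, ?_, ?_⟩
  · exact (hc.comp (continuous_id.prodMk continuous_const)).integrable_of_hasCompactSupport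
      (HasCompactSupport.intro hB fun y hy => h1 y hy x)
  · exact (hc.comp (continuous_const.prodMk continuous_id)).integrable_of_hasCompactSupport
      (HasCompactSupport.intro hK fun x hx => h2 y x hx)
  · refine (continuous_parametric_of_zero (h := fun x y => h y x) (hc.comp continuous_swap)
      hK fun x hx y => h2 y x hx).integrable_of_hasCompactSupport
      (HasCompactSupport.intro hB fun y hy => ?_)
    simp [h1 y hy]
  · refine (continuous_parametric_of_zero hc hB h1).integrable_of_hasCompactSupport
      (HasCompactSupport.intro hK fun x hx => ?_)
    simp [fun y => h2 y x hx]
  · refine integral_integral_swap_of_hasCompactSupport (f := fun x y => h y x)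
      (hc.comp continuous_swap) (HasCompactSupport.intro (hK.prod hB) fun p hp => ?_)
    by_cases hx : p.1 ∈ K
    · exact h1 _ (fun hy => hp ⟨hx, hy⟩) _
    · exact h2 _ _ hx

theorem kd_zero_left {A : (Fin 3 → ℝ) → Fin 3 → ℝ} {f : (Fin 3 → ℝ) → Fin 2 → ℂ}
    (h : ∀ x t, f x t = 0) (x : Fin 3 → ℝ) : dirac A f x = 0 := by
  have : f = fun _ _ => 0 := by ext x t; exact h x t
  funext s
  simp [this, dirac, pdC]

theorem dirac_of_zero_outside {A : (Fin 3 → ℝ) → Fin 3 → ℝ} {f : (Fin 3 → ℝ) → Fin 2 → ℂ}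
    {u : Fin 3 → ℝ} {R : ℝ} (h : ∀ x, x ∉ Metric.closedBall u R → ∀ t, f x t = 0) {x : Fin 3 → ℝ}
    (hx : x ∉ Metric.closedBall u R) : dirac A f x = 0 := by
  funext s
  unfold dirac
  simp [fun k t => pdC_of_zero_outside (fun y hy => h y hy t) hx k, h x hx]

theorem kd_of_dirac_eq {A : (Fin 3 → ℝ) → Fin 3 → ℝ} {f : (Fin 3 → ℝ) → Fin 2 → ℂ}
    {x : Fin 3 → ℝ} (h : dirac A f x = 0) : kd A f x = 0 := by
  change ∑ s, ‖dirac A f x s‖ ^ 2 = 0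
  simp [h]

theorem jd_of_dirac_eq {A : (Fin 3 → ℝ) → Fin 3 → ℝ} {f : (Fin 3 → ℝ) → Fin 2 → ℂ}
    {x : Fin 3 → ℝ} (h : dirac A f x = 0) (k : Fin 3) : jd A f k x = 0 := by
  simp [jd, h]

variable {A : (Fin 3 → ℝ) → Fin 3 → ℝ}

theorem kin_facts (h : Family n ψ) (hA : Continuous A) (i : ι) :
    (Continuous fun x => ∫ y, kd A (ψ i y) x) ∧ (∀ x, Integrable fun y => kd A (ψ i y) x) ∧
      ∃ R, ∀ y x, x ∉ Metric.closedBall (0 : Fin 3 → ℝ) R → kd A (ψ i y) x = 0 := by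
  obtain ⟨R, h1, h2⟩ := h.zero
  have hc := h.continuous_kd hA i
  have z1 : ∀ y, y ∉ Metric.closedBall (0 : Fin n → Fin 3 → ℝ) R → ∀ x, kd A (ψ i y) x = 0 :=
    fun y hy x => kd_of_dirac_eq (kd_zero_left (h1 i y hy) x)
  have z2 : ∀ y x, x ∉ Metric.closedBall (0 : Fin 3 → ℝ) R → kd A (ψ i y) x = 0 :=
    fun y x hx => kd_of_dirac_eq (dirac_of_zero_outside (h2 i y) hx)
  exact ⟨continuous_parametric_of_zero hc (isCompact_closedBall _ _) z1,
    (compact_fubini hc z1 (isCompact_closedBall _ _) z2).1, R, z2⟩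

theorem cur_facts (h : Family n ψ) (hA : Continuous A) (i : ι) (k : Fin 3) :
    (Continuous fun x => ∫ y, jd A (ψ i y) k x) ∧ (∀ x, Integrable fun y => jd A (ψ i y) k x) ∧
      ∃ R, ∀ y x, x ∉ Metric.closedBall (0 : Fin 3 → ℝ) R → jd A (ψ i y) k x = 0 := by
  obtain ⟨R, h1, h2⟩ := h.zero
  have hc := h.continuous_jd hA i k
  have z1 : ∀ y, y ∉ Metric.closedBall (0 : Fin n → Fin 3 → ℝ) R → ∀ x, jd A (ψ i y) k x = 0 :=
    fun y hy x => jd_of_dirac_eq (kd_zero_left (h1 i y hy) x) k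
  have z2 : ∀ y x, x ∉ Metric.closedBall (0 : Fin 3 → ℝ) R → jd A (ψ i y) k x = 0 :=
    fun y x hx => jd_of_dirac_eq (dirac_of_zero_outside (h2 i y) hx) k
  exact ⟨continuous_parametric_of_zero hc (isCompact_closedBall _ _) z1,
    (compact_fubini hc z1 (isCompact_closedBall _ _) z2).1, R, z2⟩

theorem den_facts (h : Family n ψ) (i : ι) :
    (Continuous fun x => ∫ y, ∑ t, ‖ψ i y x t‖ ^ 2) ∧
      (∀ x, Integrable fun y => ∑ t, ‖ψ i y x t‖ ^ 2) ∧
      ∃ R, ∀ y x, x ∉ Metric.closedBall (0 : Fin 3 → ℝ) R → ∑ t, ‖ψ i y x t‖ ^ 2 = 0 := by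
  obtain ⟨R, h1, h2⟩ := h.zero
  have hc := h.continuous_normSq i
  have z1 : ∀ y, y ∉ Metric.closedBall (0 : Fin n → Fin 3 → ℝ) R → ∀ x,
      ∑ t, ‖ψ i y x t‖ ^ 2 = 0 := fun y hy x => by simp [h1 i y hy]
  have z2 : ∀ y x, x ∉ Metric.closedBall (0 : Fin 3 → ℝ) R → ∑ t, ‖ψ i y x t‖ ^ 2 = 0 :=
    fun y x hx => by simp [h2 i y x hx]
  exact ⟨continuous_parametric_of_zero hc (isCompact_closedBall _ _) z1,
    (compact_fubini hc z1 (isCompact_closedBall _ _) z2).1, R, z2⟩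

theorem mul (h : Family n ψ) {G : (Fin 3 → ℝ) → ℝ} (hG : ContDiff ℝ (⊤ : ℕ∞) G) (i : ι) :
    (∀ t, ContDiff ℝ (⊤ : ℕ∞) fun p : (Fin n → Fin 3 → ℝ) × (Fin 3 → ℝ) =>
      (G p.2 : ℂ) * ψ i p.1 p.2 t) ∧
    ∀ y t, IsTest fun x => (G x : ℂ) * ψ i y x t := by
  constructor
  · intro t
    exact (Complex.ofRealCLM.contDiff.comp (hG.comp contDiff_snd)).mul (h.smooth i t)
  · intro y t
    exact IsTest.mul_left (Complex.ofRealCLM.contDiff.comp hG) (h.isTest i y t)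

theorem tden_eq (h : Family n ψ) (hA : Continuous A) {G : (Fin 3 → ℝ) → ℝ}
    (hG : ContDiff ℝ (⊤ : ℕ∞) G) (x : Fin 3 → ℝ) :
    tden (kin A ψ) (cur A ψ) (den ψ) G x = ∑ i, ∫ y, kd A (fun z t => (G z : ℂ) * ψ i y z t) x := by
  have e : ∀ i, ∫ y, kd A (fun z t => (G z : ℂ) * ψ i y z t) x = G x ^ 2 * (∫ y, kd A (ψ i y) x) +
      G x * (∑ k, fderiv ℝ G x (Pi.single k 1) * ∫ y, jd A (ψ i y) k x) +
      gsq G x * ∫ y, ∑ t, ‖ψ i y x t‖ ^ 2 := by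
    intro i
    simp_rw [fun y => kd_smul (A := A) (hG.differentiable (by simp) x)
      (fun t => (h.isTest i y t).differentiable x)]
    have i1 := (h.kin_facts hA i).2.1 x
    have i2 := fun k => (h.cur_facts hA i k).2.1 x
    have i3 := (h.den_facts i).2.1 x
    have i4 : Integrable fun y => ∑ k, fderiv ℝ G x (Pi.single k 1) * jd A (ψ i y) k x :=
      integrable_finsetSum _ fun k _ => (i2 k).const_mul _
    rw [integral_add ((i1.const_mul _).fun_add (i4.const_mul _)) (i3.const_mul _),
      integral_add (i1.const_mul _) (i4.const_mul _), integral_const_mul, integral_const_mul,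
      integral_const_mul, integral_finsetSum _ fun k _ => (i2 k).const_mul _]
    simp_rw [integral_const_mul]
  simp_rw [e]
  unfold tden kin cur den
  simp only [Finset.sum_add_distrib, ← Finset.mul_sum]
  congr 3
  simp_rw [Finset.mul_sum]
  rw [Finset.sum_comm]

end Family

namespace Family
variable {n : ℕ} {ι : Type} [Fintype ι]
  {ψ : ι → (Fin n → Fin 3 → ℝ) → (Fin 3 → ℝ) → Fin 2 → ℂ} {A : (Fin 3 → ℝ) → Fin 3 → ℝ}
  {G : (Fin 3 → ℝ) → ℝ} {u : Fin 3 → ℝ} {s : ℝ}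

theorem mul_kin_facts (h : Family n ψ) (hA : Continuous A) (hG : ContDiff ℝ (⊤ : ℕ∞) G) (i : ι) :
    Integrable (fun y => ∫ x, kd A (fun z t => (G z : ℂ) * ψ i y z t) x) ∧
    Integrable (fun x => ∫ y, kd A (fun z t => (G z : ℂ) * ψ i y z t) x) ∧
    ∫ x, ∫ y, kd A (fun z t => (G z : ℂ) * ψ i y z t) x =
      ∫ y, ∫ x, kd A (fun z t => (G z : ℂ) * ψ i y z t) x := by
  obtain ⟨R, h1, h2⟩ := h.zero
  have hc : Continuous fun p : (Fin n → Fin 3 → ℝ) × (Fin 3 → ℝ) =>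
      kd A (fun z t => (G z : ℂ) * ψ i p.1 z t) p.2 := by
    simp_rw [fun p : (Fin n → Fin 3 → ℝ) × (Fin 3 → ℝ) => kd_smul (A := A)
      (hG.differentiable (by simp) p.2) (fun t => (h.isTest i p.1 t).differentiable p.2)]
    have c1 := h.continuous_kd hA i
    have c2 := fun k => h.continuous_jd hA i k
    have c3 := h.continuous_normSq i
    have c4 := hG.continuous
    have c5 := (continuous_gsq hG).comp (continuous_snd : Continuous
      fun p : (Fin n → Fin 3 → ℝ) × (Fin 3 → ℝ) => p.2)
    have c6 := fun k => (continuous_fderiv_single hG k).comp (continuous_snd : Continuous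
      fun p : (Fin n → Fin 3 → ℝ) × (Fin 3 → ℝ) => p.2)
    simp only [Function.comp_def] at c5 c6
    exact (((c4.comp continuous_snd).pow 2).mul c1 |>.add ((c4.comp continuous_snd).mul
      (continuous_finsetSum _ fun k _ => (c6 k).mul (c2 k)))).add (c5.mul c3)
  have f := compact_fubini (h := fun y x => kd A (fun z t => (G z : ℂ) * ψ i y z t) x) hc (R := R)
    (fun y hy x => kd_of_dirac_eq (kd_zero_left (fun z t => by simp [h1 i y hy]) x))
    (isCompact_closedBall 0 R)
    (fun y x hx => kd_of_dirac_eq (dirac_of_zero_outside (fun z hz t => by simp [h2 i y z hz]) hx))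
  exact ⟨f.2.2.1, f.2.2.2.1, f.2.2.2.2⟩

theorem mul_den_facts (h : Family n ψ) (hG : ContDiff ℝ (⊤ : ℕ∞) G) (i : ι) :
    Integrable (fun y => ∫ x, ∑ t, ‖(G x : ℂ) * ψ i y x t‖ ^ 2) ∧
    Integrable (fun x => ∫ y, ∑ t, ‖(G x : ℂ) * ψ i y x t‖ ^ 2) ∧
    ∫ x, ∫ y, ∑ t, ‖(G x : ℂ) * ψ i y x t‖ ^ 2 = ∫ y, ∫ x, ∑ t, ‖(G x : ℂ) * ψ i y x t‖ ^ 2 := by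
  obtain ⟨R, h1, h2⟩ := h.zero
  have f := compact_fubini (h := fun y x => ∑ t, ‖(G x : ℂ) * ψ i y x t‖ ^ 2)
    (continuous_finsetSum _ fun t _ => ((h.mul hG i).1 t).continuous.norm.pow 2)
    (R := R) (fun y hy x => by simp [h1 i y hy]) (isCompact_closedBall 0 R)
    (fun y x hx => by simp [h2 i y x hx])
  exact ⟨f.2.2.1, f.2.2.2.1, f.2.2.2.2⟩

theorem integral_tden (h : Family n ψ) (hA : Continuous A) (hG : ContDiff ℝ (⊤ : ℕ∞) G) :
    ∫ x, tden (kin A ψ) (cur A ψ) (den ψ) G x =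
      ∑ i, ∫ y, ∫ x, kd A (fun z t => (G z : ℂ) * ψ i y z t) x := by
  simp_rw [h.tden_eq hA hG]
  rw [integral_finsetSum _ fun i _ => (h.mul_kin_facts hA hG i).2.1]
  exact Finset.sum_congr rfl fun i _ => (h.mul_kin_facts hA hG i).2.2

theorem sq_mul_den (x : Fin 3 → ℝ) :
    G x ^ 2 * den ψ x = ∑ i, ∫ y, ∑ t, ‖(G x : ℂ) * ψ i y x t‖ ^ 2 := by
  unfold den
  rw [Finset.mul_sum]
  refine Finset.sum_congr rfl fun i _ => ?_
  rw [← integral_const_mul]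
  congr 1
  ext y
  simp [mul_pow, mul_add]

theorem integral_sq_mul_den (h : Family n ψ) (hG : ContDiff ℝ (⊤ : ℕ∞) G) :
    ∫ x, G x ^ 2 * den ψ x = ∑ i, ∫ y, ∫ x, ∑ t, ‖(G x : ℂ) * ψ i y x t‖ ^ 2 := by
  simp_rw [sq_mul_den]
  rw [integral_finsetSum _ fun i _ => (h.mul_den_facts hG i).2.1]
  exact Finset.sum_congr rfl fun i _ => (h.mul_den_facts hG i).2.2

theorem continuous_fhat_mul (h : Family n ψ) (hG : ContDiff ℝ (⊤ : ℕ∞) G)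
    (hz : ∀ x, x ∉ Metric.closedBall u s → G x = 0) (i : ι) (t : Fin 2) :
    Continuous fun p : (Fin n → Fin 3 → ℝ) × (Fin 3 → ℝ) =>
      fhat (fun x => (G x : ℂ) * ψ i p.1 x t) p.2 := by
  have h1 := (h.smooth i t).continuous
  have h2 := hG.continuous
  refine continuous_parametric_of_zero
    (h := fun x (p : (Fin n → Fin 3 → ℝ) × (Fin 3 → ℝ)) =>
      Complex.exp (((-2 * Real.pi * ∑ k, p.2 k * x k : ℝ) : ℂ) * Complex.I) *
        ((G x : ℂ) * ψ i p.1 x t)) ?_ (isCompact_closedBall u s)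
    (fun x hx p => by simp [hz x hx])
  have h3 : Continuous fun q : (Fin 3 → ℝ) × (Fin n → Fin 3 → ℝ) × (Fin 3 → ℝ) =>
      ψ i q.2.1 q.1 t :=
    h1.comp ((continuous_fst.comp continuous_snd).prodMk continuous_fst)
  fun_prop

theorem momentum_bound (h : Family n ψ) (hG : ContDiff ℝ (⊤ : ℕ∞) G)
    (hz : ∀ x, x ∉ Metric.closedBall u s → G x = 0) {m : (Fin 3 → ℝ) → ℝ} (hm : Continuous m)
    (hmc : HasCompactSupport m) (hm0 : ∀ ξ, 0 ≤ m ξ) :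
    (∀ i, Integrable fun y => ∫ ξ, m ξ * ∑ t, ‖fhat (fun x => (G x : ℂ) * ψ i y x t) ξ‖ ^ 2) ∧
    ∑ i, ∫ y, ∫ ξ, m ξ * ∑ t, ‖fhat (fun x => (G x : ℂ) * ψ i y x t) ξ‖ ^ 2 ≤
      2 * (∫ ξ, m ξ) * ∫ x, G x ^ 2 := by
  obtain ⟨R, h1, h2⟩ := h.zero
  have hf := fun i t => h.continuous_fhat_mul hG hz i t
  have f := fun i => compact_fubini
    (h := fun y ξ => m ξ * ∑ t, ‖fhat (fun x => (G x : ℂ) * ψ i y x t) ξ‖ ^ 2)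
    ((hm.comp continuous_snd).mul (continuous_finsetSum _ fun t _ => (hf i t).norm.pow 2))
    (R := R) (fun y hy x => by simp [h1 i y hy, fhat]) hmc
    (fun y x hx => by simp [image_eq_zero_of_notMem_tsupport hx])
  have f' := fun i t => compact_fubini
    (h := fun y ξ => m ξ * ‖fhat (fun x => (G x : ℂ) * ψ i y x t) ξ‖ ^ 2)
    ((hm.comp continuous_snd).mul ((hf i t).norm.pow 2))
    (R := R) (fun y hy x => by simp [h1 i y hy, fhat]) hmc
    (fun y x hx => by simp [image_eq_zero_of_notMem_tsupport hx])
  refine ⟨fun i => (f i).2.2.1, ?_⟩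
  rw [← Finset.sum_congr rfl fun i _ => (f i).2.2.2.2,
    ← integral_finsetSum _ fun i _ => (f i).2.2.2.1]
  have hr : 2 * (∫ ξ, m ξ) * ∫ x, G x ^ 2 = ∫ ξ, m ξ * (2 * ∫ x, G x ^ 2) := by
    rw [integral_mul_const]; ring
  rw [hr]
  refine integral_mono (integrable_finsetSum _ fun i _ => (f i).2.2.2.1)
    ((hm.integrable_of_hasCompactSupport hmc).mul_const _) fun ξ => ?_
  have e1 : ∑ i, ∫ y, m ξ * ∑ t, ‖fhat (fun x => (G x : ℂ) * ψ i y x t) ξ‖ ^ 2 =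
      m ξ * ∑ t, ∑ i, ∫ y, ‖fhat (fun x => (G x : ℂ) * ψ i y x t) ξ‖ ^ 2 := by
    rw [Finset.sum_comm, Finset.mul_sum]
    have : ∀ i, ∫ y, m ξ * ∑ t, ‖fhat (fun x => (G x : ℂ) * ψ i y x t) ξ‖ ^ 2 =
        ∑ t, m ξ * ∫ y, ‖fhat (fun x => (G x : ℂ) * ψ i y x t) ξ‖ ^ 2 := by
      intro i
      simp_rw [Finset.mul_sum]
      rw [integral_finsetSum _ fun t _ => (f' i t).1 ξ]
      simp_rw [integral_const_mul]
    simp_rw [this, Finset.mul_sum]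
  change ∑ i, ∫ y, m ξ * ∑ t, ‖fhat (fun x => (G x : ℂ) * ψ i y x t) ξ‖ ^ 2 ≤ _
  rw [e1]
  refine mul_le_mul_of_nonneg_left ?_ (hm0 ξ)
  have e2 : ∀ t, ∑ i, ∫ y, ‖fhat (fun x => (G x : ℂ) * ψ i y x t) ξ‖ ^ 2 ≤ ∫ x, G x ^ 2 := by
    intro t
    have := h.exclusion t (fun x => Complex.exp (((-2 * Real.pi * ∑ k, ξ k * x k : ℝ) : ℂ) *
      Complex.I) * (G x : ℂ)) (by have := hG.continuous; fun_prop)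
      (HasCompactSupport.intro (isCompact_closedBall u s) fun x hx => by simp [hz x hx])
    simp_rw [norm_mul, Complex.norm_exp_ofReal_mul_I, one_mul, Complex.norm_real,
      Real.norm_eq_abs, sq_abs] at this
    unfold fhat
    simpa only [mul_assoc] using this
  rw [Fin.sum_univ_two]
  linarith [e2 0, e2 1]

end Family

theorem exists_oneBody : ∃ C0 : ℝ, 0 < C0 ∧ ∀ A : (Fin 3 → ℝ) → Fin 3 → ℝ,
    ContDiff ℝ (⊤ : ℕ∞) A → ∀ (n : ℕ) (ι : Type) [Fintype ι]
    (ψ : ι → (Fin n → Fin 3 → ℝ) → (Fin 3 → ℝ) → Fin 2 → ℂ), Family n ψ →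
    OneBody C0 A (Family.kin A ψ) (Family.cur A ψ) (Family.den ψ) := by
  obtain ⟨C0, hC0, hloc⟩ := kd_local_lower
  refine ⟨C0, hC0, fun A hA n ι _ ψ h => ?_⟩
  have hAc := hA.continuous
  refine ⟨hA, ?_, ?_, ?_, ?_, ?_, ?_⟩
  · exact continuous_finsetSum _ fun i _ => (h.kin_facts hAc i).1
  · exact fun k => continuous_finsetSum _ fun i _ => (h.cur_facts hAc i k).1
  · exact continuous_finsetSum _ fun i _ => (h.den_facts i).1
  · obtain ⟨R, h1, h2⟩ := h.zero
    refine ⟨R, fun x hx => ⟨?_, fun k => ?_, ?_⟩⟩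
    · exact Finset.sum_eq_zero fun i _ => by
        simp [fun y => Family.kd_of_dirac_eq (Family.dirac_of_zero_outside (A := A) (h2 i y) hx)]
    · exact Finset.sum_eq_zero fun i _ => by
        simp [fun y => Family.jd_of_dirac_eq (Family.dirac_of_zero_outside (A := A) (h2 i y) hx) k]
    · exact Finset.sum_eq_zero fun i _ => by simp [fun y => h2 i y x hx]
  · intro x s v
    have e : ∀ i, s ^ 2 * (∫ y, kd A (ψ i y) x) + s * (∑ k, v k * ∫ y, jd A (ψ i y) k x) +
        (∑ k, v k ^ 2) * (∫ y, ∑ t, ‖ψ i y x t‖ ^ 2) =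
        ∫ y, (s ^ 2 * kd A (ψ i y) x + s * (∑ k, v k * jd A (ψ i y) k x) +
          (∑ k, v k ^ 2) * ∑ t, ‖ψ i y x t‖ ^ 2) := by
      intro i
      have i1 := (h.kin_facts hAc i).2.1 x
      have i2 := fun k => (h.cur_facts hAc i k).2.1 x
      have i3 := (h.den_facts i).2.1 x
      have i4 : Integrable fun y => ∑ k, v k * jd A (ψ i y) k x :=
        integrable_finsetSum _ fun k _ => (i2 k).const_mul _
      rw [integral_add ((i1.const_mul _).fun_add (i4.const_mul _)) (i3.const_mul _),
        integral_add (i1.const_mul _) (i4.const_mul _), integral_const_mul, integral_const_mul,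
        integral_const_mul, integral_finsetSum _ fun k _ => (i2 k).const_mul _]
      simp_rw [integral_const_mul]
    have : s ^ 2 * Family.kin A ψ x + s * (∑ k, v k * Family.cur A ψ k x) +
        (∑ k, v k ^ 2) * Family.den ψ x = ∑ i, ∫ y, (s ^ 2 * kd A (ψ i y) x +
          s * (∑ k, v k * jd A (ψ i y) k x) + (∑ k, v k ^ 2) * ∑ t, ‖ψ i y x t‖ ^ 2) := by
      simp_rw [← e, Finset.sum_add_distrib, ← Finset.mul_sum]
      unfold Family.kin Family.cur Family.den
      congr 3
      simp_rw [Finset.mul_sum]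
      rw [Finset.sum_comm]
    rw [this]
    exact Finset.sum_nonneg fun i _ => integral_nonneg fun y => kd_pos A (ψ i y) x s v
  · intro G hG u s hs hz ε η b hε hε1 hη hb
    obtain ⟨c, hc⟩ := hloc A hA u s hs
    rw [h.integral_tden hAc hG, h.integral_sq_mul_den hG]
    set E := C0 / ε ^ 3 * (∫ x in Metric.closedBall u (2 * s), gradSq A x) ^ 2 with hE
    have ha : 0 < (1 - ε) * η := mul_pos (by linarith) hη
    obtain ⟨im, hm⟩ := h.momentum_bound hG hz (continuous_max_momentum ((1 - ε) * η) b c)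
      (hasCompactSupport_max_momentum ha b c) fun ξ => le_max_right _ _
    rw [integral_max_momentum ha hb] at hm
    have ik := fun i => (h.mul_kin_facts hAc hG i).1
    have id := fun i => (h.mul_den_facts hG i).1
    have key : ∀ i, b * (∫ y, ∫ x, ∑ t, ‖(G x : ℂ) * ψ i y x t‖ ^ 2) ≤
        η * (∫ y, ∫ x, kd A (fun z t => (G z : ℂ) * ψ i y z t) x) +
        η * E * (∫ y, ∫ x, ∑ t, ‖(G x : ℂ) * ψ i y x t‖ ^ 2) +
        ∫ y, ∫ ξ, max (b - (1 - ε) * η * nsq (fun k => 2 * Real.pi * ξ k + c k)) 0 *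
          ∑ t, ‖fhat (fun x => (G x : ℂ) * ψ i y x t) ξ‖ ^ 2 := by
      intro i
      rw [← integral_const_mul, ← integral_const_mul, ← integral_const_mul,
        ← integral_add ((ik i).const_mul _) ((id i).const_mul _),
        ← integral_add (((ik i).const_mul _).fun_add ((id i).const_mul _)) (im i)]
      refine integral_mono ((id i).const_mul _)
        ((((ik i).const_mul _).fun_add ((id i).const_mul _)).add (im i)) fun y => ?_
      have k1 := kd_const_lower ((h.mul hG i).2 y) ha b c
      have k2 := mul_le_mul_of_nonneg_left (hc (fun x t => (G x : ℂ) * ψ i y x t)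
        ((h.mul hG i).2 y) (fun x hx t => by simp [hz x hx]) ε hε) hη.le
      simp only []
      rw [← hE] at k2
      nlinarith
    have := Finset.sum_le_sum fun i (_ : i ∈ Finset.univ) => key i
    simp only [Finset.sum_add_distrib, ← Finset.mul_sum] at this
    refine this.trans ?_
    refine add_le_add le_rfl (hm.trans (le_of_eq ?_))
    ring

/-- Insertion of a particle at position `j`. -/
def ins {β : Type*} {n : ℕ} (j : Fin (n + 1)) (x : β) (y : Fin n → β) : Fin (n + 1) → β :=
  Fin.insertNth (α := fun _ => β) j x y

section ins
variable {β : Type*} {n : ℕ}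

@[simp] theorem ins_same (j : Fin (n + 1)) (x : β) (y : Fin n → β) : ins j x y j = x :=
  Fin.insertNth_apply_same (α := fun _ => β) j x y

@[simp] theorem ins_succAbove (j : Fin (n + 1)) (x : β) (y : Fin n → β) (k : Fin n) :
    ins j x y (j.succAbove k) = y k :=
  Fin.insertNth_apply_succAbove (α := fun _ => β) j x y k

@[simp] theorem update_ins (j : Fin (n + 1)) (x x' : β) (y : Fin n → β) :
    Function.update (ins j x y) j x' = ins j x' y :=
  Fin.update_insertNth (α := fun _ => β) j x x' y

theorem ins_of_ne {i j : Fin (n + 1)} (h : i ≠ j) (x x' : β) (y : Fin n → β) :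
    ins j x y i = ins j x' y i := by
  obtain ⟨k, rfl⟩ := Fin.exists_succAbove_eq h
  simp

theorem contDiff_ins (j : Fin (n + 1)) : ContDiff ℝ (⊤ : ℕ∞)
    fun p : (Fin n → Fin 3 → ℝ) × (Fin 3 → ℝ) => ins j p.2 p.1 := by
  rw [contDiff_pi]
  refine (Fin.forall_iff_succAbove j).2 ⟨?_, fun k => ?_⟩
  · simpa using contDiff_snd
  · simp only [ins_succAbove]
    exact (contDiff_apply ℝ (Fin 3 → ℝ) k).comp contDiff_fst

theorem measurePreserving_ins (j : Fin (n + 1)) : MeasurePreserving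
    (MeasurableEquiv.piFinSuccAbove (fun _ : Fin (n + 1) => Fin 3 → ℝ) j).symm :=
  (volume_preserving_piFinSuccAbove (fun _ => Fin 3 → ℝ) j).symm _

theorem integral_ins {E : Type*} [NormedAddCommGroup E] [NormedSpace ℝ E] (j : Fin (n + 1))
    {g : (Fin (n + 1) → Fin 3 → ℝ) → E} (hg : Integrable g) :
    ∫ X, g X = ∫ y, ∫ x, g (ins j x y) := by
  have h1 := (measurePreserving_ins (n := n) j).integral_comp' g
  have h2 := ((measurePreserving_ins (n := n) j).integrable_comp_emb
    (MeasurableEquiv.measurableEmbedding _)).2 hg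
  rw [← h1]
  exact integral_prod_symm _ h2

theorem lintegral_ins (j : Fin (n + 1)) {g : (Fin (n + 1) → Fin 3 → ℝ) → ENNReal}
    (hg : Measurable g) : ∫⁻ X, g X = ∫⁻ y, ∫⁻ x, g (ins j x y) := by
  have h1 := (measurePreserving_ins (n := n) j).lintegral_comp hg
  rw [← h1]
  exact lintegral_prod_symm' _ (hg.comp (MeasurableEquiv.measurable _))

theorem sum_ins {M : Type*} [AddCommMonoid M] (j : Fin (n + 1)) (f : (Fin (n + 1) → Fin 2) → M) :
    ∑ S, f S = ∑ σ : Fin n → Fin 2, ∑ t : Fin 2, f (ins j t σ) := by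
  rw [← (Fin.insertNthEquiv (fun _ => Fin 2) j).sum_comp f, Fintype.sum_prod_type_right]
  rfl

end ins

/-- Continuous compactly supported spin functions. -/
def IsCC {N : ℕ} {E : Type*} [TopologicalSpace E] [Zero E]
    (a : (Fin N → Fin 3 → ℝ) → (Fin N → Fin 2) → E) : Prop :=
  ∀ S, Continuous (fun X => a X S) ∧ HasCompactSupport fun X => a X S

namespace IsCC

theorem integrable {N : ℕ} {E : Type*} [NormedAddCommGroup E]
    {a : (Fin N → Fin 3 → ℝ) → (Fin N → Fin 2) → E} (h : IsCC a) (S : Fin N → Fin 2) :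
    Integrable fun X => a X S := (h S).1.integrable_of_hasCompactSupport (h S).2

theorem exists_radius {N : ℕ} {E : Type*} [NormedAddCommGroup E]
    {a : (Fin N → Fin 3 → ℝ) → (Fin N → Fin 2) → E} (h : IsCC a) :
    ∃ R, ∀ X, X ∉ Metric.closedBall (0 : Fin N → Fin 3 → ℝ) R → ∀ S, a X S = 0 := by
  have := fun S => (h S).2.isCompact.isBounded.subset_closedBall (0 : Fin N → Fin 3 → ℝ)
  choose r hr using this
  refine ⟨∑ S, |r S|, fun X hX S => ?_⟩
  by_contra hne
  refine hX ?_
  have h1 := hr S (subset_tsupport _ hne)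
  rw [mem_closedBall_zero_iff] at h1 ⊢
  exact h1.trans ((le_abs_self _).trans
    (Finset.single_le_sum (f := fun S => |r S|) (fun _ _ => abs_nonneg _) (Finset.mem_univ S)))

theorem of_zero {N : ℕ} {E : Type*} [NormedAddCommGroup E]
    {a : (Fin N → Fin 3 → ℝ) → (Fin N → Fin 2) → E} (h : ∀ S, Continuous fun X => a X S) {R : ℝ}
    (hz : ∀ X, X ∉ Metric.closedBall (0 : Fin N → Fin 3 → ℝ) R → ∀ S, a X S = 0) : IsCC a :=
  fun S => ⟨h S, HasCompactSupport.intro (isCompact_closedBall 0 R) fun X hX => hz X hX S⟩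

theorem sum_integral {n : ℕ} {E : Type*} [NormedAddCommGroup E] [NormedSpace ℝ E]
    {a : (Fin (n + 1) → Fin 3 → ℝ) → (Fin (n + 1) → Fin 2) → E} (h : IsCC a) (j : Fin (n + 1)) :
    ∑ S, ∫ X, a X S = ∑ σ : Fin n → Fin 2, ∑ t, ∫ y, ∫ x, a (ins j x y) (ins j t σ) := by
  rw [sum_ins j]
  exact Finset.sum_congr rfl fun σ _ => Finset.sum_congr rfl fun t _ =>
    integral_ins j (h.integrable _)

variable {N : ℕ} {a b : (Fin N → Fin 3 → ℝ) → (Fin N → Fin 2) → ℂ}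

theorem sub (ha : IsCC a) (hb : IsCC b) : IsCC fun X S => a X S - b X S :=
  fun S => ⟨(ha S).1.sub (hb S).1, (ha S).2.sub (hb S).2⟩

theorem const_mul (c : ℂ) (ha : IsCC a) : IsCC fun X S => c * a X S :=
  fun S => ⟨continuous_const.mul (ha S).1, (ha S).2.mul_left⟩

theorem sum {ι : Type*} (s : Finset ι) {f : ι → (Fin N → Fin 3 → ℝ) → (Fin N → Fin 2) → ℂ}
    (hf : ∀ i, IsCC (f i)) : IsCC fun X S => ∑ i ∈ s, f i X S := by
  classical
  induction s using Finset.induction_on with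
  | empty => exact fun S => ⟨by simpa using continuous_const, by
      simp only [Finset.sum_empty]
      exact HasCompactSupport.zero⟩
  | insert i s hi ih =>
    simp_rw [Finset.sum_insert hi]
    exact fun S => ⟨(hf i S).1.add (ih S).1, (hf i S).2.add (ih S).2⟩

theorem conj_mul (ha : IsCC a) (hb : IsCC b) : IsCC fun X S => starRingEnd ℂ (a X S) * b X S :=
  fun S => ⟨(Complex.continuous_conj.comp (ha S).1).mul (hb S).1, (hb S).2.mul_left⟩

end IsCC

/-- The inner product of spin functions. -/
def inn {N : ℕ} (a b : (Fin N → Fin 3 → ℝ) → (Fin N → Fin 2) → ℂ) : ℂ :=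
  ∑ S, ∫ X, starRingEnd ℂ (a X S) * b X S

section inn
variable {N : ℕ} {a b c : (Fin N → Fin 3 → ℝ) → (Fin N → Fin 2) → ℂ}

theorem inn_sub_right (ha : IsCC a) (hb : IsCC b) (hc : IsCC c) :
    inn a (fun X S => b X S - c X S) = inn a b - inn a c := by
  unfold inn
  rw [← Finset.sum_sub_distrib]
  refine Finset.sum_congr rfl fun S _ => ?_
  rw [← integral_sub ((ha.conj_mul hb).integrable S) ((ha.conj_mul hc).integrable S)]
  simp_rw [mul_sub]

theorem inn_const_mul_right (r : ℂ) : inn a (fun X S => r * b X S) = r * inn a b := by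
  unfold inn
  rw [Finset.mul_sum]
  refine Finset.sum_congr rfl fun S _ => ?_
  rw [← integral_const_mul]
  congr 1; ext X; ring

theorem inn_sum_right {ι : Type*} (s : Finset ι)
    {f : ι → (Fin N → Fin 3 → ℝ) → (Fin N → Fin 2) → ℂ} (ha : IsCC a) (hf : ∀ i, IsCC (f i)) :
    inn a (fun X S => ∑ i ∈ s, f i X S) = ∑ i ∈ s, inn a (f i) := by
  unfold inn
  rw [Finset.sum_comm]
  refine Finset.sum_congr rfl fun S _ => ?_
  rw [← integral_finsetSum _ fun i _ => (ha.conj_mul (hf i)).integrable S]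
  simp_rw [Finset.mul_sum]

theorem inn_conj : starRingEnd ℂ (inn a b) = inn b a := by
  unfold inn
  rw [map_sum]
  refine Finset.sum_congr rfl fun S _ => ?_
  rw [← integral_conj]
  congr 1; ext X; simp [mul_comm]

theorem inn_self : inn a a = ((∑ S, ∫ X, ‖a X S‖ ^ 2 : ℝ) : ℂ) := by
  unfold inn
  push_cast
  refine Finset.sum_congr rfl fun S _ => ?_
  rw [← integral_complex_ofReal]
  congr 1; ext X
  rw [Complex.conj_mul']
  push_cast; rfl

end inn

section exclusion
variable {n : ℕ} {Ψ : (Fin (n + 1) → Fin 3 → ℝ) → (Fin (n + 1) → Fin 2) → ℂ} {t : Fin 2}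
  {F : (Fin 3 → ℝ) → ℂ}

theorem IsWaveFun.isCC {N : ℕ} {Ψ : (Fin N → Fin 3 → ℝ) → (Fin N → Fin 2) → ℂ}
    (h : IsWaveFun N Ψ) : IsCC Ψ := fun S => ⟨(h.smooth S).continuous, h.compactSupport S⟩

/-- Removal of a particle in the state `F` with spin `t` from the slot `j`. -/
def annih (F : (Fin 3 → ℝ) → ℂ) (t : Fin 2)
    (Ψ : (Fin (n + 1) → Fin 3 → ℝ) → (Fin (n + 1) → Fin 2) → ℂ) (j : Fin (n + 1))
    (y : Fin n → Fin 3 → ℝ) (σ : Fin n → Fin 2) : ℂ :=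
  ∫ x, F x * Ψ (ins j x y) (ins j t σ)

/-- Projection of the particle in slot `j` onto the state `conj F` with spin `t`. -/
def slotProj (F : (Fin 3 → ℝ) → ℂ) (t : Fin 2)
    (Ψ : (Fin (n + 1) → Fin 3 → ℝ) → (Fin (n + 1) → Fin 2) → ℂ) (j : Fin (n + 1))
    (X : Fin (n + 1) → Fin 3 → ℝ) (S : Fin (n + 1) → Fin 2) : ℂ :=
  if S j = t then starRingEnd ℂ (F (X j)) *
    ∫ x, F x * Ψ (Function.update X j x) (Function.update S j t) else 0

theorem isCC_slotProj (hΨ : IsCC Ψ) (hF : Continuous F) (hFc : HasCompactSupport F)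
    (j : Fin (n + 1)) : IsCC (slotProj F t Ψ j) := by
  obtain ⟨R, hR⟩ := hΨ.exists_radius
  obtain ⟨R', hR'⟩ := hFc.isCompact.isBounded.subset_closedBall 0
  refine IsCC.of_zero (R := max R R') (fun S => ?_) fun X hX S => ?_
  · unfold slotProj
    split_ifs
    · refine (Complex.continuous_conj.comp (hF.comp (continuous_apply j))).mul ?_
      refine continuous_parametric_of_zero (h := fun x (X : Fin (n + 1) → Fin 3 → ℝ) =>
        F x * Ψ (Function.update X j x) (Function.update S j t)) ?_ hFc
        (fun x hx X => by simp [image_eq_zero_of_notMem_tsupport hx])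
      exact (hF.comp continuous_fst).mul ((hΨ _).1.comp
        (continuous_snd.update j continuous_fst))
    · exact continuous_const
  · unfold slotProj
    by_contra hne
    simp only [ite_eq_right_iff, not_forall] at hne
    obtain ⟨-, hne⟩ := hne
    obtain ⟨h1, h2⟩ := mul_ne_zero_iff.1 hne
    have h3 : X j ∈ Metric.closedBall 0 R' := by
      refine hR' (subset_tsupport _ fun h => h1 ?_)
      rw [h, map_zero]
    obtain ⟨x, hx⟩ : ∃ x, Ψ (Function.update X j x) (Function.update S j t) ≠ 0 := by
      by_contra! h
      exact h2 (by simp [h])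
    have h4 : Function.update X j x ∈ Metric.closedBall 0 R := by
      by_contra h
      exact hx (hR _ h _)
    rw [mem_closedBall_zero_iff] at h3 h4
    refine hX (mem_closedBall_zero_iff.2 ?_)
    have h0 : 0 ≤ max R R' := le_max_of_le_left ((norm_nonneg _).trans h4)
    refine (pi_norm_le_iff_of_nonneg h0).2 fun i => ?_
    by_cases hi : i = j
    · subst hi; exact h3.trans (le_max_right _ _)
    · have := (norm_le_pi_norm (Function.update X j x) i).trans h4
      rw [Function.update_of_ne hi] at this
      exact this.trans (le_max_left _ _)

theorem slotProj_ins (j : Fin (n + 1)) (x : Fin 3 → ℝ) (y : Fin n → Fin 3 → ℝ) (t' : Fin 2)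
    (σ : Fin n → Fin 2) : slotProj F t Ψ j (ins j x y) (ins j t' σ) =
      if t' = t then starRingEnd ℂ (F x) * annih F t Ψ j y σ else 0 := by
  simp [slotProj, annih]

theorem inn_slotProj {Θ : (Fin (n + 1) → Fin 3 → ℝ) → (Fin (n + 1) → Fin 2) → ℂ} (hΨ : IsCC Ψ)
    (hΘ : IsCC Θ) (hF : Continuous F) (hFc : HasCompactSupport F) (j : Fin (n + 1)) :
    inn (slotProj F t Ψ j) Θ = ∑ σ : Fin n → Fin 2, ∫ y,
      starRingEnd ℂ (annih F t Ψ j y σ) * annih F t Θ j y σ := by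
  unfold inn
  rw [((isCC_slotProj hΨ hF hFc j).conj_mul hΘ).sum_integral j]
  refine Finset.sum_congr rfl fun σ _ => ?_
  rw [Finset.sum_eq_single t]
  · congr 1; ext y
    unfold annih
    rw [← integral_const_mul]
    congr 1; ext x
    rw [slotProj_ins, if_pos rfl]
    simp [annih]
    ring
  · intro t' _ h
    simp [slotProj_ins, h]
  · simp

theorem annih_slotProj_self (j : Fin (n + 1)) (y : Fin n → Fin 3 → ℝ) (σ : Fin n → Fin 2) :
    annih F t (slotProj F t Ψ j) j y σ = ((∫ x, ‖F x‖ ^ 2 : ℝ) : ℂ) * annih F t Ψ j y σ := by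
  have h1 : annih F t (slotProj F t Ψ j) j y σ =
      ∫ x, ((‖F x‖ ^ 2 : ℝ) : ℂ) * annih F t Ψ j y σ := by
    change ∫ x, F x * slotProj F t Ψ j (ins j x y) (ins j t σ) = _
    congr 1; ext x
    rw [slotProj_ins, if_pos rfl, ← mul_assoc, Complex.mul_conj']
    push_cast; rfl
  rw [h1, integral_mul_const, integral_complex_ofReal]

theorem annih_slotProj_of_ne (h : IsWaveFun (n + 1) Ψ) (hF : Continuous F)
    (hFc : HasCompactSupport F) {i j : Fin (n + 1)} (hij : i ≠ j) (y : Fin n → Fin 3 → ℝ)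
    (σ : Fin n → Fin 2) : annih F t (slotProj F t Ψ i) j y σ = 0 := by
  set K : (Fin 3 → ℝ) → (Fin 3 → ℝ) → ℂ := fun x x' => F x * (F x' *
    Ψ (Function.update (ins j x y) i x') (Function.update (ins j t σ) i t)) with hK
  have hKc : Continuous (Function.uncurry K) := by
    have h1 := (h.isCC (Function.update (ins j t σ) i t)).1
    have h2 : Continuous fun p : (Fin 3 → ℝ) × (Fin 3 → ℝ) =>
        Function.update (ins j p.1 y) i p.2 :=
      ((contDiff_ins j).continuous.comp
        ((continuous_const (y := y)).prodMk continuous_fst)).update i continuous_snd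
    exact (hF.comp continuous_fst).mul ((hF.comp continuous_snd).mul (h1.comp h2))
  have hanti : ∀ x x', K x' x = - K x x' := by
    intro x x'
    have h1 := h.antisymm (Equiv.swap i j) (Function.update (ins j x y) i x')
      (Function.update (ins j t σ) i t)
    have h2 : (fun k => Function.update (ins j x y) i x' (Equiv.swap i j k)) =
        Function.update (ins j x' y) i x := by
      funext k
      by_cases hki : k = i
      · subst hki
        rw [Equiv.swap_apply_left, Function.update_of_ne hij.symm]; simp
      · by_cases hkj : k = j
        · subst hkj
          rw [Equiv.swap_apply_right, Function.update_of_ne hij.symm]; simp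
        · rw [Equiv.swap_apply_of_ne_of_ne hki hkj, Function.update_of_ne hki,
            Function.update_of_ne hki, ins_of_ne hkj]
    have h3 : (fun k => Function.update (ins j t σ) i t (Equiv.swap i j k)) =
        Function.update (ins j t σ) i t := by
      funext k
      by_cases hki : k = i
      · subst hki
        rw [Equiv.swap_apply_left, Function.update_of_ne hij.symm]; simp
      · by_cases hkj : k = j
        · subst hkj
          rw [Equiv.swap_apply_right, Function.update_of_ne hij.symm]; simp
        · rw [Equiv.swap_apply_of_ne_of_ne hki hkj]
    rw [h2, h3, Equiv.Perm.sign_swap hij] at h1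
    simp only [hK, h1]
    push_cast
    ring
  have hsupp : HasCompactSupport (Function.uncurry K) :=
    HasCompactSupport.intro (hFc.isCompact.prod hFc.isCompact) fun p hp => by
      by_cases hx : p.1 ∈ tsupport F
      · have : p.2 ∉ tsupport F := fun hy => hp ⟨hx, hy⟩
        simp [Function.uncurry, hK, image_eq_zero_of_notMem_tsupport this]
      · simp [Function.uncurry, hK, image_eq_zero_of_notMem_tsupport hx]
  have hswap := integral_integral_swap_of_hasCompactSupport (μ := volume) (ν := volume) hKc hsupp
  have hzero : ∫ x, ∫ x', K x x' = 0 := by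
    have e : ∫ x', ∫ x, K x x' = -∫ x, ∫ x', K x x' := by
      rw [← integral_neg]
      congr 1; ext x'
      rw [← integral_neg]
      congr 1; ext x
      exact hanti x' x
    rw [e] at hswap
    exact self_eq_neg.1 hswap
  change ∫ x, F x * (if ins j t σ i = t then starRingEnd ℂ (F (ins j x y i)) *
    ∫ x', F x' * Ψ (Function.update (ins j x y) i x') (Function.update (ins j t σ) i t)
      else 0) = 0
  split_ifs
  · have e : ∀ x, F x * (starRingEnd ℂ (F (ins j x y i)) * ∫ x', F x' *
        Ψ (Function.update (ins j x y) i x') (Function.update (ins j t σ) i t)) =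
        starRingEnd ℂ (F (ins j 0 y i)) * ∫ x', K x x' := by
      intro x
      rw [ins_of_ne hij x 0, hK]
      simp only []
      rw [integral_const_mul]
      ring
    simp_rw [e]
    rw [integral_const_mul, hzero, mul_zero]
  · simp

theorem pauli_exclusion (h : IsWaveFun (n + 1) Ψ) (t : Fin 2) (hF : Continuous F)
    (hFc : HasCompactSupport F) :
    ∑ j, ∑ σ : Fin n → Fin 2, ∫ y, ‖annih F t Ψ j y σ‖ ^ 2 ≤ ∫ x, ‖F x‖ ^ 2 := by
  set M := ∫ x, ‖F x‖ ^ 2 with hM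
  set H : Fin (n + 1) → ℝ := fun j => ∑ σ : Fin n → Fin 2, ∫ y, ‖annih F t Ψ j y σ‖ ^ 2 with hH
  have hM0 : 0 ≤ M := integral_nonneg fun x => sq_nonneg _
  rcases hM0.eq_or_lt with hM1 | hM1
  · have hF0 : F = 0 := by
      by_contra hne
      obtain ⟨x, hx⟩ := Function.ne_iff.1 hne
      have h1 : HasCompactSupport fun x => ‖F x‖ ^ 2 :=
        hFc.comp_left (g := fun z : ℂ => ‖z‖ ^ 2) (by simp)
      have h2 : ‖F x‖ ^ 2 ≠ 0 := pow_ne_zero _ (norm_ne_zero_iff.2 hx)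
      have h3 : Continuous fun x => ‖F x‖ ^ 2 := hF.norm.pow 2
      have h4 : 0 < ∫ x, ‖F x‖ ^ 2 := h3.integral_pos_of_hasCompactSupport_nonneg_nonzero h1
        (fun x => sq_nonneg ‖F x‖) h2
      rw [← hM] at h4
      exact h4.ne hM1
    have h1 : ∀ j y σ, annih F t Ψ j y σ = 0 := fun j y σ => by simp [hF0, annih]
    simpa [hH, h1] using hM0
  have hΨ := h.isCC
  have hP := fun j => isCC_slotProj (t := t) hΨ hF hFc j
  set Θ : (Fin (n + 1) → Fin 3 → ℝ) → (Fin (n + 1) → Fin 2) → ℂ := fun X S =>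
    Ψ X S - (M : ℂ)⁻¹ * ∑ i, slotProj F t Ψ i X S with hΘ
  have hS := IsCC.sum Finset.univ hP
  have hΘc : IsCC Θ := hΨ.sub (hS.const_mul _)
  have hsplit : ∀ j, inn (slotProj F t Ψ j) Ψ = H j := by
    intro j
    rw [inn_slotProj hΨ hΨ hF hFc, hH]
    push_cast
    refine Finset.sum_congr rfl fun σ _ => ?_
    rw [← integral_complex_ofReal]
    congr 1; ext y
    rw [Complex.conj_mul']
    push_cast; rfl
  have hcross : ∀ i j, inn (slotProj F t Ψ j) (slotProj F t Ψ i) =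
      if i = j then (M : ℂ) * H j else 0 := by
    intro i j
    rw [inn_slotProj hΨ (hP i) hF hFc]
    split_ifs with hij
    · subst hij
      simp_rw [annih_slotProj_self]
      rw [← hsplit, inn_slotProj hΨ hΨ hF hFc, Finset.mul_sum]
      refine Finset.sum_congr rfl fun σ _ => ?_
      rw [← integral_const_mul]
      congr 1; ext y; ring
    · simp [annih_slotProj_of_ne h hF hFc hij]
  have hMC : (M : ℂ) ≠ 0 := by exact_mod_cast hM1.ne'
  have horth : ∀ j, inn (slotProj F t Ψ j) Θ = 0 := by
    intro j
    rw [hΘ, inn_sub_right (hP j) hΨ (hS.const_mul _), inn_const_mul_right,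
      inn_sum_right _ (hP j) hP, hsplit]
    simp_rw [hcross]
    simp [hMC]
  have hΘΘ : inn Θ Θ = 1 - (M : ℂ)⁻¹ * ∑ j, (H j : ℂ) := by
    have e1 : inn Θ Θ = inn Θ Ψ := by
      conv_lhs => rw [show inn Θ Θ = inn Θ (fun X S =>
        Ψ X S - (M : ℂ)⁻¹ * ∑ i, slotProj F t Ψ i X S) from rfl]
      rw [inn_sub_right hΘc hΨ (hS.const_mul _), inn_const_mul_right, inn_sum_right _ hΘc hP]
      simp_rw [← inn_conj (a := slotProj F t Ψ _), horth]
      simp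
    have e2 : inn Ψ Θ = 1 - (M : ℂ)⁻¹ * ∑ j, (H j : ℂ) := by
      rw [hΘ, inn_sub_right hΨ hΨ (hS.const_mul _), inn_const_mul_right, inn_sum_right _ hΨ hP,
        inn_self, h.normalized]
      simp_rw [← inn_conj (a := slotProj F t Ψ _), hsplit]
      simp
    rw [e1, ← inn_conj, e2]
    simp
  rw [inn_self] at hΘΘ
  have hre : (∑ S, ∫ X, ‖Θ X S‖ ^ 2 : ℝ) = 1 - M⁻¹ * ∑ j, H j := by exact_mod_cast hΘΘ
  have hpos : 0 ≤ ∑ S, ∫ X, ‖Θ X S‖ ^ 2 :=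
    Finset.sum_nonneg fun S _ => integral_nonneg fun X => sq_nonneg _
  rw [hre] at hpos
  have h1 : M⁻¹ * ∑ j, H j ≤ 1 := by linarith
  have h2 := mul_le_mul_of_nonneg_left h1 hM0
  rwa [mul_inv_cancel_left₀ hM1.ne', mul_one] at h2

end exclusion

/-- The family of one-particle slices of a wave function. -/
def slice {n : ℕ} (Ψ : (Fin (n + 1) → Fin 3 → ℝ) → (Fin (n + 1) → Fin 2) → ℂ)
    (i : Fin (n + 1) × (Fin n → Fin 2)) (y : Fin n → Fin 3 → ℝ) (x : Fin 3 → ℝ) (t : Fin 2) : ℂ :=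
  Ψ (ins i.1 x y) (ins i.1 t i.2)

section slice
variable {n : ℕ} {Ψ : (Fin (n + 1) → Fin 3 → ℝ) → (Fin (n + 1) → Fin 2) → ℂ}

theorem ins_notMem_closedBall_left (j : Fin (n + 1)) {R : ℝ} {y : Fin n → Fin 3 → ℝ}
    (hy : y ∉ Metric.closedBall 0 R) (x : Fin 3 → ℝ) : ins j x y ∉ Metric.closedBall 0 R := by
  intro h
  rw [mem_closedBall_zero_iff] at h hy
  refine hy ((pi_norm_le_iff_of_nonneg ((norm_nonneg _).trans h)).2 fun k => ?_)
  simpa using (norm_le_pi_norm (ins j x y) (j.succAbove k)).trans h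

theorem ins_notMem_closedBall_right (j : Fin (n + 1)) {R : ℝ} (y : Fin n → Fin 3 → ℝ)
    {x : Fin 3 → ℝ} (hx : x ∉ Metric.closedBall 0 R) : ins j x y ∉ Metric.closedBall 0 R := by
  intro h
  rw [mem_closedBall_zero_iff] at h hx
  refine hx ?_
  simpa using (norm_le_pi_norm (ins j x y) j).trans h

theorem family_slice (h : IsWaveFun (n + 1) Ψ) : Family n (slice Ψ) := by
  refine ⟨fun i t => (h.smooth _).comp (contDiff_ins i.1), ?_, fun t F hF hFc => ?_⟩
  · obtain ⟨R, hR⟩ := h.isCC.exists_radius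
    exact ⟨R, fun i y hy x t => hR _ (ins_notMem_closedBall_left _ hy x) _,
      fun i y x hx t => hR _ (ins_notMem_closedBall_right _ y hx) _⟩
  · rw [Fintype.sum_prod_type]
    exact pauli_exclusion h t hF hFc

theorem pdC_ins {Φ : (Fin (n + 1) → Fin 3 → ℝ) → ℂ} (hΦ : Differentiable ℝ Φ) (j : Fin (n + 1))
    (k : Fin 3) (y : Fin n → Fin 3 → ℝ) (x : Fin 3 → ℝ) :
    pdC k (fun z => Φ (ins j z y)) x = fderiv ℝ Φ (ins j x y) (eVec (n + 1) j k) := by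
  have h1 : HasFDerivAt (fun z : Fin 3 → ℝ => ins j z y)
      (.pi (Pi.single j (.id ℝ (Fin 3 → ℝ))) : (Fin 3 → ℝ) →L[ℝ] (Fin (n + 1) → Fin 3 → ℝ)) x := by
    have := hasFDerivAt_update (𝕜 := ℝ) (ins j x y) (i := j) x
    have e : Function.update (ins j x y) j = fun z => ins j z y := by
      funext z; simp
    rwa [e] at this
  have h2 := ((hΦ (ins j x y)).hasFDerivAt.comp x h1).fderiv
  simp only [Function.comp_def] at h2
  unfold pdC
  rw [h2]
  simp only [ContinuousLinearMap.comp_apply]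
  congr 1
  funext i
  by_cases hi : i = j
  · subst hi; simp [eVec]
  · simp [eVec, Pi.single_eq_of_ne hi]

theorem contDiff_cutMul (h : IsWaveFun (n + 1) Ψ) {G : (Fin 3 → ℝ) → ℝ}
    (hG : ContDiff ℝ (⊤ : ℕ∞) G) (j : Fin (n + 1)) (S : Fin (n + 1) → Fin 2) :
    ContDiff ℝ (⊤ : ℕ∞) fun X => cutMul (n + 1) G j Ψ X S :=
  (Complex.ofRealCLM.contDiff.comp (hG.comp (contDiff_apply ℝ (Fin 3 → ℝ) j))).mul (h.smooth S)

theorem pauliKin_eq (h : IsWaveFun (n + 1) Ψ) {G : (Fin 3 → ℝ) → ℝ} (hG : ContDiff ℝ (⊤ : ℕ∞) G)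
    {A : (Fin 3 → ℝ) → Fin 3 → ℝ} (hA : Continuous A) (j : Fin (n + 1)) :
    pauliKin (n + 1) A j (cutMul (n + 1) G j Ψ) = ∑ σ : Fin n → Fin 2, ∫ y, ∫ x,
      kd A (fun z t => (G z : ℂ) * slice Ψ (j, σ) y z t) x := by
  obtain ⟨R, hR⟩ := h.isCC.exists_radius
  set g : (Fin (n + 1) → Fin 3 → ℝ) → (Fin (n + 1) → Fin 2) → ℝ := fun x s =>
    ‖∑ k : Fin 3, ∑ t : Fin 2, pauli k (s j) t *
      (-Complex.I * fderiv ℝ (fun y => cutMul (n + 1) G j Ψ y (Function.update s j t)) x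
        (eVec (n + 1) j k)
        + (A (x j) k : ℂ) * cutMul (n + 1) G j Ψ x (Function.update s j t))‖ ^ 2 with hg
  have hgc : ∀ S, Continuous fun X => g X S := by
    intro S
    refine (continuous_finsetSum _ fun k _ => continuous_finsetSum _ fun t _ => ?_).norm.pow 2
    have h1 := contDiff_cutMul h hG j (Function.update S j t)
    have h2 := (h1.continuous_fderiv (by simp)).clm_apply
      (continuous_const (y := eVec (n + 1) j k))
    have h3 := h1.continuous
    have h4 : Continuous fun X : Fin (n + 1) → Fin 3 → ℝ => (A (X j) k : ℂ) :=
      Complex.continuous_ofReal.comp ((continuous_apply k).comp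
        (hA.comp (continuous_apply j)))
    exact continuous_const.mul ((continuous_const.mul h2).add (h4.mul h3))
  have hgi : ∀ x y s σ, g (ins j x y) (ins j s σ) =
      ‖dirac A (fun z t => (G z : ℂ) * slice Ψ (j, σ) y z t) x s‖ ^ 2 := by
    intro x y s σ
    simp only [hg, dirac, ins_same, update_ins]
    congr 3
    funext k
    congr 1
    funext t
    rw [← pdC_ins ((contDiff_cutMul h hG j (ins j t σ)).differentiable (by simp))]
    simp only [cutMul, ins_same, slice]
  have hz1 : ∀ y, y ∉ Metric.closedBall (0 : Fin n → Fin 3 → ℝ) R → ∀ x s σ,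
      g (ins j x y) (ins j s σ) = 0 := by
    intro y hy x s σ
    rw [hgi, Family.kd_zero_left fun x t => by
      simp [slice, hR _ (ins_notMem_closedBall_left j hy x)]]
    simp
  have hz2 : ∀ y x, x ∉ Metric.closedBall (0 : Fin 3 → ℝ) R → ∀ s σ,
      g (ins j x y) (ins j s σ) = 0 := by
    intro y x hx s σ
    rw [hgi, Family.dirac_of_zero_outside (u := 0) (R := R) (fun z hz t => by
      simp [slice, hR _ (ins_notMem_closedBall_right j y hz)]) hx]
    simp
  have hcc : IsCC g := by
    refine IsCC.of_zero hgc (R := R) fun X hX S => ?_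
    have e : X = ins j (X j) (fun k => X (j.succAbove k)) :=
      (Fin.insertNth_self_removeNth (α := fun _ => Fin 3 → ℝ) j X).symm
    have e' : S = ins j (S j) (fun k => S (j.succAbove k)) :=
      (Fin.insertNth_self_removeNth (α := fun _ => Fin 2) j S).symm
    by_cases h1 : X j ∈ Metric.closedBall 0 R
    · by_cases h2 : (fun k => X (j.succAbove k)) ∈ Metric.closedBall 0 R
      · refine absurd ?_ hX
        rw [mem_closedBall_zero_iff] at h1 h2 ⊢
        refine (pi_norm_le_iff_of_nonneg ((norm_nonneg _).trans h1)).2 ?_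
        exact (Fin.forall_iff_succAbove j).2 ⟨h1, fun k => (norm_le_pi_norm _ k).trans h2⟩
      · rw [e, e']; exact hz1 _ h2 _ _ _
    · rw [e, e']; exact hz2 _ _ h1 _ _
  change ∑ S, ∫ X, g X S = _
  rw [hcc.sum_integral j]
  refine Finset.sum_congr rfl fun σ _ => ?_
  have f := fun s => Family.compact_fubini (h := fun y x => g (ins j x y) (ins j s σ))
    ((hgc _).comp (contDiff_ins j).continuous) (fun y hy x => hz1 y hy x s σ)
    (isCompact_closedBall 0 R) (fun y x hx => hz2 y x hx s σ)
  rw [← integral_finsetSum _ fun s _ => (f s).2.2.1]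
  congr 1; ext y
  rw [← integral_finsetSum _ fun s _ => (f s).2.1 y]
  congr 1; ext x
  exact Finset.sum_congr rfl fun s _ => hgi x y s σ

theorem sum_pauliKin (h : IsWaveFun (n + 1) Ψ) {G : (Fin 3 → ℝ) → ℝ} (hG : ContDiff ℝ (⊤ : ℕ∞) G)
    {A : (Fin 3 → ℝ) → Fin 3 → ℝ} (hA : Continuous A) :
    ∑ j, pauliKin (n + 1) A j (cutMul (n + 1) G j Ψ) = ∫ x, tden (Family.kin A (slice Ψ))
      (Family.cur A (slice Ψ)) (Family.den (slice Ψ)) G x := by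
  rw [(family_slice h).integral_tden hA hG, Fintype.sum_prod_type]
  exact Finset.sum_congr rfl fun j _ => pauliKin_eq h hG hA j

theorem IsWaveFun.integrable_mul {N : ℕ} {Ψ : (Fin N → Fin 3 → ℝ) → (Fin N → Fin 2) → ℂ}
    (h : IsWaveFun N Ψ) {W : (Fin N → Fin 3 → ℝ) → ℝ} (hW : Measurable W) {B : ℝ}
    (hB : ∀ X, |W X| ≤ B) (S : Fin N → Fin 2) : Integrable fun X => W X * ‖Ψ X S‖ ^ 2 := by
  have h1 : Continuous fun X => ‖Ψ X S‖ ^ 2 := (h.smooth S).continuous.norm.pow 2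
  have h2 : HasCompactSupport fun X => ‖Ψ X S‖ ^ 2 :=
    (h.compactSupport S).comp_left (g := fun z : ℂ => ‖z‖ ^ 2) (by simp)
  have h3 : Integrable fun X => ‖Ψ X S‖ ^ 2 := h1.integrable_of_hasCompactSupport h2
  exact h3.bdd_mul (c := B) hW.aestronglyMeasurable
    (Filter.Eventually.of_forall fun X => by simpa using hB X)

theorem sum_potInt (h : IsWaveFun (n + 1) Ψ) {W : (Fin 3 → ℝ) → ℝ} (hW : Measurable W) {B : ℝ}
    (hB : ∀ x, |W x| ≤ B) :
    ∑ j, potInt (n + 1) (fun X => W (X j)) Ψ = ∫ x, W x * Family.den (slice Ψ) x := by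
  have hi := fun (j : Fin (n + 1)) S => h.integrable_mul (W := fun X => W (X j))
    (hW.comp (measurable_pi_apply j)) (fun X => hB _) S
  have hi2 := fun (j : Fin (n + 1)) S => ((measurePreserving_ins (n := n) j).integrable_comp_emb
    (MeasurableEquiv.measurableEmbedding _)).2 (hi j S)
  have e1 : ∀ (j : Fin (n + 1)) S, ∫ X : Fin (n + 1) → Fin 3 → ℝ, W (X j) * ‖Ψ X S‖ ^ 2 =
      ∫ x, W x * ∫ y, ‖Ψ (ins j x y) S‖ ^ 2 := by
    intro j S
    have h1 := (measurePreserving_ins (n := n) j).integral_comp' fun X => W (X j) * ‖Ψ X S‖ ^ 2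
    rw [← h1]
    refine (integral_prod _ (hi2 j S)).trans ?_
    congr 1; ext x
    rw [← integral_const_mul]
    congr 1; ext y
    change W (ins j x y j) * ‖Ψ (ins j x y) S‖ ^ 2 = _
    rw [ins_same]
  have i1 : ∀ (j : Fin (n + 1)) S, Integrable fun x => W x * ∫ y, ‖Ψ (ins j x y) S‖ ^ 2 := by
    intro j S
    refine (hi2 j S).integral_prod_left.congr (Filter.Eventually.of_forall fun x => ?_)
    simp only []
    rw [← integral_const_mul]
    congr 1; ext y
    change W (ins j x y j) * ‖Ψ (ins j x y) S‖ ^ 2 = _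
    rw [ins_same]
  have i2 : ∀ (j : Fin (n + 1)) S x, Integrable fun y => ‖Ψ (ins j x y) S‖ ^ 2 := by
    intro j S x
    obtain ⟨R, hR⟩ := h.isCC.exists_radius
    refine Continuous.integrable_of_hasCompactSupport (((h.isCC S).1.comp
      ((contDiff_ins j).continuous.comp (continuous_id.prodMk continuous_const))).norm.pow 2)
      (HasCompactSupport.intro (isCompact_closedBall 0 R) fun y hy => ?_)
    simp [hR _ (ins_notMem_closedBall_left j hy x)]
  have e2 : ∀ x, W x * Family.den (slice Ψ) x =
      ∑ j, ∑ σ : Fin n → Fin 2, ∑ t, W x * ∫ y, ‖Ψ (ins j x y) (ins j t σ)‖ ^ 2 := by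
    intro x
    unfold Family.den
    rw [Fintype.sum_prod_type]
    simp_rw [← Finset.mul_sum]
    congr 1
    refine Finset.sum_congr rfl fun j _ => Finset.sum_congr rfl fun σ _ => ?_
    exact integral_finsetSum _ fun t _ => i2 j (ins j t σ) x
  simp_rw [e2]
  rw [integral_finsetSum _ fun j _ => integrable_finsetSum _ fun σ _ =>
    integrable_finsetSum _ fun t _ => i1 j _]
  refine Finset.sum_congr rfl fun j _ => ?_
  rw [integral_finsetSum _ fun σ _ => integrable_finsetSum _ fun t _ => i1 j _]
  unfold potInt
  rw [sum_ins j]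
  refine Finset.sum_congr rfl fun σ _ => ?_
  rw [integral_finsetSum _ fun t _ => i1 j _]
  exact Finset.sum_congr rfl fun t _ => e1 j _

end slice

section coulombExpectation
variable {n : ℕ} {Ψ : (Fin (n + 1) → Fin 3 → ℝ) → (Fin (n + 1) → Fin 2) → ℂ}

theorem ae_pairwise_ne : ∀ᵐ X : Fin (n + 1) → Fin 3 → ℝ, ∀ i j, i ≠ j → X i ≠ X j := by
  refine Filter.eventually_all.2 fun i => Filter.eventually_all.2 fun j => ?_
  rcases eq_or_ne i j with h | h
  · exact Filter.Eventually.of_forall fun X h' => absurd h h'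
  obtain ⟨k, rfl⟩ := Fin.exists_succAbove_eq h.symm
  have hm : MeasurableSet {X : Fin (n + 1) → Fin 3 → ℝ | X i = X (i.succAbove k)} :=
    measurableSet_eq_fun (measurable_pi_apply _) (measurable_pi_apply _)
  have h0 : volume {X : Fin (n + 1) → Fin 3 → ℝ | X i = X (i.succAbove k)} = 0 := by
    rw [← lintegral_indicator_one hm, lintegral_ins i (measurable_one.indicator hm)]
    refine (lintegral_congr fun y => ?_).trans lintegral_zero
    refine lintegral_eq_zero_of_ae_eq_zero ?_
    filter_upwards [ae_ne3 (y k)] with x hx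
    refine Set.indicator_of_notMem ?_ _
    simpa [ins_same, ins_succAbove] using hx
  filter_upwards [measure_eq_zero_iff_ae_notMem.1 h0] with X hX _ hX'
  exact hX hX'

theorem lintegral_inv_enorm3_lt_top (R : ℝ) :
    ∫⁻ z in Metric.closedBall (0 : Fin 3 → ℝ) R, ENNReal.ofReal (enorm3 z)⁻¹ < ⊤ := by
  refine lt_of_le_of_lt (lintegral_mono fun z => ENNReal.ofReal_le_ofReal ?_)
    (lintegral_norm_rpow_lt_top (a := 1) (by norm_num) R)
  rw [Real.rpow_neg_one]
  rcases eq_or_ne z 0 with rfl | h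
  · simp [enorm3_zero]
  · exact inv_enorm3_le h

theorem IsWaveFun.integrable_coulomb (h : IsWaveFun (n + 1) Ψ) {i j : Fin (n + 1)} (hij : i ≠ j)
    (S : Fin (n + 1) → Fin 2) :
    Integrable fun X => (enorm3 (X i - X j))⁻¹ * ‖Ψ X S‖ ^ 2 := by
  obtain ⟨k, rfl⟩ := Fin.exists_succAbove_eq hij.symm
  obtain ⟨R, hR⟩ := h.isCC.exists_radius
  have hc : Continuous fun X => ‖Ψ X S‖ ^ 2 := (h.smooth S).continuous.norm.pow 2
  obtain ⟨C, hC⟩ := (h.smooth S).continuous.bounded_above_of_compact_support (h.compactSupport S)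
  have hm : Measurable fun X : Fin (n + 1) → Fin 3 → ℝ =>
      (enorm3 (X i - X (i.succAbove k)))⁻¹ :=
    (continuous_enorm3.measurable.comp
      ((measurable_pi_apply i).sub (measurable_pi_apply (i.succAbove k)))).inv
  have hB : MeasurableSet (Metric.closedBall (0 : Fin 3 → ℝ) (R + R)) :=
    Metric.isClosed_closedBall.measurableSet
  have hBn : MeasurableSet (Metric.closedBall (0 : Fin n → Fin 3 → ℝ) R) :=
    Metric.isClosed_closedBall.measurableSet
  set J : (Fin 3 → ℝ) → ENNReal := (Metric.closedBall (0 : Fin 3 → ℝ) (R + R)).indicator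
    fun z => ENNReal.ofReal (enorm3 z)⁻¹ with hJ
  have hJm : Measurable J :=
    (continuous_enorm3.measurable.inv.ennreal_ofReal).indicator hB
  set K := ∫⁻ z in Metric.closedBall (0 : Fin 3 → ℝ) (R + R), ENNReal.ofReal (enorm3 z)⁻¹ with hK
  have hKt : K < ⊤ := lintegral_inv_enorm3_lt_top _
  refine ⟨(hm.fun_mul hc.measurable).aestronglyMeasurable, ?_⟩
  rw [hasFiniteIntegral_iff_enorm]
  rw [lintegral_ins i (hm.fun_mul hc.measurable).enorm]
  have key : ∀ y x, ‖(enorm3 (ins i x y i - ins i x y (i.succAbove k)))⁻¹ *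
      ‖Ψ (ins i x y) S‖ ^ 2‖ₑ ≤ (Metric.closedBall (0 : Fin n → Fin 3 → ℝ) R).indicator 1 y *
        (ENNReal.ofReal (C ^ 2) * J (x - y k)) := by
    intro y x
    rw [ins_same, ins_succAbove]
    by_cases hy : y ∈ Metric.closedBall (0 : Fin n → Fin 3 → ℝ) R
    · by_cases hx : x ∈ Metric.closedBall (0 : Fin 3 → ℝ) R
      · have hxy : x - y k ∈ Metric.closedBall (0 : Fin 3 → ℝ) (R + R) := by
          rw [mem_closedBall_zero_iff] at *
          exact (norm_sub_le _ _).trans (add_le_add hx ((norm_le_pi_norm y k).trans hy))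
        rw [Set.indicator_of_mem hy, hJ, Set.indicator_of_mem hxy, Pi.one_apply, one_mul,
          ← ENNReal.ofReal_mul (by positivity), Real.enorm_eq_ofReal
            (mul_nonneg (inv_nonneg.2 (enorm3_nonneg _)) (by positivity))]
        refine ENNReal.ofReal_le_ofReal ?_
        rw [mul_comm]
        exact mul_le_mul_of_nonneg_right (pow_le_pow_left₀ (norm_nonneg _) (hC _) 2)
          (inv_nonneg.2 (enorm3_nonneg _))
      · simp [hR _ (ins_notMem_closedBall_right i y hx)]
    · simp [hR _ (ins_notMem_closedBall_left i hy x)]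
  calc _ ≤ ∫⁻ y : Fin n → Fin 3 → ℝ, (Metric.closedBall (0 : Fin n → Fin 3 → ℝ) R).indicator 1 y *
        (ENNReal.ofReal (C ^ 2) * K) := by
        refine lintegral_mono fun y => (lintegral_mono fun x => key y x).trans (le_of_eq ?_)
        have hJ' : Measurable fun x => J (x - y k) := hJm.comp (measurable_sub_const (y k))
        rw [lintegral_const_mul _ (hJ'.const_mul _), lintegral_const_mul _ hJ',
          lintegral_sub_right_eq_self J, hJ, lintegral_indicator hB]
    _ < ⊤ := by
        rw [lintegral_mul_const _ (measurable_one.indicator hBn), lintegral_indicator_one hBn]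
        exact ENNReal.mul_lt_top measure_closedBall_lt_top
          (ENNReal.mul_lt_top ENNReal.ofReal_lt_top hKt)

theorem coulomb_expectation_lower (h : IsWaveFun (n + 1) Ψ) {T : ℝ} (hT : 0 ≤ T)
    {ρ : (Fin 3 → ℝ) → ℝ} (hρ : Measurable ρ) (h0 : ∀ x, 0 ≤ ρ x) (hD : coulombSelf ρ < ⊤)
    {m l r B Z : ℝ} (hm : 0 ≤ m) (hl : 0 < l) (hr : 0 < r) (hB : 0 ≤ B) (hZ : 1 ≤ Z)
    {q : (Fin 3 → ℝ) → ℝ} (hqm : Measurable q) (hq0 : ∀ x, 0 ≤ q x) (hq1 : ∀ x, q x ≤ 1)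
    (hq : ∀ x, r ≤ ‖x‖ → q x = 0) :
    (∫ x, (q x * (l * m * PT T ρ (l • x) - l * (cK * T / 2)) +
        if r ≤ ‖x‖ then B * Z / enorm3 x else 0) * Family.den (slice Ψ) x)
      - l * m ^ 2 * (coulombSelf ρ).toReal - (B + 1) ^ 2 * Z ^ 2 / r ≤
    ∑ i, ∑ j, if i < j then potInt (n + 1) (fun X => (enorm3 (X i - X j))⁻¹) Ψ else 0 := by
  set W : (Fin 3 → ℝ) → ℝ := fun x => q x * (l * m * PT T ρ (l • x) - l * (cK * T / 2)) +
        if r ≤ ‖x‖ then B * Z / enorm3 x else 0 with hW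
  have hWm : Measurable W := by
    refine (hqm.fun_mul ((((measurable_PT T hρ).comp (measurable_const_smul l)).const_mul
      _).sub_const _)).fun_add (Measurable.ite (measurableSet_le measurable_const measurable_norm)
        (continuous_enorm3.measurable.const_div _) measurable_const)
  obtain ⟨M, hM⟩ : ∃ M, ∀ x, |W x| ≤ M := by
    refine ⟨l * m * ((cK * T + 2 * (coulombSelf ρ).toReal) / 2) + l * (cK * T / 2) + B * Z / r,
      fun x => ?_⟩
    have hc := cK_pos
    have h1 := PT_nonneg T ρ (l • x)
    have h2 : PT T ρ (l • x) ≤ (cK * T + 2 * (coulombSelf ρ).toReal) / 2 := by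
      linarith [PT_le hT hρ h0 hD (l • x)]
    refine (abs_add_le _ _).trans (add_le_add ?_ ?_)
    · rw [abs_mul, abs_of_nonneg (hq0 x)]
      refine (mul_le_of_le_one_left (abs_nonneg _) (hq1 x)).trans ((abs_sub _ _).trans ?_)
      rw [abs_of_nonneg (by positivity), abs_of_nonneg (by positivity)]
      gcongr
    · split_ifs with hx
      · have : r ≤ enorm3 x := hx.trans (norm_le_enorm3 x)
        rw [abs_of_nonneg (div_nonneg (by positivity) (enorm3_nonneg x))]
        gcongr
      · rw [abs_zero]; positivity
  have hWi := fun j S => h.integrable_mul (W := fun X => W (X j))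
    (hWm.comp (measurable_pi_apply j)) (fun X => hM _) S
  have hone := fun S => h.integrable_mul (W := fun _ => (1 : ℝ)) measurable_const
    (B := 1) (by simp) S
  set c := l * m ^ 2 * (coulombSelf ρ).toReal + (B + 1) ^ 2 * Z ^ 2 / r with hc
  have e1 : (∫ x, W x * Family.den (slice Ψ) x) - c =
      ∑ S, ∫ X, (∑ j, W (X j) - c) * ‖Ψ X S‖ ^ 2 := by
    rw [← sum_potInt h hWm hM]
    have : c = ∑ S, c * ∫ X, 1 * ‖Ψ X S‖ ^ 2 := by
      rw [← Finset.mul_sum]; simp [h.normalized]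
    conv_lhs => rw [this]
    unfold potInt
    rw [Finset.sum_comm, ← Finset.sum_sub_distrib]
    refine Finset.sum_congr rfl fun S _ => ?_
    rw [← integral_finsetSum _ fun j _ => hWi j S, ← integral_const_mul,
      ← integral_sub (integrable_finsetSum _ fun j _ => hWi j S) ((hone S).const_mul c)]
    congr 1; ext X
    rw [sub_mul, Finset.sum_mul, one_mul]
  have hI : ∀ S i j, Integrable fun X => (if i < j then (enorm3 (X i - X j))⁻¹ else 0) *
      ‖Ψ X S‖ ^ 2 := by
    intro S i j
    split_ifs with hij
    · exact h.integrable_coulomb hij.ne S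
    · simp
  have e2 : ∑ i, ∑ j, (if i < j then potInt (n + 1) (fun X => (enorm3 (X i - X j))⁻¹) Ψ else 0) =
      ∑ S, ∫ X, (∑ i, ∑ j, if i < j then (enorm3 (X i - X j))⁻¹ else 0) * ‖Ψ X S‖ ^ 2 := by
    have : ∀ S, ∫ X, (∑ i, ∑ j, if i < j then (enorm3 (X i - X j))⁻¹ else 0) * ‖Ψ X S‖ ^ 2 =
        ∑ i, ∑ j, ∫ X, (if i < j then (enorm3 (X i - X j))⁻¹ else 0) * ‖Ψ X S‖ ^ 2 := by
      intro S
      simp_rw [Finset.sum_mul]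
      rw [integral_finsetSum _ fun i _ => integrable_finsetSum _ fun j _ => hI S i j]
      exact Finset.sum_congr rfl fun i _ => integral_finsetSum _ fun j _ => hI S i j
    simp_rw [this]
    conv_rhs => rw [Finset.sum_comm]
    refine Finset.sum_congr rfl fun i _ => ?_
    conv_rhs => rw [Finset.sum_comm]
    refine Finset.sum_congr rfl fun j _ => ?_
    split_ifs with hij
    · rfl
    · simp
  rw [sub_sub, e1, e2]
  refine Finset.sum_le_sum fun S _ => integral_mono_ae ?_ ?_ ?_
  · have : Integrable fun X => ∑ j, W (X j) * ‖Ψ X S‖ ^ 2 - c * (1 * ‖Ψ X S‖ ^ 2) :=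
      (integrable_finsetSum _ fun j _ => hWi j S).sub ((hone S).const_mul c)
    refine this.congr (Filter.Eventually.of_forall fun X => ?_)
    simp only [Finset.sum_mul, sub_mul, one_mul]
  · have : Integrable fun X => ∑ i, ∑ j, (if i < j then (enorm3 (X i - X j))⁻¹ else 0) *
        ‖Ψ X S‖ ^ 2 := integrable_finsetSum _ fun i _ => integrable_finsetSum _ fun j _ => hI S i j
    simpa only [Finset.sum_mul] using this
  · filter_upwards [ae_pairwise_ne] with X hX
    refine mul_le_mul_of_nonneg_right ?_ (by positivity)
    have := coulomb_lower hT hρ h0 hD hm hl hr hB hZ (fun j => q (X j)) (fun j => hq0 _)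
      (fun j => hq1 _) X hX (fun j => hq _)
    rw [hc]
    simp only [hW]
    linarith

end coulombExpectation

theorem exists_localized_lower {C0 : ℝ} (hC0 : 0 ≤ C0) : ∃ Kg CP : ℝ, 0 ≤ Kg ∧ 0 < CP ∧
    ∀ A τ J ρ, OneBody C0 A τ J ρ → ∀ θ : (Fin 3 → ℝ) → ℝ, ContDiff ℝ (⊤ : ℕ∞) θ →
      (∀ x, |θ x| ≤ 1) → ∀ L r ε Vm F1 γ : ℝ, 0 < L → 0 < ε → ε < 1 → 0 < Vm → 0 ≤ γ →
      0 ≤ F1 → (∀ F, F1 ≤ F → CP * (Vm * (1 + (2 * Vm) ^ ((3 : ℝ) / 2) * L ^ 3 + L * F)) ≤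
        γ * L ^ 3 * F) →
      ∀ V v p : (Fin 3 → ℝ) → ℝ, Measurable V → (∀ x, 0 ≤ V x) → (∀ x, V x ≤ Vm) →
      (∀ x, r ≤ ‖x‖ → V x = 0) → (∀ w, 0 ≤ v w) →
      (∀ w, ∀ x ∈ Metric.closedBall w L, V x ≤ v w) →
      IntegrableOn p (Metric.closedBall 0 (r + L)) →
      (∀ w, 2 / (15 * Real.pi ^ 2) * ((1 - ε) ^ (-(3 : ℝ) / 2) *
        ((1 + ε) * v w + C0 / ε ^ 3 * F1 ^ 2) ^ ((5 : ℝ) / 2)) ≤ p w) →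
      ∫ x, V x * (θ x ^ 2 * ρ x) ≤ (∫ x, tden τ J ρ θ x) +
        1 / ε * ((L ^ 2)⁻¹ * Kg) * (∫ x in Metric.closedBall 0 (r + L + L), θ x ^ 2 * ρ x) +
        γ * (∫ w in Metric.closedBall 0 (r + L), ∫ x in Metric.closedBall w (6 * L), gradSq A x) +
        ∫ w in Metric.closedBall 0 (r + L), p w := by
  obtain ⟨C, hC, hP⟩ := localBound_one hC0
  obtain ⟨g, hg, hz, hgi⟩ := exists_unit_bump
  obtain ⟨gm, hgm0, hgm⟩ := exists_bound_of_zero_outside hg.continuous hz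
  refine ⟨∫ y, gsq g y, 2 * C * gm ^ 2 + 1, integral_nonneg fun y => gsq_nonneg g y,
    by positivity, ?_⟩
  intro A τ J ρ h θ hθ hθ1 L r ε Vm F1 γ hL hε hε1 hVm hγ hF1 hbad V v p hVmeas hV0 hVle hVr hv0
    hVv hpi hp
  have hgc := continuous_gradSq h.smooth
  obtain ⟨R0, hR0⟩ := h.zero
  have hcomp : ∀ {f : (Fin 3 → ℝ) → ℝ}, Continuous f →
      (∀ x, x ∉ Metric.closedBall 0 R0 → f x = 0) → Integrable f := fun hf hfz =>
    hf.integrable_of_hasCompactSupport (HasCompactSupport.intro (isCompact_closedBall 0 R0) hfz)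
  have hθc := hθ.continuous
  have hdθ := continuous_fderiv_single hθ
  have hcd := h.cont_den
  have hcJ := h.cont_cur
  have hρi : Integrable fun y => θ y ^ 2 * ρ y :=
    hcomp (by fun_prop) fun x hx => by rw [(hR0 x hx).2.2]; simp
  have hJi : ∀ k, Integrable (curG J ρ θ k) := fun k =>
    hcomp (by unfold curG; have := hdθ k; have := hcJ k; fun_prop) fun x hx => by
      unfold curG; rw [(hR0 x hx).2.2, (hR0 x hx).2.1]; simp
  have hτi : Integrable (tden τ J ρ θ) :=
    hcomp (continuous_tden h.cont_kin h.cont_cur h.cont_den hθ) fun x hx => by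
      obtain ⟨h1, h2, h3⟩ := hR0 x hx
      simp [tden, h1, h2, h3]
  obtain ⟨hi1, hi2⟩ := ims_integrated (h.pos.mul θ) hτi hJi hρi hg hgi hz hL 0 (r + L) hε
  have hform : ∀ w x, tden (tden τ J ρ θ) (curG J ρ θ) (fun y => θ y ^ 2 * ρ y) (gw g L w) x =
      tden τ J ρ (fun y => gw g L w y * θ y) x := fun w x =>
    (tden_mul τ J ρ ((contDiff_gw hg w).differentiable (by simp) x)
      (hθ.differentiable (by simp) x)).symm
  simp_rw [hform] at hi1 hi2
  have hVi : Integrable fun y => V y * (θ y ^ 2 * ρ y) :=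
    hρi.bdd_mul (c := Vm) hVmeas.aestronglyMeasurable (Filter.Eventually.of_forall fun x => by
      rw [Real.norm_eq_abs, abs_of_nonneg (hV0 x)]; exact hVle x)
  obtain ⟨Bg, -, hBg⟩ := exists_bound_of_zero_outside (u := 0) (R := 1)
    (h := fun x => (L ^ 3)⁻¹ * g x ^ 2)
    (by have := hg.continuous; fun_prop) (fun x hx => by simp [hz x hx])
  have hkc : Continuous fun q : (Fin 3 → ℝ) × (Fin 3 → ℝ) => gw g L q.1 q.2 ^ 2 := by
    have := hg.continuous; unfold gw; fun_prop
  have hkB : ∀ w x, |gw g L w x ^ 2| ≤ Bg := fun w x => by rw [gw_sq hL]; exact hBg _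
  obtain ⟨k1, -, k3, k4⟩ := kernel_swap hkc hkB hVi 0 (r + L)
  obtain ⟨-, -, m3, -⟩ := kernel_swap hkc hkB hρi 0 (r + L)
  have hMeq : ∫ x, (∫ w in Metric.closedBall (0 : Fin 3 → ℝ) (r + L), gw g L w x ^ 2) *
      (V x * (θ x ^ 2 * ρ x)) = ∫ x, V x * (θ x ^ 2 * ρ x) := by
    refine integral_congr_ae (Filter.Eventually.of_forall fun x => ?_)
    simp only
    by_cases hx : r ≤ ‖x‖
    · rw [hVr x hx]; simp
    · rw [setIntegral_gw_sq_eq hgi hz hL, one_mul]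
      intro w hw
      rw [mem_closedBall_zero_iff]
      rw [Metric.mem_closedBall, dist_eq_norm, norm_sub_rev] at hw
      have := norm_add_le (w - x) x
      rw [sub_add_cancel] at this
      linarith
  rw [hMeq] at k4
  set Fw : (Fin 3 → ℝ) → ℝ := fun w => ∫ x in Metric.closedBall w (6 * L), gradSq A x with hFw
  have hFwc : Continuous Fw := continuous_setIntegral_closedBall hgc _
  have hFw0 : ∀ w, 0 ≤ Fw w := fun w => setIntegral_closedBall_nonneg (gradSq_nonneg A) _ _
  set Tw : (Fin 3 → ℝ) → ℝ := fun w => ∫ x, tden τ J ρ (fun y => gw g L w y * θ y) x with hTw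
  have hTw0 : ∀ w, 0 ≤ Tw w := fun w => integral_nonneg fun x => h.pos.tden_nonneg _ x
  have hp0 : ∀ w, 0 ≤ p w := fun w => le_trans (by
    have := hv0 w
    have : (0 : ℝ) < 1 - ε := by linarith
    positivity) (hp w)
  have hρ0 : ∀ x, 0 ≤ θ x ^ 2 * ρ x := fun x => mul_nonneg (sq_nonneg _) (h.pos.rho_nonneg x)
  have point : ∀ w, (1 + ε) * ∫ x, gw g L w x ^ 2 * (V x * (θ x ^ 2 * ρ x)) ≤
      Tw w + (1 + ε) * (γ * Fw w + p w) := by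
    intro w
    set M := ∫ x, gw g L w x ^ 2 * (θ x ^ 2 * ρ x) with hM
    have hM0 : 0 ≤ M := integral_nonneg fun x => mul_nonneg (sq_nonneg _) (hρ0 x)
    have hGs : ContDiff ℝ (⊤ : ℕ∞) fun y => gw g L w y * θ y := (contDiff_gw hg w).mul hθ
    have hGz : ∀ x ∉ Metric.closedBall w L, gw g L w x * θ x = 0 := fun x hx => by
      rw [gw_zero hz hL hx, zero_mul]
    have hM' : ∫ x, (gw g L w x * θ x) ^ 2 * ρ x = M := by
      rw [hM]; congr 1; ext x; ring
    have hsq : ∀ c, (∀ x ∈ Metric.closedBall w L, V x ≤ c) →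
        ∫ x, gw g L w x ^ 2 * (V x * (θ x ^ 2 * ρ x)) ≤ c * M := by
      intro c hc
      rw [hM, ← integral_const_mul]
      refine integral_mono (k3 w) ((m3 w).const_mul c) fun x => ?_
      by_cases hx : x ∈ Metric.closedBall w L
      · have := mul_le_mul_of_nonneg_right (hc x hx) (mul_nonneg (sq_nonneg (gw g L w x)) (hρ0 x))
        linarith
      · simp [gw_zero hz hL hx]
    have hpFw := mul_nonneg hγ (hFw0 w)
    rcases le_or_gt (Fw w) F1 with hF | hF
    · have hl := h.loc _ hGs w L hL hGz ε 1 ((1 + ε) * v w + C0 / ε ^ 3 * F1 ^ 2) hε hε1 one_pos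
        (by have := hv0 w; positivity)
      rw [hM', mul_one, one_mul, one_mul] at hl
      have hF2 : (∫ x in Metric.closedBall w (2 * L), gradSq A x) ^ 2 ≤ F1 ^ 2 := by
        refine pow_le_pow_left₀ (setIntegral_closedBall_nonneg (gradSq_nonneg A) _ _) ?_ 2
        refine le_trans (setIntegral_closedBall_mono hgc (gradSq_nonneg A)
          (Metric.closedBall_subset_closedBall ?_)) hF
        linarith
      have h2 : C0 / ε ^ 3 * (∫ x in Metric.closedBall w (2 * L), gradSq A x) ^ 2 * M ≤
          C0 / ε ^ 3 * F1 ^ 2 * M := by gcongr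
      have hG1 : ∫ x, (gw g L w x * θ x) ^ 2 ≤ 1 := by
        have e : ∫ x, gw g L w x ^ 2 = 1 := by
          simp_rw [gw_sq hL]
          have := integral_comp_scale (fun y => g (-y) ^ 2) hL w
          have e2 : ∫ y, g (-y) ^ 2 = 1 := by
            rw [← hgi]; exact integral_neg_eq_self (fun y => g y ^ 2) volume
          rw [e2] at this
          rw [← this]
          congr 1; ext x
          rw [← smul_neg, neg_sub]
        rw [← e]
        have hc1 : ∀ {f : (Fin 3 → ℝ) → ℝ}, Continuous f →
            (∀ x, x ∉ Metric.closedBall w L → f x = 0) → Integrable f := fun hf hfz =>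
          hf.integrable_of_hasCompactSupport
            (HasCompactSupport.intro (isCompact_closedBall w L) hfz)
        have hgwc := (contDiff_gw (s := L) hg w).continuous
        refine integral_mono (hc1 (by fun_prop) fun x hx => by simp [gw_zero hz hL hx])
          (hc1 (by fun_prop) fun x hx => by simp [gw_zero hz hL hx]) fun x => ?_
        simp only
        rw [mul_pow]
        refine mul_le_of_le_one_right (sq_nonneg _) ?_
        rw [← sq_abs]
        exact pow_le_one₀ (abs_nonneg _) (hθ1 x)
      have h3 := hsq (v w) (hVv w)
      have h4 : 2 / (15 * Real.pi ^ 2) * ((1 - ε) ^ (-(3 : ℝ) / 2) *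
          ((1 + ε) * v w + C0 / ε ^ 3 * F1 ^ 2) ^ ((5 : ℝ) / 2)) *
          ∫ x, (gw g L w x * θ x) ^ 2 ≤ p w := by
        refine le_trans (mul_le_of_le_one_right ?_ hG1) (hp w)
        have := hv0 w
        have : (0 : ℝ) < 1 - ε := by linarith
        positivity
      have h5 : Tw w = ∫ x, tden τ J ρ (fun y => gw g L w y * θ y) x := rfl
      rw [← h5] at hl
      have h6 := mul_le_mul_of_nonneg_left h3 (by linarith : (0 : ℝ) ≤ 1 + ε)
      nlinarith [hp0 w, mul_nonneg hε.le hpFw, mul_nonneg hε.le (hp0 w)]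
    · have hb : ∀ x, |gw g L w x * θ x| ≤ L ^ (-(3 : ℝ) / 2) * gm := fun x => by
        rw [abs_mul]
        refine (mul_le_of_le_one_right (abs_nonneg _) (hθ1 x)).trans ?_
        unfold gw
        rw [abs_mul, abs_of_nonneg (by positivity)]
        exact mul_le_mul_of_nonneg_left (hgm _) (by positivity)
      have hl := hP A τ J ρ h w L hL _ hGs hGz _ hb ((1 + ε) * Vm) (by positivity)
      rw [hM', Real.rpow_one, mul_pow, rpow_neg_sq hL] at hl
      have h5 : Tw w = ∫ x, tden τ J ρ (fun y => gw g L w y * θ y) x := rfl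
      have h6 : Fw w = ∫ x in Metric.closedBall w (6 * L), gradSq A x := rfl
      rw [← h5, ← h6] at hl
      have h3 := mul_le_mul_of_nonneg_left (hsq Vm fun x _ => hVle x)
        (by linarith : (0 : ℝ) ≤ 1 + ε)
      have hFp := hFw0 w
      have hV2 : (1 + ε) * Vm ≤ 2 * Vm := by gcongr; linarith
      have h7 : C * ((L ^ 3)⁻¹ * gm ^ 2) * ((1 + ε) * Vm) *
          (1 + ((1 + ε) * Vm) ^ ((3 : ℝ) / 2) * L ^ 3 + L * Fw w) ≤ γ * Fw w := by
        have h8 := hbad (Fw w) hF.le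
        have h9 : C * ((L ^ 3)⁻¹ * gm ^ 2) * ((1 + ε) * Vm) *
          (1 + ((1 + ε) * Vm) ^ ((3 : ℝ) / 2) * L ^ 3 + L * Fw w) ≤
          C * ((L ^ 3)⁻¹ * gm ^ 2) * (2 * Vm) *
          (1 + (2 * Vm) ^ ((3 : ℝ) / 2) * L ^ 3 + L * Fw w) := by gcongr
        refine h9.trans ?_
        have h10 : (2 * C * gm ^ 2) *
            (Vm * (1 + (2 * Vm) ^ ((3 : ℝ) / 2) * L ^ 3 + L * Fw w)) ≤ γ * L ^ 3 * Fw w :=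
          le_trans (mul_le_mul_of_nonneg_right (by linarith) (by positivity)) h8
        have h11 := mul_le_mul_of_nonneg_left h10 (by positivity : (0 : ℝ) ≤ (L ^ 3)⁻¹)
        calc _ = (L ^ 3)⁻¹ * ((2 * C * gm ^ 2) *
            (Vm * (1 + (2 * Vm) ^ ((3 : ℝ) / 2) * L ^ 3 + L * Fw w))) := by ring
          _ ≤ _ := h11
          _ = γ * Fw w := by field_simp
      nlinarith [hp0 w, mul_nonneg hε.le hpFw, mul_nonneg hε.le (hp0 w)]
  have hQ : IsCompact (Metric.closedBall (0 : Fin 3 → ℝ) (r + L)) := isCompact_closedBall _ _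
  have hFi : IntegrableOn Fw (Metric.closedBall 0 (r + L)) := hFwc.continuousOn.integrableOn_compact hQ
  have hsum : (1 + ε) * ∫ x, V x * (θ x ^ 2 * ρ x) ≤
      (∫ w in Metric.closedBall 0 (r + L), Tw w) +
        (1 + ε) * (γ * (∫ w in Metric.closedBall 0 (r + L), Fw w) +
          ∫ w in Metric.closedBall 0 (r + L), p w) := by
    have i2 : IntegrableOn (fun w => γ * Fw w + p w) (Metric.closedBall 0 (r + L)) :=
      (hFi.const_mul γ).add hpi
    have i3 : IntegrableOn (fun w => Tw w + (1 + ε) * (γ * Fw w + p w))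
      (Metric.closedBall 0 (r + L)) := Integrable.add hi1 (i2.const_mul _)
    rw [← k4, ← integral_const_mul]
    refine (integral_mono (k1.const_mul _) i3 point).trans (le_of_eq ?_)
    rw [integral_add hi1 (i2.const_mul _), integral_const_mul, integral_add (hFi.const_mul γ) hpi,
      integral_const_mul]
  have hfin := hsum.trans (add_le_add_left hi2 _)
  have e : (1 + 1 / ε) * ((L ^ 2)⁻¹ * ∫ y, gsq g y) = (1 + ε) * (1 / ε * ((L ^ 2)⁻¹ * ∫ y, gsq g y)) := by
    field_simp
    ring
  rw [e] at hfin
  refine le_of_mul_le_mul_left (hfin.trans (le_of_eq ?_)) (by linarith : (0 : ℝ) < 1 + ε)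
  ring

namespace AdmissibleCutoffs
variable {d c₁ : ℝ} {θ₀ θ₁ : (Fin 3 → ℝ) → ℝ}

theorem abs_le_one (h : AdmissibleCutoffs d c₁ θ₀ θ₁) (x : Fin 3 → ℝ) : |θ₀ x| ≤ 1 := by
  rw [abs_of_nonneg (h.mem₀ x).1]; exact (h.mem₀ x).2

theorem eq_zero (h : AdmissibleCutoffs d c₁ θ₀ θ₁) {x : Fin 3 → ℝ} (hx : enorm3 x ≤ d) :
    θ₀ x = 0 := by
  have := h.partition x
  rw [h.one₁ x hx] at this
  exact pow_eq_zero_iff (two_ne_zero) |>.1 (by linarith)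

theorem grad_eq_zero (h : AdmissibleCutoffs d c₁ θ₀ θ₁) {x : Fin 3 → ℝ} (hx : 2 * d < enorm3 x) :
    grad3 θ₀ x = 0 ∧ grad3 θ₁ x = 0 := by
  have ho : {y : Fin 3 → ℝ | 2 * d < enorm3 y} ∈ nhds x :=
    (isOpen_lt continuous_const continuous_enorm3).mem_nhds hx
  have h1 : θ₁ =ᶠ[nhds x] fun _ => (0 : ℝ) := by
    filter_upwards [ho] with y hy using h.support₁ y hy
  have h0 : θ₀ =ᶠ[nhds x] fun _ => (1 : ℝ) := by
    filter_upwards [ho] with y hy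
    have := h.partition y
    rw [h.support₁ y hy] at this
    nlinarith [(h.mem₀ y).1]
  constructor <;> ext k <;> unfold grad3
  · rw [h0.fderiv_eq]; simp
  · rw [h1.fderiv_eq]; simp

theorem Wloc_le (h : AdmissibleCutoffs d c₁ θ₀ θ₁) (hd : 0 < d) (Z : ℝ) {x : Fin 3 → ℝ}
    (hx : d ≤ enorm3 x) : Wloc Z θ₀ θ₁ x ≤ (Z + 4 * c₁ ^ 2 / d) / enorm3 x := by
  have hx0 : 0 < enorm3 x := hd.trans_le hx
  unfold Wloc
  rcases le_or_gt (enorm3 x) (2 * d) with h2 | h2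
  · have key : ∀ v : Fin 3 → ℝ, enorm3 v ≤ c₁ / d → ∑ k, v k ^ 2 ≤ 2 * c₁ ^ 2 / d / enorm3 x := by
      intro v hv
      have e : ∑ k, v k ^ 2 = enorm3 v ^ 2 := (enorm3_sq v).symm
      rw [e, le_div_iff₀ hx0]
      calc enorm3 v ^ 2 * enorm3 x ≤ (c₁ / d) ^ 2 * (2 * d) := by
            gcongr
            exact enorm3_nonneg v
        _ = 2 * c₁ ^ 2 / d := by field_simp
    have k0 := key _ (h.grad₀ x)
    have k1 := key _ (h.grad₁ x)
    calc _ ≤ Z / enorm3 x + 2 * c₁ ^ 2 / d / enorm3 x + 2 * c₁ ^ 2 / d / enorm3 x := by gcongr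
      _ = _ := by ring
  · obtain ⟨h0, h1⟩ := h.grad_eq_zero h2
    rw [h0, h1]
    have : 0 ≤ 4 * c₁ ^ 2 / d := by positivity
    simp only [Pi.zero_apply, ne_eq, OfNat.ofNat_ne_zero, not_false_eq_true, zero_pow,
      Finset.sum_const_zero, add_zero]
    gcongr
    linarith

theorem Wloc_nonneg {Z : ℝ} (hZ : 0 ≤ Z) (x : Fin 3 → ℝ) : 0 ≤ Wloc Z θ₀ θ₁ x := by
  unfold Wloc
  have := enorm3_nonneg x
  positivity

theorem measurable_Wloc (h : AdmissibleCutoffs d c₁ θ₀ θ₁) (Z : ℝ) :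
    Measurable (Wloc Z θ₀ θ₁) := by
  have hg : ∀ {θ : (Fin 3 → ℝ) → ℝ}, ContDiff ℝ (⊤ : ℕ∞) θ →
      Continuous fun x => ∑ k, grad3 θ x k ^ 2 := fun hθ => by
    have := continuous_fderiv_single hθ
    unfold grad3
    fun_prop
  exact ((continuous_enorm3.measurable.const_div _).fun_add (hg h.smooth₀).measurable).fun_add
    (hg h.smooth₁).measurable

end AdmissibleCutoffs

theorem closedBall_subset_ball3 {s r : ℝ} (hsr : s ≤ 3 * r / 2) :
    Metric.closedBall 0 s ⊆ ball3 (3 * r) := by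
  intro x hx
  rw [mem_closedBall_zero_iff] at hx
  have := enorm3_le_norm x
  change enorm3 x ≤ 3 * r
  linarith

theorem field_localization {A : (Fin 3 → ℝ) → Fin 3 → ℝ} (hA : ContDiff ℝ (⊤ : ℕ∞) A)
    {γ r L : ℝ} (hL : 0 < L) (hLr : L ≤ r / 20) (hγ : 0 ≤ γ) :
    γ * (∫ w in Metric.closedBall 0 (r + L), ∫ x in Metric.closedBall w (6 * L), gradSq A x) ≤
      γ * (12 * L) ^ 3 * ∫ x in ball3 (3 * r), gradSq A x := by
  have hc := continuous_gradSq hA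
  have h1 := setIntegral_setIntegral_closedBall_le hc (gradSq_nonneg A) 0 (r + L)
    (t := 6 * L) (by linarith)
  have hb : ball3 (3 * r) ⊆ Metric.closedBall 0 (3 * r) := fun x hx => by
    rw [mem_closedBall_zero_iff]
    exact (norm_le_enorm3 x).trans hx
  have hm : MeasurableSet (ball3 (3 * r)) :=
    (isClosed_le continuous_enorm3 continuous_const).measurableSet
  have h2 : ∫ x in Metric.closedBall 0 (r + L + 6 * L), gradSq A x ≤
      ∫ x in ball3 (3 * r), gradSq A x := by
    refine setIntegral_mono_set ?_ (Filter.Eventually.of_forall (gradSq_nonneg A))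
      (Filter.Eventually.of_forall (closedBall_subset_ball3 (by linarith)))
    exact (hc.continuousOn.integrableOn_compact (isCompact_closedBall _ _)).mono_set hb
  calc _ ≤ γ * ((2 * (6 * L)) ^ 3 * ∫ x in ball3 (3 * r), gradSq A x) := by
        gcongr
        exact h1.trans (by gcongr)
    _ = _ := by ring

theorem truncEnergy_ge {C0 Kg CP : ℝ}
    (hloc : ∀ A τ J ρ, OneBody C0 A τ J ρ → ∀ θ : (Fin 3 → ℝ) → ℝ, ContDiff ℝ (⊤ : ℕ∞) θ →
      (∀ x, |θ x| ≤ 1) → ∀ L r ε Vm F1 γ : ℝ, 0 < L → 0 < ε → ε < 1 → 0 < Vm → 0 ≤ γ →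
      0 ≤ F1 → (∀ F, F1 ≤ F → CP * (Vm * (1 + (2 * Vm) ^ ((3 : ℝ) / 2) * L ^ 3 + L * F)) ≤
        γ * L ^ 3 * F) →
      ∀ V v p : (Fin 3 → ℝ) → ℝ, Measurable V → (∀ x, 0 ≤ V x) → (∀ x, V x ≤ Vm) →
      (∀ x, r ≤ ‖x‖ → V x = 0) → (∀ w, 0 ≤ v w) →
      (∀ w, ∀ x ∈ Metric.closedBall w L, V x ≤ v w) →
      IntegrableOn p (Metric.closedBall 0 (r + L)) →
      (∀ w, 2 / (15 * Real.pi ^ 2) * ((1 - ε) ^ (-(3 : ℝ) / 2) *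
        ((1 + ε) * v w + C0 / ε ^ 3 * F1 ^ 2) ^ ((5 : ℝ) / 2)) ≤ p w) →
      ∫ x, V x * (θ x ^ 2 * ρ x) ≤ (∫ x, tden τ J ρ θ x) +
        1 / ε * ((L ^ 2)⁻¹ * Kg) * (∫ x in Metric.closedBall 0 (r + L + L), θ x ^ 2 * ρ x) +
        γ * (∫ w in Metric.closedBall 0 (r + L), ∫ x in Metric.closedBall w (6 * L), gradSq A x) +
        ∫ w in Metric.closedBall 0 (r + L), p w)
    {n : ℕ} {Ψ : (Fin (n + 1) → Fin 3 → ℝ) → (Fin (n + 1) → Fin 2) → ℂ}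
    (hΨ : IsWaveFun (n + 1) Ψ) {A : (Fin 3 → ℝ) → Fin 3 → ℝ} (hA : ContDiff ℝ (⊤ : ℕ∞) A)
    (hO : OneBody C0 A (Family.kin A (slice Ψ)) (Family.cur A (slice Ψ)) (Family.den (slice Ψ)))
    {d c₁ : ℝ} (hd : 0 < d) {θ₀ θ₁ : (Fin 3 → ℝ) → ℝ} (hθ : AdmissibleCutoffs d c₁ θ₀ θ₁)
    {Z α r L ε Vm F1 T l B : ℝ} {ρ : (Fin 3 → ℝ) → ℝ} (hρ : Measurable ρ) (hρ0 : ∀ x, 0 ≤ ρ x)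
    (hD : coulombSelf ρ < ⊤) (hZ : 1 ≤ Z) (hα : 0 < α) (hr : 0 < r) (hL : 0 < L)
    (hLr : L ≤ r / 20) (hε : 0 < ε) (hε1 : ε < 1) (hVm : 0 < Vm) (hF1 : 0 ≤ F1) (hT : 0 ≤ T)
    (hl : 0 < l) (hB : 0 ≤ B)
    (hbad : ∀ F, F1 ≤ F → CP * (Vm * (1 + (2 * Vm) ^ ((3 : ℝ) / 2) * L ^ 3 + L * F)) ≤
        (27648 * Real.pi * α ^ 2)⁻¹ * F)
    {V v p : (Fin 3 → ℝ) → ℝ} (hVmeas : Measurable V) (hV0 : ∀ x, 0 ≤ V x)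
    (hVle : ∀ x, V x ≤ Vm) (hVr : ∀ x, r ≤ ‖x‖ → V x = 0) (hv0 : ∀ w, 0 ≤ v w)
    (hVv : ∀ w, ∀ x ∈ Metric.closedBall w L, V x ≤ v w)
    (hpi : IntegrableOn p (Metric.closedBall 0 (r + L)))
    (hp : ∀ w, 2 / (15 * Real.pi ^ 2) * ((1 - ε) ^ (-(3 : ℝ) / 2) *
        ((1 + ε) * v w + C0 / ε ^ 3 * F1 ^ 2) ^ ((5 : ℝ) / 2)) ≤ p w)
    (hin : ∀ x, ‖x‖ < r → d < enorm3 x → (Z + 4 * c₁ ^ 2 / d) / enorm3 x -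
      (l * Z * PT T ρ (l • x) - l * (cK * T / 2)) + 1 / ε * ((L ^ 2)⁻¹ * Kg) ≤ V x)
    (hout : ∀ x, r ≤ ‖x‖ → d < enorm3 x → (Z + 4 * c₁ ^ 2 / d) / enorm3 x +
      (if ‖x‖ ≤ r + L + L then 1 / ε * ((L ^ 2)⁻¹ * Kg) else 0) ≤ B * Z / enorm3 x) :
    -(∫ w in Metric.closedBall 0 (r + L), p w) - l * Z ^ 2 * (coulombSelf ρ).toReal -
      (B + 1) ^ 2 * Z ^ 2 / r ≤ truncEnergy (n + 1) Z α r θ₀ θ₁ A Ψ := by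
  set ν := Family.den (slice Ψ) with hν
  set Λ := 1 / ε * ((L ^ 2)⁻¹ * Kg) with hΛ
  have hν0 : ∀ x, 0 ≤ ν x := hO.pos.rho_nonneg
  have hZ0 : 0 ≤ Z := by linarith
  set γ := (27648 * Real.pi * α ^ 2 * L ^ 3)⁻¹ with hγ
  have hγ0 : 0 ≤ γ := by positivity
  have hγL : γ * L ^ 3 = (27648 * Real.pi * α ^ 2)⁻¹ := by rw [hγ]; field_simp
  have hγ12 : γ * (12 * L) ^ 3 = (16 * Real.pi * α ^ 2)⁻¹ := by rw [hγ]; field_simp; norm_num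
  have h1 := hloc A _ _ _ hO θ₀ hθ.smooth₀ hθ.abs_le_one L r ε Vm F1 γ hL hε hε1 hVm hγ0 hF1
    (by rw [hγL]; exact hbad) V v p hVmeas hV0 hVle hVr hv0 hVv hpi hp
  have h2 := field_localization hA hL hLr hγ0
  rw [hγ12] at h2
  set q : (Fin 3 → ℝ) → ℝ := fun x => if r ≤ ‖x‖ then 0 else θ₀ x ^ 2 with hq
  have hqm : Measurable q := Measurable.ite (measurableSet_le measurable_const measurable_norm)
    measurable_const (hθ.smooth₀.continuous.pow 2).measurable
  have hθ2 : ∀ x, θ₀ x ^ 2 ≤ 1 := fun x => by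
    rw [← sq_abs]; exact pow_le_one₀ (abs_nonneg _) (hθ.abs_le_one x)
  have hq0 : ∀ x, 0 ≤ q x := fun x => by simp only [hq]; split_ifs <;> positivity
  have hq1 : ∀ x, q x ≤ 1 := fun x => by
    simp only [hq]; split_ifs
    · norm_num
    · exact hθ2 x
  have h3 := coulomb_expectation_lower hΨ hT hρ hρ0 hD hZ0 hl hr hB hZ hqm hq0 hq1
    (fun x hx => by simp [hq, hx])
  set Wc : (Fin 3 → ℝ) → ℝ := fun x => q x * (l * Z * PT T ρ (l • x) - l * (cK * T / 2)) +
        if r ≤ ‖x‖ then B * Z / enorm3 x else 0 with hWc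
  have hWlm : Measurable fun x => Wloc Z θ₀ θ₁ x * θ₀ x ^ 2 :=
    (hθ.measurable_Wloc Z).fun_mul (hθ.smooth₀.continuous.pow 2).measurable
  have hWlb : ∀ x, |Wloc Z θ₀ θ₁ x * θ₀ x ^ 2| ≤ (Z + 4 * c₁ ^ 2 / d) / d := fun x => by
    rw [abs_of_nonneg (mul_nonneg (AdmissibleCutoffs.Wloc_nonneg hZ0 x) (sq_nonneg _))]
    rcases le_or_gt (enorm3 x) d with hx | hx
    · rw [hθ.eq_zero hx]
      have : 0 ≤ (Z + 4 * c₁ ^ 2 / d) / d := by positivity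
      simpa using this
    · refine (mul_le_of_le_one_right (AdmissibleCutoffs.Wloc_nonneg hZ0 x) (hθ2 x)).trans
        ((hθ.Wloc_le hd Z hx.le).trans ?_)
      gcongr
  have h4 := sum_potInt hΨ hWlm hWlb
  have h5 := sum_pauliKin hΨ hθ.smooth₀ hA.continuous
  have hνc := hO.cont_den
  obtain ⟨R0, hR0⟩ := hO.zero
  have hνi : Integrable ν := hνc.integrable_of_hasCompactSupport
    (HasCompactSupport.intro (isCompact_closedBall 0 R0) fun x hx => (hR0 x hx).2.2)
  have hθν : Integrable fun x => θ₀ x ^ 2 * ν x :=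
    hνi.bdd_mul (c := 1) (hθ.smooth₀.continuous.pow 2).aestronglyMeasurable
      (Filter.Eventually.of_forall fun x => by
        rw [Real.norm_eq_abs, abs_of_nonneg (sq_nonneg _)]; exact hθ2 x)
  have i1 : Integrable fun x => Wloc Z θ₀ θ₁ x * θ₀ x ^ 2 * ν x :=
    hνi.bdd_mul hWlm.aestronglyMeasurable (Filter.Eventually.of_forall hWlb)
  have i2 : Integrable fun x => V x * (θ₀ x ^ 2 * ν x) :=
    hθν.bdd_mul (c := Vm) hVmeas.aestronglyMeasurable (Filter.Eventually.of_forall fun x => by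
      rw [Real.norm_eq_abs, abs_of_nonneg (hV0 x)]; exact hVle x)
  have hQm : MeasurableSet (Metric.closedBall (0 : Fin 3 → ℝ) (r + L + L)) :=
    Metric.isClosed_closedBall.measurableSet
  have i3 : Integrable ((Metric.closedBall (0 : Fin 3 → ℝ) (r + L + L)).indicator
      fun x => Λ * (θ₀ x ^ 2 * ν x)) := (hθν.const_mul Λ).indicator hQm
  have hcK := cK_pos
  have i4 : Integrable fun x => Wc x * ν x := by
    refine hνi.bdd_mul (c := l * Z * ((cK * T + 2 * (coulombSelf ρ).toReal) / 2) +
      l * (cK * T / 2) + B * Z / r) ?_ (Filter.Eventually.of_forall fun x => ?_)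
    · exact ((hqm.fun_mul ((((measurable_PT T hρ).comp (measurable_const_smul l)).const_mul
        _).sub_const _)).fun_add (Measurable.ite (measurableSet_le measurable_const measurable_norm)
        (continuous_enorm3.measurable.const_div _) measurable_const)).aestronglyMeasurable
    · have h1 := PT_nonneg T ρ (l • x)
      have h2 : PT T ρ (l • x) ≤ (cK * T + 2 * (coulombSelf ρ).toReal) / 2 := by
        linarith [PT_le hT hρ hρ0 hD (l • x)]
      rw [Real.norm_eq_abs]
      refine (abs_add_le _ _).trans (add_le_add ?_ ?_)
      · rw [abs_mul, abs_of_nonneg (hq0 x)]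
        refine (mul_le_of_le_one_left (abs_nonneg _) (hq1 x)).trans ((abs_sub _ _).trans ?_)
        rw [abs_of_nonneg (by positivity), abs_of_nonneg (by positivity)]
        gcongr
      · split_ifs with hx
        · have : r ≤ enorm3 x := hx.trans (norm_le_enorm3 x)
          rw [abs_of_nonneg (div_nonneg (by positivity) (enorm3_nonneg x))]
          gcongr
        · rw [abs_zero]; positivity
  have hind : ∀ x, (Metric.closedBall (0 : Fin 3 → ℝ) (r + L + L)).indicator
      (fun x => Λ * (θ₀ x ^ 2 * ν x)) x =
      if ‖x‖ ≤ r + L + L then Λ * (θ₀ x ^ 2 * ν x) else 0 := fun x => by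
    by_cases hx : ‖x‖ ≤ r + L + L
    · rw [if_pos hx, Set.indicator_of_mem (mem_closedBall_zero_iff.2 hx)]
    · rw [if_neg hx, Set.indicator_of_notMem (fun h => hx (mem_closedBall_zero_iff.1 h))]
  have point : ∀ x, Wloc Z θ₀ θ₁ x * θ₀ x ^ 2 * ν x + (Metric.closedBall (0 : Fin 3 → ℝ)
      (r + L + L)).indicator (fun x => Λ * (θ₀ x ^ 2 * ν x)) x ≤
      V x * (θ₀ x ^ 2 * ν x) + Wc x * ν x := by
    intro x
    have hx0 := enorm3_nonneg x
    rcases le_or_gt (enorm3 x) d with hx | hx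
    · have e : θ₀ x = 0 := hθ.eq_zero hx
      have hW0 : 0 ≤ Wc x := by
        simp only [hWc, hq, e]
        split_ifs
        · have : 0 ≤ B * Z / enorm3 x := by positivity
          simpa using this
        · simp
      have := mul_nonneg hW0 (hν0 x)
      rw [hind, e]
      simpa using this
    · have hW := hθ.Wloc_le hd Z hx.le
      have ht : 0 ≤ θ₀ x ^ 2 * ν x := mul_nonneg (sq_nonneg _) (hν0 x)
      rcases lt_or_ge ‖x‖ r with hxr | hxr
      · have hmem : x ∈ Metric.closedBall (0 : Fin 3 → ℝ) (r + L + L) := by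
          rw [mem_closedBall_zero_iff]; linarith
        rw [Set.indicator_of_mem hmem]
        simp only [hWc, hq, if_neg hxr.not_ge, add_zero]
        have := mul_le_mul_of_nonneg_right ((add_le_add_left (sub_le_sub_right hW _) _).trans
          (hin x hxr hx)) ht
        linarith
      · have h6 := hout x hxr hx
        simp only [hWc, hq, if_pos hxr, zero_mul, zero_add, hVr x hxr]
        have h7 : (Wloc Z θ₀ θ₁ x + if ‖x‖ ≤ r + L + L then Λ else 0) * (θ₀ x ^ 2 * ν x) ≤
            B * Z / enorm3 x * (θ₀ x ^ 2 * ν x) :=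
          mul_le_mul_of_nonneg_right ((add_le_add_left hW _).trans h6) ht
        have h8 : B * Z / enorm3 x * (θ₀ x ^ 2 * ν x) ≤ B * Z / enorm3 x * ν x :=
          mul_le_mul_of_nonneg_left (mul_le_of_le_one_left (hν0 x) (hθ2 x)) (by positivity)
        rw [hind]
        split_ifs at h7 ⊢ <;> linarith
  have h_mono_int := integral_mono (i1.add i3) (i2.add i4) point
  have e1 : ∫ x, (((fun x => Wloc Z θ₀ θ₁ x * θ₀ x ^ 2 * ν x) +
      (Metric.closedBall (0 : Fin 3 → ℝ) (r + L + L)).indicator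
      fun x => Λ * (θ₀ x ^ 2 * ν x)) x) = (∫ x, Wloc Z θ₀ θ₁ x * θ₀ x ^ 2 * ν x) +
      Λ * ∫ x in Metric.closedBall 0 (r + L + L), θ₀ x ^ 2 * ν x := by
    rw [integral_add' i1 i3, integral_indicator hQm, integral_const_mul]
  have e2 := integral_add' i2 i4
  rw [e1, e2] at h_mono_int
  unfold truncEnergy
  rw [Finset.sum_sub_distrib, h4, h5]
  linarith

theorem add_rpow_five_halves_le {x y η : ℝ} (hx : 0 ≤ x) (hy : 0 ≤ y) (hη : 0 < η) :
    (x + y) ^ ((5 : ℝ) / 2) ≤ (1 + η) ^ ((3 : ℝ) / 2) * x ^ ((5 : ℝ) / 2) +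
      (1 + 1 / η) ^ ((3 : ℝ) / 2) * y ^ ((5 : ℝ) / 2) := by
  have key : ∀ c u : ℝ, 0 < c → 0 ≤ u → c⁻¹ * (c * u) ^ ((5 : ℝ) / 2) =
      c ^ ((3 : ℝ) / 2) * u ^ ((5 : ℝ) / 2) := by
    intro c u hc hu
    rw [Real.mul_rpow hc.le hu, ← mul_assoc, show (5 : ℝ) / 2 = 3 / 2 + 1 by norm_num,
      Real.rpow_add_one hc.ne']
    field_simp
  have h1 : 0 < 1 + η := by linarith
  have h2 : 0 < 1 + 1 / η := by positivity
  have hsum : (1 + η)⁻¹ + (1 + 1 / η)⁻¹ = 1 := by field_simp; ring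
  have h := (convexOn_rpow (p := (5 : ℝ) / 2) (by norm_num)).2
    (Set.mem_Ici.2 (mul_nonneg h1.le hx)) (Set.mem_Ici.2 (mul_nonneg h2.le hy))
    (inv_nonneg.2 h1.le) (inv_nonneg.2 h2.le) hsum
  simp only [smul_eq_mul] at h
  rw [key _ _ h1 hx, key _ _ h2 hy, inv_mul_cancel_left₀ h1.ne', inv_mul_cancel_left₀ h2.ne'] at h
  exact h

theorem integrable_wTF_smul {T : ℝ} (hT : 0 < T) {ρ : (Fin 3 → ℝ) → ℝ} (hρ : Measurable ρ)
    (hI : tfNegIntegral ρ < ⊤) {l : ℝ} (hl : 0 < l) :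
    Integrable (fun w => wTF T ρ (l • w) ^ ((5 : ℝ) / 2)) ∧
      ∫ w, wTF T ρ (l • w) ^ ((5 : ℝ) / 2) ≤ (l ^ 3)⁻¹ * (tfNegIntegral ρ).toReal := by
  have hm : Measurable fun U => wTF T ρ U ^ ((5 : ℝ) / 2) := (measurable_wTF T hρ).pow_const _
  have h0 : ∀ U, 0 ≤ wTF T ρ U ^ ((5 : ℝ) / 2) := fun U => Real.rpow_nonneg (wTF_nonneg _ _ _) _
  have h1 := lintegral_wTF_le hT hρ hI
  have hi : Integrable fun U => wTF T ρ U ^ ((5 : ℝ) / 2) := by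
    refine ⟨hm.aestronglyMeasurable, ?_⟩
    rw [hasFiniteIntegral_iff_ofReal (Filter.Eventually.of_forall h0)]
    exact h1.trans_lt hI
  refine ⟨hi.comp_smul hl.ne', ?_⟩
  rw [Measure.integral_comp_smul volume (fun U => wTF T ρ U ^ ((5 : ℝ) / 2)) l, smul_eq_mul]
  simp only [Module.finrank_fintype_fun_eq_card, Fintype.card_fin]
  rw [abs_of_nonneg (by positivity)]
  gcongr
  rw [integral_eq_lintegral_of_nonneg_ae (Filter.Eventually.of_forall h0) hm.aestronglyMeasurable]
  exact ENNReal.toReal_mono hI.ne h1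

theorem inv_one_sub_le_exp {ε : ℝ} (h0 : 0 ≤ ε) (h1 : ε ≤ 1 / 4) : (1 - ε)⁻¹ ≤ Real.exp (2 * ε) := by
  rw [inv_le_comm₀ (by linarith) (Real.exp_pos _), ← Real.exp_neg]
  have h := Real.exp_bound_div_one_sub_of_interval (x := ε)
  have h2 : Real.exp (-(2 * ε)) * Real.exp (2 * ε) = 1 := by rw [← Real.exp_add]; simp
  have h3 := Real.quadratic_le_exp_of_nonneg (x := 2 * ε) (by linarith)
  have h4 : 1 ≤ (1 - ε) * Real.exp (2 * ε) := by nlinarith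
  nlinarith [Real.exp_pos (-(2 * ε))]

theorem semiclassical_coefficient_le {ε a : ℝ} (h0 : 0 ≤ ε) (h1 : ε ≤ 1 / 4) (ha0 : 0 ≤ a)
    (ha : a ≤ (1 - ε) ^ (-(3 : ℝ) / 2) * Real.exp ε) :
    (1 - ε) ^ (-(3 : ℝ) / 2) * ((1 + ε) ^ ((3 : ℝ) / 2) * ((1 + ε) * a) ^ ((5 : ℝ) / 2)) ≤
      1 + 17 * Real.exp 17 * ε := by
  have e1 : (1 - ε) ^ (-(3 : ℝ) / 2) ≤ Real.exp (3 * ε) := by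
    rw [show -(3 : ℝ) / 2 = -(3 / 2) by ring, Real.rpow_neg (by linarith),
      ← Real.inv_rpow (by linarith)]
    refine (Real.rpow_le_rpow (inv_nonneg.2 (by linarith)) (inv_one_sub_le_exp h0 h1)
      (by norm_num)).trans (le_of_eq ?_)
    rw [← Real.exp_mul]; ring_nf
  have e2 : 1 + ε ≤ Real.exp ε := by linarith [Real.add_one_le_exp ε]
  have e3 : (1 + ε) ^ ((3 : ℝ) / 2) ≤ Real.exp (3 / 2 * ε) := by
    refine (Real.rpow_le_rpow (by linarith) e2 (by norm_num)).trans (le_of_eq ?_)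
    rw [← Real.exp_mul]; ring_nf
  have e4 : (1 + ε) * a ≤ Real.exp (5 * ε) := by
    calc (1 + ε) * a ≤ Real.exp ε * (Real.exp (3 * ε) * Real.exp ε) := by
          gcongr
          exact ha.trans (by gcongr)
      _ = _ := by rw [← Real.exp_add, ← Real.exp_add]; ring_nf
  have e5 : ((1 + ε) * a) ^ ((5 : ℝ) / 2) ≤ Real.exp (25 / 2 * ε) := by
    refine (Real.rpow_le_rpow (by positivity) e4 (by norm_num)).trans (le_of_eq ?_)
    rw [← Real.exp_mul]; ring_nf
  calc _ ≤ Real.exp (3 * ε) * (Real.exp (3 / 2 * ε) * Real.exp (25 / 2 * ε)) := by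
        gcongr
    _ = Real.exp (17 * ε) := by rw [← Real.exp_add, ← Real.exp_add]; ring_nf
    _ ≤ 1 + 17 * ε * Real.exp (17 * ε) := by
        have h2 : Real.exp (-(17 * ε)) * Real.exp (17 * ε) = 1 := by rw [← Real.exp_add]; simp
        nlinarith [Real.add_one_le_exp (-(17 * ε)), Real.exp_pos (17 * ε)]
    _ ≤ 1 + 17 * ε * Real.exp 17 := by gcongr; linarith
    _ = _ := by ring

theorem exp_mul_exp_eq {a b c : ℝ} (h : a + b = c) : Real.exp a * Real.exp b = Real.exp c := by
  rw [← Real.exp_add, h]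

theorem inv_le_exp_of_exp_neg_le {a y : ℝ} (h : Real.exp (-a) ≤ y) : y⁻¹ ≤ Real.exp a := by
  have := inv_anti₀ (Real.exp_pos _) h
  rwa [← Real.exp_neg, neg_neg] at this

/-- Pointwise upper bound for the effective potential away from the nucleus. -/
theorem effective_potential_le {z t c K P y : ℝ} (ht : 0 ≤ t) (htz : 39 * t ≤ 2 * z)
    (hc : 0 ≤ c) (hK : 0 ≤ K) (hP : 0 ≤ P) (hy : Real.exp (-(t + z / 3)) < y) :
    (Real.exp z + c / Real.exp (-(t + z / 3))) / y -
      (Real.exp (z / 3) * Real.exp z * P - Real.exp (z / 3) * (cK * Real.exp (z / 5) / 2)) +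
      K * Real.exp (4 * z / 3 + (-(3 * z / 25) + 3 * t / 2)) ≤
      (2 + c + K) * Real.exp (4 * z / 3 + t) := by
  have hy0 : 0 < y := (Real.exp_pos _).trans hy
  have hyi := inv_le_exp_of_exp_neg_le hy.le
  have h1 : Real.exp z * y⁻¹ ≤ Real.exp (4 * z / 3 + t) := by
    rw [← exp_mul_exp_eq (show z + (t + z / 3) = 4 * z / 3 + t by ring)]
    gcongr
  have h2 : c * Real.exp (t + z / 3) * y⁻¹ ≤ c * Real.exp (4 * z / 3 + t) := by
    rw [mul_assoc]
    gcongr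
    refine (mul_le_mul_of_nonneg_left hyi (Real.exp_pos _).le).trans ?_
    rw [← Real.exp_add]
    exact Real.exp_le_exp.2 (by linarith)
  have h3 : Real.exp (z / 3) * (cK * Real.exp (z / 5) / 2) ≤ Real.exp (4 * z / 3 + t) := by
    calc _ = cK / 2 * (Real.exp (z / 3) * Real.exp (z / 5)) := by ring
      _ ≤ 1 * (Real.exp (z / 3) * Real.exp (z / 5)) := by
          gcongr
          linarith [cK_le]
      _ ≤ _ := by
          rw [one_mul, ← Real.exp_add]
          exact Real.exp_le_exp.2 (by linarith)
  have h4 : K * Real.exp (4 * z / 3 + (-(3 * z / 25) + 3 * t / 2)) ≤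
      K * Real.exp (4 * z / 3 + t) := by
    gcongr
    linarith
  have h5 : 0 ≤ Real.exp (z / 3) * Real.exp z * P := by positivity
  have h6 : (Real.exp z + c / Real.exp (-(t + z / 3))) / y =
      Real.exp z * y⁻¹ + c * Real.exp (t + z / 3) * y⁻¹ := by
    rw [Real.exp_neg]; field_simp
  rw [h6]
  linarith

/-- Comparison of the effective potential with the smeared Thomas–Fermi potential. -/
theorem effective_potential_le_wTF {z t c K a W y P : ℝ} (ht : 0 ≤ t) (htz : 39 * t ≤ 2 * z)
    (hc : 0 ≤ c) (hK : 0 ≤ K) (hy : Real.exp (-(t + z / 3)) < y)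
    (h : (Real.exp (z / 3) * y)⁻¹ - P ≤ a * W +
      2 / (Real.exp (z / 5) * (Real.exp (z / 3) * y) ^ 2)) :
    (Real.exp z + c / Real.exp (-(t + z / 3))) / y -
      (Real.exp (z / 3) * Real.exp z * P - Real.exp (z / 3) * (cK * Real.exp (z / 5) / 2)) +
      K * Real.exp (4 * z / 3 + (-(3 * z / 25) + 3 * t / 2)) ≤
      Real.exp (4 * z / 3) * (a * W + (3 + c + K) * Real.exp (-(z / 12) + 39 * t / 40)) := by
  have hy0 : 0 < y := (Real.exp_pos _).trans hy
  have hyi := inv_le_exp_of_exp_neg_le hy.le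
  have hyl : Real.exp (-t) ≤ Real.exp (z / 3) * y := by
    rw [← exp_mul_exp_eq (show z / 3 + -(t + z / 3) = -t by ring)]
    gcongr
  set G := Real.exp (-(z / 12) + 39 * t / 40) with hG
  have e1 : Real.exp (z / 3) * Real.exp z = Real.exp (4 * z / 3) := exp_mul_exp_eq (by ring)
  have h1 : 2 / (Real.exp (z / 5) * (Real.exp (z / 3) * y) ^ 2) ≤ 2 * G := by
    calc _ ≤ 2 / (Real.exp (z / 5) * Real.exp (-t) ^ 2) := by gcongr
      _ = 2 * Real.exp (-(z / 5) + 2 * t) := by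
          rw [← Real.exp_nat_mul, ← Real.exp_add, div_eq_mul_inv, ← Real.exp_neg]
          congr 2
          push_cast; ring
      _ ≤ _ := by
          rw [hG]; gcongr 2 * Real.exp ?_
          linarith
  have h2 : c * Real.exp (t + z / 3) * y⁻¹ ≤ Real.exp (4 * z / 3) * (c * G) := by
    calc _ ≤ c * Real.exp (t + z / 3) * Real.exp (t + z / 3) := by gcongr
      _ = c * Real.exp (t + z / 3 + (t + z / 3)) := by rw [mul_assoc, ← Real.exp_add]
      _ ≤ c * Real.exp (4 * z / 3 + (-(z / 12) + 39 * t / 40)) := by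
          gcongr c * Real.exp ?_
          linarith
      _ = _ := by rw [Real.exp_add, hG]; ring
  have h3 : Real.exp (z / 3) * (cK * Real.exp (z / 5) / 2) ≤ Real.exp (4 * z / 3) * G := by
    calc _ = cK / 2 * (Real.exp (z / 3) * Real.exp (z / 5)) := by ring
      _ ≤ 1 * (Real.exp (z / 3) * Real.exp (z / 5)) := by
          gcongr
          linarith [cK_le]
      _ ≤ _ := by
          rw [one_mul, hG, ← Real.exp_add, ← Real.exp_add]
          exact Real.exp_le_exp.2 (by linarith)
  have h4 : K * Real.exp (4 * z / 3 + (-(3 * z / 25) + 3 * t / 2)) ≤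
      Real.exp (4 * z / 3) * (K * G) := by
    rw [Real.exp_add, hG, mul_left_comm]
    gcongr _ * (_ * Real.exp ?_)
    linarith
  have h6 : (Real.exp z + c / Real.exp (-(t + z / 3))) / y =
      Real.exp (4 * z / 3) * (Real.exp (z / 3) * y)⁻¹ + c * Real.exp (t + z / 3) * y⁻¹ := by
    rw [Real.exp_neg, ← e1]; field_simp
  rw [h6, e1]
  have h7 := mul_le_mul_of_nonneg_left h (Real.exp_pos (4 * z / 3)).le
  have h8 := mul_le_mul_of_nonneg_left h1 (Real.exp_pos (4 * z / 3)).le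
  have e2 : Real.exp (4 * z / 3) * (a * W + (3 + c + K) * G) = Real.exp (4 * z / 3) * (a * W) +
      Real.exp (4 * z / 3) * (2 * G) + Real.exp (4 * z / 3) * (c * G) + Real.exp (4 * z / 3) * G +
      Real.exp (4 * z / 3) * (K * G) := by ring
  rw [e2]
  linarith

/-- The large-field regime: the field energy dominates the crude local bound. -/
theorem strong_field_le {z t CV CP α F : ℝ} (ht : 0 ≤ t) (hz : 0 ≤ z) (htz : 39 * t ≤ 2 * z)
    (hCV : 0 < CV) (hCP : 0 < CP) (hα : 0 < α)
    (hκ : Real.exp z * α ^ 2 ≤ (27648 * Real.pi * (CP * (2 * CV + 3 * CV * CV ^ ((3 : ℝ) / 2))))⁻¹)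
    (hF : Real.exp (23 * z / 40 + 39 * t / 80) ≤ F) :
    CP * (CV * Real.exp (4 * z / 3 + t) * (1 + (2 * (CV * Real.exp (4 * z / 3 + t))) ^ ((3 : ℝ) / 2) *
      (Real.exp (-(59 * z / 100 + 3 * t / 4)) / 20) ^ 3 +
      Real.exp (-(59 * z / 100 + 3 * t / 4)) / 20 * F)) ≤ (27648 * Real.pi * α ^ 2)⁻¹ * F := by
  have hF0 : 0 < F := (Real.exp_pos _).trans_le hF
  have hF' : ∀ x, x ≤ z + (23 * z / 40 + 39 * t / 80) → Real.exp x ≤ Real.exp z * F := fun x hx =>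
    calc Real.exp x ≤ Real.exp z * Real.exp (23 * z / 40 + 39 * t / 80) := by
          rw [← Real.exp_add]; exact Real.exp_le_exp.2 hx
      _ ≤ _ := by gcongr
  have h1 : Real.exp (4 * z / 3 + t) ≤ Real.exp z * F := hF' _ (by linarith)
  have hp : (2 * (CV * Real.exp (4 * z / 3 + t))) ^ ((3 : ℝ) / 2) ≤
      3 * CV ^ ((3 : ℝ) / 2) * Real.exp (2 * z + 3 * t / 2) := by
    rw [Real.mul_rpow (by norm_num) (by positivity), Real.mul_rpow hCV.le (Real.exp_pos _).le,
      ← Real.exp_mul, show (4 * z / 3 + t) * (3 / 2) = 2 * z + 3 * t / 2 by ring, ← mul_assoc]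
    gcongr
    have h2 : (2 : ℝ) ^ ((3 : ℝ) / 2) = 2 * Real.sqrt 2 := by
      rw [show (3 : ℝ) / 2 = 1 + 1 / 2 by norm_num, Real.rpow_add (by norm_num), Real.rpow_one,
        ← Real.sqrt_eq_rpow]
    rw [h2]
    have : Real.sqrt 2 ≤ 3 / 2 := Real.sqrt_le_iff.2 (by norm_num)
    linarith
  have h2 : Real.exp (4 * z / 3 + t) * ((2 * (CV * Real.exp (4 * z / 3 + t))) ^ ((3 : ℝ) / 2) *
      (Real.exp (-(59 * z / 100 + 3 * t / 4)) / 20) ^ 3) ≤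
      3 * CV ^ ((3 : ℝ) / 2) * (Real.exp z * F) := by
    calc _ ≤ Real.exp (4 * z / 3 + t) * ((3 * CV ^ ((3 : ℝ) / 2) * Real.exp (2 * z + 3 * t / 2)) *
          (Real.exp (-(59 * z / 100 + 3 * t / 4))) ^ 3) := by
          gcongr
          exact div_le_self (Real.exp_pos _).le (by norm_num)
      _ = 3 * CV ^ ((3 : ℝ) / 2) * Real.exp (4 * z / 3 + t + (2 * z + 3 * t / 2) +
          (3 : ℕ) * (-(59 * z / 100 + 3 * t / 4))) := by
          rw [← Real.exp_nat_mul, Real.exp_add (4 * z / 3 + t + (2 * z + 3 * t / 2)),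
            Real.exp_add (4 * z / 3 + t)]
          ring
      _ ≤ _ := by
          gcongr
          refine hF' _ ?_
          push_cast
          linarith
  have h3 : Real.exp (4 * z / 3 + t) * (Real.exp (-(59 * z / 100 + 3 * t / 4)) / 20 * F) ≤
      Real.exp z * F := by
    calc _ ≤ Real.exp (4 * z / 3 + t) * (Real.exp (-(59 * z / 100 + 3 * t / 4)) * F) := by
          gcongr
          exact div_le_self (Real.exp_pos _).le (by norm_num)
      _ = Real.exp (4 * z / 3 + t + -(59 * z / 100 + 3 * t / 4)) * F := by
          rw [← mul_assoc, ← Real.exp_add]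
      _ ≤ _ := by
          gcongr
          linarith
  have h4 : CP * (2 * CV + 3 * CV * CV ^ ((3 : ℝ) / 2)) * Real.exp z ≤
      (27648 * Real.pi * α ^ 2)⁻¹ := by
    have hK : 0 < CP * (2 * CV + 3 * CV * CV ^ ((3 : ℝ) / 2)) := by positivity
    set K := CP * (2 * CV + 3 * CV * CV ^ ((3 : ℝ) / 2))
    rw [le_inv_comm₀ (by positivity) (by positivity)]
    have h5 := mul_le_mul_of_nonneg_left hκ
      (show (0 : ℝ) ≤ 27648 * Real.pi * (Real.exp z)⁻¹ by positivity)
    calc 27648 * Real.pi * α ^ 2 = 27648 * Real.pi * (Real.exp z)⁻¹ * (Real.exp z * α ^ 2) := by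
          field_simp
      _ ≤ _ := h5
      _ = _ := by field_simp
  calc _ = CP * CV * (Real.exp (4 * z / 3 + t) + Real.exp (4 * z / 3 + t) *
        ((2 * (CV * Real.exp (4 * z / 3 + t))) ^ ((3 : ℝ) / 2) *
          (Real.exp (-(59 * z / 100 + 3 * t / 4)) / 20) ^ 3) +
        Real.exp (4 * z / 3 + t) * (Real.exp (-(59 * z / 100 + 3 * t / 4)) / 20 * F)) := by ring
    _ ≤ CP * CV * (Real.exp z * F + 3 * CV ^ ((3 : ℝ) / 2) * (Real.exp z * F) + Real.exp z * F) := by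
        gcongr
    _ = CP * (2 * CV + 3 * CV * CV ^ ((3 : ℝ) / 2)) * Real.exp z * F := by ring
    _ ≤ _ := by gcongr

/-- The semiclassical density with all errors collected in one constant term. -/
theorem semiclassical_density_le {z t C0 Cb a W : ℝ} (hz : 0 ≤ z) (hC0 : 0 ≤ C0) (hCb : 0 ≤ Cb)
    (ha0 : 0 ≤ a) (hW : 0 ≤ W)
    (ha : a ≤ (1 - Real.exp (-(z / 30)) / 4) ^ (-(3 : ℝ) / 2) * Real.exp (Real.exp (-(z / 30)) / 4)) :
    2 / (15 * Real.pi ^ 2) * ((1 - Real.exp (-(z / 30)) / 4) ^ (-(3 : ℝ) / 2) *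
      ((1 + Real.exp (-(z / 30)) / 4) *
        (Real.exp (4 * z / 3) * (a * W + Cb * Real.exp (-(z / 12) + 39 * t / 40))) +
        C0 / (Real.exp (-(z / 30)) / 4) ^ 3 * Real.exp (23 * z / 40 + 39 * t / 80) ^ 2) ^
          ((5 : ℝ) / 2)) ≤
    2 / (15 * Real.pi ^ 2) * (Real.exp (10 * z / 3) *
      ((1 + 17 * Real.exp 17 * (Real.exp (-(z / 30)) / 4)) * W ^ ((5 : ℝ) / 2) +
        24 * (2 * Cb + 64 * C0) ^ ((5 : ℝ) / 2) *
          Real.exp (z / 20 + (-(5 * z / 24) + 39 * t / 16)))) := by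
  set ε := Real.exp (-(z / 30)) / 4 with hε
  have hε0 : 0 < ε := by positivity
  have hε1 : ε ≤ 1 / 4 := by
    have : Real.exp (-(z / 30)) ≤ 1 := Real.exp_le_one_iff.2 (by linarith)
    rw [hε]; linarith
  set G := Real.exp (-(z / 12) + 39 * t / 40) with hG
  have hbase : (1 + ε) * (Real.exp (4 * z / 3) * (a * W + Cb * G)) +
      C0 / ε ^ 3 * Real.exp (23 * z / 40 + 39 * t / 80) ^ 2 ≤
      Real.exp (4 * z / 3) * ((1 + ε) * a * W + (2 * Cb + 64 * C0) * G) := by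
    have e1 : C0 / ε ^ 3 * Real.exp (23 * z / 40 + 39 * t / 80) ^ 2 =
        Real.exp (4 * z / 3) * (64 * C0 * G) := by
      have e2 : (Real.exp (-(z / 30)) ^ 3)⁻¹ * Real.exp (23 * z / 40 + 39 * t / 80) ^ 2 =
          Real.exp (4 * z / 3) * G := by
        rw [hG, ← Real.exp_nat_mul, ← Real.exp_nat_mul, ← Real.exp_neg, ← Real.exp_add,
          ← Real.exp_add]
        congr 1
        push_cast; ring
      calc _ = 64 * C0 * ((Real.exp (-(z / 30)) ^ 3)⁻¹ *
            Real.exp (23 * z / 40 + 39 * t / 80) ^ 2) := by rw [hε]; field_simp; norm_num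
        _ = _ := by rw [e2]; ring
    rw [e1]
    have e3 : (1 + ε) * (Real.exp (4 * z / 3) * (Cb * G)) ≤
        2 * (Real.exp (4 * z / 3) * (Cb * G)) := by
      gcongr; linarith
    linarith
  have h10 : Real.exp (4 * z / 3) ^ ((5 : ℝ) / 2) = Real.exp (10 * z / 3) := by
    rw [← Real.exp_mul]; congr 1; ring
  have hGp : ((2 * Cb + 64 * C0) * G) ^ ((5 : ℝ) / 2) =
      (2 * Cb + 64 * C0) ^ ((5 : ℝ) / 2) * Real.exp (-(5 * z / 24) + 39 * t / 16) := by
    rw [Real.mul_rpow (by positivity) (by positivity), hG, ← Real.exp_mul]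
    congr 2; ring
  have hinv : (1 - ε) ^ (-(3 : ℝ) / 2) ≤ 2 := by
    rw [show -(3 : ℝ) / 2 = -(3 / 2) by ring, Real.rpow_neg (by linarith),
      ← Real.inv_rpow (by linarith)]
    have h1 : (1 - ε)⁻¹ ≤ 4 / 3 := by
      rw [inv_le_comm₀ (by linarith) (by norm_num)]; linarith
    calc ((1 - ε)⁻¹) ^ ((3 : ℝ) / 2) ≤ (4 / 3 : ℝ) ^ ((3 : ℝ) / 2) :=
          Real.rpow_le_rpow (inv_nonneg.2 (by linarith)) h1 (by norm_num)
      _ ≤ (4 / 3 : ℝ) ^ (2 : ℝ) := Real.rpow_le_rpow_of_exponent_le (by norm_num) (by norm_num)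
      _ ≤ 2 := by norm_num
  have heps : (1 + 1 / ε) ^ ((3 : ℝ) / 2) ≤ 12 * Real.exp (z / 20) := by
    have h1 : 1 + 1 / ε ≤ 5 * Real.exp (z / 30) := by
      have h2 : 1 / ε = 4 * Real.exp (z / 30) := by
        rw [hε, Real.exp_neg]; field_simp
      linarith [Real.one_le_exp (show 0 ≤ z / 30 by linarith)]
    calc _ ≤ (5 * Real.exp (z / 30)) ^ ((3 : ℝ) / 2) :=
          Real.rpow_le_rpow (by positivity) h1 (by norm_num)
      _ = 5 ^ ((3 : ℝ) / 2) * Real.exp (z / 20) := by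
          rw [Real.mul_rpow (by norm_num) (Real.exp_pos _).le, ← Real.exp_mul]
          congr 2; ring
      _ ≤ _ := by
          gcongr
          have h2 : (5 : ℝ) ^ ((3 : ℝ) / 2) = 5 * Real.sqrt 5 := by
            rw [show (3 : ℝ) / 2 = 1 + 1 / 2 by norm_num, Real.rpow_add (by norm_num),
              Real.rpow_one, ← Real.sqrt_eq_rpow]
          have h3 : Real.sqrt 5 ≤ 12 / 5 := Real.sqrt_le_iff.2 (by norm_num)
          rw [h2]; linarith
  have h0 : 0 ≤ (1 + ε) * (Real.exp (4 * z / 3) * (a * W + Cb * G)) +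
      C0 / ε ^ 3 * Real.exp (23 * z / 40 + 39 * t / 80) ^ 2 := by positivity
  have hm : 0 ≤ (1 - ε) ^ (-(3 : ℝ) / 2) := Real.rpow_nonneg (by linarith) _
  have hsc := semiclassical_coefficient_le hε0.le hε1 ha0 ha
  have hW' : 0 ≤ W ^ ((5 : ℝ) / 2) := Real.rpow_nonneg hW _
  gcongr 2 / (15 * Real.pi ^ 2) * ?_
  calc _ ≤ (1 - ε) ^ (-(3 : ℝ) / 2) *
        (Real.exp (4 * z / 3) * ((1 + ε) * a * W + (2 * Cb + 64 * C0) * G)) ^ ((5 : ℝ) / 2) := by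
        gcongr
    _ = Real.exp (10 * z / 3) * ((1 - ε) ^ (-(3 : ℝ) / 2) *
        ((1 + ε) * a * W + (2 * Cb + 64 * C0) * G) ^ ((5 : ℝ) / 2)) := by
        rw [Real.mul_rpow (Real.exp_pos _).le (by positivity), h10]; ring
    _ ≤ Real.exp (10 * z / 3) * ((1 - ε) ^ (-(3 : ℝ) / 2) *
        ((1 + ε) ^ ((3 : ℝ) / 2) * ((1 + ε) * a * W) ^ ((5 : ℝ) / 2) +
          (1 + 1 / ε) ^ ((3 : ℝ) / 2) * ((2 * Cb + 64 * C0) * G) ^ ((5 : ℝ) / 2))) := by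
        gcongr
        exact add_rpow_five_halves_le (by positivity) (by positivity) hε0
    _ = Real.exp (10 * z / 3) * ((1 - ε) ^ (-(3 : ℝ) / 2) *
        ((1 + ε) ^ ((3 : ℝ) / 2) * ((1 + ε) * a) ^ ((5 : ℝ) / 2)) * W ^ ((5 : ℝ) / 2) +
        (1 - ε) ^ (-(3 : ℝ) / 2) * (1 + 1 / ε) ^ ((3 : ℝ) / 2) *
          ((2 * Cb + 64 * C0) ^ ((5 : ℝ) / 2) * Real.exp (-(5 * z / 24) + 39 * t / 16))) := by
        rw [Real.mul_rpow (show 0 ≤ (1 + ε) * a by positivity) hW, hGp]; ring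
    _ ≤ Real.exp (10 * z / 3) * ((1 + 17 * Real.exp 17 * ε) * W ^ ((5 : ℝ) / 2) +
        2 * (12 * Real.exp (z / 20)) *
          ((2 * Cb + 64 * C0) ^ ((5 : ℝ) / 2) * Real.exp (-(5 * z / 24) + 39 * t / 16))) := by
        gcongr
    _ = _ := by rw [Real.exp_add (z / 20)]; ring

theorem integral_semiclassical_density {T : ℝ} (hT : 0 < T) {ρ : (Fin 3 → ℝ) → ℝ}
    (hρ : Measurable ρ) (hI : tfNegIntegral ρ < ⊤) {l : ℝ} (hl : 0 < l) {a b k R : ℝ}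
    (ha : 0 ≤ a) (hk : 0 ≤ k) (hR : 0 ≤ R) :
    IntegrableOn (fun w => a * (k * wTF T ρ (l • w) ^ ((5 : ℝ) / 2) + b)) (Metric.closedBall 0 R) ∧
      ∫ w in Metric.closedBall 0 R, a * (k * wTF T ρ (l • w) ^ ((5 : ℝ) / 2) + b) ≤
        a * (k * ((l ^ 3)⁻¹ * (tfNegIntegral ρ).toReal) + b * (2 * R) ^ 3) := by
  obtain ⟨h1, h2⟩ := integrable_wTF_smul hT hρ hI hl
  have hc : IntegrableOn (fun _ : Fin 3 → ℝ => b) (Metric.closedBall 0 R) :=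
    integrableOn_const (isCompact_closedBall 0 R).measure_lt_top.ne
  have h3 : IntegrableOn (fun w => k * wTF T ρ (l • w) ^ ((5 : ℝ) / 2)) (Metric.closedBall 0 R) :=
    (h1.const_mul k).integrableOn
  refine ⟨(h3.add hc).const_mul a, ?_⟩
  rw [integral_const_mul, integral_add h3 hc, integral_const_mul]
  gcongr
  · refine (setIntegral_le_integral h1 (Filter.Eventually.of_forall fun w => ?_)).trans h2
    exact Real.rpow_nonneg (wTF_nonneg _ _ _) _
  · rw [setIntegral_const, volume_real_closedBall3 0 hR, smul_eq_mul, mul_comm]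

set_option maxHeartbeats 2000000 in
/-- The lower bound in logarithmic coordinates `Z = exp z`, `δ = exp (-t)`, `D = exp s`. -/
theorem truncEnergy_ge_exp (c₁ : ℝ) : ∃ κ C : ℝ, 0 < κ ∧ 0 < C ∧ ∀ z t s α : ℝ, 0 ≤ z → 0 ≤ t →
    0 ≤ s → s ≤ z / 24 - 13 * t / 16 → 0 < α → Real.exp z * α ^ 2 ≤ κ →
    ∀ θ₀ θ₁, AdmissibleCutoffs (Real.exp (-(t + z / 3))) c₁ θ₀ θ₁ →
    ∀ n A, IsVecPot A → ∀ Ψ, IsWaveFun (n + 1) Ψ →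
      -cTF * Real.exp (7 * z / 3) -
        C * Real.exp (7 * z / 3) * (Real.exp (-(z / 30)) + Real.exp (-s)) ≤
      truncEnergy (n + 1) (Real.exp z) α (Real.exp (s - z / 3)) θ₀ θ₁ A Ψ := by
  obtain ⟨C0, hC0, hbody⟩ := exists_oneBody
  obtain ⟨Kg, CP, hKg, hCP, hloc⟩ := exists_localized_lower hC0.le
  set c := 4 * c₁ ^ 2 with hc
  have hc0 : 0 ≤ c := by positivity
  set K := 1600 * Kg with hK
  have hK0 : 0 ≤ K := by positivity
  set CV := 2 + c + K with hCV
  have hCV0 : 0 < CV := by positivity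
  set B := 1 + c + 3 * K with hB
  have hB0 : 0 ≤ B := by positivity
  set Q := (2 * (3 + c + K) + 64 * C0) ^ ((5 : ℝ) / 2) with hQ
  have hQ0 : 0 ≤ Q := by positivity
  have hcTF := cTF_nonneg
  refine ⟨(27648 * Real.pi * (CP * (2 * CV + 3 * CV * CV ^ ((3 : ℝ) / 2))))⁻¹,
    1 + 17 * Real.exp 17 * (cTF + 1) + 240 * Q + (B + 1) ^ 2, by positivity, by positivity, ?_⟩
  intro z t s α hz ht hs hst hα hκ θ₀ θ₁ hθ n A hA Ψ hΨ
  have htz : 39 * t ≤ 2 * z := by linarith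
  set ε := Real.exp (-(z / 30)) / 4 with hε
  have hη1 : Real.exp (-(z / 30)) ≤ 1 := Real.exp_le_one_iff.2 (by linarith)
  have hε0 : 0 < ε := by positivity
  have hε1 : ε < 1 := by rw [hε]; linarith
  set L := Real.exp (-(59 * z / 100 + 3 * t / 4)) / 20 with hL
  have hL0 : 0 < L := by positivity
  set d := Real.exp (-(t + z / 3)) with hd
  set r := Real.exp (s - z / 3) with hr
  have hr0 : 0 < r := Real.exp_pos _
  have hLr : L ≤ r / 20 := by
    rw [hL, hr]
    gcongr
    linarith
  obtain ⟨ρ, hρ, hρ0, hD, hI, hTF⟩ := exists_tf_density (Real.exp_pos (-(z / 30)))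
  set W := wTF (Real.exp (z / 5) * Real.sqrt (1 - ε)) ρ with hW
  have hW0 : ∀ U, 0 ≤ W U := wTF_nonneg _ _
  have hT' : 0 < Real.exp (z / 5) * Real.sqrt (1 - ε) :=
    mul_pos (Real.exp_pos _) (Real.sqrt_pos.2 (by linarith))
  set l := Real.exp (z / 3) with hl
  have hl0 : 0 < l := Real.exp_pos _
  set a := (1 - ε) ^ (-(3 : ℝ) / 2) * Real.exp (Real.exp (z / 5) ^ 2 * (l * (2 * L)) ^ 2 / ε) with ha
  have hpow0 : 0 ≤ (1 - ε) ^ (-(3 : ℝ) / 2) := Real.rpow_nonneg (by linarith) _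
  have ha0 : 0 ≤ a := by positivity
  have hae : a ≤ (1 - ε) ^ (-(3 : ℝ) / 2) * Real.exp ε := by
    rw [ha]
    gcongr
    rw [div_le_iff₀ hε0]
    calc Real.exp (z / 5) ^ 2 * (l * (2 * L)) ^ 2 =
          Real.exp ((2 : ℕ) * (z / 5) + (2 : ℕ) * (z / 3) +
            (2 : ℕ) * (-(59 * z / 100 + 3 * t / 4))) / 100 := by
          rw [Real.exp_add, Real.exp_add, Real.exp_nat_mul, Real.exp_nat_mul, Real.exp_nat_mul, hl,
            hL]
          ring
      _ ≤ Real.exp (-(z / 30) + -(z / 30)) / 16 := by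
          refine div_le_div₀ (Real.exp_pos _).le (Real.exp_le_exp.2 ?_) (by norm_num) (by norm_num)
          push_cast
          linarith
      _ = ε * ε := by rw [Real.exp_add, hε]; ring
  set Λ := 1 / ε * ((L ^ 2)⁻¹ * Kg) with hΛdef
  have hΛ : Λ = K * Real.exp (4 * z / 3 + (-(3 * z / 25) + 3 * t / 2)) := by
    have h1 : 4 * z / 3 + (-(3 * z / 25) + 3 * t / 2) =
        z / 30 + (2 : ℕ) * (59 * z / 100 + 3 * t / 4) := by push_cast; ring
    rw [h1, Real.exp_add, Real.exp_nat_mul, hΛdef, hε, hL, hK, Real.exp_neg, Real.exp_neg]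
    field_simp
    ring
  set Vm := CV * Real.exp (4 * z / 3 + t) with hVm
  have hVm0 : 0 < Vm := by positivity
  set U : (Fin 3 → ℝ) → ℝ := fun x => (Real.exp z + c / d) / enorm3 x -
    (l * Real.exp z * PT (Real.exp (z / 5)) ρ (l • x) - l * (cK * Real.exp (z / 5) / 2)) + Λ with hU
  have hUm : Measurable U := by
    have h1 : Measurable fun x : Fin 3 → ℝ => PT (Real.exp (z / 5)) ρ (l • x) :=
      (measurable_PT _ hρ).comp (measurable_const_smul l)
    have h2 : Measurable enorm3 := continuous_enorm3.measurable
    exact ((measurable_const.div h2).sub ((h1.const_mul _).sub measurable_const)).add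
      measurable_const
  set V : (Fin 3 → ℝ) → ℝ := fun x => if ‖x‖ < r ∧ d < enorm3 x then max (U x) 0 else 0 with hV
  have hVmeas : Measurable V := by
    refine Measurable.ite ?_ (hUm.max measurable_const) measurable_const
    exact (measurableSet_lt measurable_norm measurable_const).inter
      (measurableSet_lt measurable_const continuous_enorm3.measurable)
  have hUVm : ∀ x, d < enorm3 x → U x ≤ Vm := fun x hx => by
    have := effective_potential_le ht htz hc0 hK0
      (PT_nonneg (Real.exp (z / 5)) ρ (l • x)) hx
    rw [← hΛ] at this
    exact this
  set v : (Fin 3 → ℝ) → ℝ := fun w => Real.exp (4 * z / 3) *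
    (a * W (l • w) + (3 + c + K) * Real.exp (-(z / 12) + 39 * t / 40)) with hv
  have hv0 : ∀ w, 0 ≤ v w := fun w => by
    have := hW0 (l • w)
    positivity
  have hUv : ∀ w x, ‖x - w‖ ≤ L → d < enorm3 x → U x ≤ v w := fun w x hxw hx => by
    have hx0 : l • x ≠ 0 := by
      refine smul_ne_zero hl0.ne' ?_
      rintro rfl
      rw [enorm3_zero] at hx
      exact absurd hx (not_lt.2 (Real.exp_pos _).le)
    have hn : nsq (l • x - l • w) ≤ (l * (2 * L)) ^ 2 := by
      rw [← smul_sub, nsq_smul]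
      have h1 := nsq_le_norm (x - w)
      have h2 : ‖x - w‖ ^ 2 ≤ L ^ 2 := by gcongr
      calc l ^ 2 * nsq (x - w) ≤ l ^ 2 * (4 * L ^ 2) := by
            gcongr
            nlinarith
        _ = _ := by ring
    have h := inv_sub_PT_le (Real.exp_pos (z / 5)) hε0 hε1 hρ hρ0 hD hI hx0 hn
    rw [← ha, ← enorm3_sq, enorm3_smul, abs_of_pos hl0] at h
    have := effective_potential_le_wTF ht htz hc0 hK0 hx h
    rw [← hΛ] at this
    exact this
  set k := 1 + 17 * Real.exp 17 * ε with hk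
  set b := 24 * Q * Real.exp (z / 20 + (-(5 * z / 24) + 39 * t / 16)) with hb
  set m := 2 / (15 * Real.pi ^ 2) with hm
  have hm0 : 0 ≤ m := by positivity
  have hm1 : m ≤ 1 := by
    rw [hm, div_le_one (by positivity)]
    nlinarith [Real.pi_gt_three]
  obtain ⟨hpi, hple⟩ := integral_semiclassical_density hT' hρ hI hl0
    (a := m * Real.exp (10 * z / 3)) (b := b) (k := k) (R := r + L)
    (by positivity) (by positivity) (by positivity)
  have hmain := truncEnergy_ge hloc hΨ hA.1 (hbody A hA.1 n _ _ (family_slice hΨ))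
    (Real.exp_pos _) hθ hρ hρ0 hD (Real.one_le_exp hz) hα hr0 hL0 hLr hε0 hε1 hVm0
    (Real.exp_pos (23 * z / 40 + 39 * t / 80)).le (Real.exp_pos (z / 5)).le hl0 hB0
    (fun F hF => strong_field_le ht hz htz hCV0 hCP hα hκ hF) hVmeas
    (fun x => by simp only [hV]; split_ifs <;> simp)
    (fun x => by
      simp only [hV]; split_ifs with h
      · exact max_le (hUVm x h.2) hVm0.le
      · exact hVm0.le)
    (fun x hx => if_neg fun h => absurd h.1 (not_lt.2 hx)) hv0
    (fun w x hx => by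
      simp only [hV]; split_ifs with h
      · exact max_le (hUv w x (by rwa [mem_closedBall_iff_norm] at hx) h.2) (hv0 w)
      · exact hv0 w)
    hpi
    (fun w => by
      have := semiclassical_density_le (t := t) hz hC0.le (show 0 ≤ 3 + c + K by positivity) ha0
        (hW0 (l • w)) hae
      exact this.trans_eq (mul_assoc _ _ _).symm)
    (fun x hx hdx => by
      have : V x = max (U x) 0 := if_pos ⟨hx, hdx⟩
      rw [this]
      exact le_max_left _ _)
    (fun x hx hdx => by
      have hx0 : 0 < enorm3 x := (Real.exp_pos _).trans hdx
      have h1 : c / d ≤ c * Real.exp z := by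
        rw [hd, Real.exp_neg, div_inv_eq_mul]
        gcongr
        linarith
      have h2 : (if ‖x‖ ≤ r + L + L then Λ else 0) ≤ 3 * K * Real.exp z / enorm3 x := by
        split_ifs with h
        · rw [le_div_iff₀ hx0]
          have h3 : enorm3 x ≤ 3 * r := (enorm3_le_norm x).trans (by linarith)
          calc Λ * enorm3 x ≤ K * Real.exp (4 * z / 3 + (-(3 * z / 25) + 3 * t / 2)) *
                (3 * r) := by rw [hΛ]; gcongr
            _ = 3 * K * Real.exp (4 * z / 3 + (-(3 * z / 25) + 3 * t / 2) + (s - z / 3)) := by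
                rw [Real.exp_add _ (s - z / 3), hr]; ring
            _ ≤ _ := by
                gcongr
                linarith
        · positivity
      calc _ ≤ (Real.exp z + c * Real.exp z) / enorm3 x + 3 * K * Real.exp z / enorm3 x := by
            gcongr
        _ = _ := by rw [hB]; ring)
  refine le_trans ?_ hmain
  have hS0 : 0 ≤ (coulombSelf ρ).toReal := ENNReal.toReal_nonneg
  have hI0 : 0 ≤ (tfNegIntegral ρ).toReal := ENNReal.toReal_nonneg
  set S := (coulombSelf ρ).toReal
  set I := (tfNegIntegral ρ).toReal
  set E := Real.exp (7 * z / 3) with hE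
  have hE0 : 0 < E := Real.exp_pos _
  have e1 : l * Real.exp z ^ 2 = E := by
    rw [hl, ← Real.exp_nat_mul, ← Real.exp_add, hE]
    congr 1
    push_cast; ring
  have e2 : Real.exp z ^ 2 / r = E * Real.exp (-s) := by
    rw [hr, div_eq_mul_inv, ← Real.exp_neg, ← Real.exp_nat_mul, ← Real.exp_add, hE, ← Real.exp_add]
    congr 1
    push_cast; ring
  have e3 : Real.exp (10 * z / 3) * (l ^ 3)⁻¹ = E := by
    rw [hl, ← Real.exp_nat_mul, ← Real.exp_neg, ← Real.exp_add, hE]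
    congr 1
    push_cast; ring
  have e4 : Real.exp (10 * z / 3) * (b * (2 * (r + L)) ^ 3) ≤
      E * (240 * Q * Real.exp (-(z / 30))) := by
    have h1 : (2 * (r + L)) ^ 3 ≤ 10 * r ^ 3 := by
      calc _ ≤ (21 / 10 * r) ^ 3 := pow_le_pow_left₀ (by positivity) (by linarith) 3
        _ ≤ _ := by nlinarith [pow_pos hr0 3]
    calc _ ≤ Real.exp (10 * z / 3) * (b * (10 * r ^ 3)) := by gcongr
      _ = 240 * Q * Real.exp (10 * z / 3 + (z / 20 + (-(5 * z / 24) + 39 * t / 16)) +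
          (3 : ℕ) * (s - z / 3)) := by
          rw [Real.exp_add _ ((3 : ℕ) * (s - z / 3)), Real.exp_add (10 * z / 3), Real.exp_nat_mul,
            hb, hr]
          ring
      _ ≤ 240 * Q * Real.exp (7 * z / 3 + -(z / 30)) := by
          refine mul_le_mul_of_nonneg_left (Real.exp_le_exp.2 ?_) (by positivity)
          push_cast
          linarith
      _ = _ := by rw [Real.exp_add, hE]; ring
  have h1 : m * Real.exp (10 * z / 3) * (k * ((l ^ 3)⁻¹ * I) + b * (2 * (r + L)) ^ 3) ≤
      E * (k * (m * I) + 240 * Q * Real.exp (-(z / 30))) := by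
    calc _ = Real.exp (10 * z / 3) * (l ^ 3)⁻¹ * (k * (m * I)) +
          m * (Real.exp (10 * z / 3) * (b * (2 * (r + L)) ^ 3)) := by ring
      _ ≤ E * (k * (m * I)) + 1 * (E * (240 * Q * Real.exp (-(z / 30)))) := by
          rw [e3]
          gcongr
      _ = _ := by ring
  have hmI : k * (m * I) ≤ m * I + 17 * Real.exp 17 * (cTF + 1) * Real.exp (-(z / 30)) := by
    have h2 : m * I ≤ cTF + 1 := by linarith
    have h3 : ε ≤ Real.exp (-(z / 30)) := div_le_self (Real.exp_pos _).le (by norm_num)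
    calc k * (m * I) = m * I + 17 * Real.exp 17 * (m * I) * ε := by rw [hk]; ring
      _ ≤ _ := by gcongr
  have h4 : E * (S + (k * (m * I) + 240 * Q * Real.exp (-(z / 30)))) ≤
      E * (cTF + (1 + 17 * Real.exp 17 * (cTF + 1) + 240 * Q) * Real.exp (-(z / 30))) := by
    refine mul_le_mul_of_nonneg_left ?_ hE0.le
    linarith
  have h5 : 0 ≤ E * ((1 + 17 * Real.exp 17 * (cTF + 1) + 240 * Q) * Real.exp (-s) +
      (B + 1) ^ 2 * Real.exp (-(z / 30))) := by positivity
  rw [mul_div_assoc ((B + 1) ^ 2), e1, e2]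
  have h6 := hple.trans h1
  linarith

/-- Removing the magnetic field from the truncated Hamiltonian:
𝓔⁰_N[Ψ,A] ≥ −c_TF Z^{7/3} − C Z^{7/3}(Z^{−1/30} + D⁻¹). -/
theorem remove_field_bound (c₁ : ℝ) (hc₁ : 0 < c₁) :
    ∃ κ C : ℝ, 0 < κ ∧ 0 < C ∧ ∀ Z α D δ : ℝ, 1 ≤ Z → 0 < α → Z * α ^ 2 ≤ κ →
      Z ^ (-(1 : ℝ) / 6) ≤ δ → δ ≤ 1 → 1 ≤ D → D ≤ Z ^ ((1 : ℝ) / 24) * δ ^ ((13 : ℝ) / 16) →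
      ∀ θ₀ θ₁, AdmissibleCutoffs (δ * Z ^ (-(1 : ℝ) / 3)) c₁ θ₀ θ₁ →
      ∀ N : ℕ, 1 ≤ N → ∀ A, IsVecPot A → ∀ Ψ, IsWaveFun N Ψ →
        truncEnergy N Z α (D * Z ^ (-(1 : ℝ) / 3)) θ₀ θ₁ A Ψ
          ≥ -cTF * Z ^ ((7 : ℝ) / 3)
            - C * Z ^ ((7 : ℝ) / 3) * (Z ^ (-(1 : ℝ) / 30) + D⁻¹) := by
  obtain ⟨κ, C, hκ, hC, h⟩ := truncEnergy_ge_exp c₁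
  refine ⟨κ, C, hκ, hC, fun Z α D δ hZ hα hZα hδZ hδ1 hD1 hDle θ₀ θ₁ hθ N hN A hA Ψ hΨ => ?_⟩
  obtain ⟨n, rfl⟩ : ∃ n, N = n + 1 := ⟨N - 1, by omega⟩
  have hZ0 : 0 < Z := by linarith
  have hδ0 : 0 < δ := (Real.rpow_pos_of_pos hZ0 _).trans_le hδZ
  have hD0 : 0 < D := by linarith
  obtain ⟨z, rfl⟩ : ∃ z, Real.exp z = Z := ⟨_, Real.exp_log hZ0⟩
  obtain ⟨t, rfl⟩ : ∃ t, Real.exp (-t) = δ := ⟨-Real.log δ, by rw [neg_neg, Real.exp_log hδ0]⟩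
  obtain ⟨s, rfl⟩ : ∃ s, Real.exp s = D := ⟨_, Real.exp_log hD0⟩
  simp only [← Real.exp_mul, ← Real.exp_add, ← Real.exp_neg, Real.exp_le_exp] at *
  rw [Real.one_le_exp_iff] at hZ hD1
  rw [Real.exp_le_one_iff] at hδ1
  rw [show -t + z * (-1 / 3) = -(t + z / 3) by ring] at hθ
  have := h z t s α hZ (by linarith) hD1 (by linarith) hα hZα θ₀ θ₁ hθ n A hA Ψ hΨ
  rw [show s + z * (-1 / 3) = s - z / 3 by ring, show z * (7 / 3) = 7 * z / 3 by ring,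
    show z * (-1 / 30) = -(z / 30) by ring]
  exact this
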